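/- Let P be a simple polygon with n ≥ 3 vertices and let s be a point of the interior of P. Then for every integer k ≥ ⌊n/2⌋ − 1, the interior of P is contained in V_k(s); that is, every interior point of P is illuminated from s after at most ⌊n/2⌋ − 1 diffuse reflections. -/

import Mathlib

open Set

/-- The plane ℝ². -/
abbrev Plane := EuclideanSpace ℝ (Fin 2)

/-- The `i`-th edge of a polygon with vertices `v 0, …, v (n-1)`:
the segment from `v i` to `v ((i+1) % n)`. -/
def polyEdge (n : ℕ) (v : ℕ → Plane) (i : ℕ) : Set Plane :=
  segment ℝ (v i) (v ((i + 1) % n))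

/-- `P` is a simple polygon with vertices `v 0, …, v (n-1)`: a compact set with
nonempty connected interior whose frontier is the union of the `n` edges; the
vertices are pairwise distinct, consecutive edges meet exactly in their common
vertex, and non-consecutive edges are disjoint. -/
def IsSimplePolygon (n : ℕ) (P : Set Plane) (v : ℕ → Plane) : Prop :=
  IsCompact P ∧ IsConnected (interior P) ∧
  (∀ i < n, ∀ j < n, v i = v j → i = j) ∧
  (frontier P = ⋃ i ∈ Finset.range n, polyEdge n v i) ∧
  (∀ i < n, ∀ j < n, i ≠ j →
    (j = (i + 1) % n → polyEdge n v i ∩ polyEdge n v j = {v j}) ∧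
    (i = (j + 1) % n → polyEdge n v i ∩ polyEdge n v j = {v i}) ∧
    (j ≠ (i + 1) % n → i ≠ (j + 1) % n →
      Disjoint (polyEdge n v i) (polyEdge n v j)))

/-- A diffuse reflection path in `P` from `s` to `t` with `m` segments
(`m - 1` reflections), given by the points `p 0 = s, p 1, …, p m = t`:
all points lie in `P`, every intermediate point lies in the relative interior
(open segment) of some edge of `P`, and the relative interior of each segment
of the path lies in the interior of `P`. -/
def IsDiffusePath (n : ℕ) (P : Set Plane) (v : ℕ → Plane)
    (s t : Plane) (m : ℕ) (p : ℕ → Plane) : Prop :=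
  p 0 = s ∧ p m = t ∧ (∀ i ≤ m, p i ∈ P) ∧
  (∀ i, 0 < i → i < m → ∃ j < n, p i ∈ openSegment ℝ (v j) (v ((j + 1) % n))) ∧
  (∀ i < m, openSegment ℝ (p i) (p (i + 1)) ⊆ interior P)

/-- `Vis n P v s k` is `V_k(s)`: the set of points `t ∈ P` reachable from `s`
by a diffuse reflection path with at most `k` reflections. -/
def Vis (n : ℕ) (P : Set Plane) (v : ℕ → Plane) (s : Plane) (k : ℕ) : Set Plane :=
  {t | t ∈ P ∧ ∃ m, m - 1 ≤ k ∧ ∃ p : ℕ → Plane, IsDiffusePath n P v s t m p}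

section
open Filter

/-- Twice the signed area of the triangle `p q x`. -/
def orient (p q x : Plane) : ℝ := (q 0 - p 0) * (x 1 - p 1) - (q 1 - p 1) * (x 0 - p 0)

/-- The scalar product of `q - p` and `x - p`. -/
def scal (p q x : Plane) : ℝ := (q 0 - p 0) * (x 0 - p 0) + (q 1 - p 1) * (x 1 - p 1)

theorem plane_ext {x y : Plane} (h0 : x 0 = y 0) (h1 : x 1 = y 1) : x = y := by
  ext i; fin_cases i
  · exact h0
  · exact h1

theorem lineMap_coord (p q : Plane) (t : ℝ) (i : Fin 2) :
    (AffineMap.lineMap p q t : Plane) i = p i + t * (q i - p i) := by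
  simp [AffineMap.lineMap_apply]; ring

theorem comb_coord (p q : Plane) (a b : ℝ) (i : Fin 2) :
    (a • p + b • q : Plane) i = a * p i + b * q i := by
  simp

theorem orient_cycle (p q x : Plane) : orient q x p = orient p q x := by
  unfold orient; ring

theorem orient_swap (p q x : Plane) : orient q p x = - orient p q x := by
  unfold orient; ring

theorem orient_swap' (p q x : Plane) : orient p x q = - orient p q x := by
  unfold orient; ring

@[simp] theorem orient_left (p q : Plane) : orient p q p = 0 := by
  unfold orient; ring

@[simp] theorem orient_right (p q : Plane) : orient p q q = 0 := by
  unfold orient; ring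

theorem continuous_orient (p q : Plane) : Continuous (orient p q) := by
  unfold orient; fun_prop

theorem continuous_scal (p q : Plane) : Continuous (scal p q) := by
  unfold scal; fun_prop

theorem orient_comb (p q x y : Plane) {a b : ℝ} (h : a + b = 1) :
    orient p q (a • x + b • y) = a * orient p q x + b * orient p q y := by
  obtain rfl : b = 1 - a := by linarith
  unfold orient; simp only [comb_coord]; ring

theorem scal_comb (p q x y : Plane) {a b : ℝ} (h : a + b = 1) :
    scal p q (a • x + b • y) = a * scal p q x + b * scal p q y := by
  obtain rfl : b = 1 - a := by linarith
  unfold scal; simp only [comb_coord]; ring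

theorem orient_lineMap (p q x y : Plane) (t : ℝ) :
    orient p q (AffineMap.lineMap x y t) = orient p q x + t * (orient p q y - orient p q x) := by
  unfold orient; simp only [lineMap_coord]; ring

theorem scal_lineMap (p q x y : Plane) (t : ℝ) :
    scal p q (AffineMap.lineMap x y t) = scal p q x + t * (scal p q y - scal p q x) := by
  unfold scal; simp only [lineMap_coord]; ring

theorem mem_openSegment_iff {p q x : Plane} :
    x ∈ openSegment ℝ p q ↔ ∃ t : ℝ, 0 < t ∧ t < 1 ∧ AffineMap.lineMap p q t = x := by
  rw [openSegment_eq_image_lineMap]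
  constructor
  · rintro ⟨t, ⟨h0, h1⟩, rfl⟩; exact ⟨t, h0, h1, rfl⟩
  · rintro ⟨t, h0, h1, rfl⟩; exact ⟨t, ⟨h0, h1⟩, rfl⟩

theorem mem_segment_iff {p q x : Plane} :
    x ∈ segment ℝ p q ↔ ∃ t : ℝ, 0 ≤ t ∧ t ≤ 1 ∧ AffineMap.lineMap p q t = x := by
  rw [segment_eq_image_lineMap]
  constructor
  · rintro ⟨t, ⟨h0, h1⟩, rfl⟩; exact ⟨t, h0, h1, rfl⟩
  · rintro ⟨t, h0, h1, rfl⟩; exact ⟨t, ⟨h0, h1⟩, rfl⟩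

theorem scal_self_pos {p q : Plane} (h : p ≠ q) : 0 < scal p q q := by
  have : q 0 - p 0 ≠ 0 ∨ q 1 - p 1 ≠ 0 := by
    by_contra! hh
    exact h (plane_ext (by linarith [hh.1]) (by linarith [hh.2]))
  unfold scal
  rcases this with h | h
  · nlinarith [mul_self_pos.2 h, mul_self_nonneg (q 1 - p 1)]
  · nlinarith [mul_self_pos.2 h, mul_self_nonneg (q 0 - p 0)]

theorem eq_lineMap_of_orient {p q x : Plane} (h : p ≠ q) (hx : orient p q x = 0) :
    x = AffineMap.lineMap p q (scal p q x / scal p q q) := by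
  have hs := (scal_self_pos h).ne'
  have e0 : scal p q x * (q 0 - p 0) = scal p q q * (x 0 - p 0) := by
    unfold orient at hx; unfold scal
    linear_combination (q 1 - p 1) * hx
  have e1 : scal p q x * (q 1 - p 1) = scal p q q * (x 1 - p 1) := by
    unfold orient at hx; unfold scal
    linear_combination -(q 0 - p 0) * hx
  apply plane_ext <;> rw [lineMap_coord] <;> field_simp <;> linarith

@[simp] theorem scal_left (p q : Plane) : scal p q p = 0 := by
  unfold scal; ring

theorem orient_of_mem_segment {p q x : Plane} (h : x ∈ segment ℝ p q) : orient p q x = 0 := by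
  obtain ⟨t, -, -, rfl⟩ := mem_segment_iff.1 h
  rw [orient_lineMap]; simp

theorem orient_of_mem_openSegment {p q x : Plane} (h : x ∈ openSegment ℝ p q) :
    orient p q x = 0 := orient_of_mem_segment (openSegment_subset_segment _ _ _ h)

theorem mem_openSegment_of_orient {p q x : Plane} (h : p ≠ q) (hx : orient p q x = 0)
    (h0 : 0 < scal p q x) (h1 : scal p q x < scal p q q) : x ∈ openSegment ℝ p q :=
  mem_openSegment_iff.2 ⟨_, div_pos h0 (scal_self_pos h),
    (div_lt_one (scal_self_pos h)).2 h1, (eq_lineMap_of_orient h hx).symm⟩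

theorem mem_segment_of_orient {p q x : Plane} (h : p ≠ q) (hx : orient p q x = 0)
    (h0 : 0 ≤ scal p q x) (h1 : scal p q x ≤ scal p q q) : x ∈ segment ℝ p q :=
  mem_segment_iff.2 ⟨_, div_nonneg h0 (scal_self_pos h).le,
    (div_le_one (scal_self_pos h)).2 h1, (eq_lineMap_of_orient h hx).symm⟩

theorem ne_of_mem_openSegment {p q x : Plane} (h : p ≠ q) (hx : x ∈ openSegment ℝ p q) :
    x ≠ p ∧ x ≠ q := by
  obtain ⟨t, h0, h1, rfl⟩ := mem_openSegment_iff.1 hx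
  have hs := scal_self_pos h
  have hc := scal_lineMap p q p q t
  rw [scal_left] at hc
  constructor <;> intro he <;> rw [he] at hc
  · rw [scal_left] at hc
    nlinarith
  · nlinarith

theorem mem_openSegment_of_mem_segment {p q x : Plane} (hx : x ∈ segment ℝ p q)
    (h0 : x ≠ p) (h1 : x ≠ q) : x ∈ openSegment ℝ p q :=
  mem_openSegment_of_ne_left_right h0.symm h1.symm hx

theorem mem_segment_cases {p q x : Plane} (hx : x ∈ segment ℝ p q) :
    x = p ∨ x = q ∨ x ∈ openSegment ℝ p q := by
  by_cases h0 : x = p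
  · exact .inl h0
  by_cases h1 : x = q
  · exact .inr (.inl h1)
  exact .inr (.inr (mem_openSegment_of_mem_segment hx h0 h1))

theorem openSegment_nonempty (p q : Plane) : (openSegment ℝ p q).Nonempty :=
  ⟨_, mem_openSegment_iff.2 ⟨1 / 2, by norm_num, by norm_num, rfl⟩⟩

theorem convex_orient_pos (p q : Plane) (σ : ℝ) : Convex ℝ {x | 0 < σ * orient p q x} := by
  intro x hx y hy a b ha hb hab
  simp only [mem_ofPred_eq] at *
  rw [orient_comb p q x y hab]
  rcases ha.eq_or_lt with rfl | ha
  · obtain rfl : b = 1 := by linarith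
    simpa using hy
  · nlinarith [mul_pos ha hx, mul_nonneg hb hy.le]

theorem convex_scal_neg (p q : Plane) : Convex ℝ {x | scal p q x < 0} := by
  intro x hx y hy a b ha hb hab
  simp only [mem_ofPred_eq] at *
  rw [scal_comb p q x y hab]
  rcases ha.eq_or_lt with rfl | ha
  · obtain rfl : b = 1 := by linarith
    simpa using hy
  · nlinarith [mul_neg_of_pos_of_neg ha hx, mul_nonpos_of_nonneg_of_nonpos hb hy.le]

/-- The point obtained from `z` by moving along the left normal of `q - p`. -/
noncomputable def shift (p q z : Plane) (t : ℝ) : Plane := !₂[z 0 - t * (q 1 - p 1), z 1 + t * (q 0 - p 0)]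

theorem orient_shift (p q z : Plane) (t : ℝ) :
    orient p q (shift p q z t) = orient p q z + t * scal p q q := by
  simp [orient, shift, scal]; ring

theorem scal_shift (p q z : Plane) (t : ℝ) :
    scal p q (shift p q z t) = scal p q z := by
  simp [shift, scal]; ring

theorem continuous_shift (p q z : Plane) : Continuous (shift p q z) := by
  unfold shift
  refine (PiLp.continuous_toLp 2 _).comp (continuous_pi fun i => ?_)
  fin_cases i <;> simp <;> fun_prop

@[simp] theorem shift_zero (p q z : Plane) : shift p q z 0 = z := by
  apply plane_ext <;> simp [shift]

/-- Every neighbourhood of a point contains points on either side of a line through it. -/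
theorem exists_shift_mem {p q z : Plane} {U : Set Plane} (hU : U ∈ nhds z) (σ : ℝ) : ∃ t, 0 < t ∧ shift p q z (σ * t) ∈ U := by
  have hc : Filter.Tendsto (fun t : ℝ => shift p q z (σ * t)) (nhds 0) (nhds z) := by
    have : Continuous fun t : ℝ => shift p q z (σ * t) :=
      (continuous_shift p q z).comp (by fun_prop)
    simpa using this.tendsto 0
  have : ∀ᶠ t in nhds (0:ℝ), shift p q z (σ * t) ∈ U := hc hU
  obtain ⟨t, ht, ht0⟩ := ((this.filter_mono nhdsWithin_le_nhds).and
    (self_mem_nhdsWithin : Ioi (0:ℝ) ∈ nhdsWithin 0 (Ioi 0))).exists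
  exact ⟨t, ht0, ht⟩

theorem IsPreconnected.subset_or_disjoint_of_frontier {X : Type*} [TopologicalSpace X] {S H : Set X}
    (hS : IsPreconnected S) (h : Disjoint S (frontier H)) : S ⊆ H ∨ Disjoint S H := by
  have hcov : S ⊆ interior H ∪ interior Hᶜ := by
    intro x hx
    have := disjoint_left.1 h hx
    rw [← compl_frontier_eq_union_interior]
    exact this
  rcases hS.subset_or_subset isOpen_interior isOpen_interior
    (disjoint_compl_right.mono interior_subset interior_subset) hcov with h | h
  · exact .inl (h.trans interior_subset)
  · exact .inr (disjoint_left.2 fun x hx => interior_subset (h hx))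

theorem isPreconnected_halfBall (p q z : Plane) (r σ : ℝ) :
    IsPreconnected (Metric.ball z r ∩ {x | 0 < σ * orient p q x}) :=
  ((convex_ball z r).inter (convex_orient_pos p q σ)).isPreconnected

/-- A ball slit along a radius is connected. -/
theorem isPreconnected_slit {v q : Plane} (h : v ≠ q) {r : ℝ} (hr : 0 < r) (hrq : r ≤ dist q v) :
    IsPreconnected (Metric.ball v r \ segment ℝ v q) := by
  have hs := scal_self_pos h
  have key : Metric.ball v r \ segment ℝ v q =
      ((Metric.ball v r ∩ {x | 0 < (1:ℝ) * orient v q x}) ∪ (Metric.ball v r ∩ {x | scal v q x < 0}))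
      ∪ (Metric.ball v r ∩ {x | 0 < (-1:ℝ) * orient v q x}) := by
    ext x
    simp only [Set.mem_sdiff, mem_union, mem_inter_iff, mem_ofPred_eq, one_mul, neg_one_mul]
    constructor
    · rintro ⟨hx, hn⟩
      rcases lt_trichotomy (orient v q x) 0 with h1 | h1 | h1
      · exact .inr ⟨hx, by linarith⟩
      · refine .inl (.inr ⟨hx, ?_⟩)
        by_contra! hc
        refine hn (mem_segment_of_orient h h1 hc ?_)
        by_contra! hlt
        have e := eq_lineMap_of_orient h h1
        have : dist x v = (scal v q x / scal v q q) * dist q v := by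
          conv_lhs => rw [e]
          rw [dist_lineMap_left, dist_comm v q, Real.norm_of_nonneg (by positivity)]
        have h2 : 1 < scal v q x / scal v q q := (one_lt_div hs).2 hlt
        rw [Metric.mem_ball] at hx
        have hd : 0 < dist q v := dist_pos.2 h.symm
        nlinarith
      · exact .inl (.inl ⟨hx, h1⟩)
    · rintro ((⟨hx, h1⟩ | ⟨hx, h1⟩) | ⟨hx, h1⟩)
      · exact ⟨hx, fun hm => by rw [orient_of_mem_segment hm] at h1; simp at h1⟩
      · refine ⟨hx, fun hm => ?_⟩
        obtain ⟨t, h0, -, rfl⟩ := mem_segment_iff.1 hm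
        rw [scal_lineMap, scal_left] at h1
        nlinarith
      · exact ⟨hx, fun hm => by rw [orient_of_mem_segment hm] at h1; simp at h1⟩
  have hpt : ∀ σ : ℝ, σ = 1 ∨ σ = -1 → ∃ x ∈ Metric.ball v r, scal v q x < 0 ∧ 0 < σ * orient v q x := by
    intro σ hσ
    obtain ⟨y, hy, hyn⟩ : ∃ y ∈ Metric.ball v r, scal v q y < 0 ∧ orient v q y = 0 := by
      have hc : Filter.Tendsto (fun t : ℝ => (AffineMap.lineMap v q t : Plane)) (nhds 0) (nhds v) := by
        have : Continuous (fun t : ℝ => (AffineMap.lineMap v q t : Plane)) :=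
          AffineMap.lineMap_continuous
        simpa using this.tendsto 0
      have : ∀ᶠ t in nhds (0:ℝ), (AffineMap.lineMap v q t : Plane) ∈ Metric.ball v r :=
        hc (Metric.ball_mem_nhds v hr)
      obtain ⟨t, ht, ht0⟩ := ((this.filter_mono nhdsWithin_le_nhds).and
        (self_mem_nhdsWithin : Iio (0:ℝ) ∈ nhdsWithin 0 (Iio 0))).exists
      refine ⟨_, ht, ?_, ?_⟩
      · rw [scal_lineMap, scal_left]
        have : t < 0 := ht0
        nlinarith
      · rw [orient_lineMap]; simp
    obtain ⟨t, ht, hm⟩ := exists_shift_mem (p := v) (q := q) (Metric.isOpen_ball.mem_nhds hy) σ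
    refine ⟨_, hm, ?_, ?_⟩
    · rw [scal_shift]; exact hyn.1
    · rw [orient_shift, hyn.2]
      rcases hσ with rfl | rfl <;> nlinarith
  have hn : IsPreconnected (Metric.ball v r ∩ {x | scal v q x < 0}) :=
    ((convex_ball v r).inter (convex_scal_neg v q)).isPreconnected
  rw [key]
  obtain ⟨x, hx, hx1, hx2⟩ := hpt 1 (.inl rfl)
  obtain ⟨y, hy, hy1, hy2⟩ := hpt (-1) (.inr rfl)
  refine IsPreconnected.union y (.inr ⟨hy, hy1⟩) ⟨hy, hy2⟩ ?_ (isPreconnected_halfBall v q v r (-1))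
  exact IsPreconnected.union x ⟨hx, hx2⟩ ⟨hx, hx1⟩ (isPreconnected_halfBall v q v r 1) hn

/-- The consecutive pairs of a list of points. -/
def pathEdges : List Plane → List (Plane × Plane)
  | [] => []
  | [_] => []
  | a :: b :: l => (a, b) :: pathEdges (b :: l)

/-- The cyclically consecutive pairs of a list of points. -/
def cycEdges : List Plane → List (Plane × Plane)
  | [] => []
  | a :: l => pathEdges (a :: l ++ [a])

@[simp] theorem pathEdges_nil : pathEdges [] = [] := rfl
@[simp] theorem pathEdges_singleton (a : Plane) : pathEdges [a] = [] := rfl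
@[simp] theorem pathEdges_cons_cons (a b : Plane) (l : List Plane) :
    pathEdges (a :: b :: l) = (a, b) :: pathEdges (b :: l) := rfl
theorem cycEdges_cons (a : Plane) (l : List Plane) :
    cycEdges (a :: l) = pathEdges (a :: l ++ [a]) := rfl

theorem pathEdges_append (A : List Plane) (x : Plane) (B : List Plane) :
    pathEdges (A ++ x :: B) = pathEdges (A ++ [x]) ++ pathEdges (x :: B) := by
  induction A with
  | nil => simp
  | cons a A ih =>
    cases A with
    | nil => simp
    | cons c A => simpa using ih

theorem pathEdges_append_two (A : List Plane) (x y : Plane) :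
    pathEdges (A ++ [x, y]) = pathEdges (A ++ [x]) ++ [(x, y)] := by
  rw [show A ++ [x, y] = A ++ x :: [y] by simp, pathEdges_append]; simp

theorem map_fst_pathEdges (l : List Plane) : (pathEdges l).map Prod.fst = l.dropLast := by
  induction l with
  | nil => simp
  | cons a l ih => cases l with
    | nil => simp
    | cons b l => simpa using ih

theorem map_snd_pathEdges (l : List Plane) : (pathEdges l).map Prod.snd = l.tail := by
  induction l with
  | nil => simp
  | cons a l ih => cases l with
    | nil => simp
    | cons b l => simpa using ih

theorem fst_mem_of_mem_pathEdges {l : List Plane} {e : Plane × Plane} (h : e ∈ pathEdges l) :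
    e.1 ∈ l := by
  have : e.1 ∈ (pathEdges l).map Prod.fst := List.mem_map_of_mem h
  rw [map_fst_pathEdges] at this
  exact List.dropLast_subset _ this

theorem snd_mem_of_mem_pathEdges {l : List Plane} {e : Plane × Plane} (h : e ∈ pathEdges l) :
    e.2 ∈ l := by
  have : e.2 ∈ (pathEdges l).map Prod.snd := List.mem_map_of_mem h
  rw [map_snd_pathEdges] at this
  exact List.mem_of_mem_tail this

theorem map_fst_cycEdges (l : List Plane) : (cycEdges l).map Prod.fst = l := by
  cases l with
  | nil => rfl
  | cons a l => rw [cycEdges_cons, map_fst_pathEdges, List.dropLast_concat]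

theorem map_snd_cycEdges (a : Plane) (l : List Plane) :
    (cycEdges (a :: l)).map Prod.snd = l ++ [a] := by
  rw [cycEdges_cons, map_snd_pathEdges]; rfl

theorem fst_mem_of_mem_cycEdges {l : List Plane} {e : Plane × Plane} (h : e ∈ cycEdges l) :
    e.1 ∈ l := by
  have : e.1 ∈ (cycEdges l).map Prod.fst := List.mem_map_of_mem h
  rwa [map_fst_cycEdges] at this

theorem snd_mem_of_mem_cycEdges {l : List Plane} {e : Plane × Plane} (h : e ∈ cycEdges l) :
    e.2 ∈ l := by
  cases l with
  | nil => cases h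
  | cons a l =>
    have : e.2 ∈ (cycEdges (a :: l)).map Prod.snd := List.mem_map_of_mem h
    rw [map_snd_cycEdges] at this
    simp only [List.mem_append, List.mem_cons] at *
    tauto

theorem cycEdges_fst_inj {l : List Plane} (hl : l.Nodup) {e f : Plane × Plane}
    (he : e ∈ cycEdges l) (hf : f ∈ cycEdges l) (h : e.1 = f.1) : e = f := by
  refine List.inj_on_of_nodup_map ?_ he hf h
  rwa [map_fst_cycEdges]

theorem cycEdges_snd_inj {l : List Plane} (hl : l.Nodup) {e f : Plane × Plane}
    (he : e ∈ cycEdges l) (hf : f ∈ cycEdges l) (h : e.2 = f.2) : e = f := by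
  cases l with
  | nil => cases he
  | cons a l =>
    refine List.inj_on_of_nodup_map ?_ he hf h
    rw [map_snd_cycEdges]
    rw [List.nodup_append_comm]; simpa using hl

theorem exists_fst_eq {l : List Plane} {v : Plane} (h : v ∈ l) : ∃ e ∈ cycEdges l, e.1 = v := by
  rw [← map_fst_cycEdges l] at h
  simpa using h

theorem cycEdges_split (p : Plane) (B : List Plane) (q : Plane) (C : List Plane) :
    cycEdges (p :: B ++ q :: C) = pathEdges (p :: B ++ [q]) ++ pathEdges (q :: C ++ [p]) := by
  rw [List.cons_append, cycEdges_cons]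
  rw [show p :: (B ++ q :: C) ++ [p] = (p :: B) ++ q :: (C ++ [p]) by simp, pathEdges_append]
  simp

theorem cycEdges_concat (A : List Plane) (a b : Plane) :
    cycEdges (a :: A ++ [b]) = pathEdges (a :: A ++ [b]) ++ [(b, a)] := by
  rw [cycEdges_split]; simp

theorem mem_cycEdges_append_comm {A B : List Plane} {e : Plane × Plane} :
    e ∈ cycEdges (A ++ B) ↔ e ∈ cycEdges (B ++ A) := by
  cases A with
  | nil => simp
  | cons a A => cases B with
    | nil => simp
    | cons b B => rw [cycEdges_split, cycEdges_split]; simp [or_comm]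

theorem mem_pathEdges_reverse {l : List Plane} {e : Plane × Plane} :
    e ∈ pathEdges l.reverse ↔ e.swap ∈ pathEdges l := by
  induction l with
  | nil => simp
  | cons a l ih => cases l with
    | nil => simp
    | cons b l =>
      rw [List.reverse_cons, List.reverse_cons, List.append_assoc]
      rw [show [b] ++ [a] = [b, a] from rfl, pathEdges_append_two, ← List.reverse_cons]
      simp only [List.mem_append, ih, pathEdges_cons_cons, List.mem_cons, List.not_mem_nil,
        or_false]
      rw [or_comm]
      refine or_congr ?_ Iff.rfl
      rcases e with ⟨x, y⟩; simp [and_comm]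

theorem mem_cycEdges_reverse {l : List Plane} {e : Plane × Plane} :
    e ∈ cycEdges l.reverse ↔ e.swap ∈ cycEdges l := by
  cases l with
  | nil => simp [cycEdges]
  | cons a l =>
    rw [List.reverse_cons, mem_cycEdges_append_comm, List.singleton_append, cycEdges_cons,
      cycEdges_cons, ← mem_pathEdges_reverse]
    simp

theorem pathEdges_subset_cycEdges {l : List Plane} {e : Plane × Plane} (h : e ∈ pathEdges l) :
    e ∈ cycEdges l := by
  cases l with
  | nil => cases h
  | cons a l =>
    rcases List.eq_nil_or_concat' l with rfl | ⟨A, b, rfl⟩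
    · simp at h
    · rw [← List.cons_append] at *
      rw [cycEdges_concat]
      exact List.mem_append_left _ h

/-- The union of the segments of a set of edges. -/
def edgeUnion (E : Set (Plane × Plane)) : Set Plane := ⋃ e ∈ E, segment ℝ e.1 e.2

theorem mem_edgeUnion {E : Set (Plane × Plane)} {x : Plane} :
    x ∈ edgeUnion E ↔ ∃ e ∈ E, x ∈ segment ℝ e.1 e.2 := by
  simp [edgeUnion]

/-- The edges are nondegenerate and meet only in common end points. -/
def IsPlaneGraph (E : Set (Plane × Plane)) : Prop :=
  (∀ e ∈ E, e.1 ≠ e.2) ∧ ∀ e ∈ E, ∀ f ∈ E, e ≠ f → ∀ x ∈ segment ℝ e.1 e.2,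
    x ∈ segment ℝ f.1 f.2 → (x = e.1 ∨ x = e.2) ∧ (x = f.1 ∨ x = f.2)

/-- Near `z`, the set `H` contains the side `σ` of the edge `e` and misses the other side. -/
def SideAt (H : Set Plane) (e : Plane × Plane) (σ : ℝ) (z : Plane) : Prop :=
  ∃ r > 0, ∀ x ∈ Metric.ball z r, (0 < σ * orient e.1 e.2 x → x ∈ H) ∧
    (σ * orient e.1 e.2 x < 0 → x ∉ H)

/-- The set `H` lies locally on the side `σ` of the edge `e`. -/
def Side (H : Set Plane) (e : Plane × Plane) (σ : ℝ) : Prop :=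
  ∀ z ∈ openSegment ℝ e.1 e.2, SideAt H e σ z

/-- `G` is the interior of a polygon with vertex list `L`. -/
structure PolyInt (L : List Plane) (G : Set Plane) : Prop where
  len : 3 ≤ L.length
  nodup : L.Nodup
  graph : IsPlaneGraph {e | e ∈ cycEdges L}
  isOpen : IsOpen G
  conn : IsPreconnected G
  nonempty : G.Nonempty
  bdd : Bornology.IsBounded G
  front : frontier G ⊆ edgeUnion {e | e ∈ cycEdges L}
  side : ∀ e ∈ cycEdges L, ∃ σ : ℝ, (σ = 1 ∨ σ = -1) ∧ Side G e σ

theorem isClosed_segment' (p q : Plane) : IsClosed (segment ℝ p q) := by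
  rw [segment_eq_image_lineMap]
  exact (isCompact_Icc.image AffineMap.lineMap_continuous).isClosed

theorem isClosed_edgeUnion {E : Set (Plane × Plane)} (hE : E.Finite) : IsClosed (edgeUnion E) :=
  hE.isClosed_biUnion fun _ _ => isClosed_segment' _ _

theorem finite_cycEdges (L : List Plane) : {e | e ∈ cycEdges L}.Finite := List.finite_toSet _

/-- Around a relatively interior point of an edge of a finite plane graph there is a ball that
avoids all the other edges. -/
theorem exists_ball_disjoint {E : Set (Plane × Plane)} (hE : E.Finite) (hg : IsPlaneGraph E)
    {e : Plane × Plane} (he : e ∈ E) {z : Plane} (hz : z ∈ openSegment ℝ e.1 e.2) :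
    ∃ r > 0, ∀ f ∈ E, f ≠ e → Disjoint (Metric.ball z r) (segment ℝ f.1 f.2) := by
  have hfin : (E \ {e}).Finite := hE.subset sdiff_subset
  have hz' : z ∈ (edgeUnion (E \ {e}))ᶜ := by
    intro h
    obtain ⟨f, ⟨hf, hfe⟩, hzf⟩ := mem_edgeUnion.1 h
    have := (hg.2 e he f hf (Ne.symm hfe) z (openSegment_subset_segment _ _ _ hz) hzf).1
    have h2 := ne_of_mem_openSegment (hg.1 e he) hz
    tauto
  obtain ⟨r, hr, hb⟩ := Metric.isOpen_iff.1 (isClosed_edgeUnion hfin).isOpen_compl z hz'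
  refine ⟨r, hr, fun f hf hfe => ?_⟩
  rw [disjoint_left]
  intro x hx hxf
  exact hb hx (mem_edgeUnion.2 ⟨f, ⟨hf, hfe⟩, hxf⟩)

theorem SideAt.notMem {H : Set Plane} (hH : IsOpen H) {e : Plane × Plane} (he : e.1 ≠ e.2) {σ : ℝ}
    (hσ : σ = 1 ∨ σ = -1) {z : Plane} (hz : z ∈ segment ℝ e.1 e.2) (h : SideAt H e σ z) :
    z ∉ H := by
  intro hzH
  obtain ⟨r, hr, hb⟩ := h
  obtain ⟨t, ht, hm⟩ := exists_shift_mem (p := e.1) (q := e.2)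
    (Filter.inter_mem (hH.mem_nhds hzH) (Metric.ball_mem_nhds z hr)) (-σ)
  refine (hb _ hm.2).2 ?_ hm.1
  rw [orient_shift, orient_of_mem_segment hz]
  have := scal_self_pos he
  rcases hσ with rfl | rfl <;> nlinarith

theorem SideAt.mem_closure {H : Set Plane} {e : Plane × Plane} (he : e.1 ≠ e.2) {σ : ℝ}
    (hσ : σ = 1 ∨ σ = -1) {z : Plane} (hz : z ∈ segment ℝ e.1 e.2) (h : SideAt H e σ z) :
    z ∈ closure H := by
  obtain ⟨r, hr, hb⟩ := h
  rw [mem_closure_iff_nhds]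
  intro U hU
  obtain ⟨t, ht, hm⟩ := exists_shift_mem (p := e.1) (q := e.2)
    (Filter.inter_mem hU (Metric.ball_mem_nhds z hr)) σ
  refine ⟨_, hm.1, (hb _ hm.2).1 ?_⟩
  rw [orient_shift, orient_of_mem_segment hz]
  have := scal_self_pos he
  rcases hσ with rfl | rfl <;> nlinarith

theorem SideAt.unique {H : Set Plane} {e : Plane × Plane} (he : e.1 ≠ e.2) {z : Plane}
    (hz : z ∈ segment ℝ e.1 e.2) (h : SideAt H e 1 z) (h' : SideAt H e (-1) z) : False := by
  obtain ⟨r, hr, hb⟩ := h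
  obtain ⟨r', hr', hb'⟩ := h'
  obtain ⟨t, ht, hm⟩ := exists_shift_mem (p := e.1) (q := e.2)
    (Filter.inter_mem (Metric.ball_mem_nhds z hr) (Metric.ball_mem_nhds z hr')) 1
  have hp : 0 < orient e.1 e.2 (shift e.1 e.2 z (1 * t)) := by
    rw [orient_shift, orient_of_mem_segment hz]
    have := scal_self_pos he
    nlinarith
  exact (hb' _ hm.2).2 (by linarith) ((hb _ hm.1).1 (by linarith))

theorem isPreconnected_openSegment (p q : Plane) : IsPreconnected (openSegment ℝ p q) :=
  (convex_openSegment p q).isPreconnected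

/-- An open set bounded by a plane graph lies on exactly one side of an edge, or stays away from it,
unless it contains both sides near some point. -/
theorem side_or_disjoint {E : Set (Plane × Plane)} (hE : E.Finite) (hg : IsPlaneGraph E)
    {H : Set Plane} (hH : IsOpen H) (hf : frontier H ⊆ edgeUnion E) {e : Plane × Plane}
    (he : e ∈ E)
    (h2 : ∀ z ∈ openSegment ℝ e.1 e.2, ∀ r > 0,
      ¬ ∀ x ∈ Metric.ball z r, orient e.1 e.2 x ≠ 0 → x ∈ H) :
    Side H e 1 ∨ Side H e (-1) ∨ Disjoint (openSegment ℝ e.1 e.2) (closure H) := by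
  set S := openSegment ℝ e.1 e.2 with hS
  have hlocal : ∀ z ∈ S, ∃ r > 0, (∀ z' ∈ S ∩ Metric.ball z r, SideAt H e 1 z') ∨
      (∀ z' ∈ S ∩ Metric.ball z r, SideAt H e (-1) z') ∨
      (∀ z' ∈ S ∩ Metric.ball z r, z' ∉ closure H) := by
    intro z hz
    obtain ⟨r, hr, hb⟩ := exists_ball_disjoint hE hg he hz
    have hdis : ∀ σ : ℝ, Disjoint (Metric.ball z r ∩ {x | 0 < σ * orient e.1 e.2 x}) (frontier H) := by
      intro σ
      rw [disjoint_left]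
      rintro x ⟨hx, hxo⟩ hxf
      obtain ⟨f, hfE, hxf⟩ := mem_edgeUnion.1 (hf hxf)
      by_cases hfe : f = e
      · subst hfe
        simp [orient_of_mem_segment hxf] at hxo
      · exact disjoint_left.1 (hb f hfE hfe) hx hxf
    have key : ∀ σ : ℝ, (σ = 1 ∨ σ = -1) →
        (∀ x ∈ Metric.ball z r, 0 < σ * orient e.1 e.2 x → x ∈ H) →
        (∀ x ∈ Metric.ball z r, 0 < -σ * orient e.1 e.2 x → x ∉ H) →
        ∀ z' ∈ S ∩ Metric.ball z r, SideAt H e σ z' := by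
      rintro σ hσ h1 h2 z' ⟨hz', hz'r⟩
      obtain ⟨r', hr', hb'⟩ := Metric.isOpen_iff.1 Metric.isOpen_ball z' hz'r
      exact ⟨r', hr', fun x hx => ⟨h1 x (hb' hx), fun hx2 => h2 x (hb' hx) (by linarith)⟩⟩
    rcases (isPreconnected_halfBall e.1 e.2 z r 1).subset_or_disjoint_of_frontier (hdis 1) with hp | hp <;>
    rcases (isPreconnected_halfBall e.1 e.2 z r (-1)).subset_or_disjoint_of_frontier (hdis (-1)) with hm | hm
    · exfalso
      refine h2 z hz r hr fun x hx hne => ?_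
      rcases lt_or_gt_of_ne hne with h | h
      · exact hm ⟨hx, by simpa using h⟩
      · exact hp ⟨hx, by simpa using h⟩
    · exact ⟨r, hr, .inl (key 1 (.inl rfl) (fun x hx h => hp ⟨hx, h⟩)
        fun x hx h hxH => disjoint_left.1 hm ⟨hx, by simpa using h⟩ hxH)⟩
    · refine ⟨r, hr, .inr (.inl (key (-1) (.inr rfl) (fun x hx h => hm ⟨hx, h⟩)
        fun x hx h hxH => disjoint_left.1 hp ⟨hx, by simpa using h⟩ hxH))⟩
    · refine ⟨r, hr, .inr (.inr ?_)⟩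
      rintro z' ⟨-, hz'⟩ hcl
      obtain ⟨y, hyb, hyH⟩ := mem_closure_iff.1 hcl _ Metric.isOpen_ball hz'
      obtain ⟨y', hy', hne⟩ : ∃ y' ∈ H ∩ Metric.ball z r, orient e.1 e.2 y' ≠ 0 := by
        by_cases h0 : orient e.1 e.2 y = 0
        · obtain ⟨t, ht, hm⟩ := exists_shift_mem (p := e.1) (q := e.2)
            (Filter.inter_mem (hH.mem_nhds hyH) (Metric.isOpen_ball.mem_nhds hyb)) 1
          refine ⟨_, hm, ?_⟩
          rw [orient_shift, h0]
          have := scal_self_pos (hg.1 e he)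
          have : 0 < t * scal e.1 e.2 e.2 := mul_pos ht this
          linarith
        · exact ⟨y, ⟨hyH, hyb⟩, h0⟩
      rcases lt_or_gt_of_ne hne with h | h
      · exact disjoint_left.1 hm ⟨hy'.2, by simpa using h⟩ hy'.1
      · exact disjoint_left.1 hp ⟨hy'.2, by simpa using h⟩ hy'.1
  have hpc := isPreconnected_openSegment e.1 e.2
  have hne := hg.1 e he
  have hseg : S ⊆ segment ℝ e.1 e.2 := openSegment_subset_segment _ _ _
  -- three relatively open classes
  have main : ∀ Q R : Plane → Prop,
      (∀ z ∈ S, ∃ r > 0, (∀ z' ∈ S ∩ Metric.ball z r, Q z') ∨ (∀ z' ∈ S ∩ Metric.ball z r, R z')) →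
      (∀ z ∈ S, Q z → R z → False) → (∀ z ∈ S, Q z) ∨ (∀ z ∈ S, R z) := by
    intro Q R hQR hno
    let U : (Plane → Prop) → Set Plane := fun T =>
      {x | ∃ z ∈ S, ∃ r > 0, (∀ z' ∈ S ∩ Metric.ball z r, T z') ∧ x ∈ Metric.ball z r}
    have hU : ∀ T, IsOpen (U T) := by
      intro T
      rw [Metric.isOpen_iff]
      rintro x ⟨z, hz, r, hr, hT, hx⟩
      obtain ⟨r', hr', hb'⟩ := Metric.isOpen_iff.1 Metric.isOpen_ball x hx
      exact ⟨r', hr', fun y hy => ⟨z, hz, r, hr, hT, hb' hy⟩⟩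
    have hUT : ∀ T, ∀ x ∈ S, x ∈ U T → T x := by
      rintro T x hxS ⟨z, hz, r, hr, hT, hx⟩
      exact hT x ⟨hxS, hx⟩
    have hcov : S ⊆ U Q ∪ U R := by
      intro z hz
      obtain ⟨r, hr, h | h⟩ := hQR z hz
      · exact .inl ⟨z, hz, r, hr, h, Metric.mem_ball_self hr⟩
      · exact .inr ⟨z, hz, r, hr, h, Metric.mem_ball_self hr⟩
    have hemp : S ∩ (U Q ∩ U R) = ∅ := by
      rw [eq_empty_iff_forall_notMem]
      rintro x ⟨hxS, hq, hr⟩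
      exact hno x hxS (hUT Q x hxS hq) (hUT R x hxS hr)
    rcases isPreconnected_iff_subset_of_disjoint.1 hpc _ _ (hU Q) (hU R) hcov hemp with h | h
    · exact .inl fun z hz => hUT Q z hz (h hz)
    · exact .inr fun z hz => hUT R z hz (h hz)
  have m1 := main (fun z => SideAt H e 1 z) (fun z => SideAt H e (-1) z ∨ z ∉ closure H) (by
    intro z hz
    obtain ⟨r, hr, h1 | h1 | h1⟩ := hlocal z hz
    · exact ⟨r, hr, .inl h1⟩
    · exact ⟨r, hr, .inr fun z' hz' => .inl (h1 z' hz')⟩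
    · exact ⟨r, hr, .inr fun z' hz' => .inr (h1 z' hz')⟩) (by
    rintro z hz h1 (h2 | h2)
    · exact h1.unique hne (hseg hz) h2
    · exact h2 (h1.mem_closure hne (.inl rfl) (hseg hz)))
  rcases m1 with h | h
  · exact .inl h
  have m2 := main (fun z => SideAt H e (-1) z) (fun z => z ∉ closure H) (by
    intro z hz
    obtain ⟨r, hr, h1 | h1 | h1⟩ := hlocal z hz
    · exfalso
      have h3 := h1 z ⟨hz, Metric.mem_ball_self hr⟩
      rcases h z hz with h4 | h4
      · exact h3.unique hne (hseg hz) h4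
      · exact h4 (h3.mem_closure hne (.inl rfl) (hseg hz))
    · exact ⟨r, hr, .inl h1⟩
    · exact ⟨r, hr, .inr h1⟩) (by
    intro z hz h1 h2
    exact h2 (h1.mem_closure hne (.inr rfl) (hseg hz)))
  rcases m2 with h | h
  · exact .inr (.inl h)
  · exact .inr (.inr (disjoint_left.2 h))

theorem exists_near {v q : Plane} {ρ : ℝ} (hρ : 0 < ρ) :
    ∃ z ∈ openSegment ℝ v q, z ∈ Metric.ball v ρ := by
  have : Continuous (fun t : ℝ => (AffineMap.lineMap v q t : Plane)) := AffineMap.lineMap_continuous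
  have hc := this.tendsto 0
  rw [AffineMap.lineMap_apply_zero] at hc
  have h1 : ∀ᶠ t in nhds (0:ℝ), (AffineMap.lineMap v q t : Plane) ∈ Metric.ball v ρ :=
    hc (Metric.ball_mem_nhds v hρ)
  obtain ⟨t, ⟨ht, ht1⟩, ht0⟩ := (((h1.and (gt_mem_nhds one_pos)).filter_mono nhdsWithin_le_nhds).and
    (self_mem_nhdsWithin : Ioi (0:ℝ) ∈ nhdsWithin 0 (Ioi 0))).exists
  exact ⟨_, mem_openSegment_iff.2 ⟨t, ht0, ht1, rfl⟩, ht⟩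

theorem endpoint_of_mem_segment {E : Set (Plane × Plane)} (hg : IsPlaneGraph E)
    {e f : Plane × Plane} (he : e ∈ E) (hf : f ∈ E) {v : Plane} (hv : v = e.1 ∨ v = e.2)
    (h : v ∈ segment ℝ f.1 f.2) : v = f.1 ∨ v = f.2 := by
  by_cases hef : e = f
  · subst hef; exact hv
  · refine (hg.2 e he f hf hef v ?_ h).2
    rcases hv with rfl | rfl
    · exact left_mem_segment _ _ _
    · exact right_mem_segment _ _ _

theorem exists_slit {E : Set (Plane × Plane)} (hE : E.Finite) (hg : IsPlaneGraph E)
    {H : Set Plane} (hf : frontier H ⊆ edgeUnion E) {e : Plane × Plane}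
    (he : e ∈ E) {v q : Plane} (hv : e = (v, q) ∨ e = (q, v))
    (hn : ∀ f ∈ E, f ≠ e → v ∈ segment ℝ f.1 f.2 → Disjoint (openSegment ℝ f.1 f.2) (closure H)) :
    ∃ ρ > 0, Metric.ball v ρ \ segment ℝ v q ⊆ H ∨ Disjoint (Metric.ball v ρ \ segment ℝ v q) H := by
  have hvq : v ≠ q := by
    have := hg.1 e he
    rcases hv with rfl | rfl
    · exact this
    · exact this.symm
  have hseg : segment ℝ e.1 e.2 = segment ℝ v q := by
    rcases hv with rfl | rfl
    · rfl
    · exact segment_symm _ _ _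
  have hve : v = e.1 ∨ v = e.2 := by rcases hv with rfl | rfl <;> simp
  let K : Set Plane := edgeUnion {f ∈ E | v ∉ segment ℝ f.1 f.2} ∪
    ((Prod.fst '' E ∪ Prod.snd '' E) \ {v})
  have hK : IsClosed K := (isClosed_edgeUnion (hE.subset (sep_subset _ _))).union
    ((((hE.image _).union (hE.image _)).subset sdiff_subset).isClosed)
  have hvK : v ∈ Kᶜ := by
    rintro (h | h)
    · obtain ⟨f, hf, hvf⟩ := mem_edgeUnion.1 h
      exact hf.2 hvf
    · exact h.2 rfl
  obtain ⟨r, hr, hb⟩ := Metric.isOpen_iff.1 hK.isOpen_compl v hvK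
  refine ⟨min r (dist q v), lt_min hr (dist_pos.2 hvq.symm), ?_⟩
  refine (isPreconnected_slit hvq (lt_min hr (dist_pos.2 hvq.symm)) (min_le_right _ _)
    ).subset_or_disjoint_of_frontier ?_
  rw [disjoint_left]
  rintro x ⟨hx, hxs⟩ hxf
  have hxK : x ∉ K := hb (Metric.ball_subset_ball (min_le_left _ _) hx)
  have hxv : x ≠ v := by rintro rfl; exact hxs (left_mem_segment _ _ _)
  obtain ⟨f, hfE, hxf'⟩ := mem_edgeUnion.1 (hf hxf)
  by_cases hfe : f = e
  · subst hfe; rw [hseg] at hxf'; exact hxs hxf'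
  · by_cases hvf : v ∈ segment ℝ f.1 f.2
    · refine disjoint_left.1 (hn f hfE hfe hvf) (mem_openSegment_of_mem_segment hxf' ?_ ?_)
        (frontier_subset_closure hxf)
      · rintro rfl
        exact hxK (.inr ⟨.inl ⟨f, hfE, rfl⟩, hxv⟩)
      · rintro rfl
        exact hxK (.inr ⟨.inr ⟨f, hfE, rfl⟩, hxv⟩)
    · exact hxK (.inl (mem_edgeUnion.2 ⟨f, ⟨hfE, hvf⟩, hxf'⟩))

theorem openSegment_eq_of_eq_or {e : Plane × Plane} {v q : Plane} (hv : e = (v, q) ∨ e = (q, v)) :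
    openSegment ℝ e.1 e.2 = openSegment ℝ v q := by
  rcases hv with rfl | rfl
  · rfl
  · exact openSegment_symm _ _ _

theorem segment_eq_of_eq_or {e : Plane × Plane} {v q : Plane} (hv : e = (v, q) ∨ e = (q, v)) :
    segment ℝ e.1 e.2 = segment ℝ v q := by
  rcases hv with rfl | rfl
  · rfl
  · exact segment_symm _ _ _

theorem exists_sides_near {e : Plane × Plane} (he : e.1 ≠ e.2) {z : Plane}
    (hz : z ∈ segment ℝ e.1 e.2) {U : Set Plane} (hU : U ∈ nhds z) {σ : ℝ} (hσ : σ = 1 ∨ σ = -1) :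
    ∃ x ∈ U, 0 < σ * orient e.1 e.2 x := by
  obtain ⟨t, ht, hm⟩ := exists_shift_mem (p := e.1) (q := e.2) hU σ
  refine ⟨_, hm, ?_⟩
  rw [orient_shift, orient_of_mem_segment hz]
  have := scal_self_pos he
  rcases hσ with rfl | rfl <;> nlinarith

/-- An open set bounded by a plane graph that touches an edge touches another edge at each of
its end points. -/
theorem exists_adjacent {E : Set (Plane × Plane)} (hE : E.Finite) (hg : IsPlaneGraph E)
    {H : Set Plane} (hf : frontier H ⊆ edgeUnion E) {e : Plane × Plane}
    (he : e ∈ E) {v q : Plane} (hv : e = (v, q) ∨ e = (q, v)) {σ : ℝ} (hσ : σ = 1 ∨ σ = -1)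
    (hs : Side H e σ) :
    ∃ f ∈ E, f ≠ e ∧ v ∈ segment ℝ f.1 f.2 ∧ ¬ Disjoint (openSegment ℝ f.1 f.2) (closure H) := by
  by_contra! hn
  obtain ⟨ρ, hρ, h⟩ := exists_slit hE hg hf he hv hn
  obtain ⟨z, hz, hzb⟩ := exists_near (v := v) (q := q) hρ
  rw [← openSegment_eq_of_eq_or hv] at hz
  have hz' := openSegment_subset_segment _ _ _ hz
  obtain ⟨r, hr, hb⟩ := hs z hz
  have hU : Metric.ball v ρ ∩ Metric.ball z r ∈ nhds z :=
    Filter.inter_mem (Metric.isOpen_ball.mem_nhds hzb) (Metric.ball_mem_nhds z hr)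
  have hne := hg.1 e he
  have hoff : ∀ x, orient e.1 e.2 x ≠ 0 → x ∉ segment ℝ v q := by
    intro x hx hxs
    rw [← segment_eq_of_eq_or hv] at hxs
    exact hx (orient_of_mem_segment hxs)
  have hσ0 : -σ = 1 ∨ -σ = -1 := by rcases hσ with rfl | rfl <;> simp
  obtain ⟨x, hx, hxo⟩ := exists_sides_near hne hz' hU hσ
  obtain ⟨y, hy, hyo⟩ := exists_sides_near hne hz' hU hσ0
  rcases h with h | h
  · refine (hb y hy.2).2 (by linarith) (h ⟨hy.1, hoff _ ?_⟩)
    rintro h0; simp [h0] at hyo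
  · refine disjoint_left.1 h ⟨hx.1, hoff _ ?_⟩ ((hb x hx.2).1 hxo)
    rintro h0; simp [h0] at hxo

theorem notMem_closure_vertex {E : Set (Plane × Plane)} (hE : E.Finite) (hg : IsPlaneGraph E)
    {H : Set Plane} (hf : frontier H ⊆ edgeUnion E) (hd : Disjoint (edgeUnion E) H)
    {e : Plane × Plane} (he : e ∈ E) {v q : Plane} (hv : e = (v, q) ∨ e = (q, v))
    (hn : ∀ f ∈ E, v ∈ segment ℝ f.1 f.2 → Disjoint (openSegment ℝ f.1 f.2) (closure H)) :
    v ∉ closure H := by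
  obtain ⟨ρ, hρ, h⟩ := exists_slit hE hg hf he hv (fun f hf _ => hn f hf)
  rcases h with h | h
  · exfalso
    obtain ⟨z, hz, hzb⟩ := exists_near (v := v) (q := q) hρ
    rw [← openSegment_eq_of_eq_or hv] at hz
    have hz' := openSegment_subset_segment _ _ _ hz
    refine disjoint_left.1 (hn e he ?_) hz ?_
    · rw [segment_eq_of_eq_or hv]; exact left_mem_segment _ _ _
    · rw [mem_closure_iff_nhds]
      intro U hU
      obtain ⟨x, hx, hxo⟩ := exists_sides_near (hg.1 e he) hz'
        (Filter.inter_mem hU (Metric.isOpen_ball.mem_nhds hzb)) (.inl rfl)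
      refine ⟨x, hx.1, h ⟨hx.2, fun hxs => ?_⟩⟩
      rw [← segment_eq_of_eq_or hv] at hxs
      simp [orient_of_mem_segment hxs] at hxo
  · intro hcl
    obtain ⟨x, hxb, hxH⟩ := mem_closure_iff.1 hcl _ Metric.isOpen_ball (Metric.mem_ball_self hρ)
    by_cases hxs : x ∈ segment ℝ v q
    · rw [← segment_eq_of_eq_or hv] at hxs
      exact disjoint_left.1 hd (mem_edgeUnion.2 ⟨e, he, hxs⟩) hxH
    · exact disjoint_left.1 h ⟨hxb, hxs⟩ hxH

namespace PolyInt
variable {L : List Plane} {G : Set Plane}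

theorem ne (h : PolyInt L G) {e : Plane × Plane} (he : e ∈ cycEdges L) : e.1 ≠ e.2 :=
  h.graph.1 e he

theorem openSegment_disjoint (h : PolyInt L G) {e : Plane × Plane} (he : e ∈ cycEdges L)
    {z : Plane} (hz : z ∈ openSegment ℝ e.1 e.2) : z ∉ G := by
  obtain ⟨σ, hσ, hs⟩ := h.side e he
  exact (hs z hz).notMem h.isOpen (h.ne he) hσ (openSegment_subset_segment _ _ _ hz)

theorem segment_disjoint (h : PolyInt L G) {e : Plane × Plane} (he : e ∈ cycEdges L)
    {z : Plane} (hz : z ∈ segment ℝ e.1 e.2) : z ∉ G := by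
  intro hzG
  have : z ∈ closure (openSegment ℝ e.1 e.2) := by rwa [closure_openSegment]
  obtain ⟨y, hy, hy'⟩ := mem_closure_iff.1 this G h.isOpen hzG
  exact h.openSegment_disjoint he hy' hy

theorem vertex_notMem (h : PolyInt L G) {v : Plane} (hv : v ∈ L) : v ∉ G := by
  obtain ⟨e, he, rfl⟩ := exists_fst_eq hv
  exact h.segment_disjoint he (left_mem_segment _ _ _)

theorem edgeUnion_disjoint (h : PolyInt L G) : Disjoint (edgeUnion {e | e ∈ cycEdges L}) G := by
  rw [disjoint_left]
  intro x hx
  obtain ⟨e, he, hx⟩ := mem_edgeUnion.1 hx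
  exact h.segment_disjoint he hx

theorem segment_subset_closure (h : PolyInt L G) {e : Plane × Plane} (he : e ∈ cycEdges L) :
    segment ℝ e.1 e.2 ⊆ closure G := by
  rw [← closure_openSegment]
  refine closure_minimal (fun z hz => ?_) isClosed_closure
  obtain ⟨σ, hσ, hs⟩ := h.side e he
  exact (hs z hz).mem_closure (h.ne he) hσ (openSegment_subset_segment _ _ _ hz)

theorem vertex_endpoint (h : PolyInt L G) {v : Plane} (hv : v ∈ L) {e : Plane × Plane}
    (he : e ∈ cycEdges L) (hve : v ∈ segment ℝ e.1 e.2) : v = e.1 ∨ v = e.2 := by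
  obtain ⟨f, hf, rfl⟩ := exists_fst_eq hv
  exact endpoint_of_mem_segment h.graph hf he (.inl rfl) hve

theorem vertex_notMem_openSegment (h : PolyInt L G) {v : Plane} (hv : v ∈ L) {e : Plane × Plane}
    (he : e ∈ cycEdges L) : v ∉ openSegment ℝ e.1 e.2 := by
  intro hve
  have h1 := ne_of_mem_openSegment (h.ne he) hve
  have h2 := h.vertex_endpoint hv he (openSegment_subset_segment _ _ _ hve)
  tauto

theorem congr_edges (h : PolyInt L G) {L' : List Plane} (h3 : 3 ≤ L'.length) (hn : L'.Nodup)
    (hm : ∀ e, e ∈ cycEdges L' ↔ e ∈ cycEdges L) : PolyInt L' G := by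
  have he : {e | e ∈ cycEdges L'} = {e | e ∈ cycEdges L} := Set.ext hm
  exact ⟨h3, hn, he ▸ h.graph, h.isOpen, h.conn, h.nonempty, h.bdd, he ▸ h.front,
    fun e he => h.side e ((hm e).1 he)⟩

theorem rotate {A B : List Plane} (h : PolyInt (A ++ B) G) : PolyInt (B ++ A) G :=
  h.congr_edges (by have := h.len; simp at *; omega) (List.nodup_append_comm.1 h.nodup)
    fun _ => mem_cycEdges_append_comm

theorem reverse (h : PolyInt L G) : PolyInt L.reverse G where
  len := by simpa using h.len
  nodup := List.nodup_reverse.2 h.nodup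
  graph := by
    constructor
    · intro e he
      exact (h.ne (mem_cycEdges_reverse.1 he)).symm
    · intro e he f hf hef x hxe hxf
      rw [segment_symm] at hxe hxf
      have := h.graph.2 _ (mem_cycEdges_reverse.1 he) _ (mem_cycEdges_reverse.1 hf)
        (fun h => hef (Prod.swap_injective h)) x hxe hxf
      exact ⟨this.1.symm, this.2.symm⟩
  isOpen := h.isOpen
  conn := h.conn
  nonempty := h.nonempty
  bdd := h.bdd
  front := by
    intro x hx
    obtain ⟨e, he, hxe⟩ := mem_edgeUnion.1 (h.front hx)
    refine mem_edgeUnion.2 ⟨e.swap, ?_, by rw [segment_symm]; exact hxe⟩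
    exact mem_cycEdges_reverse.2 (by simpa using he)
  side := by
    intro e he
    obtain ⟨σ, hσ, hs⟩ := h.side _ (mem_cycEdges_reverse.1 he)
    refine ⟨-σ, by rcases hσ with rfl | rfl <;> simp, ?_⟩
    intro z hz
    rw [openSegment_symm] at hz
    obtain ⟨r, hr, hb⟩ := hs z hz
    refine ⟨r, hr, fun x hx => ?_⟩
    have := hb x hx
    rw [show orient e.swap.1 e.swap.2 x = - orient e.1 e.2 x from orient_swap _ _ _] at this
    simpa using this

end PolyInt

theorem mem_segment_of_mem_left {p q x y : Plane} (hx : x ∈ segment ℝ p q)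
    (hy : y ∈ segment ℝ p x) : y ∈ segment ℝ p q := by
  have h : segment ℝ p x ⊆ segment ℝ p q :=
    (convex_segment p q).segment_subset (left_mem_segment _ _ _) hx
  exact h hy

theorem eq_of_mem_segments {p q x y : Plane} (hpq : p ≠ q) (hx : x ∈ openSegment ℝ p q)
    (h1 : y ∈ segment ℝ p x) (h2 : y ∈ segment ℝ x q) : y = x := by
  have hy := mem_segment_of_mem_left (openSegment_subset_segment _ _ _ hx) h1
  have hs := scal_self_pos hpq
  obtain ⟨t, ht0, ht1, rfl⟩ := mem_openSegment_iff.1 hx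
  obtain ⟨s, hs0, hs1, rfl⟩ := mem_segment_iff.1 hy
  obtain ⟨a, ha0, ha1, ha⟩ := mem_segment_iff.1 h1
  obtain ⟨b, hb0, hb1, hb⟩ := mem_segment_iff.1 h2
  have e1 := congrArg (scal p q) ha
  have e2 := congrArg (scal p q) hb
  simp only [scal_lineMap, scal_left] at e1 e2
  have h1 : s ≤ t := by
    by_contra! h
    have : a * t * scal p q q = s * scal p q q := by linarith
    have := mul_right_cancel₀ hs.ne' this
    nlinarith
  have h2 : t ≤ s := by
    by_contra! h
    have : (t + b * (1 - t)) * scal p q q = s * scal p q q := by linarith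
    have := mul_right_cancel₀ hs.ne' this
    nlinarith
  rw [le_antisymm h1 h2]

theorem orient_subsegment {p q x : Plane} {t : ℝ} (hx : (AffineMap.lineMap p q t : Plane) = x)
    (y : Plane) : orient p x y = t * orient p q y := by
  subst hx; unfold orient; simp only [lineMap_coord]; ring

theorem Side.left {G : Set Plane} {p q x : Plane} (hx : x ∈ openSegment ℝ p q) {σ : ℝ}
    (h : Side G (p, q) σ) : Side G (p, x) σ := by
  intro z hz
  have hz' : z ∈ openSegment ℝ p q := by
    obtain ⟨t, h0, h1, rfl⟩ := mem_openSegment_iff.1 hx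
    obtain ⟨s, h0', h1', rfl⟩ := mem_openSegment_iff.1 hz
    refine mem_openSegment_iff.2 ⟨s * t, by positivity, by nlinarith, ?_⟩
    apply plane_ext <;> simp only [lineMap_coord] <;> ring
  obtain ⟨t, h0, h1, ht⟩ := mem_openSegment_iff.1 hx
  obtain ⟨r, hr, hb⟩ := h z hz'
  refine ⟨r, hr, fun y hy => ?_⟩
  have := hb y hy
  simp only [orient_subsegment ht] at *
  refine ⟨fun hh => this.1 ?_, fun hh => this.2 ?_⟩
  · by_contra! hc; nlinarith
  · by_contra! hc; nlinarith

theorem Side.swap {G : Set Plane} {p q : Plane} {σ : ℝ}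
    (h : Side G (p, q) σ) : Side G (q, p) (-σ) := by
  intro z hz
  rw [openSegment_symm] at hz
  obtain ⟨r, hr, hb⟩ := h z hz
  refine ⟨r, hr, fun x hx => ?_⟩
  have := hb x hx
  simp only [orient_swap p q x] at *
  simpa using this

theorem Side.right {G : Set Plane} {p q x : Plane} (hx : x ∈ openSegment ℝ p q) {σ : ℝ}
    (h : Side G (p, q) σ) : Side G (x, q) σ := by
  have := (h.swap.left (by rwa [openSegment_symm])).swap
  simpa using this

theorem segment_subset_union {p q x y : Plane} (hx : x ∈ openSegment ℝ p q)
    (hy : y ∈ segment ℝ p q) : y ∈ segment ℝ p x ∨ y ∈ segment ℝ x q := by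
  obtain ⟨t, h0, h1, rfl⟩ := mem_openSegment_iff.1 hx
  obtain ⟨s, h0', h1', rfl⟩ := mem_segment_iff.1 hy
  rcases le_total s t with h | h
  · left
    refine mem_segment_iff.2 ⟨s / t, by positivity, (div_le_one h0).2 h, ?_⟩
    apply plane_ext <;> simp only [lineMap_coord] <;> field_simp <;> ring
  · right
    have h2 : 0 < 1 - t := by linarith
    refine mem_segment_iff.2 ⟨(s - t) / (1 - t), div_nonneg (by linarith) h2.le,
      (div_le_one h2).2 (by linarith), ?_⟩
    apply plane_ext <;> simp only [lineMap_coord] <;> field_simp <;> ring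

/-- A point of an edge may be added to the list of vertices. -/
theorem PolyInt.insert_vertex {a b x : Plane} {A : List Plane} {G : Set Plane}
    (h : PolyInt (a :: A ++ [b]) G) (hx : x ∈ openSegment ℝ b a) :
    PolyInt (a :: A ++ [b, x]) G := by
  have hba : (b, a) ∈ cycEdges (a :: A ++ [b]) := by rw [cycEdges_concat]; simp
  have hne : b ≠ a := h.ne hba
  have hxn := ne_of_mem_openSegment hne hx
  have hxs := openSegment_subset_segment _ _ _ hx
  have hcyc : ∀ e, e ∈ cycEdges (a :: A ++ [b, x]) ↔
      e ∈ pathEdges (a :: A ++ [b]) ∨ e = (b, x) ∨ e = (x, a) := by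
    intro e
    rw [show a :: A ++ [b, x] = a :: (A ++ [b]) ++ [x] by simp, cycEdges_concat,
      show a :: (A ++ [b]) ++ [x] = a :: A ++ [b, x] by simp, pathEdges_append_two]
    simp
  have hsub1 : segment ℝ b x ⊆ segment ℝ b a := fun y => mem_segment_of_mem_left hxs
  have hsub2 : segment ℝ x a ⊆ segment ℝ b a :=
    (convex_segment b a).segment_subset hxs (right_mem_segment _ _ _)
  have hpath : ∀ e ∈ pathEdges (a :: A ++ [b]), e ∈ cycEdges (a :: A ++ [b]) ∧ e ≠ (b, a) := by
    intro e he
    refine ⟨pathEdges_subset_cycEdges he, ?_⟩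
    rintro rfl
    have := h.nodup
    have h2 := fst_mem_of_mem_pathEdges he
    have h3 : (pathEdges (a :: A ++ [b])).map Prod.fst = a :: A := by
      rw [map_fst_pathEdges, List.dropLast_concat]
    have h4 : b ∈ a :: A := by
      rw [← h3]; exact List.mem_map.2 ⟨_, he, rfl⟩
    rw [List.nodup_append] at this
    exact this.2.2 b h4 b (by simp) rfl
  have hxL : x ∉ a :: A ++ [b] := fun hxL => h.vertex_notMem_openSegment hxL hba hx
  have hanb : a ∉ segment ℝ b x := by
    intro ha
    have := eq_of_mem_segments hne hx ha (right_mem_segment _ _ _)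
    exact hxn.2 this.symm
  have hbna : b ∉ segment ℝ x a := by
    intro hb
    have := eq_of_mem_segments hne hx (left_mem_segment _ _ _) hb
    exact hxn.1 this.symm
  have hA : ∀ e ∈ pathEdges (a :: A ++ [b]), ∀ y ∈ segment ℝ e.1 e.2, y ∈ segment ℝ b x →
      (y = e.1 ∨ y = e.2) ∧ (y = b ∨ y = x) := by
    intro e he y hye hyb
    have := h.graph.2 e (hpath e he).1 (b, a) hba (hpath e he).2 y hye (hsub1 hyb)
    refine ⟨this.1, ?_⟩
    rcases this.2 with rfl | rfl
    · exact .inl rfl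
    · exact absurd hyb hanb
  have hB : ∀ e ∈ pathEdges (a :: A ++ [b]), ∀ y ∈ segment ℝ e.1 e.2, y ∈ segment ℝ x a →
      (y = e.1 ∨ y = e.2) ∧ (y = x ∨ y = a) := by
    intro e he y hye hyb
    have := h.graph.2 e (hpath e he).1 (b, a) hba (hpath e he).2 y hye (hsub2 hyb)
    refine ⟨this.1, ?_⟩
    rcases this.2 with rfl | rfl
    · exact absurd hyb hbna
    · exact .inr rfl
  have hC : ∀ y ∈ segment ℝ b x, y ∈ segment ℝ x a → y = x := fun y => eq_of_mem_segments hne hx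
  refine ⟨?_, ?_, ⟨?_, ?_⟩, h.isOpen, h.conn, h.nonempty, h.bdd, ?_, ?_⟩
  · simp
  · rw [show a :: A ++ [b, x] = (a :: A ++ [b]) ++ [x] by simp, ← List.concat_eq_append]
    exact List.Nodup.concat hxL h.nodup
  · intro e he
    rcases (hcyc e).1 he with he | rfl | rfl
    · exact h.ne (hpath e he).1
    · exact hxn.1.symm
    · exact hxn.2
  · intro e he f hf hef y hye hyf
    rcases (hcyc e).1 he with he | rfl | rfl <;> rcases (hcyc f).1 hf with hf | rfl | rfl
    · exact h.graph.2 e (hpath e he).1 f (hpath f hf).1 hef y hye hyf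
    · exact hA e he y hye hyf
    · exact hB e he y hye hyf
    · exact (hA f hf y hyf hye).symm
    · exact absurd rfl hef
    · have := hC y hye hyf; simp [this]
    · exact (hB f hf y hyf hye).symm
    · have := hC y hyf hye; simp [this]
    · exact absurd rfl hef
  · intro y hy
    obtain ⟨e, he, hye⟩ := mem_edgeUnion.1 (h.front hy)
    have he' : e ∈ cycEdges (a :: A ++ [b]) := he
    rw [cycEdges_concat] at he'
    rcases List.mem_append.1 he' with he | he
    · exact mem_edgeUnion.2 ⟨e, (hcyc e).2 (.inl he), hye⟩
    · obtain rfl : e = (b, a) := by simpa using he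
      rcases segment_subset_union hx hye with h1 | h1
      · exact mem_edgeUnion.2 ⟨(b, x), (hcyc _).2 (.inr (.inl rfl)), h1⟩
      · exact mem_edgeUnion.2 ⟨(x, a), (hcyc _).2 (.inr (.inr rfl)), h1⟩
  · intro e he
    rcases (hcyc e).1 he with he | rfl | rfl
    · exact h.side e (hpath e he).1
    · obtain ⟨σ, hσ, hs⟩ := h.side _ hba
      exact ⟨σ, hσ, hs.left hx⟩
    · obtain ⟨σ, hσ, hs⟩ := h.side _ hba
      exact ⟨σ, hσ, hs.right hx⟩

/-- `1` if the ray from `x` in the direction of the left normal of `q - p` crosses the edge `e`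
(with a half-open convention at the end points), and `0` otherwise. -/
noncomputable def crossing (p q : Plane) (e : Plane × Plane) (x : Plane) : ZMod 2 :=
  open Classical in
  if (scal p q e.1 ≤ scal p q x ∧ scal p q x < scal p q e.2 ∧ orient e.1 e.2 x < 0) ∨
    (scal p q e.2 ≤ scal p q x ∧ scal p q x < scal p q e.1 ∧ 0 < orient e.1 e.2 x) then 1 else 0

/-- The contribution of a vertex `v` above `x₀` to the crossing number of an edge ending at `v`. -/
noncomputable def vertexJump (p q x₀ v x : Plane) : ZMod 2 :=
  open Classical in
  if scal p q v = scal p q x₀ ∧ orient p q x₀ < orient p q v ∧ scal p q v ≤ scal p q x then 1 else 0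

theorem crossing_swap (p q : Plane) (e : Plane × Plane) (x : Plane) :
    crossing p q e.swap x = crossing p q e x := by
  unfold crossing
  simp only [Prod.fst_swap, Prod.snd_swap, orient_swap e.1 e.2]
  congr 1
  rw [or_comm]
  simp

theorem orient_scal (p q a b x : Plane) :
    scal p q q * orient a b x = (scal p q b - scal p q a) * (orient p q x - orient p q a) -
      (orient p q b - orient p q a) * (scal p q x - scal p q a) := by
  unfold scal orient; ring

theorem crossing_local {p q : Plane} (hpq : p ≠ q) {e : Plane × Plane} (he : e.1 ≠ e.2)
    {x₀ : Plane} (hx : x₀ ∉ segment ℝ e.1 e.2) :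
    ∃ k : ZMod 2, ∀ᶠ x in nhds x₀,
      crossing p q e x = k + vertexJump p q x₀ e.1 x + vertexJump p q x₀ e.2 x := by
  wlog hle : scal p q e.1 ≤ scal p q e.2 generalizing e
  · obtain ⟨k, hk⟩ := this (e := e.swap) he.symm (by rwa [segment_symm]) (le_of_not_ge hle)
    refine ⟨k, hk.mono fun x hx => ?_⟩
    rw [← crossing_swap, hx]
    simp only [Prod.fst_swap, Prod.snd_swap]; ring
  obtain ⟨a, b⟩ := e
  simp only at *
  have hN := scal_self_pos hpq
  have hc : ∀ᶠ x in nhds x₀, ∀ c : ℝ, (c = scal p q a ∨ c = scal p q b) →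
      ((scal p q x₀ < c → scal p q x < c) ∧ (c < scal p q x₀ → c < scal p q x)) := by
    have h1 : ∀ c : ℝ, ∀ᶠ x in nhds x₀, ((scal p q x₀ < c → scal p q x < c) ∧
        (c < scal p q x₀ → c < scal p q x)) := by
      intro c
      refine Eventually.and ?_ ?_
      · by_cases h : scal p q x₀ < c
        · exact ((continuous_scal p q).continuousAt.eventually_lt continuousAt_const h).mono
            fun _ h _ => h
        · exact Eventually.of_forall fun _ h' => absurd h' h
      · by_cases h : c < scal p q x₀
        · exact (continuousAt_const.eventually_lt (continuous_scal p q).continuousAt h).mono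
            fun _ h _ => h
        · exact Eventually.of_forall fun _ h' => absurd h' h
    filter_upwards [h1 (scal p q a), h1 (scal p q b)] with x h1 h2 c hc
    rcases hc with rfl | rfl
    · exact h1
    · exact h2
  have ho : ∀ᶠ x in nhds x₀, ((orient a b x₀ < 0 → orient a b x < 0) ∧
        (0 < orient a b x₀ → 0 < orient a b x)) := by
    refine Eventually.and ?_ ?_
    · by_cases h : orient a b x₀ < 0
      · exact ((continuous_orient a b).continuousAt.eventually_lt continuousAt_const h).mono
          fun _ h _ => h
      · exact Eventually.of_forall fun _ h' => absurd h' h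
    · by_cases h : 0 < orient a b x₀
      · exact (continuousAt_const.eventually_lt (continuous_orient a b).continuousAt h).mono
          fun _ h _ => h
      · exact Eventually.of_forall fun _ h' => absurd h' h
  have horient := orient_scal p q a b x₀
  have hline : orient a b x₀ = 0 → ∃ t : ℝ, x₀ = AffineMap.lineMap a b t ∧ (t < 0 ∨ 1 < t) := by
    intro h0
    refine ⟨_, eq_lineMap_of_orient he h0, ?_⟩
    by_contra! hcon
    exact hx (mem_segment_iff.2 ⟨_, hcon.1, hcon.2, (eq_lineMap_of_orient he h0).symm⟩)
  rcases hle.lt_or_eq with hlt | heq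
  · rcases lt_trichotomy (scal p q x₀) (scal p q a) with h1 | h1 | h1
    · refine ⟨0, ?_⟩
      filter_upwards [hc] with x hc
      have hxa := (hc _ (.inl rfl)).1 h1
      rw [crossing, vertexJump, vertexJump, if_neg, if_neg, if_neg]
      · simp
      · rintro ⟨h1, h2, h3⟩; linarith
      · rintro ⟨h1, h2, h3⟩; linarith
      · rintro (⟨h1, h2, h3⟩ | ⟨h1, h2, h3⟩) <;> simp only [] at * <;> linarith
    · have hsgn : scal p q q * orient a b x₀ =
          (scal p q b - scal p q a) * (orient p q x₀ - orient p q a) := by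
        rw [horient, h1]; ring
      have hne : orient p q x₀ ≠ orient p q a := by
        intro h
        rw [h, sub_self, mul_zero] at hsgn
        obtain ⟨t, ht, ht'⟩ := hline ((mul_eq_zero.1 hsgn).resolve_left hN.ne')
        rw [ht, scal_lineMap] at h1
        have : t * (scal p q b - scal p q a) = 0 := by linarith
        rcases mul_eq_zero.1 this with h | h
        · subst h; norm_num at ht'
        · linarith
      refine ⟨0, ?_⟩
      filter_upwards [hc, ho] with x hc ho
      have hxb := (hc _ (.inr rfl)).1 (h1 ▸ hlt)
      have hb0 : vertexJump p q x₀ b x = 0 := by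
        rw [vertexJump, if_neg]; rintro ⟨h, -⟩; linarith
      rw [hb0, add_zero, zero_add, crossing, vertexJump]
      rcases lt_or_gt_of_ne hne with h | h
      · have : orient a b x₀ < 0 := by
          by_contra! hh
          nlinarith [mul_pos (sub_pos.2 hlt) (sub_pos.2 h), mul_nonneg hN.le hh]
        have hox := ho.1 this
        congr 1
        simp only [eq_iff_iff]
        constructor
        · rintro (⟨h2, h3, h4⟩ | ⟨h2, h3, h4⟩)
          · exact ⟨h1.symm, h, h2⟩
          · linarith
        · rintro ⟨h1, h2, h3⟩
          exact .inl ⟨h3, hxb, hox⟩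
      · have : 0 < orient a b x₀ := by
          by_contra! hh
          nlinarith [mul_pos (sub_pos.2 hlt) (sub_pos.2 h), mul_nonneg hN.le (neg_nonneg.2 hh)]
        have hox := ho.2 this
        rw [if_neg, if_neg]
        · rintro ⟨h1, h2, h3⟩; linarith
        · rintro (⟨h1, h2, h3⟩ | ⟨h1, h2, h3⟩) <;> simp only [] at * <;> linarith
    · rcases lt_trichotomy (scal p q x₀) (scal p q b) with h2 | h2 | h2
      · have hne : orient a b x₀ ≠ 0 := by
          intro h0
          obtain ⟨t, ht, ht'⟩ := hline h0
          rw [ht, scal_lineMap] at h1 h2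
          rcases ht' with h | h <;> nlinarith
        have hj : ∀ x, vertexJump p q x₀ a x = 0 ∧ vertexJump p q x₀ b x = 0 := by
          intro x
          constructor <;> rw [vertexJump, if_neg] <;> rintro ⟨h, -⟩ <;> linarith
        rcases lt_or_gt_of_ne hne with h | h
        · refine ⟨1, ?_⟩
          filter_upwards [hc, ho] with x hc ho
          rw [(hj x).1, (hj x).2, crossing, if_pos]
          · simp
          · exact .inl ⟨((hc _ (.inl rfl)).2 h1).le, (hc _ (.inr rfl)).1 h2, ho.1 h⟩
        · refine ⟨0, ?_⟩
          filter_upwards [hc, ho] with x hc ho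
          rw [(hj x).1, (hj x).2, crossing, if_neg]
          · simp
          · have := ho.2 h
            rintro (⟨h1, h2, h3⟩ | ⟨h1, h2, h3⟩) <;> simp only [] at * <;> linarith
      · have hsgn : scal p q q * orient a b x₀ =
            (scal p q b - scal p q a) * (orient p q x₀ - orient p q b) := by
          rw [horient, h2]; ring
        have hne : orient p q x₀ ≠ orient p q b := by
          intro h
          rw [h, sub_self, mul_zero] at hsgn
          obtain ⟨t, ht, ht'⟩ := hline ((mul_eq_zero.1 hsgn).resolve_left hN.ne')
          rw [ht, scal_lineMap] at h2
          have : (1 - t) * (scal p q b - scal p q a) = 0 := by linarith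
          rcases mul_eq_zero.1 this with h | h
          · obtain rfl : t = 1 := by linarith
            norm_num at ht'
          · linarith
        rcases lt_or_gt_of_ne hne with h | h
        · refine ⟨1, ?_⟩
          have : orient a b x₀ < 0 := by
            by_contra! hh
            nlinarith [mul_pos (sub_pos.2 hlt) (sub_pos.2 h), mul_nonneg hN.le hh]
          filter_upwards [hc, ho] with x hc ho
          have hox := ho.1 this
          have hxa := (hc _ (.inl rfl)).2 h1
          have ha0 : vertexJump p q x₀ a x = 0 := by
            rw [vertexJump, if_neg]; rintro ⟨h, -⟩; linarith
          rw [ha0, add_zero, crossing, vertexJump]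
          by_cases hxb : scal p q b ≤ scal p q x
          · rw [if_neg, if_pos ⟨h2.symm, h, hxb⟩]
            · decide
            · rintro (⟨h1, h2, h3⟩ | ⟨h1, h2, h3⟩) <;> simp only [] at * <;> linarith
          · rw [if_pos, if_neg]
            · simp
            · rintro ⟨-, -, h⟩; exact hxb h
            · exact .inl ⟨hxa.le, not_le.1 hxb, hox⟩
        · refine ⟨0, ?_⟩
          have : 0 < orient a b x₀ := by
            by_contra! hh
            nlinarith [mul_pos (sub_pos.2 hlt) (sub_pos.2 h), mul_nonneg hN.le (neg_nonneg.2 hh)]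
          filter_upwards [hc, ho] with x hc ho
          have hox := ho.2 this
          rw [crossing, vertexJump, vertexJump, if_neg, if_neg, if_neg]
          · simp
          · rintro ⟨h1, h2, h3⟩; linarith
          · rintro ⟨h1, h2, h3⟩; linarith
          · rintro (⟨h1, h2, h3⟩ | ⟨h1, h2, h3⟩) <;> simp only [] at * <;> linarith
      · refine ⟨0, ?_⟩
        filter_upwards [hc] with x hc
        have hxb := (hc _ (.inr rfl)).2 h2
        rw [crossing, vertexJump, vertexJump, if_neg, if_neg, if_neg]
        · simp
        · rintro ⟨h1, h2, h3⟩; linarith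
        · rintro ⟨h1, h2, h3⟩; linarith
        · rintro (⟨h1, h2, h3⟩ | ⟨h1, h2, h3⟩) <;> simp only [] at * <;> linarith
  · refine ⟨0, Eventually.of_forall fun x => ?_⟩
    have h0 : crossing p q (a, b) x = 0 := by
      rw [crossing, if_neg]
      rintro (⟨h1, h2, h3⟩ | ⟨h1, h2, h3⟩) <;> simp only [] at * <;> linarith
    have h1 : vertexJump p q x₀ a x = vertexJump p q x₀ b x := by
      unfold vertexJump
      rw [heq]
      by_cases hm : scal p q b = scal p q x₀
      · have hz : orient a b x₀ = 0 := by
          have : scal p q q * orient a b x₀ = 0 := by rw [horient, heq, hm]; ring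
          exact (mul_eq_zero.1 this).resolve_left hN.ne'
        obtain ⟨t, ht, ht'⟩ := hline hz
        have hY : orient p q x₀ = orient p q a + t * (orient p q b - orient p q a) := by
          rw [ht, orient_lineMap]
        congr 1
        simp only [eq_iff_iff]
        refine and_congr_right fun _ => and_congr_left fun _ => ?_
        rw [hY]
        constructor
        · intro h
          rcases ht' with h' | h' <;> by_contra! hc <;> nlinarith
        · intro h
          rcases ht' with h' | h' <;> by_contra! hc <;> nlinarith
      · rw [if_neg, if_neg]
        · rintro ⟨h, -⟩; exact hm h
        · rintro ⟨h, -⟩; exact hm h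
    rw [h0, h1, zero_add, CharTwo.add_self_eq_zero]

/-- The number of crossings, modulo two, of a polygonal path with the ray from `x`. -/
noncomputable def pathCrossing (p q : Plane) (l : List Plane) (x : Plane) : ZMod 2 :=
  ((pathEdges l).map fun e => crossing p q e x).sum

theorem pathCrossing_local {p q : Plane} (hpq : p ≠ q) (B : List Plane) (a b : Plane) {x₀ : Plane}
    (hne : ∀ e ∈ pathEdges (a :: B ++ [b]), e.1 ≠ e.2)
    (hx : ∀ e ∈ pathEdges (a :: B ++ [b]), x₀ ∉ segment ℝ e.1 e.2) :
    ∃ k : ZMod 2, ∀ᶠ x in nhds x₀, pathCrossing p q (a :: B ++ [b]) x =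
      k + vertexJump p q x₀ a x + vertexJump p q x₀ b x := by
  induction B generalizing a with
  | nil =>
    obtain ⟨k, hk⟩ := crossing_local hpq (hne (a, b) (by simp)) (hx (a, b) (by simp))
    exact ⟨k, hk.mono fun x hx => by simpa [pathCrossing] using hx⟩
  | cons c B ih =>
    obtain ⟨k, hk⟩ := crossing_local hpq (hne (a, c) (by simp)) (hx (a, c) (by simp))
    obtain ⟨k', hk'⟩ := ih c (fun e he => hne e (by simp at he ⊢; tauto))
      (fun e he => hx e (by simp at he ⊢; tauto))
    refine ⟨k + k', ?_⟩
    filter_upwards [hk, hk'] with x h1 h2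
    have : pathCrossing p q (a :: c :: B ++ [b]) x =
        crossing p q (a, c) x + pathCrossing p q (c :: B ++ [b]) x := by
      simp [pathCrossing]
    rw [this, h1, h2]
    have := CharTwo.add_self_eq_zero (vertexJump p q x₀ c x)
    linear_combination this

/-- The parity of a closed polygonal path formed by `p :: B ++ [q]` and the edge `(p, q)`. -/
noncomputable def parity (p q : Plane) (B : List Plane) (x : Plane) : ZMod 2 :=
  pathCrossing p q (p :: B ++ [q]) x + crossing p q (p, q) x

theorem parity_local {p q : Plane} (hpq : p ≠ q) {B : List Plane} {x₀ : Plane}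
    (hne : ∀ e ∈ pathEdges (p :: B ++ [q]), e.1 ≠ e.2)
    (hx : ∀ e ∈ pathEdges (p :: B ++ [q]), x₀ ∉ segment ℝ e.1 e.2)
    (hx' : x₀ ∉ segment ℝ p q) : ∀ᶠ x in nhds x₀, parity p q B x = parity p q B x₀ := by
  obtain ⟨k, hk⟩ := pathCrossing_local hpq B p q hne hx
  obtain ⟨k', hk'⟩ := crossing_local hpq (e := (p, q)) hpq hx'
  have : ∀ᶠ x in nhds x₀, parity p q B x = k + k' := by
    filter_upwards [hk, hk'] with x h1 h2
    rw [parity, h1, h2]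
    linear_combination CharTwo.add_self_eq_zero (vertexJump p q x₀ p x) +
      CharTwo.add_self_eq_zero (vertexJump p q x₀ q x)
  filter_upwards [this] with x hx
  rw [hx, this.self_of_nhds]

theorem parity_flip {p q : Plane} (hpq : p ≠ q) {B : List Plane} {z : Plane}
    (hne : ∀ e ∈ pathEdges (p :: B ++ [q]), e.1 ≠ e.2)
    (hx : ∀ e ∈ pathEdges (p :: B ++ [q]), z ∉ segment ℝ e.1 e.2)
    (hz : z ∈ openSegment ℝ p q) : ∃ k : ZMod 2, ∀ᶠ x in nhds z,
      (0 < orient p q x → parity p q B x = k) ∧ (orient p q x < 0 → parity p q B x = k + 1) := by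
  obtain ⟨k, hk⟩ := pathCrossing_local hpq B p q hne hx
  have hN := scal_self_pos hpq
  obtain ⟨t, h0, h1, rfl⟩ := mem_openSegment_iff.1 hz
  set z := (AffineMap.lineMap p q t : Plane)
  have hs : scal p q z = t * scal p q q := by rw [scal_lineMap, scal_left]; ring
  have ha : 0 < scal p q z := by rw [hs]; positivity
  have hb : scal p q z < scal p q q := by rw [hs]; nlinarith
  refine ⟨k, ?_⟩
  filter_upwards [hk, continuousAt_const.eventually_lt (continuous_scal p q).continuousAt ha,
    (continuous_scal p q).continuousAt.eventually_lt continuousAt_const hb] with x h1 h2 h3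
  have hj : vertexJump p q z p x = 0 ∧ vertexJump p q z q x = 0 := by
    constructor <;> rw [vertexJump, if_neg] <;> rintro ⟨h, -⟩
    · rw [scal_left] at h; linarith
    · linarith
  rw [parity, h1, hj.1, hj.2]
  constructor
  · intro ho
    rw [crossing, if_neg]
    · simp
    · rintro (⟨h1, h2, h3⟩ | ⟨h1, h2, h3⟩) <;> simp only [] at * <;> linarith
  · intro ho
    rw [crossing, if_pos]
    · simp
    · exact .inl ⟨by simpa using h2.le, h3, ho⟩

theorem Side.eq_of_subset {H O : Set Plane} (hOH : O ⊆ H) {e : Plane × Plane} (he : e.1 ≠ e.2)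
    {σ τ : ℝ} (hσ : σ = 1 ∨ σ = -1) (hτ : τ = 1 ∨ τ = -1) {z : Plane}
    (hz : z ∈ segment ℝ e.1 e.2) (h : SideAt H e σ z) (h' : SideAt O e τ z) : τ = σ := by
  by_contra hne
  obtain rfl : σ = -τ := by
    rcases hσ with rfl | rfl <;> rcases hτ with rfl | rfl <;> simp at hne ⊢
  obtain ⟨r, hr, hb⟩ := h
  obtain ⟨r', hr', hb'⟩ := h'
  obtain ⟨x, hx, hxo⟩ := exists_sides_near he hz
    (inter_mem (Metric.ball_mem_nhds z hr) (Metric.ball_mem_nhds z hr')) hτ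
  exact (hb x hx.1).2 (by linarith) (hOH ((hb' x hx.2).1 hxo))

theorem SideAt.not_both {H O : Set Plane} (hOH : O ⊆ H) {e : Plane × Plane} (he : e.1 ≠ e.2)
    {σ : ℝ} (hσ : σ = 1 ∨ σ = -1) {z : Plane}
    (hz : z ∈ segment ℝ e.1 e.2) (h : SideAt H e σ z) {r : ℝ} (hr : 0 < r) :
    ¬ ∀ x ∈ Metric.ball z r, orient e.1 e.2 x ≠ 0 → x ∈ O := by
  intro hall
  obtain ⟨r', hr', hb'⟩ := h
  have hσ0 : -σ = 1 ∨ -σ = -1 := by rcases hσ with rfl | rfl <;> simp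
  obtain ⟨x, hx, hxo⟩ := exists_sides_near he hz
    (inter_mem (Metric.ball_mem_nhds z hr) (Metric.ball_mem_nhds z hr')) hσ0
  refine (hb' x hx.2).2 (by linarith) (hOH (hall x hx.1 ?_))
  rintro h0; simp [h0] at hxo

theorem PolyInt.insert_graph {L : List Plane} {G : Set Plane} (h : PolyInt L G) {p q : Plane}
    (hp : p ∈ L) (hq : q ∈ L) (hpq : p ≠ q) (hd : openSegment ℝ p q ⊆ G) :
    IsPlaneGraph (insert (p, q) {e | e ∈ cycEdges L}) := by
  have key : ∀ e ∈ cycEdges L, ∀ x ∈ segment ℝ e.1 e.2, x ∈ segment ℝ p q →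
      (x = e.1 ∨ x = e.2) ∧ (x = p ∨ x = q) := by
    intro e he x hxe hx
    rcases mem_segment_cases hx with rfl | rfl | hx
    · exact ⟨h.vertex_endpoint hp he hxe, .inl rfl⟩
    · exact ⟨h.vertex_endpoint hq he hxe, .inr rfl⟩
    · exact absurd (hd hx) (h.segment_disjoint he hxe)
  constructor
  · rintro e (rfl | he)
    · exact hpq
    · exact h.ne he
  · rintro e (rfl | he) f (rfl | hf) hef x hxe hxf
    · exact absurd rfl hef
    · exact (key f hf x hxf hxe).symm
    · exact key e he x hxe hxf
    · exact h.graph.2 e he f hf hef x hxe hxf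

theorem PolyInt.of_half {p q : Plane} {B C : List Plane} {G H : Set Plane}
    (h : PolyInt (p :: B ++ q :: C) G) (hB : B ≠ []) (hd : openSegment ℝ p q ⊆ G)
    (hH : IsOpen H) (hHG : H ⊆ G) (hHd : Disjoint H (segment ℝ p q))
    (hf : frontier H ⊆ edgeUnion {e | e ∈ cycEdges (p :: B ++ q :: C)} ∪ segment ℝ p q)
    {σ : ℝ} (hσ : σ = 1 ∨ σ = -1) (hs : Side H (q, p) σ)
    (h1 : ∀ e ∈ pathEdges (p :: B ++ [q]), ¬ Disjoint (openSegment ℝ e.1 e.2) (closure H))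
    (h2 : ∀ e ∈ pathEdges (q :: C ++ [p]), Disjoint (openSegment ℝ e.1 e.2) (closure H)) :
    PolyInt (p :: B ++ [q]) H := by
  have hnd := h.nodup
  have hpL : p ∈ p :: B ++ q :: C := by simp
  have hqL : q ∈ p :: B ++ q :: C := by simp
  have hpq : q ≠ p := by
    rintro rfl; simp at hnd
  have hg := h.insert_graph hqL hpL hpq (by rwa [openSegment_symm])
  set E := insert (q, p) {e | e ∈ cycEdges (p :: B ++ q :: C)} with hE
  have hEfin : E.Finite := (finite_cycEdges _).insert _
  have hcyc : ∀ e, e ∈ cycEdges (p :: B ++ q :: C) ↔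
      e ∈ pathEdges (p :: B ++ [q]) ∨ e ∈ pathEdges (q :: C ++ [p]) := by
    intro e; rw [cycEdges_split, List.mem_append]
  have hfE : frontier H ⊆ edgeUnion E := by
    intro x hx
    rcases hf hx with h | h
    · obtain ⟨e, he, hxe⟩ := mem_edgeUnion.1 h
      exact mem_edgeUnion.2 ⟨e, .inr he, hxe⟩
    · exact mem_edgeUnion.2 ⟨(q, p), .inl rfl, by rwa [segment_symm]⟩
  have hEH : Disjoint (edgeUnion E) H := by
    rw [disjoint_left]
    intro x hx hxH
    obtain ⟨e, he | he, hxe⟩ := mem_edgeUnion.1 hx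
    · subst he
      exact disjoint_left.1 hHd hxH (by rwa [segment_symm])
    · exact h.segment_disjoint he hxe (hHG hxH)
  have hcyc' : ∀ e, e ∈ cycEdges (p :: B ++ [q]) ↔ e ∈ pathEdges (p :: B ++ [q]) ∨ e = (q, p) := by
    intro e; rw [cycEdges_concat]; simp
  have hsub : {e | e ∈ cycEdges (p :: B ++ [q])} ⊆ E := by
    intro e he
    rcases (hcyc' e).1 he with he | rfl
    · exact .inr ((hcyc e).2 (.inl he))
    · exact .inl rfl
  have hfG : ∀ x ∈ frontier H, x ∈ G → x ∈ openSegment ℝ q p := by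
    intro x hx hxG
    rcases hf hx with h' | h'
    · exact absurd hxG (disjoint_left.1 h.edgeUnion_disjoint h')
    · rw [segment_symm] at h'
      refine mem_openSegment_of_mem_segment h' ?_ ?_
      · rintro rfl; exact h.vertex_notMem hqL hxG
      · rintro rfl; exact h.vertex_notMem hpL hxG
  obtain ⟨z, hz⟩ := openSegment_nonempty q p
  have hz' := openSegment_subset_segment _ _ _ hz
  refine ⟨?_, ?_, ⟨fun e he => hg.1 e (hsub he), fun e he f hf => hg.2 e (hsub he) f (hsub hf)⟩,
    hH, ?_, ?_, h.bdd.subset hHG, ?_, ?_⟩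
  · have := List.length_pos_of_ne_nil hB
    simp; omega
  · have : (p :: B ++ [q]).Sublist (p :: B ++ q :: C) :=
      List.Sublist.append_left (by simp) _
    exact this.nodup hnd
  · rw [isPreconnected_iff_subset_of_disjoint]
    intro U V hU hV hcov hdis
    have hfr : ∀ U V : Set Plane, IsOpen U → IsOpen V → H ⊆ U ∪ V → H ∩ (U ∩ V) = ∅ →
        frontier (H ∩ U) ⊆ frontier H := by
      intro U V hU hV hcov hdis x hx
      rw [(hH.inter hU).frontier_eq] at hx
      rw [hH.frontier_eq]
      refine ⟨closure_mono inter_subset_left hx.1, fun hxH => ?_⟩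
      rcases hcov hxH with h | h
      · exact hx.2 ⟨hxH, h⟩
      · obtain ⟨y, hyV, hyH, hyU⟩ := mem_closure_iff.1 hx.1 V hV h
        exact eq_empty_iff_forall_notMem.1 hdis y ⟨hyH, hyU, hyV⟩
    have hempty : ∀ U V : Set Plane, IsOpen U → IsOpen V → H ⊆ U ∪ V → H ∩ (U ∩ V) = ∅ →
        Disjoint (openSegment ℝ q p) (closure (H ∩ U)) → H ⊆ V := by
      intro U V hU hV hcov hdis hn
      have hGf : Disjoint G (frontier (H ∩ U)) := by
        rw [disjoint_left]
        intro x hxG hxf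
        exact disjoint_left.1 hn (hfG x (hfr U V hU hV hcov hdis hxf) hxG)
          (frontier_subset_closure hxf)
      rcases h.conn.subset_or_disjoint_of_frontier hGf with h' | h'
      · exfalso
        exact disjoint_left.1 hHd (h' (hd (by rwa [openSegment_symm]))).1 (by rwa [segment_symm])
      · intro x hx
        exact (hcov hx).resolve_left fun hxU => disjoint_left.1 h' (hHG hx) ⟨hx, hxU⟩
    have hside : ∀ O : Set Plane, IsOpen O → frontier O ⊆ frontier H → O ⊆ H →
        SideAt O (q, p) σ z ∨ Disjoint (openSegment ℝ q p) (closure O) := by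
      intro O hO hfO hOH
      rcases side_or_disjoint hEfin hg hO (hfO.trans hfE) (e := (q, p)) (.inl rfl)
        (fun z hz r hr => (hs z hz).not_both hOH hpq hσ
          (openSegment_subset_segment _ _ _ hz) hr) with h | h | h
      · have := Side.eq_of_subset hOH hpq hσ (.inl rfl) hz' (hs z hz) (h z hz)
        subst this; exact .inl (h z hz)
      · have := Side.eq_of_subset hOH hpq hσ (.inr rfl) hz' (hs z hz) (h z hz)
        subst this; exact .inl (h z hz)
      · exact .inr h
    have hcov' : H ⊆ V ∪ U := by rwa [union_comm]
    have hdis' : H ∩ (V ∩ U) = ∅ := by rwa [inter_comm V]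
    rcases hside _ (hH.inter hU) (hfr U V hU hV hcov hdis) inter_subset_left with hu | hu
    · rcases hside _ (hH.inter hV) (hfr V U hV hU hcov' hdis') inter_subset_left with hv | hv
      · exfalso
        obtain ⟨r, hr, hb⟩ := hu
        obtain ⟨r', hr', hb'⟩ := hv
        obtain ⟨x, hx, hxo⟩ := exists_sides_near (e := (q, p)) hpq hz'
          (inter_mem (Metric.ball_mem_nhds z hr) (Metric.ball_mem_nhds z hr')) hσ
        have h1 := (hb x hx.1).1 hxo
        have h2 := (hb' x hx.2).1 hxo
        exact eq_empty_iff_forall_notMem.1 hdis x ⟨h1.1, h1.2, h2.2⟩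
      · exact .inl (hempty V U hV hU hcov' hdis' hv)
    · exact .inr (hempty U V hU hV hcov hdis hu)
  · have := (hs z hz).mem_closure hpq hσ hz'
    exact closure_nonempty_iff.1 ⟨z, this⟩
  · intro x hx
    have hxcl := frontier_subset_closure hx
    have hD : ∀ x ∈ segment ℝ p q, x ∈ edgeUnion {e | e ∈ cycEdges (p :: B ++ [q])} := by
      intro x hx
      exact mem_edgeUnion.2 ⟨(q, p), (hcyc' _).2 (.inr rfl), by rwa [segment_symm]⟩
    rcases hf hx with hx' | hx'
    swap
    · exact hD x hx'
    obtain ⟨e, he, hxe⟩ := mem_edgeUnion.1 hx'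
    rcases (hcyc e).1 he with he' | he'
    · exact mem_edgeUnion.2 ⟨e, (hcyc' _).2 (.inl he'), hxe⟩
    have hvert : ∀ v ∈ q :: C ++ [p], ∀ w, (e = (v, w) ∨ e = (w, v)) → v ∈ closure H →
        v ∈ segment ℝ p q := by
      intro v hv w hvw hvcl
      by_cases hvp : v = p
      · rw [hvp]; exact left_mem_segment _ _ _
      by_cases hvq : v = q
      · rw [hvq]; exact right_mem_segment _ _ _
      exfalso
      have hvC : v ∈ C := by simp at hv; tauto
      refine notMem_closure_vertex hEfin hg hfE hEH (.inr he) hvw ?_ hvcl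
      have hvL : v ∈ p :: B ++ q :: C := by simp [hvC]
      rintro f (rfl | hf) hvf
      · exfalso
        have := endpoint_of_mem_segment hg (.inr he : e ∈ E) (f := (q, p)) (.inl rfl)
          (v := v) (by rcases hvw with rfl | rfl <;> simp) hvf
        exact this.elim hvq hvp
      · rcases (hcyc f).1 hf with hf' | hf'
        · exfalso
          have hv1 : v ∈ p :: B ++ [q] := by
            rcases h.vertex_endpoint hvL hf hvf with h' | h'
            · rw [h']; exact fst_mem_of_mem_pathEdges hf'
            · rw [h']; exact snd_mem_of_mem_pathEdges hf'
          have hvB : v ∈ p :: B := by simp at hv1 ⊢; tauto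
          rw [List.nodup_append] at hnd
          exact hnd.2.2 v hvB v (by simp [hvC]) rfl
        · exact h2 f hf'
    rcases mem_segment_cases hxe with rfl | rfl | hxo
    · exact hD _ (hvert _ (fst_mem_of_mem_pathEdges he') e.2 (.inl rfl) hxcl)
    · exact hD _ (hvert _ (snd_mem_of_mem_pathEdges he') e.1 (.inr rfl) hxcl)
    · exact absurd hxcl (disjoint_left.1 (h2 e he') hxo)
  · intro e he
    rcases (hcyc' e).1 he with he' | rfl
    · have hec := (hcyc e).2 (.inl he')
      obtain ⟨τ, hτ, hsτ⟩ := h.side e hec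
      rcases side_or_disjoint hEfin hg hH hfE (.inr hec)
        (fun z hz r hr => (hsτ z hz).not_both hHG (h.ne hec) hτ
          (openSegment_subset_segment _ _ _ hz) hr) with h | h | h
      · exact ⟨1, .inl rfl, h⟩
      · exact ⟨-1, .inr rfl, h⟩
      · exact absurd h (h1 e he')
    · exact ⟨σ, hσ, hs⟩

/-- A diagonal splits a polygon into two polygons. -/
theorem PolyInt.split {p q : Plane} {B C : List Plane} {G : Set Plane}
    (h : PolyInt (p :: B ++ q :: C) G) (hB : B ≠ []) (hC : C ≠ []) (hd : openSegment ℝ p q ⊆ G) :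
    ∃ G₁ G₂, PolyInt (p :: B ++ [q]) G₁ ∧ PolyInt (q :: C ++ [p]) G₂ ∧ Disjoint G₁ G₂ ∧
      G = G₁ ∪ G₂ ∪ openSegment ℝ p q ∧ Disjoint G₁ (segment ℝ p q) ∧
      Disjoint G₂ (segment ℝ p q) := by
  have hz1 : ∀ k i : ZMod 2, k = i ∨ k + 1 = i := by decide
  have hz1' : ∀ k i : ZMod 2, k = i ∨ k = i + 1 := by decide
  have hz2 : ∀ k : ZMod 2, k ≠ k + 1 := by decide
  have hz3 : ∀ i j : ZMod 2, i ≠ j → j = i + 1 := by decide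
  have hnd := h.nodup
  have hpL : p ∈ p :: B ++ q :: C := by simp
  have hqL : q ∈ p :: B ++ q :: C := by simp
  have hpq : p ≠ q := by
    rintro rfl; simp at hnd
  have hg := h.insert_graph hpL hqL hpq hd
  set cyc := {e | e ∈ cycEdges (p :: B ++ q :: C)} with hcycdef
  set E := insert (p, q) cyc with hE
  have hEfin : E.Finite := (finite_cycEdges _).insert _
  have hcyc : ∀ e, e ∈ cyc ↔
      e ∈ pathEdges (p :: B ++ [q]) ∨ e ∈ pathEdges (q :: C ++ [p]) := by
    intro e; rw [hcycdef, mem_ofPred_eq, cycEdges_split, List.mem_append]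
  have hpne : ∀ e ∈ pathEdges (p :: B ++ [q]), e.1 ≠ e.2 :=
    fun e he => h.ne ((hcyc e).2 (.inl he))
  have hpx : ∀ x ∈ G, ∀ e ∈ pathEdges (p :: B ++ [q]), x ∉ segment ℝ e.1 e.2 :=
    fun x hx e he hxe => h.segment_disjoint ((hcyc e).2 (.inl he)) hxe hx
  have hGseg : ∀ x ∈ G, x ∈ segment ℝ p q → x ∈ openSegment ℝ p q := by
    intro x hxG hx
    refine mem_openSegment_of_mem_segment hx ?_ ?_
    · rintro rfl; exact h.vertex_notMem hpL hxG
    · rintro rfl; exact h.vertex_notMem hqL hxG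
  let H : ZMod 2 → Set Plane := fun i => {x | x ∈ G ∧ x ∉ segment ℝ p q ∧ parity p q B x = i}
  have hloc : ∀ x, x ∈ G → x ∉ segment ℝ p q → ∀ᶠ y in nhds x, y ∈ H (parity p q B x) := by
    intro x hx hxs
    filter_upwards [parity_local hpq hpne (hpx x hx) hxs, h.isOpen.mem_nhds hx,
      (isClosed_segment' p q).isOpen_compl.mem_nhds hxs] with y h1 h2 h3
    exact ⟨h2, h3, h1⟩
  have hHo : ∀ i, IsOpen (H i) := by
    intro i
    rw [isOpen_iff_mem_nhds]
    rintro x ⟨hx, hxs, rfl⟩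
    exact hloc x hx hxs
  have hHG : ∀ i, H i ⊆ G := fun i x hx => hx.1
  have hHd : ∀ i, Disjoint (H i) (segment ℝ p q) := fun i => disjoint_left.2 fun x hx => hx.2.1
  have hdisj : ∀ i j, i ≠ j → Disjoint (H i) (H j) := by
    intro i j hij
    rw [disjoint_left]
    rintro x ⟨-, -, rfl⟩ ⟨-, -, h⟩
    exact hij h
  have hcover : ∀ i x, x ∈ G → x ∈ segment ℝ p q ∨ x ∈ H i ∨ x ∈ H (i + 1) := by
    intro i x hx
    by_cases hxs : x ∈ segment ℝ p q
    · exact .inl hxs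
    · right
      have : parity p q B x = i ∨ parity p q B x = i + 1 := by
        generalize parity p q B x = k
        exact hz1' k i
      rcases this with h | h
      · exact .inl ⟨hx, hxs, h⟩
      · exact .inr ⟨hx, hxs, h⟩
  have hf : ∀ i, frontier (H i) ⊆ edgeUnion cyc ∪ segment ℝ p q := by
    intro i x hx
    by_cases hxs : x ∈ segment ℝ p q
    · exact .inr hxs
    by_cases hxG : x ∈ G
    · exfalso
      have hev := hloc x hxG hxs
      rw [(hHo i).frontier_eq] at hx
      obtain ⟨y, hy, hyi⟩ := mem_closure_iff_nhds.1 hx.1 _ hev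
      have : parity p q B x = i := by
        by_contra hne
        exact disjoint_left.1 (hdisj _ _ hne) hy hyi
      exact hx.2 ⟨hxG, hxs, this⟩
    · refine .inl (h.front ?_)
      rw [h.isOpen.frontier_eq]
      exact ⟨closure_mono (hHG i) (frontier_subset_closure hx), hxG⟩
  have hfE : ∀ i, frontier (H i) ⊆ edgeUnion E := by
    intro i x hx
    rcases hf i hx with h | h
    · obtain ⟨e, he, hxe⟩ := mem_edgeUnion.1 h
      exact mem_edgeUnion.2 ⟨e, .inr he, hxe⟩
    · exact mem_edgeUnion.2 ⟨(p, q), .inl rfl, h⟩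
  have hDside : ∀ i, ∃ σ : ℝ, (σ = 1 ∨ σ = -1) ∧ Side (H i) (p, q) σ := by
    intro i
    have hat : ∀ z ∈ openSegment ℝ p q, ∃ σ : ℝ, (σ = 1 ∨ σ = -1) ∧ SideAt (H i) (p, q) σ z := by
      intro z hz
      obtain ⟨k, hk⟩ := parity_flip hpq (B := B) hpne (hpx z (hd hz)) hz
      obtain ⟨r, hr, hb⟩ := Metric.eventually_nhds_iff_ball.1 (hk.and (h.isOpen.mem_nhds (hd hz)))
      have hoff : ∀ x, orient p q x ≠ 0 → x ∉ segment ℝ p q :=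
        fun x hx hxs => hx (orient_of_mem_segment hxs)
      have hk2 := hz1 k i
      have hk3 := hz2 k
      rcases hk2 with rfl | rfl
      · refine ⟨1, .inl rfl, r, hr, fun x hx => ⟨fun ho => ?_, fun ho hxH => ?_⟩⟩
        · simp only [one_mul] at ho
          exact ⟨(hb x hx).2, hoff x ho.ne', (hb x hx).1.1 ho⟩
        · simp only [one_mul] at ho
          exact hk3 (hxH.2.2.symm.trans ((hb x hx).1.2 ho))
      · refine ⟨-1, .inr rfl, r, hr, fun x hx => ⟨fun ho => ?_, fun ho hxH => ?_⟩⟩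
        · simp only [neg_one_mul] at ho
          have ho : orient p q x < 0 := by linarith
          exact ⟨(hb x hx).2, hoff x ho.ne, (hb x hx).1.2 ho⟩
        · simp only [neg_one_mul] at ho
          exact hk3 (((hb x hx).1.1 (by linarith)).symm.trans hxH.2.2)
    rcases side_or_disjoint hEfin hg (hHo i) (hfE i) (e := (p, q)) (.inl rfl)
      (fun z hz r hr => by
        obtain ⟨σ, hσ, hs⟩ := hat z hz
        exact hs.not_both subset_rfl hpq hσ (openSegment_subset_segment _ _ _ hz) hr)
      with h | h | h
    · exact ⟨1, .inl rfl, h⟩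
    · exact ⟨-1, .inr rfl, h⟩
    · exfalso
      obtain ⟨z, hz⟩ := openSegment_nonempty p q
      obtain ⟨σ, hσ, hs⟩ := hat z hz
      exact disjoint_left.1 h hz (hs.mem_closure hpq hσ (openSegment_subset_segment _ _ _ hz))
  have hside : ∀ i, ∀ e ∈ cyc, ¬ Disjoint (openSegment ℝ e.1 e.2) (closure (H i)) →
      ∃ σ : ℝ, (σ = 1 ∨ σ = -1) ∧ Side (H i) e σ := by
    intro i e he hn
    obtain ⟨τ, hτ, hsτ⟩ := h.side e he
    rcases side_or_disjoint hEfin hg (hHo i) (hfE i) (.inr he)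
      (fun z hz r hr => (hsτ z hz).not_both (hHG i) (h.ne he) hτ
        (openSegment_subset_segment _ _ _ hz) hr) with h | h | h
    · exact ⟨1, .inl rfl, h⟩
    · exact ⟨-1, .inr rfl, h⟩
    · exact absurd h hn
  have hone : ∀ i, ∀ e ∈ cyc, ¬ Disjoint (openSegment ℝ e.1 e.2) (closure (H i)) ∨
      ¬ Disjoint (openSegment ℝ e.1 e.2) (closure (H (i + 1))) := by
    intro i e he
    by_contra! hcon
    obtain ⟨z, hz⟩ := openSegment_nonempty e.1 e.2
    have hz' := openSegment_subset_segment _ _ _ hz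
    have hcl : G ⊆ segment ℝ p q ∪ (closure (H i) ∪ closure (H (i + 1))) := by
      intro x hx
      rcases hcover i x hx with h | h | h
      · exact .inl h
      · exact .inr (.inl (subset_closure h))
      · exact .inr (.inr (subset_closure h))
    have hcl' := closure_minimal hcl
      ((isClosed_segment' p q).union (isClosed_closure.union isClosed_closure))
    rcases hcl' (h.segment_subset_closure he hz') with h' | h' | h'
    · have hne : e ≠ (p, q) := by
        rintro rfl
        exact h.openSegment_disjoint he hz (hd hz)
      have := (hg.2 e (.inr he) (p, q) (.inl rfl) hne z hz' h').1
      have h2 := ne_of_mem_openSegment (h.ne he) hz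
      tauto
    · exact disjoint_left.1 hcon.1 hz h'
    · exact disjoint_left.1 hcon.2 hz h'
  have huniq : ∀ i j, i ≠ j → ∀ e ∈ cyc, ¬ Disjoint (openSegment ℝ e.1 e.2) (closure (H i)) →
      Disjoint (openSegment ℝ e.1 e.2) (closure (H j)) := by
    intro i j hij e he hi
    by_contra hj
    obtain ⟨σ, hσ, hsσ⟩ := hside i e he hi
    obtain ⟨τ, hτ, hsτ⟩ := hside j e he hj
    obtain ⟨ρ, hρ, hsρ⟩ := h.side e he
    obtain ⟨z, hz⟩ := openSegment_nonempty e.1 e.2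
    have hz' := openSegment_subset_segment _ _ _ hz
    obtain rfl := Side.eq_of_subset (hHG i) (h.ne he) hρ hσ hz' (hsρ z hz) (hsσ z hz)
    obtain rfl := Side.eq_of_subset (hHG j) (h.ne he) hσ hτ hz' (hsρ z hz) (hsτ z hz)
    obtain ⟨r, hr, hb⟩ := hsσ z hz
    obtain ⟨r', hr', hb'⟩ := hsτ z hz
    obtain ⟨x, hx, hxo⟩ := exists_sides_near (h.ne he) hz'
      (inter_mem (Metric.ball_mem_nhds z hr) (Metric.ball_mem_nhds z hr')) hσ
    exact disjoint_left.1 (hdisj i j hij) ((hb x hx.1).1 hxo) ((hb' x hx.2).1 hxo)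
  have hprop : ∀ i, ∀ e ∈ cyc, ∀ f ∈ cyc, e.2 = f.1 → e.2 ≠ p → e.2 ≠ q →
      ¬ Disjoint (openSegment ℝ e.1 e.2) (closure (H i)) →
      ¬ Disjoint (openSegment ℝ f.1 f.2) (closure (H i)) := by
    intro i e he f hf hef hp hq hi
    obtain ⟨σ, hσ, hsσ⟩ := hside i e he hi
    obtain ⟨g, hgE, hge, hvg, hgi⟩ := exists_adjacent hEfin hg (hfE i) (.inr he : e ∈ E)
      (v := e.2) (q := e.1) (.inr rfl) hσ hsσ
    have hend := endpoint_of_mem_segment hg (.inr he : e ∈ E) hgE (.inr rfl) hvg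
    rcases hgE with rfl | hgc
    · rcases hend with h | h
      · exact absurd h hp
      · exact absurd h hq
    · rcases hend with h' | h'
      · rwa [← cycEdges_fst_inj hnd hgc hf (h'.symm.trans hef)]
      · exact absurd (cycEdges_snd_inj hnd hgc he h'.symm) hge
  have hchain : ∀ (M : List Plane) (a b : Plane), (∀ e ∈ pathEdges (a :: M ++ [b]), e ∈ cyc) →
      (∀ x ∈ M, x ≠ p ∧ x ≠ q) → ∃ i, ∀ e ∈ pathEdges (a :: M ++ [b]),
        ¬ Disjoint (openSegment ℝ e.1 e.2) (closure (H i)) := by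
    intro M
    induction M with
    | nil =>
      intro a b hsub _
      rcases hone 0 (a, b) (hsub _ (by simp)) with h | h
      · exact ⟨0, by simpa using h⟩
      · exact ⟨0 + 1, by simpa using h⟩
    | cons c M ih =>
      intro a b hsub hM
      obtain ⟨i, hi⟩ := ih c b (fun e he => hsub e (by simp at he ⊢; tauto))
        (fun x hx => hM x (by simp [hx]))
      refine ⟨i, ?_⟩
      intro e he
      have he' : e = (a, c) ∨ e ∈ pathEdges (c :: M ++ [b]) := by simpa using he
      rcases he' with rfl | he'
      swap
      · exact hi e he'
      have hac : (a, c) ∈ cyc := hsub _ he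
      rcases hone i (a, c) hac with h' | h'
      · exact h'
      · exfalso
        obtain ⟨f, hf, hfc⟩ : ∃ f ∈ pathEdges (c :: M ++ [b]), f.1 = c := by
          cases M with
          | nil => exact ⟨(c, b), by simp, rfl⟩
          | cons d M => exact ⟨(c, d), by simp, rfl⟩
        have hcM := hM c (by simp)
        have hfc' : f ∈ cyc := hsub f (by simp at hf ⊢; tauto)
        have := hprop (i + 1) (a, c) hac f hfc' hfc.symm hcM.1 hcM.2 h'
        have h3 := hz2 i
        exact this (huniq i (i + 1) h3 f hfc' (hi f hf))
  have hBmem : ∀ x ∈ B, x ≠ p ∧ x ≠ q := by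
    intro x hx
    constructor
    · rintro rfl; simp [hx] at hnd
    · rintro rfl
      rw [List.nodup_append] at hnd
      exact hnd.2.2 x (by simp [hx]) x (by simp) rfl
  have hCmem : ∀ x ∈ C, x ≠ q ∧ x ≠ p := by
    intro x hx
    rw [List.nodup_append] at hnd
    constructor
    · rintro rfl; simp [hx] at hnd
    · rintro rfl
      exact hnd.2.2 x (by simp) x (by simp [hx]) rfl
  obtain ⟨i, hi⟩ := hchain B p q (fun e he => (hcyc e).2 (.inl he)) hBmem
  obtain ⟨j, hj⟩ := hchain C q p (fun e he => (hcyc e).2 (.inr he)) fun x hx => (hCmem x hx).symm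
  have hall : ∀ k, k = i ∨ k = j := by
    intro k
    obtain ⟨σ, hσ, hs⟩ := hDside k
    obtain ⟨g, hgE, hge, hvg, hgi⟩ := exists_adjacent hEfin hg (hfE k) (.inl rfl : (p, q) ∈ E)
      (v := p) (q := q) (.inl rfl) hσ hs
    have hgc : g ∈ cyc := hgE.resolve_left hge
    rcases (hcyc g).1 hgc with h1 | h1
    · left
      by_contra hki
      exact hgi (huniq i k (Ne.symm hki) g hgc (hi g h1))
    · right
      by_contra hki
      exact hgi (huniq j k (Ne.symm hki) g hgc (hj g h1))
  have hij : i ≠ j := by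
    rintro rfl
    have := hall (i + 1)
    have h3 := (hz2 i).symm
    tauto
  have hji := hz3 i j hij
  obtain ⟨σ, hσ, hsσ⟩ := hDside i
  obtain ⟨τ, hτ, hsτ⟩ := hDside j
  refine ⟨H i, H j, ?_, ?_, hdisj i j hij, ?_, hHd i, hHd j⟩
  · exact h.of_half hB hd (hHo i) (hHG i) (hHd i) (hf i)
      (σ := -σ) (by rcases hσ with rfl | rfl <;> simp) hsσ.swap hi
      fun e he => huniq j i hij.symm e ((hcyc e).2 (.inr he)) (hj e he)
  · have hrot : PolyInt (q :: C ++ p :: B) G := h.rotate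
    have hseg : segment ℝ q p = segment ℝ p q := segment_symm _ _ _
    have hcyc2 : {e | e ∈ cycEdges (q :: C ++ p :: B)} = cyc := by
      ext e; exact mem_cycEdges_append_comm
    refine hrot.of_half hC (by rwa [openSegment_symm]) (hHo j) (hHG j) (by rw [hseg]; exact hHd j)
      (by rw [hseg, hcyc2]; exact hf j) hτ hsτ hj
      fun e he => huniq i j hij e ((hcyc e).2 (.inl he)) (hi e he)
  · ext x
    constructor
    · intro hx
      rcases hcover i x hx with h' | h' | h'
      · exact .inr (hGseg x hx h')
      · exact .inl (.inl h')
      · exact .inl (.inr (by rwa [hji]))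
    · rintro ((h' | h') | h')
      · exact hHG _ h'
      · exact hHG _ h'
      · exact hd h'

/-- The open triangle `p q r`; the sign `σ` is that of its orientation. -/
def tri (σ : ℝ) (p q r : Plane) : Set Plane :=
  {x | 0 < σ * orient p q x ∧ 0 < σ * orient q r x ∧ 0 < σ * orient r p x}

theorem orient_sum (p q r x : Plane) :
    orient p q x + orient q r x + orient r p x = orient p q r := by
  unfold orient; ring

theorem orient_bary (p q r x : Plane) (i : Fin 2) :
    orient p q r * x i = orient q r x * p i + orient r p x * q i + orient p q x * r i := by
  fin_cases i <;> simp [orient] <;> ring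

theorem tri_cycle (σ : ℝ) (p q r : Plane) : tri σ q r p = tri σ p q r := by
  ext x; simp only [tri, mem_ofPred_eq]; tauto

theorem convex_tri (σ : ℝ) (p q r : Plane) : Convex ℝ (tri σ p q r) :=
  (convex_orient_pos p q σ).inter ((convex_orient_pos q r σ).inter (convex_orient_pos r p σ))

theorem ne_of_orient {σ : ℝ} {p q r : Plane} (h : 0 < σ * orient p q r) : p ≠ q := by
  rintro rfl
  simp [orient] at h

theorem mem_segment_of_tri {σ : ℝ} {p q r w : Plane} (h : 0 < σ * orient p q r)
    (h1 : σ * orient p q w = 0) (h2 : 0 ≤ σ * orient q r w) (h3 : 0 ≤ σ * orient r p w) :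
    w ∈ segment ℝ p q := by
  have hs := orient_sum p q r w
  have hσ : σ ≠ 0 := by rintro rfl; simp at h
  have h1' : orient p q w = 0 := by simpa [hσ] using h1
  have ho : orient p q r ≠ 0 := by intro h0; simp [h0] at h
  refine mem_segment_iff.2 ⟨σ * orient r p w / (σ * orient p q r), by positivity, ?_, ?_⟩
  · rw [div_le_one h]
    rw [← hs, h1']; nlinarith
  · have key : ∀ i, (AffineMap.lineMap p q (σ * orient r p w / (σ * orient p q r)) : Plane) i
        = w i := by
      intro i
      rw [lineMap_coord, mul_div_mul_left _ _ hσ]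
      have hb := orient_bary p q r w i
      rw [h1'] at hb hs
      have : orient q r w = orient p q r - orient r p w := by linarith
      rw [this] at hb
      field_simp
      linarith
    exact plane_ext (key 0) (key 1)

theorem tri_exit_aux {σ : ℝ} {p q r x m : Plane} (h : 0 < σ * orient p q r)
    (hx : x ∉ tri σ p q r) (hm : m ∈ tri σ p q r)
    (hle : σ * orient q r m ≤ σ * orient q r x) :
    ∃ w ∈ segment ℝ m x, 0 < σ * orient q r w ∧ (w ∈ segment ℝ p q ∨ w ∈ segment ℝ p r) := by
  obtain ⟨m1, m2, m3⟩ := hm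
  have key1 : ∀ t : ℝ, σ * orient p q (AffineMap.lineMap m x t) =
      σ * orient p q m + t * (σ * orient p q x - σ * orient p q m) := by
    intro t; rw [orient_lineMap]; ring
  have key2 : ∀ t : ℝ, σ * orient q r (AffineMap.lineMap m x t) =
      σ * orient q r m + t * (σ * orient q r x - σ * orient q r m) := by
    intro t; rw [orient_lineMap]; ring
  have key3 : ∀ t : ℝ, σ * orient r p (AffineMap.lineMap m x t) =
      σ * orient r p m + t * (σ * orient r p x - σ * orient r p m) := by
    intro t; rw [orient_lineMap]; ring
  have h' : 0 < σ * orient r p q := by rw [← orient_cycle r p q]; exact h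
  set a := σ * orient p q m
  set a' := σ * orient p q x
  set c := σ * orient r p m
  set c' := σ * orient r p x
  have f2 : ∀ t : ℝ, 0 ≤ t → 0 < σ * orient q r (AffineMap.lineMap m x t) := by
    intro t ht; rw [key2]; nlinarith [mul_nonneg ht (sub_nonneg.2 hle)]
  have case1 : ∀ t : ℝ, 0 ≤ t → t ≤ 1 → a + t * (a' - a) = 0 → 0 ≤ c + t * (c' - c) →
      ∃ w ∈ segment ℝ m x, 0 < σ * orient q r w ∧ (w ∈ segment ℝ p q ∨ w ∈ segment ℝ p r) := by
    intro t h0 h1 ha hc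
    exact ⟨_, mem_segment_iff.2 ⟨t, h0, h1, rfl⟩, f2 t h0, .inl
      (mem_segment_of_tri h (by rw [key1, ha]) (f2 t h0).le (by rw [key3]; exact hc))⟩
  have case3 : ∀ t : ℝ, 0 ≤ t → t ≤ 1 → c + t * (c' - c) = 0 → 0 ≤ a + t * (a' - a) →
      ∃ w ∈ segment ℝ m x, 0 < σ * orient q r w ∧ (w ∈ segment ℝ p q ∨ w ∈ segment ℝ p r) := by
    intro t h0 h1 hc ha
    refine ⟨_, mem_segment_iff.2 ⟨t, h0, h1, rfl⟩, f2 t h0, .inr ?_⟩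
    rw [segment_symm]
    exact mem_segment_of_tri h' (by rw [key3, hc]) (by rw [key1]; exact ha) (f2 t h0).le
  have hx' : a' ≤ 0 ∨ c' ≤ 0 := by
    by_contra! hcon
    exact hx ⟨hcon.1, lt_of_lt_of_le m2 hle, hcon.2⟩
  have root : ∀ u v : ℝ, 0 < u → v ≤ 0 → 0 ≤ u / (u - v) ∧ u / (u - v) ≤ 1 ∧
      u + u / (u - v) * (v - u) = 0 := by
    intro u v hu hv
    have : 0 < u - v := by linarith
    refine ⟨by positivity, (div_le_one this).2 (by linarith), ?_⟩
    field_simp; ring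
  have stay : ∀ u v t : ℝ, 0 < u → 0 < v → 0 ≤ t → t ≤ 1 → 0 ≤ u + t * (v - u) := by
    intro u v t hu hv h0 h1
    nlinarith [mul_nonneg h0 hv.le, mul_nonneg (sub_nonneg.2 h1) hu.le]
  by_cases ha : a' ≤ 0
  · obtain ⟨r0, r1, r2⟩ := root a a' m1 ha
    by_cases hc : 0 ≤ c + a / (a - a') * (c' - c)
    · exact case1 _ r0 r1 r2 hc
    · have hc' : c' ≤ 0 := by
        by_contra! hcon
        exact hc (stay _ _ _ m3 hcon r0 r1)
      obtain ⟨s0, s1, s2⟩ := root c c' m3 hc'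
      refine case3 _ s0 s1 s2 ?_
      set t := a / (a - a')
      set s := c / (c - c')
      have hst : s ≤ t := by
        by_contra! hlt
        apply hc
        nlinarith
      nlinarith
  · have hc' := hx'.resolve_left ha
    obtain ⟨s0, s1, s2⟩ := root c c' m3 hc'
    exact case3 _ s0 s1 s2 (stay _ _ _ m1 (not_le.1 ha) s0 s1)

/-- A segment with end points outside an open triangle `p q r` that meets the triangle meets one
of the half-open sides at `p`. -/
theorem tri_exit {σ : ℝ} {p q r x y m : Plane} (h : 0 < σ * orient p q r)
    (hx : x ∉ tri σ p q r) (hy : y ∉ tri σ p q r) (hm : m ∈ tri σ p q r)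
    (hmxy : m ∈ segment ℝ x y) :
    ∃ w ∈ segment ℝ x y, 0 < σ * orient q r w ∧ (w ∈ segment ℝ p q ∨ w ∈ segment ℝ p r) := by
  obtain ⟨t, h0, h1, rfl⟩ := mem_segment_iff.1 hmxy
  have hk : σ * orient q r (AffineMap.lineMap x y t) =
      σ * orient q r x + t * (σ * orient q r y - σ * orient q r x) := by
    rw [orient_lineMap]; ring
  have hc := convex_segment (𝕜 := ℝ) x y
  rcases le_total (σ * orient q r x) (σ * orient q r y) with hxy | hxy
  · obtain ⟨w, hw, hw'⟩ := tri_exit_aux h hy hm (by rw [hk]; nlinarith)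
    exact ⟨w, hc.segment_subset hmxy (right_mem_segment _ _ _) hw, hw'⟩
  · obtain ⟨w, hw, hw'⟩ := tri_exit_aux h hx hm (by rw [hk]; nlinarith)
    exact ⟨w, hc.segment_subset hmxy (left_mem_segment _ _ _) hw, hw'⟩

variable {L : List Plane} {G : Set Plane}

/-- An open triangle meeting a polygon that contains no vertex and whose two sides at `p` are not
crossed is contained in the polygon. -/
theorem PolyInt.tri_subset (h : PolyInt L G) {σ : ℝ} {p q r : Plane} (ho : 0 < σ * orient p q r)
    (hv : ∀ v ∈ L, v ∉ tri σ p q r)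
    (he : ∀ e ∈ cycEdges L, Disjoint (segment ℝ e.1 e.2) (tri σ p q r) ∨
      ∀ w ∈ segment ℝ e.1 e.2, 0 < σ * orient q r w → w ∉ segment ℝ p q ∧ w ∉ segment ℝ p r)
    (hne : (tri σ p q r ∩ G).Nonempty) : tri σ p q r ⊆ G := by
  have hd : Disjoint (tri σ p q r) (frontier G) := by
    rw [disjoint_left]
    intro x hx hxf
    obtain ⟨e, hec, hxe⟩ := mem_edgeUnion.1 (h.front hxf)
    rcases he e hec with h1 | h1
    · exact disjoint_left.1 h1 hxe hx
    · obtain ⟨w, hw, hw2, hw3⟩ := tri_exit ho (hv _ (fst_mem_of_mem_cycEdges hec))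
        (hv _ (snd_mem_of_mem_cycEdges hec)) hx hxe
      have := h1 w hw hw2
      tauto
  rcases (convex_tri σ p q r).isPreconnected.subset_or_disjoint_of_frontier hd with h1 | h1
  · exact h1
  · obtain ⟨x, hx, hxG⟩ := hne
    exact absurd hxG (disjoint_left.1 h1 hx)

theorem mem_tri_of_pos {σ : ℝ} {p q r : Plane} (ho : 0 < σ * orient p q r) {a b c : ℝ}
    (ha : 0 < a) (hb : 0 < b) (hc : 0 < c) (habc : a + b + c = 1) {x : Plane}
    (hx : ∀ i, x i = a * p i + b * q i + c * r i) : x ∈ tri σ p q r := by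
  obtain rfl : a = 1 - b - c := by linarith
  have e1 : orient p q x = c * orient p q r := by
    unfold orient; rw [hx, hx]; ring
  have e2 : orient q r x = (1 - b - c) * orient p q r := by
    unfold orient; rw [hx, hx]; ring
  have e3 : orient r p x = b * orient p q r := by
    unfold orient; rw [hx, hx]; ring
  refine ⟨?_, ?_, ?_⟩
  · rw [e1]; nlinarith [mul_pos hc ho]
  · rw [e2]; nlinarith [mul_pos ha ho]
  · rw [e3]; nlinarith [mul_pos hb ho]

theorem openSegment_subset_tri {σ : ℝ} {p q r m : Plane} (ho : 0 < σ * orient p q r)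
    (hm : m ∈ openSegment ℝ q r) : openSegment ℝ p m ⊆ tri σ p q r := by
  intro x hx
  obtain ⟨t, t0, t1, rfl⟩ := mem_openSegment_iff.1 hm
  obtain ⟨s, s0, s1, rfl⟩ := mem_openSegment_iff.1 hx
  refine mem_tri_of_pos ho (a := 1 - s) (b := s * (1 - t)) (c := s * t) (by linarith)
    (mul_pos s0 (by linarith)) (mul_pos s0 t0) (by ring) fun i => ?_
  simp only [lineMap_coord]; ring

/-- The relatively interior points of a side are in the closure of the triangle. -/
theorem mem_closure_tri {σ : ℝ} {p q r m : Plane} (ho : 0 < σ * orient p q r)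
    (hm : m ∈ openSegment ℝ q r) : m ∈ closure (tri σ p q r) := by
  have h1 : m ∈ closure (openSegment ℝ p m) := by
    rw [closure_openSegment]; exact right_mem_segment _ _ _
  exact closure_mono (openSegment_subset_tri ho hm) h1

/-- The open side `q r` of a triangle contained in a polygon is contained in the polygon unless
it contains a vertex or is part of an edge. -/
theorem PolyInt.openSegment_subset_of_tri (h : PolyInt L G) {σ : ℝ} {p q r : Plane}
    (ho : 0 < σ * orient p q r) (ht : tri σ p q r ⊆ G) (hv : ∀ v ∈ L, v ∉ openSegment ℝ q r)
    (he : ∀ e ∈ cycEdges L, q ∈ segment ℝ e.1 e.2 → r ∈ segment ℝ e.1 e.2 → False) :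
    openSegment ℝ q r ⊆ G := by
  intro m hm
  by_contra hmG
  have hqr : q ≠ r := by
    have : 0 < σ * orient q r p := by rw [orient_cycle p q r]; exact ho
    exact ne_of_orient this
  have hmf : m ∈ frontier G := by
    rw [h.isOpen.frontier_eq]
    exact ⟨closure_mono ht (mem_closure_tri ho hm), hmG⟩
  obtain ⟨e, hec, hme⟩ := mem_edgeUnion.1 (h.front hmf)
  have hm1 : m ≠ e.1 := by rintro rfl; exact hv _ (fst_mem_of_mem_cycEdges hec) hm
  have hm2 : m ≠ e.2 := by rintro rfl; exact hv _ (snd_mem_of_mem_cycEdges hec) hm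
  have hed : Disjoint (segment ℝ e.1 e.2) (tri σ p q r) :=
    disjoint_left.2 fun x hx hxt => h.segment_disjoint hec hx (ht hxt)
  obtain ⟨s, s0, s1, hs⟩ := mem_openSegment_iff.1 hm
  have fm1 : 0 < σ * orient p q m := by
    rw [← hs, orient_lineMap, orient_right]; nlinarith [mul_pos s0 ho]
  have fm2 : σ * orient q r m = 0 := by rw [orient_of_mem_openSegment hm]; ring
  have fm3 : 0 < σ * orient r p m := by
    rw [← hs, orient_lineMap, orient_left, ← orient_cycle r p q]
    nlinarith [mul_pos (sub_pos.2 s1) ho]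
  have hnear : ∀ y ∈ segment ℝ e.1 e.2, σ * orient q r y ≤ 0 := by
    intro y hy
    by_contra! hpos
    have hc : ∀ᶠ t in nhds (0:ℝ), 0 < σ * orient p q (AffineMap.lineMap m y t) ∧
        0 < σ * orient r p (AffineMap.lineMap m y t) := by
      have c1 : Continuous fun t : ℝ => σ * orient p q (AffineMap.lineMap m y t) := by
        simp only [orient_lineMap]; fun_prop
      have c3 : Continuous fun t : ℝ => σ * orient r p (AffineMap.lineMap m y t) := by
        simp only [orient_lineMap]; fun_prop
      refine ((c1.tendsto 0).eventually (lt_mem_nhds ?_)).and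
        ((c3.tendsto 0).eventually (lt_mem_nhds ?_))
      · simpa using fm1
      · simpa using fm3
    obtain ⟨δ, hδ, hb⟩ := Metric.eventually_nhds_iff_ball.1 hc
    set t := min (δ / 2) 1
    have ht0 : 0 < t := by positivity
    have ht1 : t ≤ 1 := min_le_right _ _
    have htb : t ∈ Metric.ball (0:ℝ) δ := by
      rw [Metric.mem_ball, Real.dist_eq, sub_zero, abs_of_pos ht0]
      exact lt_of_le_of_lt (min_le_left _ _) (by linarith)
    have hin : (AffineMap.lineMap m y t : Plane) ∈ segment ℝ e.1 e.2 :=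
      (convex_segment e.1 e.2).segment_subset hme hy (mem_segment_iff.2 ⟨t, ht0.le, ht1, rfl⟩)
    refine disjoint_left.1 hed hin ⟨(hb t htb).1, ?_, (hb t htb).2⟩
    rw [orient_lineMap]
    have : orient q r m = 0 := orient_of_mem_openSegment hm
    rw [this]
    nlinarith [mul_pos ht0 hpos]
  have hmo := mem_openSegment_of_mem_segment hme hm1 hm2
  obtain ⟨u, u0, u1, hu⟩ := mem_openSegment_iff.1 hmo
  have n1 := hnear e.1 (left_mem_segment _ _ _)
  have n2 := hnear e.2 (right_mem_segment _ _ _)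
  have hσ : σ ≠ 0 := by rintro rfl; simp at ho
  have hlin : σ * orient q r e.1 * (1 - u) + u * (σ * orient q r e.2) = 0 := by
    rw [← fm2, ← hu, orient_lineMap]; ring
  have z1 : orient q r e.1 = 0 := by
    have : σ * orient q r e.1 = 0 := by
      apply le_antisymm n1
      nlinarith [mul_nonneg u0.le (neg_nonneg.2 n2), mul_nonneg (sub_pos.2 u1).le (neg_nonneg.2 n1)]
    simpa [hσ] using this
  have z2 : orient q r e.2 = 0 := by
    rw [z1] at hlin
    have : u * (σ * orient q r e.2) = 0 := by linarith
    simpa [hσ, u0.ne'] using this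
  have g1 := eq_lineMap_of_orient hqr z1
  have g2 := eq_lineMap_of_orient hqr z2
  set t1 := scal q r e.1 / scal q r r
  set t2 := scal q r e.2 / scal q r r
  have o1 : ¬ (0 < t1 ∧ t1 < 1) := fun hh =>
    hv _ (fst_mem_of_mem_cycEdges hec) (mem_openSegment_iff.2 ⟨t1, hh.1, hh.2, g1.symm⟩)
  have o2 : ¬ (0 < t2 ∧ t2 < 1) := fun hh =>
    hv _ (snd_mem_of_mem_cycEdges hec) (mem_openSegment_iff.2 ⟨t2, hh.1, hh.2, g2.symm⟩)
  have hsu : s = t1 + u * (t2 - t1) := by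
    have hinj := AffineMap.lineMap_injective ℝ hqr
    apply hinj
    rw [hs, ← hu]
    conv_lhs => rw [g1, g2]
    apply plane_ext <;> simp only [lineMap_coord] <;> ring
  have hmem : ∀ w : ℝ, (t1 ≤ w ∧ w ≤ t2 ∨ t2 ≤ w ∧ w ≤ t1) → t1 ≠ t2 →
      (AffineMap.lineMap q r w : Plane) ∈ segment ℝ e.1 e.2 := by
    intro w hw hne
    have hne' : t2 - t1 ≠ 0 := sub_ne_zero.2 hne.symm
    refine mem_segment_iff.2 ⟨(w - t1) / (t2 - t1), ?_, ?_, ?_⟩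
    · rcases hw with hw | hw
      · exact div_nonneg (by linarith) (by linarith)
      · exact div_nonneg_of_nonpos (by linarith) (by linarith)
    · rcases hw with hw | hw
      · rw [div_le_one (lt_of_le_of_ne (by linarith) hne'.symm)]; linarith
      · rw [div_le_one_of_neg (lt_of_le_of_ne (by linarith) hne')]; linarith
    · rw [g1, g2]
      apply plane_ext <;> simp only [lineMap_coord] <;> field_simp <;> ring
  have key : (t1 ≤ 0 ∧ 1 ≤ t2) ∨ (t2 ≤ 0 ∧ 1 ≤ t1) := by
    by_cases a1 : t1 ≤ 0
    · left
      refine ⟨a1, ?_⟩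
      by_contra! hlt
      have : t2 ≤ 0 := by by_contra! h0; exact o2 ⟨h0, hlt⟩
      nlinarith
    · have a1' : 1 ≤ t1 := by by_contra! hlt; exact o1 ⟨not_le.1 a1, hlt⟩
      right
      refine ⟨?_, a1'⟩
      by_contra! h0
      have : 1 ≤ t2 := by by_contra! hlt; exact o2 ⟨h0, hlt⟩
      nlinarith
  have hq := hmem 0 (by rcases key with k | k <;> [left; right] <;> constructor <;> linarith)
    (by rcases key with k | k <;> intro hh <;> linarith)
  have hr := hmem 1 (by rcases key with k | k <;> [left; right] <;> constructor <;> linarith)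
    (by rcases key with k | k <;> intro hh <;> linarith)
  simp only [AffineMap.lineMap_apply_zero, AffineMap.lineMap_apply_one] at hq hr
  exact he e hec hq hr

theorem sides_inter_nonempty {σ : ℝ} (hσ : σ = 1 ∨ σ = -1) {p q r z : Plane}
    (ho : 0 < σ * orient p q r) (hz : z ∈ openSegment ℝ p q)
    (hS : ∃ δ > 0, ∀ x ∈ Metric.ball z δ, 0 < σ * orient p q x → x ∈ G) :
    (tri σ p q r ∩ G).Nonempty := by
  obtain ⟨δ, hδ, hS⟩ := hS
  obtain ⟨t, t0, t1, rfl⟩ := mem_openSegment_iff.1 hz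
  set z := (AffineMap.lineMap p q t : Plane)
  have h2 : 0 < σ * orient q r z := by
    rw [orient_lineMap, orient_left, orient_cycle p q r]
    nlinarith [mul_pos (sub_pos.2 t1) ho]
  have h3 : 0 < σ * orient r p z := by
    rw [orient_lineMap, orient_right, ← orient_cycle r p q]
    nlinarith [mul_pos t0 ho]
  have hU : ∀ᶠ x in nhds z, x ∈ Metric.ball z δ ∧ 0 < σ * orient q r x ∧ 0 < σ * orient r p x :=
    (show ∀ᶠ x in nhds z, x ∈ Metric.ball z δ from Metric.ball_mem_nhds z hδ).and
      ((((continuous_const.mul (continuous_orient q r)).tendsto z).eventually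
        (lt_mem_nhds h2)).and
      (((continuous_const.mul (continuous_orient r p)).tendsto z).eventually (lt_mem_nhds h3)))
  obtain ⟨x, ⟨hx, x2, x3⟩, x1⟩ := exists_sides_near (e := (p, q)) (ne_of_orient ho)
    (openSegment_subset_segment ℝ _ _ hz) hU hσ
  exact ⟨x, ⟨x1, x2, x3⟩, hS x hx x1⟩

theorem Side.inter_tri_nonempty {σ : ℝ} (hσ : σ = 1 ∨ σ = -1) {p q r : Plane}
    (ho : 0 < σ * orient p q r) (hS : Side G (p, q) σ) : (tri σ p q r ∩ G).Nonempty := by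
  obtain ⟨z, hz⟩ := openSegment_nonempty p q
  obtain ⟨δ, hδ, h⟩ := hS z hz
  exact sides_inter_nonempty hσ ho hz ⟨δ, hδ, fun x hx => (h x hx).1⟩

/-- The interior product of the plane, as a linear function of the second argument. -/
def dotp (v x : Plane) : ℝ := v 0 * x 0 + v 1 * x 1

theorem continuous_dotp (v : Plane) : Continuous (dotp v) := by
  unfold dotp; fun_prop

theorem dotp_lineMap (v x y : Plane) (t : ℝ) :
    dotp v (AffineMap.lineMap x y t) = dotp v x + t * (dotp v y - dotp v x) := by
  unfold dotp; simp only [lineMap_coord]; ring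

theorem exists_extreme {l : List Plane} (hl : l ≠ []) :
    ∃ v ∈ l, ∀ x ∈ l, x ≠ v → dotp v x < dotp v v := by
  obtain ⟨v, hv, hmax⟩ := l.toFinset.exists_max_image (fun x => dotp x x)
    (by simpa using hl)
  refine ⟨v, by simpa using hv, fun x hx hne => ?_⟩
  have h1 := hmax x (by simpa using hx)
  simp only [dotp] at *
  by_contra! hcon
  apply hne
  have : (x 0 - v 0) ^ 2 + (x 1 - v 1) ^ 2 ≤ 0 := by nlinarith
  exact plane_ext (by nlinarith [sq_nonneg (x 0 - v 0), sq_nonneg (x 1 - v 1)])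
    (by nlinarith [sq_nonneg (x 0 - v 0), sq_nonneg (x 1 - v 1)])

theorem dotp_lt_of_mem_segment {v x y z : Plane} {c : ℝ} (hx : dotp v x < c) (hy : dotp v y < c)
    (hz : z ∈ segment ℝ x y) : dotp v z < c := by
  obtain ⟨t, t0, t1, rfl⟩ := mem_segment_iff.1 hz
  rw [dotp_lineMap]
  rcases t1.lt_or_eq with h | rfl
  · nlinarith
  · linarith

theorem orient_nonneg_of_mem_segment {p q x y z : Plane} {σ : ℝ} (hx : 0 ≤ σ * orient p q x)
    (hy : 0 ≤ σ * orient p q y) (hz : z ∈ segment ℝ x y) : 0 ≤ σ * orient p q z := by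
  obtain ⟨t, t0, t1, rfl⟩ := mem_segment_iff.1 hz
  rw [orient_lineMap]
  nlinarith [mul_nonneg t0 hy, mul_nonneg (sub_nonneg.2 t1) hx]

theorem orient_pos_of_mem_openSegment {p q x y z : Plane} {σ : ℝ} (hx : 0 ≤ σ * orient p q x)
    (hy : 0 < σ * orient p q y) (hz : z ∈ openSegment ℝ x y) : 0 < σ * orient p q z := by
  obtain ⟨t, t0, t1, rfl⟩ := mem_openSegment_iff.1 hz
  rw [orient_lineMap]
  nlinarith [mul_pos t0 hy, mul_nonneg (sub_nonneg.2 t1.le) hx]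

theorem mem_cycEdges_ends {v u w : Plane} {A : List Plane} {e : Plane × Plane}
    (h : (v :: u :: A ++ [w]).Nodup) (he : e ∈ cycEdges (v :: u :: A ++ [w]))
    (hv : e.1 = v ∨ e.2 = v) : e = (v, u) ∨ e = (w, v) := by
  have e1 : (v, u) ∈ cycEdges (v :: u :: A ++ [w]) := by simp [cycEdges_cons]
  have e2 : (w, v) ∈ cycEdges (v :: u :: A ++ [w]) := by
    rw [show v :: u :: A ++ [w] = v :: (u :: A) ++ [w] by simp, cycEdges_concat]; simp
  rcases hv with hv | hv
  · exact .inl (cycEdges_fst_inj h he e1 hv)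
  · exact .inr (cycEdges_snd_inj h he e2 hv)

/-- The interior angle at an extreme vertex is convex. -/
theorem PolyInt.convex_of_extreme {v u w : Plane} {A : List Plane}
    (h : PolyInt (v :: u :: A ++ [w]) G)
    (hv : ∀ x ∈ v :: u :: A ++ [w], x ≠ v → dotp v x < dotp v v) {σ : ℝ} (hσ : σ = 1 ∨ σ = -1)
    (hS : Side G (v, u) σ) : 0 < σ * orient v u w := by
  by_contra! hle
  have hnd := h.nodup
  have huv : u ≠ v := by rintro rfl; simp at hnd
  have hdu := hv u (by simp) huv
  obtain ⟨c, hc1, hc⟩ : ∃ c < dotp v v, ∀ x ∈ v :: u :: A ++ [w], x ≠ v → dotp v x < c := by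
    have hf : ∀ l : List Plane, (∀ x ∈ l, x ≠ v → dotp v x < dotp v v) →
        ∃ c < dotp v v, ∀ x ∈ l, x ≠ v → dotp v x < c := by
      intro l hl
      induction l with
      | nil => exact ⟨dotp v v - 1, by linarith, by simp⟩
      | cons a l ih =>
        obtain ⟨c, hc1, hc⟩ := ih fun x hx => hl x (List.mem_cons_of_mem _ hx)
        by_cases ha : a = v
        · refine ⟨c, hc1, fun x hx hne => ?_⟩
          rcases List.mem_cons.1 hx with rfl | hx
          · exact absurd ha hne
          · exact hc x hx hne
        · have := hl a (by simp) ha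
          refine ⟨max c ((dotp v a + dotp v v) / 2), max_lt hc1 (by linarith), fun x hx hne => ?_⟩
          rcases List.mem_cons.1 hx with rfl | hx
          · exact lt_max_of_lt_right (by linarith)
          · exact lt_max_of_lt_left (hc x hx hne)
    exact hf _ hv
  obtain ⟨ρ, hρ, hball⟩ := Metric.eventually_nhds_iff_ball.1
    (((continuous_dotp v).tendsto v).eventually (lt_mem_nhds hc1))
  obtain ⟨z, hz, hzb⟩ := exists_near (v := v) (q := u) hρ
  obtain ⟨δ, hδ, hside⟩ := hS z hz
  have hzc : z ∈ segment ℝ (v, u).1 (v, u).2 := openSegment_subset_segment ℝ _ _ hz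
  obtain ⟨x, ⟨hx1, hx2⟩, hx3⟩ := exists_sides_near (e := (v, u)) huv.symm hzc
    (inter_mem (Metric.ball_mem_nhds z hδ) (Metric.isOpen_ball.mem_nhds hzb)) hσ
  have hxG := (hside x hx1).1 hx3
  have hxc := hball x hx2
  have hR : ∀ t : ℝ, 0 ≤ t → (x + t • (v - u)) ∉ edgeUnion {e | e ∈ cycEdges (v :: u :: A ++ [w])} := by
    intro t ht hmem
    obtain ⟨e, he, hmem⟩ := mem_edgeUnion.1 hmem
    have he : e ∈ cycEdges (v :: u :: A ++ [w]) := he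
    have o1 : 0 < σ * orient v u (x + t • (v - u)) := by
      have : orient v u (x + t • (v - u)) = orient v u x := by
        unfold orient; simp; ring
      rwa [this]
    have d1 : c < dotp v (x + t • (v - u)) := by
      have : dotp v (x + t • (v - u)) = dotp v x + t * (dotp v v - dotp v u) := by
        unfold dotp; simp; ring
      rw [this]; nlinarith
    by_cases hev : e.1 = v ∨ e.2 = v
    · rcases mem_cycEdges_ends hnd he hev with rfl | rfl
      · rw [orient_of_mem_segment hmem] at o1; simp at o1
      · have := orient_nonneg_of_mem_segment (σ := -σ) (p := v) (q := u) (by linarith)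
          (by simp) hmem
        linarith
    · push Not at hev
      have := dotp_lt_of_mem_segment (hc _ (fst_mem_of_mem_cycEdges he) hev.1)
        (hc _ (snd_mem_of_mem_cycEdges he) hev.2) hmem
      linarith
  have hpre : IsPreconnected ((fun t : ℝ => x + t • (v - u)) '' Ici 0) :=
    isPreconnected_Ici.image _ (by fun_prop)
  have hsub : (fun t : ℝ => x + t • (v - u)) '' Ici 0 ⊆ G := by
    have hd : Disjoint ((fun t : ℝ => x + t • (v - u)) '' Ici 0) (frontier G) := by
      rw [disjoint_left]
      rintro _ ⟨t, ht, rfl⟩ hf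
      exact hR t ht (h.front hf)
    rcases hpre.subset_or_disjoint_of_frontier hd with h1 | h1
    · exact h1
    · exact absurd hxG (disjoint_left.1 h1 ⟨0, by simp, by simp⟩)
  obtain ⟨R, hR⟩ := h.bdd.exists_norm_le
  have hn : 0 < ‖v - u‖ := norm_pos_iff.2 (sub_ne_zero.2 huv.symm)
  have := hR _ (hsub ⟨(R + ‖x‖ + 1) / ‖v - u‖, by
    have : 0 ≤ R := (norm_nonneg _).trans (hR x hxG)
    simp only [mem_Ici]; positivity, rfl⟩)
  have h0 : 0 ≤ R := (norm_nonneg _).trans (hR x hxG)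
  have h2 : ‖((R + ‖x‖ + 1) / ‖v - u‖) • (v - u)‖ = R + ‖x‖ + 1 := by
    rw [norm_smul, Real.norm_of_nonneg (by positivity)]; field_simp
  have h3 := norm_sub_le (x + ((R + ‖x‖ + 1) / ‖v - u‖) • (v - u)) x
  rw [add_sub_cancel_left, h2] at h3
  linarith

theorem List.exists_cons_concat {α : Type*} {l : List α} (h : 2 ≤ l.length) :
    ∃ a A b, l = a :: A ++ [b] := by
  match l, h with
  | a :: b :: l, _ =>
    rcases List.eq_nil_or_concat (b :: l) with h | ⟨A, c, h⟩
    · simp at h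
    · exact ⟨a, A, c, by rw [h]; simp⟩

/-- The sides of a convex corner are met by no edges other than themselves. -/
theorem PolyInt.corner_clean {v u w : Plane} {A : List Plane} (h : PolyInt (v :: u :: A ++ [w]) G)
    {σ : ℝ} (ho : 0 < σ * orient v u w) {s t : ℝ} (s0 : 0 < s) (s1 : s ≤ 1) (t0 : 0 < t)
    (t1 : t ≤ 1) :
    ∀ e ∈ cycEdges (v :: u :: A ++ [w]),
      Disjoint (segment ℝ e.1 e.2) (tri σ v (AffineMap.lineMap v u s) (AffineMap.lineMap v w t)) ∨
      ∀ x ∈ segment ℝ e.1 e.2,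
        0 < σ * orient (AffineMap.lineMap v u s) (AffineMap.lineMap v w t) x →
        x ∉ segment ℝ v (AffineMap.lineMap v u s) ∧ x ∉ segment ℝ v (AffineMap.lineMap v w t) := by
  intro e he
  have hou : orient v (AffineMap.lineMap v u s) = fun x => s * orient v u x := by
    ext x; unfold orient; simp only [lineMap_coord]; ring
  have how : (fun x => orient (AffineMap.lineMap v w t) v x) = fun x => t * orient w v x := by
    ext x; unfold orient; simp only [lineMap_coord]; ring
  by_cases hev : e.1 = v ∨ e.2 = v
  · left
    rw [disjoint_left]
    rintro x hx ⟨x1, -, x3⟩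
    rcases mem_cycEdges_ends h.nodup he hev with rfl | rfl
    · rw [hou] at x1
      simp [orient_of_mem_segment hx] at x1
    · have := congrFun how x
      rw [this, orient_of_mem_segment hx] at x3
      simp at x3
  · right
    push Not at hev
    intro x hx hpos
    have e1 : (v, u) ∈ cycEdges (v :: u :: A ++ [w]) := by simp [cycEdges_cons]
    have e2 : (w, v) ∈ cycEdges (v :: u :: A ++ [w]) := by
      rw [show v :: u :: A ++ [w] = v :: (u :: A) ++ [w] by simp, cycEdges_concat]; simp
    constructor
    · intro hxs
      have hx1 : x ∈ segment ℝ v u := (convex_segment v u).segment_subset (left_mem_segment ℝ v u)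
        (mem_segment_iff.2 ⟨s, s0.le, s1, rfl⟩) hxs
      have hne : e ≠ (v, u) := by rintro rfl; exact hev.1 rfl
      obtain ⟨ha, hb⟩ := h.graph.2 e he (v, u) e1 hne x hx hx1
      have hxv : x ≠ v := by rintro rfl; rcases ha with ha | ha <;> [exact hev.1 ha.symm; exact hev.2 ha.symm]
      have hxu : x = u := hb.resolve_left hxv
      obtain ⟨t', t0', t1', rfl⟩ := mem_segment_iff.1 hxs
      rw [orient_lineMap, orient_left] at hpos
      have h5 : (1 - t') * (σ * orient (AffineMap.lineMap v u s) (AffineMap.lineMap v w t) v) =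
          (1 - t') * (s * t * (σ * orient v u w)) := by
        unfold orient; simp only [lineMap_coord]; ring
      have h6 : t' ≠ 1 := by rintro rfl; simp at hpos
      have h7 : t' * s ≠ 1 := by
        intro h1
        nlinarith [lt_of_le_of_ne t1' h6]
      have h8 : (AffineMap.lineMap v u (t' * s) : Plane) = AffineMap.lineMap v u (1:ℝ) := by
        rw [AffineMap.lineMap_apply_one]
        refine Eq.trans ?_ hxu
        apply plane_ext <;> simp only [lineMap_coord] <;> ring
      exact h7 (AffineMap.lineMap_injective ℝ (ne_of_orient ho) h8)
    · intro hxs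
      have hx1 : x ∈ segment ℝ v w := (convex_segment v w).segment_subset (left_mem_segment ℝ v w)
        (mem_segment_iff.2 ⟨t, t0.le, t1, rfl⟩) hxs
      have hne : e ≠ (w, v) := by rintro rfl; exact hev.2 rfl
      obtain ⟨ha, hb⟩ := h.graph.2 e he (w, v) e2 hne x hx (by rwa [segment_symm])
      have hxv : x ≠ v := by rintro rfl; rcases ha with ha | ha <;> [exact hev.1 ha.symm; exact hev.2 ha.symm]
      have hxu : x = w := hb.resolve_right hxv
      have hvw : v ≠ w := by
        have : 0 < -σ * orient v w u := by rw [orient_swap' v u w]; linarith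
        exact ne_of_orient this
      obtain ⟨t', t0', t1', rfl⟩ := mem_segment_iff.1 hxs
      rw [orient_lineMap, orient_right] at hpos
      have h6 : t' ≠ 1 := by rintro rfl; simp at hpos
      have h7 : t' * t ≠ 1 := by
        intro h1
        nlinarith [lt_of_le_of_ne t1' h6]
      have h8 : (AffineMap.lineMap v w (t' * t) : Plane) = AffineMap.lineMap v w (1:ℝ) := by
        rw [AffineMap.lineMap_apply_one]
        refine Eq.trans ?_ hxu
        apply plane_ext <;> simp only [lineMap_coord] <;> ring
      exact h7 (AffineMap.lineMap_injective ℝ hvw h8)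

theorem ne_of_sign {σ : ℝ} (h : σ = 1 ∨ σ = -1) : σ ≠ 0 := by rcases h with rfl | rfl <;> norm_num

theorem neg_sign {σ : ℝ} (h : σ = 1 ∨ σ = -1) : -σ = 1 ∨ -σ = -1 := by
  rcases h with rfl | rfl <;> norm_num

theorem orient_corner (v u w : Plane) (s t : ℝ) :
    orient v (AffineMap.lineMap v u s) (AffineMap.lineMap v w t) = s * t * orient v u w := by
  unfold orient; simp only [lineMap_coord]; ring

theorem PolyInt.corner_tri {v u w : Plane} {A : List Plane} (h : PolyInt (v :: u :: A ++ [w]) G)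
    {σ : ℝ} (hσ : σ = 1 ∨ σ = -1) (hS : Side G (v, u) σ) (ho : 0 < σ * orient v u w) {s t : ℝ}
    (s0 : 0 < s) (s1 : s ≤ 1) (t0 : 0 < t) (t1 : t ≤ 1)
    (hv : ∀ x ∈ v :: u :: A ++ [w],
      x ∉ tri σ v (AffineMap.lineMap v u s) (AffineMap.lineMap v w t)) :
    tri σ v (AffineMap.lineMap v u s) (AffineMap.lineMap v w t) ⊆ G := by
  have ho' : 0 < σ * orient v (AffineMap.lineMap v u s) (AffineMap.lineMap v w t) := by
    rw [orient_corner]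
    have := mul_pos (mul_pos s0 t0) ho
    linarith
  refine h.tri_subset ho' hv (h.corner_clean ho s0 s1 t0 t1) ?_
  obtain ⟨z, hz⟩ := openSegment_nonempty v (AffineMap.lineMap v u s : Plane)
  have hz' : z ∈ openSegment ℝ v u := by
    obtain ⟨r, r0, r1, rfl⟩ := mem_openSegment_iff.1 hz
    refine mem_openSegment_iff.2 ⟨r * s, mul_pos r0 s0, by nlinarith, ?_⟩
    apply plane_ext <;> simp only [lineMap_coord] <;> ring
  obtain ⟨δ, hδ, h1⟩ := hS z hz'
  refine sides_inter_nonempty hσ ho' hz ⟨δ, hδ, fun x hx hpos => (h1 x hx).1 ?_⟩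
  have : orient v (AffineMap.lineMap v u s) x = s * orient v u x := by
    unfold orient; simp only [lineMap_coord]; ring
  rw [this] at hpos
  have h3 : 0 < s * (σ * orient v u x) := by linarith
  exact pos_of_mul_pos_right h3 s0.le

/-- A diagonal at an extreme vertex or cutting it off. -/
theorem PolyInt.diagonal_aux {v u w : Plane} {A : List Plane} (h : PolyInt (v :: u :: A ++ [w]) G)
    (hA : A ≠ [])
    (hv : ∀ x ∈ v :: u :: A ++ [w], x ≠ v → dotp v x < dotp v v) :
    openSegment ℝ u w ⊆ G ∨ ∃ z ∈ A, openSegment ℝ v z ⊆ G := by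
  have hnd := h.nodup
  have e1 : (v, u) ∈ cycEdges (v :: u :: A ++ [w]) := by simp [cycEdges_cons]
  have e2 : (w, v) ∈ cycEdges (v :: u :: A ++ [w]) := by
    rw [show v :: u :: A ++ [w] = v :: (u :: A) ++ [w] by simp, cycEdges_concat]; simp
  obtain ⟨σ, hσ, hS⟩ := h.side _ e1
  have ho := h.convex_of_extreme hv hσ hS
  have how : 0 < σ * orient w v u := by rw [← orient_cycle w v u]; exact ho
  set Z := A.toFinset.filter fun z => 0 < σ * orient v u z ∧ 0 ≤ σ * orient u w z ∧
    0 < σ * orient w v z with hZ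
  have corner : ∀ x ∈ v :: u :: A ++ [w], 0 < σ * orient v u x → 0 < σ * orient w v x →
      0 ≤ σ * orient u w x → x ∈ Z := by
    intro x hx h1 h2 h3
    have : x ∈ A := by
      simp only [List.cons_append, List.mem_cons, List.mem_append, List.not_mem_nil, or_false] at hx
      rcases hx with rfl | rfl | hx | rfl
      · simp at h1
      · simp at h1
      · exact hx
      · simp at h2
    simp [hZ, this, h1, h2, h3]
  by_cases hemp : Z = ∅
  · left
    have key : ∀ x ∈ v :: u :: A ++ [w], 0 < σ * orient v u x → 0 < σ * orient w v x →
        σ * orient u w x < 0 := by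
      intro x hx h1 h2
      by_contra! h3
      have := corner x hx h1 h2 h3
      simp [hemp] at this
    have ht : tri σ v u w ⊆ G := by
      have := h.corner_tri hσ hS ho one_pos le_rfl one_pos le_rfl (fun x hx hxt => by
        simp only [AffineMap.lineMap_apply_one] at hxt
        exact absurd hxt.2.1 (key x hx hxt.1 hxt.2.2).le.not_gt)
      simpa only [AffineMap.lineMap_apply_one] using this
    refine h.openSegment_subset_of_tri ho ht (fun x hx hxo => ?_) fun e he hu hw => ?_
    · have h1 : 0 < σ * orient v u x := orient_pos_of_mem_openSegment (by simp) ho hxo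
      have h2 : 0 < σ * orient w v x := by
        rw [openSegment_symm] at hxo
        exact orient_pos_of_mem_openSegment (by simp) how hxo
      have := key x hx h1 h2
      rw [orient_of_mem_openSegment hxo] at this
      simp at this
    · have huw : u ≠ w := by rintro rfl; simp at hnd
      have hu' := h.vertex_endpoint (by simp) he hu
      have hw' := h.vertex_endpoint (by simp) he hw
      obtain ⟨y, A', rfl⟩ : ∃ y A', A = y :: A' := List.exists_cons_of_ne_nil hA
      have e3 : (u, y) ∈ cycEdges (v :: u :: (y :: A') ++ [w]) := by simp [cycEdges_cons]
      rcases hu' with hu' | hu'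
      · have := cycEdges_fst_inj hnd he e3 hu'.symm
        subst this
        rcases hw' with rfl | rfl
        · exact huw hu'
        · simp at hnd
      · have := cycEdges_snd_inj hnd he e1 hu'.symm
        subst this
        rcases hw' with rfl | rfl
        · simp at hnd
        · exact huw rfl
  · right
    obtain ⟨z, hz, hmax⟩ := Z.exists_max_image (fun z => σ * orient u w z)
      (Finset.nonempty_iff_ne_empty.2 hemp)
    simp only [hZ, Finset.mem_filter, List.mem_toFinset] at hz
    obtain ⟨hzA, z1, z2, z3⟩ := hz
    refine ⟨z, hzA, ?_⟩
    have hsum := orient_sum v u w z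
    set D := σ * orient v u w
    have hsum' : σ * orient v u z + σ * orient u w z + σ * orient w v z = D := by
      rw [← mul_add, ← mul_add, hsum]
    set s := 1 - σ * orient u w z / D with hs
    have hsD : s * D = D - σ * orient u w z := by rw [hs]; field_simp
    have s0 : 0 < s := by
      by_contra! hle
      nlinarith
    have s1 : s ≤ 1 := by rw [hs]; have := div_nonneg z2 ho.le; linarith
    have hline : ∀ x, orient (AffineMap.lineMap v u s) (AffineMap.lineMap v w s) x =
        s * (orient u w x - (1 - s) * orient v u w) := by
      intro x; unfold orient; simp only [lineMap_coord]; ring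
    have ho' : 0 < σ * orient v (AffineMap.lineMap v u s) (AffineMap.lineMap v w s) := by
      rw [orient_corner]
      have := mul_pos (mul_pos s0 s0) ho
      linarith
    have ht : tri σ v (AffineMap.lineMap v u s) (AffineMap.lineMap v w s) ⊆ G := by
      refine h.corner_tri hσ hS ho s0 s1 s0 s1 fun x hx hxt => ?_
      obtain ⟨x1, x2, x3⟩ := hxt
      have q1 : orient v (AffineMap.lineMap v u s) x = s * orient v u x := by
        unfold orient; simp only [lineMap_coord]; ring
      have q3 : orient (AffineMap.lineMap v w s) v x = s * orient w v x := by
        unfold orient; simp only [lineMap_coord]; ring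
      rw [q1] at x1
      rw [q3] at x3
      rw [hline] at x2
      have p1 : 0 < σ * orient v u x := pos_of_mul_pos_right (a := s) (by linarith) s0.le
      have p3 : 0 < σ * orient w v x := pos_of_mul_pos_right (a := s) (by linarith) s0.le
      have p2 : 0 < σ * orient u w x - (1 - s) * D :=
        pos_of_mul_pos_right (a := s) (by linarith) s0.le
      have hD : (1 - s) * D = σ * orient u w z := by linarith
      have hxZ := corner x hx p1 p3 (by nlinarith)
      have := hmax x hxZ
      linarith
    refine (openSegment_subset_tri ho' (m := z) ?_).trans ht
    have h0 : D ≠ 0 := ho.ne'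
    have hsd : s * D ≠ 0 := (mul_pos s0 ho).ne'
    refine mem_openSegment_iff.2 ⟨σ * orient v u z / (s * D), by positivity, ?_, ?_⟩
    · rw [div_lt_one (by positivity)]; linarith
    · have hk : ∀ i, (AffineMap.lineMap (AffineMap.lineMap v u s : Plane) (AffineMap.lineMap v w s)
          (σ * orient v u z / (s * D)) : Plane) i = z i := by
        intro i
        have hb := orient_bary v u w z i
        simp only [lineMap_coord]
        have hb' : D * z i = σ * orient u w z * v i + σ * orient w v z * u i
            + σ * orient v u z * w i := by
          simp only [D]; rw [mul_assoc, hb]; ring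
        have h4 : σ * orient w v z = s * D - σ * orient v u z := by linarith
        have h5 : σ * orient u w z = D - s * D := by linarith
        rw [h4, h5] at hb'
        have h6 : D * (v i + s * (u i - v i) + σ * orient v u z / (s * D) *
            (v i + s * (w i - v i) - (v i + s * (u i - v i)))) = D * z i := by
          rw [hb']; field_simp; ring
        exact mul_left_cancel₀ h0 h6
      exact plane_ext (hk 0) (hk 1)

/-- The vertices `p`, `q` are joined by a diagonal. -/
def IsDiag (L : List Plane) (G : Set Plane) (p q : Plane) : Prop :=
  p ∈ L ∧ q ∈ L ∧ p ≠ q ∧ (p, q) ∉ cycEdges L ∧ (q, p) ∉ cycEdges L ∧ openSegment ℝ p q ⊆ G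

theorem IsDiag.symm {p q : Plane} (h : IsDiag L G p q) : IsDiag L G q p := by
  obtain ⟨h1, h2, h3, h4, h5, h6⟩ := h
  exact ⟨h2, h1, h3.symm, h5, h4, by rwa [openSegment_symm]⟩

theorem PolyInt.exists_isDiag (h : PolyInt L G) (hL : 4 ≤ L.length) : ∃ p q, IsDiag L G p q := by
  have hne : L ≠ [] := by rintro rfl; simp at hL
  obtain ⟨v, hvL, hv⟩ := exists_extreme hne
  obtain ⟨X, Y, rfl⟩ := List.append_of_mem hvL
  have hrot := h.rotate
  obtain ⟨u, A, w, hA⟩ := List.exists_cons_concat (l := Y ++ X) (by simp at hL ⊢; omega)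
  have hlist : v :: Y ++ X = v :: u :: A ++ [w] := by
    rw [List.cons_append, hA]; simp
  rw [hlist] at hrot
  have hA0 : A ≠ [] := by
    rintro rfl
    have := congrArg List.length hA
    simp at this hL; omega
  have hmem : ∀ x, x ∈ v :: u :: A ++ [w] ↔ x ∈ X ++ v :: Y := by
    intro x; rw [← hlist]; simp; tauto
  have hedge : ∀ e, e ∈ cycEdges (v :: u :: A ++ [w]) ↔ e ∈ cycEdges (X ++ v :: Y) := by
    intro e; rw [← hlist]; exact mem_cycEdges_append_comm
  have hnd := hrot.nodup
  have e1 : (v, u) ∈ cycEdges (v :: u :: A ++ [w]) := by simp [cycEdges_cons]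
  have e2 : (w, v) ∈ cycEdges (v :: u :: A ++ [w]) := by
    rw [show v :: u :: A ++ [w] = v :: (u :: A) ++ [w] by simp, cycEdges_concat]; simp
  simp only [List.cons_append, List.nodup_cons, List.mem_cons, List.mem_append,
    List.not_mem_nil, or_false, not_or, List.nodup_append] at hnd
  obtain ⟨⟨vu, vA, vw⟩, ⟨uA, uw⟩, -, -, hAw⟩ := hnd
  rcases hrot.diagonal_aux hA0 (fun x hx => hv x ((hmem x).1 hx)) with hd | ⟨z, hz, hd⟩
  · refine ⟨u, w, (hmem _).1 (by simp), (hmem _).1 (by simp), uw, ?_, ?_, hd⟩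
    · rw [← hedge]
      intro he
      obtain ⟨y, A', rfl⟩ := List.exists_cons_of_ne_nil hA0
      have e3 : (u, y) ∈ cycEdges (v :: u :: (y :: A') ++ [w]) := by simp [cycEdges_cons]
      have := cycEdges_fst_inj hrot.nodup he e3 rfl
      simp only [Prod.mk.injEq, true_and] at this
      exact hAw y (by simp) w (by simp) this.symm
    · rw [← hedge]
      intro he
      have := cycEdges_snd_inj hrot.nodup he e1 rfl
      simp only [Prod.mk.injEq, and_true] at this
      exact vw this.symm
  · refine ⟨v, z, hvL, (hmem _).1 (by simp [hz]), by rintro rfl; exact vA hz, ?_, ?_, hd⟩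
    · rw [← hedge]
      intro he
      have := cycEdges_fst_inj hrot.nodup he e1 rfl
      simp only [Prod.mk.injEq, true_and] at this
      exact uA (this ▸ hz)
    · rw [← hedge]
      intro he
      have := cycEdges_snd_inj hrot.nodup he e2 rfl
      simp only [Prod.mk.injEq, and_true] at this
      exact hAw z hz w (by simp) this

theorem IsDiag.exists_split {p q : Plane} (h : IsDiag L G p q) :
    ∃ p q X B C, IsDiag L G p q ∧ L = X ++ p :: B ++ q :: C ∧ B ≠ [] ∧ C ++ X ≠ [] := by
  have main : ∀ p q X B C, IsDiag L G p q → L = X ++ p :: B ++ q :: C →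
      ∃ p q X B C, IsDiag L G p q ∧ L = X ++ p :: B ++ q :: C ∧ B ≠ [] ∧ C ++ X ≠ [] := by
    intro p q X B C h hL
    refine ⟨p, q, X, B, C, h, hL, ?_, ?_⟩
    · rintro rfl
      apply h.2.2.2.1
      rw [hL, List.append_assoc, mem_cycEdges_append_comm]
      simp [cycEdges_cons]
    · intro h0
      simp only [List.append_eq_nil_iff] at h0
      obtain ⟨rfl, rfl⟩ := h0
      apply h.2.2.2.2.1
      rw [hL, List.nil_append, cycEdges_concat]; simp
  obtain ⟨X, Y, hL⟩ := List.append_of_mem h.1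
  have hq : q ∈ X ++ p :: Y := hL ▸ h.2.1
  simp only [List.mem_append, List.mem_cons] at hq
  rcases hq with hq | hq | hq
  · obtain ⟨X1, X2, rfl⟩ := List.append_of_mem hq
    exact main q p X1 X2 Y h.symm (by rw [hL])
  · exact absurd hq.symm h.2.2.1
  · obtain ⟨Y1, Y2, rfl⟩ := List.append_of_mem hq
    exact main p q X Y1 Y2 h (by rw [hL]; simp)

theorem Side.sign_eq_of_tri {σ τ : ℝ} (hσ : σ = 1 ∨ σ = -1) (hτ : τ = 1 ∨ τ = -1) {p q r : Plane}
    (hS : Side G (p, q) τ) (ho : 0 < σ * orient p q r) (ht : tri σ p q r ⊆ G) : τ = σ := by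
  by_contra hne
  have hτσ : τ = -σ := by rcases hσ with rfl | rfl <;> rcases hτ with rfl | rfl <;> simp_all
  obtain ⟨z, hz⟩ := openSegment_nonempty p q
  obtain ⟨δ, hδ, h⟩ := hS z hz
  obtain ⟨x, hx, hxb⟩ := sides_inter_nonempty (G := Metric.ball z δ) hσ ho hz
    ⟨δ, hδ, fun x hx _ => hx⟩
  exact (h x hxb).2 (by rw [hτσ]; have := hx.1; simp only at this ⊢; linarith) (ht hx)

theorem Side.sign_eq_of_subset {H O : Set Plane} (hOH : O ⊆ H) {e : Plane × Plane}
    (he : e.1 ≠ e.2) {σ τ : ℝ} (hσ : σ = 1 ∨ σ = -1) (hτ : τ = 1 ∨ τ = -1) (h1 : Side H e σ)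
    (h2 : Side O e τ) : τ = σ := by
  obtain ⟨z, hz⟩ := openSegment_nonempty e.1 e.2
  exact Side.eq_of_subset hOH he hσ hτ (openSegment_subset_segment ℝ _ _ hz) (h1 z hz) (h2 z hz)

/-- A polygon lies strictly on the same side of a line as its vertices. -/
theorem PolyInt.orient_pos (h : PolyInt L G) {σ : ℝ} (hσ : σ = 1 ∨ σ = -1) {p q : Plane}
    (hpq : p ≠ q) (hv : ∀ v ∈ L, 0 ≤ σ * orient p q v) {x : Plane} (hx : x ∈ G) :
    0 < σ * orient p q x := by
  by_contra! hle
  have hσ2 : σ * σ = 1 := by rcases hσ with rfl | rfl <;> norm_num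
  have hsc := scal_self_pos hpq
  have horient : ∀ (z : Plane) t, σ * orient p q (shift p q z (-σ * t)) =
      σ * orient p q z - t * scal p q q := by
    intro z t; rw [orient_shift]; linear_combination (-t * scal p q q) * hσ2
  have hneg : ∃ y ∈ G, 0 < -σ * orient p q y := by
    obtain ⟨t, ht, hm⟩ := exists_shift_mem (p := p) (q := q) (h.isOpen.mem_nhds hx) (-σ)
    refine ⟨_, hm, ?_⟩
    rw [neg_mul, horient]
    nlinarith [mul_pos ht hsc]
  obtain ⟨y, hyG, hy⟩ := hneg
  have hd : Disjoint {x | 0 < -σ * orient p q x} (frontier G) := by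
    rw [disjoint_left]
    intro z hz hzf
    obtain ⟨e, he, hze⟩ := mem_edgeUnion.1 (h.front hzf)
    have := orient_nonneg_of_mem_segment (hv _ (fst_mem_of_mem_cycEdges he))
      (hv _ (snd_mem_of_mem_cycEdges he)) hze
    simp only [mem_ofPred_eq] at hz
    linarith
  rcases (convex_orient_pos p q (-σ)).isPreconnected.subset_or_disjoint_of_frontier hd with h1 | h1
  · obtain ⟨C, hC⟩ := (h.bdd.isCompact_closure.image
      (continuous_const.mul (continuous_orient p q) : Continuous fun x => σ * orient p q x)).bddBelow
    have hb : ∀ z ∈ G, C ≤ σ * orient p q z := fun z hz => hC ⟨z, subset_closure hz, rfl⟩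
    have hc := hb y hyG
    set t := (σ * orient p q y - C + 1) / scal p q q with ht
    have ht0 : 0 ≤ t := by apply div_nonneg <;> linarith
    have hts : t * scal p q q = σ * orient p q y - C + 1 := by rw [ht]; field_simp
    have := hb (shift p q y (-σ * t)) (h1 (by
      simp only [mem_ofPred_eq]
      rw [neg_mul, horient]
      nlinarith [mul_nonneg ht0 hsc.le]))
    rw [horient] at this
    linarith
  · exact disjoint_left.1 h1 hy hyG

theorem PolyInt.triangle {p q r : Plane} (h : PolyInt [p, q, r] G) {σ : ℝ} (hσ : σ = 1 ∨ σ = -1)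
    (hS : Side G (p, q) σ) : 0 < σ * orient p q r ∧ G = tri σ p q r := by
  have rot1 : PolyInt [q, r, p] G := by
    have : PolyInt ([p] ++ [q, r]) G := h
    exact this.rotate
  have rot2 : PolyInt [r, p, q] G := by
    have : PolyInt ([p, q] ++ [r]) G := h
    exact this.rotate
  have main : ∀ {v u w : Plane}, PolyInt [v, u, w] G →
      (∀ x ∈ [v, u, w], x ≠ v → dotp v x < dotp v v) →
      ∃ τ : ℝ, (τ = 1 ∨ τ = -1) ∧ 0 < τ * orient v u w ∧ tri τ v u w ⊆ G := by
    intro v u w h hv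
    have h' : PolyInt (v :: u :: [] ++ [w]) G := h
    obtain ⟨τ, hτ, hS⟩ := h'.side (v, u) (by simp [cycEdges_cons])
    have ho := h'.convex_of_extreme hv hτ hS
    refine ⟨τ, hτ, ho, ?_⟩
    have := h'.corner_tri hτ hS ho one_pos le_rfl one_pos le_rfl (fun x hx hxt => by
      simp only [AffineMap.lineMap_apply_one, tri, mem_ofPred_eq] at hxt
      simp only [List.cons_append, List.nil_append, List.mem_cons, List.not_mem_nil, or_false] at hx
      rcases hx with rfl | rfl | rfl <;> simp at hxt)
    simpa only [AffineMap.lineMap_apply_one] using this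
  obtain ⟨τ, hτ, ho, ht⟩ : ∃ τ : ℝ, (τ = 1 ∨ τ = -1) ∧ 0 < τ * orient p q r ∧ tri τ p q r ⊆ G := by
    obtain ⟨v, hvL, hv⟩ := exists_extreme (l := [p, q, r]) (by simp)
    simp only [List.mem_cons, List.not_mem_nil, or_false] at hvL
    rcases hvL with rfl | rfl | rfl
    · exact main h hv
    · obtain ⟨τ, hτ, ho, ht⟩ := main rot1 (by intro x hx; apply hv; simp at hx ⊢; tauto)
      exact ⟨τ, hτ, by rwa [orient_cycle p v r] at ho, by rwa [tri_cycle τ p v r] at ht⟩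
    · obtain ⟨τ, hτ, ho, ht⟩ := main rot2 (by intro x hx; apply hv; simp at hx ⊢; tauto)
      exact ⟨τ, hτ, by rwa [← orient_cycle v p q] at ho, by rwa [← tri_cycle τ v p q] at ht⟩
  obtain rfl : σ = τ := hS.sign_eq_of_tri hτ hσ ho ht
  have ho2 : 0 < σ * orient q r p := by rwa [orient_cycle p q r]
  have ho3 : 0 < σ * orient r p q := by rwa [← orient_cycle r p q]
  refine ⟨ho, Subset.antisymm (fun x hx => ⟨?_, ?_, ?_⟩) ht⟩
  · refine h.orient_pos hσ (ne_of_orient ho) (fun v hv => ?_) hx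
    simp only [List.mem_cons, List.not_mem_nil, or_false] at hv
    rcases hv with rfl | rfl | rfl <;> simp [ho.le]
  · refine h.orient_pos hσ (ne_of_orient ho2) (fun v hv => ?_) hx
    simp only [List.mem_cons, List.not_mem_nil, or_false] at hv
    rcases hv with rfl | rfl | rfl <;> simp [ho2.le]
  · refine h.orient_pos hσ (ne_of_orient ho3) (fun v hv => ?_) hx
    simp only [List.mem_cons, List.not_mem_nil, or_false] at hv
    rcases hv with rfl | rfl | rfl <;> simp [ho3.le]

theorem exists_ends_of_append_eq {a b : Plane} {A X C : List Plane} {p q : Plane} {B : List Plane}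
    (h : a :: A ++ [b] = X ++ p :: B ++ q :: C) :
    ∃ A', X ++ p :: q :: C = a :: A' ++ [b] := by
  obtain ⟨a', A', b', hL⟩ := List.exists_cons_concat (l := X ++ p :: q :: C) (by simp; omega)
  have h1 : a' = a := by
    have e1 := congrArg List.head? h
    have e2 := congrArg List.head? hL
    cases X <;> simp_all
  have h2 : b' = b := by
    rcases List.eq_nil_or_concat C with rfl | ⟨C', c, rfl⟩
    · have e1 := (List.append_inj' (t₁ := [b]) (t₂ := [q]) h rfl).2
      have e2 := (List.append_inj' (s₁ := X ++ [p]) (s₂ := a' :: A') (t₁ := [q]) (t₂ := [b']) (by simpa using hL)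
        rfl).2
      simp at e1 e2
      rw [e1, e2]
    · have e1 := (List.append_inj' (s₁ := a :: A) (s₂ := X ++ p :: B ++ q :: C') (t₁ := [b]) (t₂ := [c])
        (by simpa using h) rfl).2
      have e2 := (List.append_inj' (s₁ := X ++ p :: q :: C') (s₂ := a' :: A') (t₁ := [c]) (t₂ := [b'])
        (by simpa using hL) rfl).2
      simp at e1 e2
      rw [e1, e2]
  subst h1 h2
  exact ⟨A', hL⟩

/-- Every edge is the side of an empty triangle whose apex is a vertex. -/
theorem PolyInt.apex {a b : Plane} {A : List Plane} (h : PolyInt (a :: A ++ [b]) G) {σ : ℝ}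
    (hσ : σ = 1 ∨ σ = -1) (hS : Side G (b, a) σ) :
    ∃ w ∈ A, 0 < σ * orient b a w ∧ tri σ b a w ⊆ G ∧
      (openSegment ℝ a w ⊆ G ∨ (a, w) ∈ cycEdges (a :: A ++ [b])) ∧
      (openSegment ℝ w b ⊆ G ∨ (w, b) ∈ cycEdges (a :: A ++ [b])) := by
  induction hn : A.length using Nat.strong_induction_on generalizing A G with
  | _ n ih =>
  subst hn
  have hlen := h.len
  by_cases hA : A.length = 1
  · obtain ⟨w, rfl⟩ := List.length_eq_one_iff.1 hA
    have h' : PolyInt [b, a, w] G := by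
      have : PolyInt ([a, w] ++ [b]) G := h
      exact this.rotate
    obtain ⟨h1, h2⟩ := h'.triangle hσ hS
    exact ⟨w, by simp, h1, h2.ge, by simp [cycEdges_cons], by simp [cycEdges_cons]⟩
  · obtain ⟨p0, q0, hd0⟩ := h.exists_isDiag (by simp at hlen ⊢; omega)
    obtain ⟨p, q, X, B, C, hd, hL, hB, hCX⟩ := hd0.exists_split
    have hrot : PolyInt (p :: B ++ q :: (C ++ X)) G := by
      rw [hL, List.append_assoc] at h
      simpa using h.rotate
    obtain ⟨G₁, G₂, -, h2, -, hG, -, -⟩ := hrot.split hB hCX hd.2.2.2.2.2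
    have h2' : PolyInt (X ++ p :: q :: C) G₂ := by
      have : PolyInt ((q :: C) ++ (X ++ [p])) G₂ := by simpa using h2
      simpa using this.rotate
    have hG₂ : G₂ ⊆ G := by rw [hG]; exact fun x hx => .inl (.inr hx)
    obtain ⟨A', hA'⟩ := exists_ends_of_append_eq hL
    have hedge : ∀ e ∈ cycEdges (a :: A' ++ [b]), e ∈ cycEdges (a :: A ++ [b]) ∨ e = (p, q) := by
      intro e he
      have he : e ∈ cycEdges (q :: (C ++ X) ++ [p]) := by
        rw [← hA', show X ++ p :: q :: C = (X ++ [p]) ++ q :: C by simp,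
          mem_cycEdges_append_comm] at he
        simpa using he
      rw [cycEdges_concat, List.mem_append, List.mem_singleton] at he
      refine he.imp_left fun he => ?_
      rw [hL, List.append_assoc, mem_cycEdges_append_comm,
        show p :: B ++ q :: C ++ X = p :: B ++ q :: (C ++ X) by simp, cycEdges_split]
      exact List.mem_append_right _ he
    rw [hA'] at h2'
    have hba : b ≠ a := h.ne (e := (b, a)) (by rw [cycEdges_concat]; simp)
    obtain ⟨τ, hτ, hS'⟩ := h2'.side (b, a) (by rw [cycEdges_concat]; simp)
    obtain rfl := Side.sign_eq_of_subset hG₂ hba hσ hτ hS hS'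
    obtain ⟨w, hw, w1, w2, w3, w4⟩ := ih A'.length (by
      have e1 := congrArg List.length hL
      have e2 := congrArg List.length hA'
      have := List.length_pos_iff.2 hB
      simp at e1 e2; omega) h2' hS' rfl
    have hseg : ∀ x y, (openSegment ℝ x y ⊆ G₂ ∨ (x, y) ∈ cycEdges (a :: A' ++ [b])) →
        openSegment ℝ x y ⊆ G ∨ (x, y) ∈ cycEdges (a :: A ++ [b]) := by
      rintro x y (hxy | hxy)
      · exact .inl (hxy.trans hG₂)
      · rcases hedge _ hxy with he | he
        · exact .inr he
        · obtain ⟨rfl, rfl⟩ := Prod.mk.inj he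
          exact .inl hd.2.2.2.2.2
    refine ⟨w, ?_, w1, w2.trans hG₂, hseg _ _ w3, hseg _ _ w4⟩
    have hwL : w ∈ a :: A ++ [b] := by
      rw [hL]
      have : w ∈ X ++ p :: q :: C := by rw [hA']; simp [hw]
      simp at this ⊢; tauto
    have hnd := h2'.nodup
    simp only [List.cons_append, List.nodup_cons, List.mem_append, List.nodup_append,
      List.mem_cons, not_or] at hnd
    simp only [List.cons_append, List.mem_cons, List.mem_append, List.not_mem_nil, or_false] at hwL
    rcases hwL with rfl | hwA | rfl
    · exact absurd hw hnd.1.1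
    · exact hwA
    · exact absurd rfl (hnd.2.2.2 _ hw _ (by simp))

theorem Side.sign_eq_neg_of_tri {σ τ : ℝ} (hσ : σ = 1 ∨ σ = -1) (hτ : τ = 1 ∨ τ = -1)
    {p q r : Plane} (hS : Side G (p, q) τ) (ho : 0 < σ * orient p q r)
    (ht : Disjoint (tri σ p q r) G) : τ = -σ := by
  by_contra hne
  have hτσ : τ = σ := by rcases hσ with rfl | rfl <;> rcases hτ with rfl | rfl <;> simp_all
  subst hτσ
  obtain ⟨x, hx, hxG⟩ := hS.inter_tri_nonempty hσ ho
  exact disjoint_left.1 ht hx hxG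

theorem mem_cycEdges_last (A : List Plane) (a b : Plane) : (b, a) ∈ cycEdges (a :: A ++ [b]) := by
  rw [cycEdges_concat]; simp

theorem mem_cycEdges_mid (A B : List Plane) (a b : Plane) :
    (a, b) ∈ cycEdges (A ++ a :: b :: B) := by
  rw [mem_cycEdges_append_comm]; simp [cycEdges_cons]

theorem PolyInt.side_consecutive {o a y : Plane} {R : List Plane}
    (h : PolyInt (o :: a :: R ++ [y]) G) {σ : ℝ} (hσ : σ = 1 ∨ σ = -1) (hS : Side G (o, a) σ) :
    Side G (y, o) σ := by
  induction hn : R.length using Nat.strong_induction_on generalizing a R G with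
  | _ n ih =>
  subst hn
  have hrot : PolyInt (a :: (R ++ [y]) ++ [o]) G := by
    have : PolyInt ([o] ++ (a :: R ++ [y])) G := h
    simpa using this.rotate
  obtain ⟨w, hw, w1, w2, -, w4⟩ := hrot.apex hσ hS
  have hnd := h.nodup
  have hyo : (y, o) ∈ cycEdges (o :: a :: R ++ [y]) := by
    have := mem_cycEdges_last (a :: R) o y
    simpa using this
  rw [tri_cycle σ w o a] at w2
  have w1' : 0 < σ * orient w o a := by rwa [← orient_cycle w o a]
  by_cases hwy : w = y
  · subst hwy
    obtain ⟨τ, hτ, hS'⟩ := h.side _ hyo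
    obtain rfl := hS'.sign_eq_of_tri hσ hτ w1' w2
    exact hS'
  · have hwR : w ∈ R := by simpa [hwy] using hw
    obtain ⟨R1, R2, rfl⟩ := List.append_of_mem hwR
    have hseg : openSegment ℝ w o ⊆ G := by
      refine w4.resolve_right fun he => hwy ?_
      have he' : (w, o) ∈ cycEdges (o :: a :: (R1 ++ w :: R2) ++ [y]) := by
        have : (w, o) ∈ cycEdges ((a :: (R1 ++ w :: R2 ++ [y])) ++ [o]) := he
        rw [mem_cycEdges_append_comm] at this
        simpa using this
      have := cycEdges_snd_inj hnd he' hyo rfl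
      simpa using this
    have h' : PolyInt (o :: (a :: R1) ++ w :: (R2 ++ [y])) G := by simpa using h
    obtain ⟨G₁, G₂, h1, h2, hdis, hG, -, -⟩ := h'.split (by simp) (by simp)
      (by rwa [openSegment_symm])
    have hG₁ : G₁ ⊆ G := by rw [hG]; exact fun x hx => .inl (.inl hx)
    have hG₂ : G₂ ⊆ G := by rw [hG]; exact fun x hx => .inl (.inr hx)
    have h2' : PolyInt (o :: w :: R2 ++ [y]) G₂ := by
      have : PolyInt ((w :: R2 ++ [y]) ++ [o]) G₂ := by simpa using h2
      simpa using this.rotate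
    have hoa : o ≠ a := by rintro rfl; simp at hnd
    have how : o ≠ w := by rintro rfl; simp at hnd
    obtain ⟨σ₁, hσ₁, hS₁⟩ := h1.side (o, a) (by simp [cycEdges_cons])
    obtain rfl := Side.sign_eq_of_subset hG₁ hoa hσ hσ₁ hS hS₁
    have ht₁ : tri σ₁ w o a ⊆ G₁ := by
      refine (convex_tri σ₁ w o a).isPreconnected.subset_left_of_subset_union h1.isOpen h2.isOpen
        hdis (fun x hx => ?_) ?_
      · have := w2 hx
        rw [hG] at this
        rcases this with h3 | h3
        · exact h3
        · have h4 := hx.1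
          rw [openSegment_symm] at h3
          simp [orient_of_mem_openSegment h3] at h4
      · have := hS₁.inter_tri_nonempty hσ (r := w) (by rwa [orient_cycle w o a])
        rwa [tri_cycle] at this
    obtain ⟨τ, hτ, hS₂⟩ := h2'.side (o, w) (by simp [cycEdges_cons])
    have := hS₂.swap.sign_eq_neg_of_tri hσ (neg_sign hτ) w1'
      (disjoint_left.2 fun x hx hx2 => disjoint_left.1 hdis (ht₁ hx) hx2)
    obtain rfl : τ = σ₁ := by linarith
    have h3 := ih R2.length (by simp; omega) h2' hS₂ rfl
    obtain ⟨τ', hτ', hS'⟩ := h.side _ hyo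
    obtain rfl := Side.sign_eq_of_subset hG₂ (h.ne hyo) hτ' hσ hS' h3
    exact hS'

/-- A polygon all of whose edges have the interior on the side given by `σ`. -/
structure OPoly (σ : ℝ) (L : List Plane) (G : Set Plane) : Prop extends PolyInt L G where
  sign : σ = 1 ∨ σ = -1
  sides : ∀ e ∈ cycEdges L, Side G e σ

theorem PolyInt.exists_oPoly (h : PolyInt L G) : ∃ σ, OPoly σ L G := by
  obtain ⟨o, R, rfl⟩ : ∃ o R, L = o :: R :=
    List.exists_cons_of_ne_nil (by rintro rfl; simpa using h.len)
  obtain ⟨e0, he0, he1⟩ := exists_fst_eq (l := o :: R) (v := o) (by simp)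
  obtain ⟨σ, hσ, hS⟩ := h.side e0 he0
  refine ⟨σ, h, hσ, ?_⟩
  have main : ∀ (X : List Plane) (v : Plane) (Y : List Plane), o :: R = X ++ v :: Y →
      ∀ e ∈ cycEdges (o :: R), e.1 = v → Side G e σ := by
    intro X
    induction X using List.reverseRecOn with
    | nil =>
      rintro v Y hXY e he hev
      obtain rfl : v = o := by simp at hXY; exact hXY.1.symm
      rwa [cycEdges_fst_inj h.nodup he he0 (hev.trans he1.symm)]
    | append_singleton X p ih =>
      rintro v Y hXY e he hev
      have hlen := h.len
      rw [hXY] at hlen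
      have hpv : (p, v) ∈ cycEdges (o :: R) := by
        rw [hXY, List.append_assoc]; exact mem_cycEdges_mid X Y p v
      have hS' := ih p (v :: Y) (by simpa using hXY) _ hpv rfl
      obtain ⟨a, A, b, hA⟩ := List.exists_cons_concat (l := Y ++ (X ++ [p]))
        (by simp at hlen ⊢; omega)
      have hb : b = p := by
        have := (List.append_inj' (s₁ := Y ++ X) (s₂ := a :: A) (t₁ := [p]) (t₂ := [b])
          (by simpa using hA) rfl).2
        simpa using this.symm
      subst hb
      have hrot : PolyInt (v :: a :: A ++ [b]) G := by
        rw [hXY] at h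
        have := h.rotate
        rw [List.cons_append, hA] at this
        simpa using this
      have hedge : ∀ f, f ∈ cycEdges (v :: a :: A ++ [b]) ↔ f ∈ cycEdges (o :: R) := by
        intro f
        rw [hXY, mem_cycEdges_append_comm (A := X ++ [b]) (B := v :: Y),
          show v :: Y ++ (X ++ [b]) = v :: (Y ++ (X ++ [b])) from rfl, hA]
        simp
      have hva : (v, a) ∈ cycEdges (v :: a :: A ++ [b]) := by simp [cycEdges_cons]
      obtain ⟨τ, hτ, hSa⟩ := hrot.side _ hva
      have hSb := hrot.side_consecutive hτ hSa
      obtain rfl := Side.sign_eq_of_subset Subset.rfl (h.ne hpv) hσ hτ hS' hSb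
      have : e = (v, a) := cycEdges_fst_inj h.nodup he ((hedge _).1 hva) hev
      rwa [this]
  intro e he
  obtain ⟨X, Y, hXY⟩ := List.append_of_mem (fst_mem_of_mem_cycEdges he)
  exact main X e.1 Y hXY e he rfl

theorem OPoly.of_subset {σ : ℝ} (h : OPoly σ L G) {L' : List Plane} {G' : Set Plane}
    (h' : PolyInt L' G') (hsub : G' ⊆ G) {e : Plane × Plane} (he : e ∈ cycEdges L)
    (he' : e ∈ cycEdges L') : OPoly σ L' G' := by
  obtain ⟨τ, hτ⟩ := h'.exists_oPoly
  obtain rfl := Side.sign_eq_of_subset hsub (h.ne he) h.sign hτ.sign (h.sides e he) (hτ.sides e he')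
  exact hτ

theorem OPoly.rotate {σ : ℝ} {A B : List Plane} (h : OPoly σ (A ++ B) G) : OPoly σ (B ++ A) G :=
  ⟨h.toPolyInt.rotate, h.sign, fun e he => h.sides e (mem_cycEdges_append_comm.1 he)⟩

theorem OPoly.reverse {σ : ℝ} (h : OPoly σ L G) : OPoly (-σ) L.reverse G :=
  ⟨h.toPolyInt.reverse, neg_sign h.sign, fun e he =>
    (h.sides e.swap (mem_cycEdges_reverse.1 he)).swap⟩

theorem OPoly.insert_vertex {σ : ℝ} {A B : List Plane} {u v x : Plane}
    (h : OPoly σ (A ++ u :: v :: B) G) (hx : x ∈ openSegment ℝ u v) :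
    OPoly σ (A ++ u :: x :: v :: B) G := by
  have h1 : OPoly σ (v :: (B ++ A) ++ [u]) G := by
    have : OPoly σ ((A ++ [u]) ++ (v :: B)) G := by simpa using h
    simpa using this.rotate
  have h2 := h1.toPolyInt.insert_vertex hx
  have h3 : PolyInt (A ++ u :: x :: v :: B) G := by
    have : PolyInt ((v :: B) ++ (A ++ [u, x])) G := by simpa using h2
    simpa using this.rotate
  obtain ⟨τ, hτ⟩ := h3.exists_oPoly
  have e1 : (u, x) ∈ cycEdges (A ++ u :: x :: v :: B) := mem_cycEdges_mid _ _ _ _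
  have e2 : (u, v) ∈ cycEdges (A ++ u :: v :: B) := mem_cycEdges_mid _ _ _ _
  have hux : u ≠ x := h3.ne e1
  suffices τ = σ by rwa [← this]
  obtain ⟨z, hz⟩ := openSegment_nonempty u x
  obtain ⟨t, t0, t1, hxt⟩ := mem_openSegment_iff.1 hx
  obtain ⟨s, s0, s1, hs⟩ := mem_openSegment_iff.1 hz
  have hz' : z ∈ openSegment ℝ u v := by
    refine mem_openSegment_iff.2 ⟨s * t, mul_pos s0 t0, by nlinarith, ?_⟩
    rw [← hs, ← hxt]
    apply plane_ext <;> simp only [lineMap_coord] <;> ring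
  have hS : SideAt G (u, x) σ z := by
    obtain ⟨r, hr, hrS⟩ := h.sides _ e2 z hz'
    have key : ∀ y, orient u x y = t * orient u v y := by
      intro y; rw [← hxt]; unfold orient; simp only [lineMap_coord]; ring
    refine ⟨r, hr, fun y hy => ⟨fun hpos => (hrS y hy).1 ?_, fun hpos => (hrS y hy).2 ?_⟩⟩
    · simp only [key] at hpos ⊢
      exact pos_of_mul_pos_right (a := t) (by linarith) t0.le
    · simp only [key] at hpos ⊢
      by_contra! hcon
      nlinarith [mul_nonneg t0.le hcon]
  exact Side.eq_of_subset Subset.rfl hux h.sign hτ.sign (openSegment_subset_segment ℝ _ _ hz) hS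
    (hτ.sides _ e1 z hz)

/-- Cutting a polygon along a diagonal. -/
theorem OPoly.split {σ : ℝ} {p q : Plane} {B C : List Plane} (h : OPoly σ (p :: B ++ q :: C) G)
    (hB : B ≠ []) (hC : C ≠ []) (hpq : openSegment ℝ p q ⊆ G) :
    ∃ G₁ G₂, OPoly σ (p :: B ++ [q]) G₁ ∧ OPoly σ (q :: C ++ [p]) G₂ ∧ G₁ ⊆ G ∧ G₂ ⊆ G ∧
      Disjoint G₁ G₂ ∧ (∀ x ∈ G, x ∈ G₁ ∨ x ∈ G₂ ∨ x ∈ openSegment ℝ p q) ∧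
      Disjoint G₁ (segment ℝ p q) ∧ Disjoint G₂ (segment ℝ p q) := by
  obtain ⟨G₁, G₂, h1, h2, hdis, hG, d1, d2⟩ := h.toPolyInt.split hB hC hpq
  have hG₁ : G₁ ⊆ G := by rw [hG]; exact fun x hx => .inl (.inl hx)
  have hG₂ : G₂ ⊆ G := by rw [hG]; exact fun x hx => .inl (.inr hx)
  refine ⟨G₁, G₂, ?_, ?_, hG₁, hG₂, hdis, fun x hx => ?_, d1, d2⟩
  · obtain ⟨b, B, rfl⟩ := List.exists_cons_of_ne_nil hB
    exact h.of_subset h1 hG₁ (e := (p, b)) (by simp [cycEdges_cons]) (by simp [cycEdges_cons])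
  · obtain ⟨c, C, rfl⟩ := List.exists_cons_of_ne_nil hC
    exact h.of_subset h2 hG₂ (e := (q, c)) (mem_cycEdges_mid _ _ _ _) (by simp [cycEdges_cons])
  · rw [hG] at hx
    rcases hx with (hx | hx) | hx <;> tauto

theorem OPoly.apex {a b : Plane} {A : List Plane} {σ : ℝ} (h : OPoly σ (a :: A ++ [b]) G) :
    ∃ w ∈ A, 0 < σ * orient b a w ∧ tri σ b a w ⊆ G ∧
      (openSegment ℝ a w ⊆ G ∨ (a, w) ∈ cycEdges (a :: A ++ [b])) ∧
      (openSegment ℝ w b ⊆ G ∨ (w, b) ∈ cycEdges (a :: A ++ [b])) :=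
  h.toPolyInt.apex h.sign (h.sides _ (mem_cycEdges_last _ _ _))

theorem pathEdges_map_range (w : ℕ → Plane) (n : ℕ) :
    pathEdges ((List.range (n + 1)).map w) = (List.range n).map fun i => (w i, w (i + 1)) := by
  induction n with
  | zero => simp
  | succ n ih =>
    rw [List.range_succ, List.map_append, List.range_succ, List.map_append, List.append_assoc]
    simp only [List.map_cons, List.map_nil, List.cons_append, List.nil_append]
    rw [pathEdges_append_two, List.map_append, ← ih, List.range_succ, List.map_append]
    simp

theorem mem_cycEdges_map_range {v : ℕ → Plane} {n : ℕ} (hn : 0 < n) {e : Plane × Plane} :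
    e ∈ cycEdges ((List.range n).map v) ↔ ∃ i < n, e = (v i, v ((i + 1) % n)) := by
  have h1 : cycEdges ((List.range n).map v) =
      pathEdges ((List.range (n + 1)).map fun i => v (i % n)) := by
    obtain ⟨m, rfl⟩ : ∃ m, n = m + 1 := ⟨n - 1, by omega⟩
    have h2 : (List.range (m + 1 + 1)).map (fun i => v (i % (m + 1))) =
        (List.range (m + 1)).map v ++ [v 0] := by
      rw [List.range_succ, List.map_append]
      congr 1
      · refine List.map_congr_left fun i hi => ?_
        rw [Nat.mod_eq_of_lt (List.mem_range.1 hi)]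
      · simp
    rw [h2]
    have h3 : (List.range (m + 1)).map v = v 0 :: (List.range m).map (fun i => v (i + 1)) := by
      rw [List.range_succ_eq_map]; simp [Function.comp_def]
    rw [h3, cycEdges_cons]
  rw [h1, pathEdges_map_range]
  simp only [List.mem_map, List.mem_range]
  constructor
  · rintro ⟨i, hi, rfl⟩
    exact ⟨i, hi, by simp [Nat.mod_eq_of_lt hi]⟩
  · rintro ⟨i, hi, rfl⟩
    exact ⟨i, hi, by simp [Nat.mod_eq_of_lt hi]⟩

theorem frontier_interior_subset' (P : Set Plane) : frontier (interior P) ⊆ frontier P := by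
  intro x hx
  rw [isOpen_interior.frontier_eq] at hx
  exact ⟨closure_mono interior_subset hx.1, hx.2⟩

theorem succ_mod_ne {n i : ℕ} (hn : 2 ≤ n) (hi : i < n) : (i + 1) % n ≠ i := by
  rcases Nat.lt_or_ge (i + 1) n with h | h
  · rw [Nat.mod_eq_of_lt h]; omega
  · have : i + 1 = n := by omega
    rw [this, Nat.mod_self]; omega

theorem IsSimplePolygon.polyInt {n : ℕ} (hn : 3 ≤ n) {P : Set Plane} {v : ℕ → Plane}
    (hP : IsSimplePolygon n P v) : PolyInt ((List.range n).map v) (interior P) := by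
  obtain ⟨hc, hconn, hinj, hfr, hint⟩ := hP
  have hmem : ∀ e, e ∈ cycEdges ((List.range n).map v) ↔ ∃ i < n, e = (v i, v ((i + 1) % n)) :=
    fun e => mem_cycEdges_map_range (by omega)
  have hmod : ∀ i, (i + 1) % n < n := fun i => Nat.mod_lt _ (by omega)
  have hnodup : ((List.range n).map v).Nodup := by
    refine (List.nodup_range).map_on fun i hi j hj h => hinj i (List.mem_range.1 hi) j (List.mem_range.1 hj) h
  have hgraph : IsPlaneGraph {e | e ∈ cycEdges ((List.range n).map v)} := by
    constructor
    · intro e he hne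
      obtain ⟨i, hi, rfl⟩ := (hmem e).1 he
      exact succ_mod_ne (by omega) hi (hinj _ (hmod i) _ hi hne.symm)
    · intro e he f hf hef x hxe hxf
      obtain ⟨i, hi, rfl⟩ := (hmem e).1 he
      obtain ⟨j, hj, rfl⟩ := (hmem f).1 hf
      have hij : i ≠ j := fun h => hef (by rw [h])
      obtain ⟨h1, h2, h3⟩ := hint i hi j hj hij
      have hx : x ∈ polyEdge n v i ∩ polyEdge n v j := ⟨hxe, hxf⟩
      by_cases hj' : j = (i + 1) % n
      · rw [h1 hj'] at hx
        have : x = v j := hx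
        subst this
        exact ⟨Or.inr (by rw [← hj']), Or.inl rfl⟩
      by_cases hi' : i = (j + 1) % n
      · rw [h2 hi'] at hx
        have : x = v i := hx
        subst this
        exact ⟨Or.inl rfl, Or.inr (by rw [← hi'])⟩
      exact absurd hx.2 (disjoint_left.1 (h3 hj' hi') hx.1)
  have hunion : edgeUnion {e | e ∈ cycEdges ((List.range n).map v)} = frontier P := by
    rw [hfr]
    ext x
    simp only [mem_edgeUnion, mem_iUnion, Finset.mem_range, polyEdge]
    constructor
    · rintro ⟨e, he, hx⟩
      obtain ⟨i, hi, rfl⟩ := (hmem e).1 he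
      exact ⟨i, hi, hx⟩
    · rintro ⟨i, hi, hx⟩
      exact ⟨_, (hmem _).2 ⟨i, hi, rfl⟩, hx⟩
  have hfront : frontier (interior P) ⊆ edgeUnion {e | e ∈ cycEdges ((List.range n).map v)} :=
    hunion ▸ frontier_interior_subset' P
  have hdisj : Disjoint (edgeUnion {e | e ∈ cycEdges ((List.range n).map v)}) (interior P) := by
    rw [hunion]; exact disjoint_interior_frontier.symm
  have hbdd : Bornology.IsBounded (interior P) := hc.isBounded.subset interior_subset
  have hfin : {e | e ∈ cycEdges ((List.range n).map v)}.Finite := finite_cycEdges _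
  have htri : ∀ e ∈ cycEdges ((List.range n).map v), Side (interior P) e 1 ∨
      Side (interior P) e (-1) ∨ Disjoint (openSegment ℝ e.1 e.2) (closure (interior P)) := by
    intro e he
    refine side_or_disjoint hfin hgraph isOpen_interior hfront he fun z hz r hr h => ?_
    have hzf : z ∈ frontier P := hunion ▸ mem_edgeUnion.2 ⟨e, he, openSegment_subset_segment _ _ _ hz⟩
    have hsub : Metric.ball z r ⊆ P := by
      intro x hx
      have : x ∈ closure (interior P) := by
        refine mem_closure_iff_nhds.2 fun U hU => ?_
        by_cases h0 : orient e.1 e.2 x = 0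
        · obtain ⟨t, ht, hm⟩ := exists_shift_mem (p := e.1) (q := e.2)
            (Filter.inter_mem hU (Metric.isOpen_ball.mem_nhds hx)) 1
          refine ⟨_, hm.1, h _ hm.2 ?_⟩
          have := scal_self_pos (hgraph.1 e he)
          rw [orient_shift, h0]; positivity
        · exact ⟨x, mem_of_mem_nhds hU, h x hx h0⟩
      exact hc.isClosed.closure_subset_iff.2 interior_subset this
    exact hzf.2 (mem_interior.2 ⟨_, hsub, Metric.isOpen_ball, Metric.mem_ball_self hr⟩)
  have hside : ∀ e ∈ cycEdges ((List.range n).map v),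
      ¬ Disjoint (openSegment ℝ e.1 e.2) (closure (interior P)) → ∃ σ : ℝ, (σ = 1 ∨ σ = -1) ∧
      Side (interior P) e σ := by
    intro e he h
    rcases htri e he with h1 | h1 | h1
    · exact ⟨1, .inl rfl, h1⟩
    · exact ⟨-1, .inr rfl, h1⟩
    · exact absurd h1 h
  have hstep : ∀ i < n, ¬ Disjoint (openSegment ℝ (v i) (v ((i + 1) % n))) (closure (interior P)) →
      ¬ Disjoint (openSegment ℝ (v ((i + 1) % n)) (v (((i + 1) % n + 1) % n)))
        (closure (interior P)) := by
    intro i hi h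
    obtain ⟨σ, hσ, hS⟩ := hside _ ((hmem _).2 ⟨i, hi, rfl⟩) h
    obtain ⟨f, hf, hfe, hvf, hfd⟩ := exists_adjacent hfin hgraph hfront
      ((hmem _).2 ⟨i, hi, rfl⟩) (v := v ((i + 1) % n)) (q := v i) (Or.inr rfl) hσ hS
    obtain ⟨j, hj, rfl⟩ := (hmem f).1 hf
    have hend := (hgraph.2 _ hf _ ((hmem _).2 ⟨i, hi, rfl⟩) hfe _ hvf (right_mem_segment _ _ _)).1
    rcases hend with h1 | h1
    · rwa [← hinj _ (hmod i) _ hj h1] at hfd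
    · exfalso
      have h2 := hinj _ (hmod i) _ (hmod j) h1
      have : i = j := by
        have : i + 1 ≡ j + 1 [MOD n] := h2
        exact Nat.ModEq.eq_of_lt_of_lt (Nat.ModEq.add_right_cancel' 1 this) hi hj
      exact hfe (by rw [this])
  have hex : ∃ i < n, ¬ Disjoint (openSegment ℝ (v i) (v ((i + 1) % n))) (closure (interior P)) := by
    by_contra! hcon
    have hempty : frontier (interior P) = ∅ := by
      refine eq_empty_of_forall_notMem fun x hx => ?_
      obtain ⟨e, he, hxe⟩ := mem_edgeUnion.1 (hfront hx)
      obtain ⟨i, hi, rfl⟩ := (hmem e).1 he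
      have hxc : x ∈ closure (interior P) := hx.1
      have hall : ∀ f ∈ {e | e ∈ cycEdges ((List.range n).map v)},
          Disjoint (openSegment ℝ f.1 f.2) (closure (interior P)) := by
        intro f hf
        obtain ⟨j, hj, rfl⟩ := (hmem f).1 hf
        exact hcon j hj
      rcases mem_segment_cases hxe with h | h | h
      · subst h
        exact notMem_closure_vertex hfin hgraph hfront hdisj he (Or.inl rfl) (fun f hf _ => hall f hf) hxc
      · subst h
        exact notMem_closure_vertex hfin hgraph hfront hdisj he (Or.inr rfl) (fun f hf _ => hall f hf) hxc
      · exact disjoint_left.1 (hcon i hi) h hxc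
    rcases isClopen_iff.1 (isClopen_iff_frontier_eq_empty.2 hempty) with h | h
    · exact hconn.nonempty.ne_empty h
    · rw [h] at hbdd
      exact NoncompactSpace.noncompact_univ (X := Plane) (Metric.isCompact_of_isClosed_isBounded isClosed_univ hbdd)
  refine ⟨by simpa using hn, hnodup, hgraph, isOpen_interior, hconn.isPreconnected, hconn.nonempty,
    hbdd, hfront, fun e he => hside e he ?_⟩
  obtain ⟨j, hj, rfl⟩ := (hmem e).1 he
  obtain ⟨i, hi, hi'⟩ := hex
  have hall : ∀ m, ¬ Disjoint (openSegment ℝ (v ((i + m) % n)) (v (((i + m) % n + 1) % n)))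
      (closure (interior P)) := by
    intro m
    induction m with
    | zero => rwa [add_zero, Nat.mod_eq_of_lt hi]
    | succ m ih =>
      have := hstep _ (Nat.mod_lt _ (by omega)) ih
      rwa [Nat.mod_add_mod] at this
  have h := hall (n - i + j)
  have h2 : (i + (n - i + j)) % n = j := by
    have : i + (n - i + j) = j + n := by omega
    rw [this, Nat.add_mod_right, Nat.mod_eq_of_lt hj]
  rwa [h2] at h

theorem mem_openSegment_of_lineMap {p g : Plane} {s : ℝ} (hs : 1 < s) :
    g ∈ openSegment ℝ p (AffineMap.lineMap p g s : Plane) := by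
  refine mem_openSegment_iff.2 ⟨s⁻¹, by positivity, inv_lt_one_of_one_lt₀ hs, ?_⟩
  have : s ≠ 0 := by positivity
  refine plane_ext ?_ ?_ <;> simp only [lineMap_coord] <;> field_simp <;> ring

theorem exists_lineMap_of_mem_openSegment {p g x : Plane} (hg : g ∈ openSegment ℝ p x) :
    ∃ s : ℝ, 1 < s ∧ AffineMap.lineMap p g s = x := by
  obtain ⟨t, h0, h1, rfl⟩ := mem_openSegment_iff.1 hg
  refine ⟨t⁻¹, (one_lt_inv₀ h0).2 h1, ?_⟩
  refine plane_ext ?_ ?_ <;> simp only [lineMap_coord] <;> field_simp <;> ring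

theorem PolyInt.first_hit (h : PolyInt L G) {w g : Plane} (hg : g ∈ G) (hwg : w ≠ g) :
    ∃ x, g ∈ openSegment ℝ w x ∧ openSegment ℝ g x ⊆ G ∧
      ∃ e ∈ cycEdges L, x ∈ segment ℝ e.1 e.2 := by
  have hcont : Continuous fun t : ℝ => (AffineMap.lineMap w g t : Plane) :=
    AffineMap.lineMap_continuous
  set S : Set ℝ := {t | 1 ≤ t ∧ (AffineMap.lineMap w g t : Plane) ∉ G} with hS
  have hSc : IsClosed S :=
    isClosed_Ici.inter ((h.isOpen.isClosed_compl).preimage hcont)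
  have hSn : S.Nonempty := by
    obtain ⟨R, hR⟩ := h.bdd.subset_ball w
    have hd : 0 < dist w g := dist_pos.2 hwg
    refine ⟨max 1 (R / dist w g), le_max_left _ _, fun hm => ?_⟩
    have := hR hm
    rw [Metric.mem_ball, dist_lineMap_left, Real.norm_eq_abs, abs_of_pos (by positivity)] at this
    have h2 : R / dist w g ≤ max 1 (R / dist w g) := le_max_right _ _
    rw [div_le_iff₀ hd] at h2
    linarith
  have hSb : BddBelow S := ⟨1, fun t ht => ht.1⟩
  obtain ⟨h1, h2⟩ := hSc.csInf_mem hSn hSb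
  have hs : 1 < sInf S := by
    refine lt_of_le_of_ne h1 fun he => h2 ?_
    rw [← he]; simpa using hg
  have hlt : ∀ t, 1 ≤ t → t < sInf S → (AffineMap.lineMap w g t : Plane) ∈ G := by
    intro t ht hts
    by_contra hn
    exact absurd (csInf_le hSb ⟨ht, hn⟩) (not_le.2 hts)
  refine ⟨_, mem_openSegment_of_lineMap hs, ?_, ?_⟩
  · intro y hy
    obtain ⟨t, h0, h1', rfl⟩ := mem_openSegment_iff.1 hy
    have : (AffineMap.lineMap g (AffineMap.lineMap w g (sInf S) : Plane) t : Plane) =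
        AffineMap.lineMap w g (1 + t * (sInf S - 1)) := by
      refine plane_ext ?_ ?_ <;> simp only [lineMap_coord] <;> ring
    rw [this]
    refine hlt _ (by nlinarith) (by nlinarith)
  · have hcl : (AffineMap.lineMap w g (sInf S) : Plane) ∈ closure G := by
      refine mem_closure_of_tendsto (hcont.continuousAt.tendsto.mono_left
        (nhdsWithin_le_nhds (s := Iio (sInf S)))) ?_
      filter_upwards [Ioo_mem_nhdsLT hs] with t ht
      exact hlt t ht.1.le ht.2
    exact mem_edgeUnion.1 (h.front ⟨hcl, by rwa [h.isOpen.interior_eq]⟩)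

theorem mem_cycEdges_four {o a c : Plane} {L' : List Plane} :
    ∃ N y, c :: L' = N ++ [y] ∧ ∀ e, e ∈ cycEdges (o :: a :: c :: L') ↔
      e = (o, a) ∨ e = (a, c) ∨ e ∈ pathEdges (c :: L') ∨ e = (y, o) := by
  obtain h | ⟨N, y, h⟩ := List.eq_nil_or_concat (c :: L')
  · simp at h
  · rw [List.concat_eq_append] at h
    refine ⟨N, y, h, fun e => ?_⟩
    have : cycEdges (o :: a :: c :: L') = (o, a) :: (a, c) :: (pathEdges (c :: L') ++ [(y, o)]) := by
      rw [cycEdges_cons]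
      simp only [List.cons_append, pathEdges_cons_cons]
      rw [← List.cons_append, h, List.append_assoc, List.cons_append, List.nil_append,
        pathEdges_append_two]
    rw [this]; simp

theorem exists_split_of_mem_pathEdges {L : List Plane} {e : Plane × Plane} (h : e ∈ pathEdges L) :
    ∃ A B, L = A ++ e.1 :: e.2 :: B := by
  induction L with
  | nil => simp at h
  | cons a l ih =>
    cases l with
    | nil => simp at h
    | cons b l =>
      rcases List.mem_cons.1 h with rfl | h
      · exact ⟨[], l, rfl⟩
      · obtain ⟨A, B, hAB⟩ := ih h
        exact ⟨a :: A, B, by simp [hAB]⟩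

theorem PolyInt.halfBall_subset_or_disjoint {τ : ℝ} {o a c : Plane} {L' : List Plane}
    (h : PolyInt (o :: a :: c :: L') G) (hβ : τ * orient o a c ≤ 0) :
    ∃ ρ > 0, Metric.ball a ρ ∩ {x | 0 < τ * orient o a x} ⊆ G ∨
      Disjoint (Metric.ball a ρ ∩ {x | 0 < τ * orient o a x}) G := by
  obtain ⟨N, y, hN, hed⟩ := mem_cycEdges_four (o := o) (a := a) (c := c) (L' := L')
  have hnd := h.nodup
  simp only [List.nodup_cons, List.mem_cons, not_or] at hnd
  have hpe : ∀ e ∈ cycEdges (o :: a :: c :: L'), e ≠ (o, a) → e ≠ (a, c) → a ∉ segment ℝ e.1 e.2 := by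
    intro e he h1 h2 ha
    rcases h.vertex_endpoint (by simp) he ha with h3 | h3
    · exact h2 (cycEdges_fst_inj h.nodup he ((hed _).2 (.inr (.inl rfl))) h3.symm)
    · exact h1 (cycEdges_snd_inj h.nodup he ((hed _).2 (.inl rfl)) h3.symm)
  have hball : ∃ ρ > 0, ∀ e ∈ cycEdges (o :: a :: c :: L'), e ≠ (o, a) → e ≠ (a, c) →
      Disjoint (Metric.ball a ρ) (segment ℝ e.1 e.2) := by
    have hcl : IsClosed (edgeUnion {e | e ∈ cycEdges (o :: a :: c :: L') ∧ e ≠ (o, a) ∧ e ≠ (a, c)}) :=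
      isClosed_edgeUnion ((finite_cycEdges _).subset fun e he => he.1)
    have hna : a ∉ edgeUnion {e | e ∈ cycEdges (o :: a :: c :: L') ∧ e ≠ (o, a) ∧ e ≠ (a, c)} := by
      rw [mem_edgeUnion]
      rintro ⟨e, ⟨he, h1, h2⟩, ha⟩
      exact hpe e he h1 h2 ha
    obtain ⟨ρ, hρ, hb⟩ := Metric.isOpen_iff.1 hcl.isOpen_compl a hna
    exact ⟨ρ, hρ, fun e he h1 h2 => disjoint_left.2 fun x hx hxe =>
      hb hx (mem_edgeUnion.2 ⟨e, ⟨he, h1, h2⟩, hxe⟩)⟩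
  obtain ⟨ρ, hρ, hb⟩ := hball
  refine ⟨ρ, hρ, IsPreconnected.subset_or_disjoint_of_frontier
    (isPreconnected_halfBall o a a ρ τ) ?_⟩
  have hd : Disjoint (Metric.ball a ρ ∩ {x | 0 < τ * orient o a x}) (frontier G) := by
    refine disjoint_left.2 fun w hw hwf => ?_
    obtain ⟨e, he, hwe⟩ := mem_edgeUnion.1 (h.front hwf)
    by_cases h1 : e = (o, a)
    · subst h1
      have := hw.2
      simp [orient_of_mem_segment hwe] at this
    by_cases h2 : e = (a, c)
    · subst h2
      obtain ⟨t, h0, h1, rfl⟩ := mem_segment_iff.1 hwe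
      have := hw.2
      simp only [mem_ofPred_eq, orient_lineMap, orient_right] at this
      nlinarith
    exact disjoint_left.1 (hb e he h1 h2) hw.1 hwe
  exact hd

theorem OPoly.exists_near_first {σ τ ρ : ℝ} {o a : Plane} {L' : List Plane}
    (h : OPoly σ (o :: a :: L') G) (hτ : τ = 1 ∨ τ = -1) (hρ : 0 < ρ) :
    ∃ w ∈ Metric.ball a ρ, 0 < τ * orient o a w ∧ (0 < σ * orient o a w → w ∈ G) ∧
      (σ * orient o a w < 0 → w ∉ G) := by
  have he : (o, a) ∈ cycEdges (o :: a :: L') := by simp [cycEdges_cons]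
  obtain ⟨z, hz, hzb⟩ := exists_near (v := a) (q := o) hρ
  rw [openSegment_symm] at hz
  obtain ⟨r, hr, hrz⟩ := h.sides _ he z hz
  obtain ⟨w, hw, hwo⟩ := exists_sides_near (e := (o, a)) (h.ne he)
    (openSegment_subset_segment _ _ _ hz)
    (inter_mem (Metric.ball_mem_nhds z hr) (Metric.isOpen_ball.mem_nhds hzb)) hτ
  exact ⟨w, hw.2, hwo, hrz w hw.1⟩

theorem OPoly.halfBall {σ : ℝ} {o a c : Plane} {L' : List Plane}
    (h : OPoly σ (o :: a :: c :: L') G) (hβ : σ * orient o a c ≤ 0) :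
    ∃ ρ > 0, ∀ x ∈ Metric.ball a ρ, 0 < σ * orient o a x → x ∈ G := by
  obtain ⟨ρ, hρ, h1 | h1⟩ := h.toPolyInt.halfBall_subset_or_disjoint hβ
  · exact ⟨ρ, hρ, fun x hx hxo => h1 ⟨hx, hxo⟩⟩
  · obtain ⟨w, hw, hwo, hwG, -⟩ := h.exists_near_first h.sign hρ
    exact absurd (hwG hwo) (disjoint_left.1 h1 ⟨hw, hwo⟩)

/-- Near a strictly convex vertex the polygon lies on one side of each of its two edges. -/
theorem OPoly.convex_near {σ : ℝ} {o a c : Plane} {L' : List Plane}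
    (h : OPoly σ (o :: a :: c :: L') G) (hα : 0 < σ * orient o a c) :
    ∃ ρ > 0, ∀ x ∈ Metric.ball a ρ, x ∈ G → 0 < σ * orient o a x := by
  obtain ⟨ρ, hρ, h1⟩ := h.toPolyInt.halfBall_subset_or_disjoint (τ := -σ) (by linarith)
  have h2 : Disjoint (Metric.ball a ρ ∩ {x | 0 < -σ * orient o a x}) G := by
    rcases h1 with h1 | h1
    · obtain ⟨w, hw, hwo, -, hwG⟩ := h.exists_near_first (neg_sign h.sign) hρ
      exact absurd (h1 ⟨hw, hwo⟩) (hwG (by linarith))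
    · exact h1
  refine ⟨ρ, hρ, fun x hx hxG => ?_⟩
  by_contra! hle
  obtain ⟨w, hw, hwo⟩ : ∃ w ∈ Metric.ball a ρ ∩ G, 0 < -σ * orient o a w := by
    obtain ⟨t, ht, hm⟩ := exists_shift_mem (p := o) (q := a)
      (inter_mem (Metric.isOpen_ball.mem_nhds hx) (h.isOpen.mem_nhds hxG)) (-σ)
    refine ⟨_, hm, ?_⟩
    have hs := scal_self_pos (h.ne (e := (o, a)) (by simp [cycEdges_cons]))
    have hσ : σ * σ = 1 := by rcases h.sign with h | h <;> rw [h] <;> norm_num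
    rw [orient_shift]
    have : -σ * (orient o a x + -σ * t * scal o a a) = -(σ * orient o a x) +
      (σ * σ) * (t * scal o a a) := by ring
    rw [this, hσ]
    have := mul_pos ht hs
    linarith
  exact disjoint_left.1 h2 ⟨hw.1, hwo⟩ hw.2

theorem OPoly.convex_openSegment {σ : ℝ} {o a c w : Plane} {L' : List Plane}
    (h : OPoly σ (o :: a :: c :: L') G) (hα : 0 < σ * orient o a c)
    (hw : openSegment ℝ a w ⊆ G) : 0 < σ * orient o a w := by
  obtain ⟨ρ, hρ, hb⟩ := h.convex_near hα
  obtain ⟨z, hz, hzb⟩ := exists_near (v := a) (q := w) hρ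
  have h1 := hb z hzb (hw hz)
  obtain ⟨t, t0, t1, rfl⟩ := mem_openSegment_iff.1 hz
  rw [orient_lineMap, orient_right] at h1
  by_contra! h2
  nlinarith

theorem PolyInt.collinear_beyond {o a c : Plane} {L' : List Plane}
    (h : PolyInt (o :: a :: c :: L') G) (hc : orient o a c = 0) :
    ∃ t : ℝ, 1 < t ∧ (AffineMap.lineMap o a t : Plane) = c := by
  obtain ⟨N, y, hN, hed⟩ := mem_cycEdges_four (o := o) (a := a) (c := c) (L' := L')
  have hoa : o ≠ a := h.ne ((hed _).2 (.inl rfl))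
  have hac : a ≠ c := h.ne ((hed _).2 (.inr (.inl rfl)))
  have hoc : o ≠ c := by
    have := h.nodup
    simp only [List.nodup_cons, List.mem_cons, not_or] at this
    exact this.1.2.1
  have hc' := eq_lineMap_of_orient hoa hc
  set t := scal o a c / scal o a a
  refine ⟨t, ?_, hc'.symm⟩
  by_contra! ht
  rcases lt_or_ge 0 t with h0 | h0
  · have : c ∈ segment ℝ o a := mem_segment_iff.2 ⟨t, h0.le, ht, hc'.symm⟩
    rcases h.vertex_endpoint (by simp) ((hed _).2 (.inl rfl)) this with h1 | h1
    · exact hoc h1.symm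
    · exact hac h1.symm
  · have : o ∈ segment ℝ a c := by
      refine mem_segment_iff.2 ⟨1 / (1 - t), by apply div_nonneg <;> linarith,
        by rw [div_le_one] <;> linarith, ?_⟩
      rw [hc']
      have : (1 - t) ≠ 0 := by linarith
      refine plane_ext ?_ ?_ <;> simp only [lineMap_coord] <;> field_simp <;> ring
    rcases h.vertex_endpoint (by simp) ((hed _).2 (.inr (.inl rfl))) this with h1 | h1
    · exact hoa h1
    · exact hoc h1

/-- The ray from `o` just beside a vertex `a` at which the polygon does not turn towards the
interior runs past `a` into another edge. -/
theorem OPoly.chop {σ : ℝ} {o a c : Plane} {L' : List Plane}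
    (h : OPoly σ (o :: a :: c :: L') G) (hβ : σ * orient o a c ≤ 0) :
    ∃ A u v B x, c :: L' = A ++ u :: v :: B ∧ x ∈ openSegment ℝ u v ∧ openSegment ℝ o x ⊆ G ∧
      openSegment ℝ a x ⊆ G ∧ tri σ o a x ⊆ G ∧ 0 < σ * orient o a x ∧ 0 < σ * orient x a c ∧
      ∀ w ∈ o :: a :: c :: L', 0 < σ * orient o a w → σ * orient o w x < 0 := by
  obtain ⟨N, y, hN, hed⟩ := mem_cycEdges_four (o := o) (a := a) (c := c) (L' := L')
  have hoa : o ≠ a := h.ne ((hed _).2 (.inl rfl))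
  have hyL : y ∈ c :: L' := by rw [hN]; simp
  have hnd := h.nodup
  obtain ⟨ρ, hρ, hball⟩ := h.halfBall hβ
  -- a point just beyond `a` on the ray from `o`
  obtain ⟨δ, hδ, hg0⟩ : ∃ δ : ℝ, 0 < δ ∧ (AffineMap.lineMap o a (1 + δ) : Plane) ∈ Metric.ball a ρ := by
    have hc : Tendsto (fun t : ℝ => (AffineMap.lineMap o a (1 + t) : Plane)) (nhds 0) (nhds a) := by
      have : Continuous fun t : ℝ => (AffineMap.lineMap o a (1 + t) : Plane) :=
        AffineMap.lineMap_continuous.comp (by fun_prop)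
      simpa using this.tendsto 0
    have h1 : ∀ᶠ t : ℝ in nhdsWithin 0 (Ioi 0), (AffineMap.lineMap o a (1 + t) : Plane) ∈ Metric.ball a ρ :=
      (hc.mono_left nhdsWithin_le_nhds) (Metric.ball_mem_nhds a hρ)
    obtain ⟨t, ht, ht0⟩ := (h1.and self_mem_nhdsWithin).exists
    exact ⟨t, ht0, ht⟩
  set g0 : Plane := AffineMap.lineMap o a (1 + δ) with hg0d
  have hoc : σ * orient o a c < 0 ∨ orient o a c = 0 := by
    rcases hβ.lt_or_eq with h1 | h1
    · exact .inl h1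
    · refine .inr ?_
      rcases h.sign with rfl | rfl <;> linarith
  have hex : ∃ g ∈ Metric.ball a ρ, 0 < σ * orient o a g ∧ 0 < σ * orient g a c ∧
      ∀ w ∈ o :: a :: c :: L', 0 < σ * orient o a w → σ * orient o w g < 0 := by
    have h1 : ∀ᶠ g in nhds g0, ∀ w ∈ {w | w ∈ o :: a :: c :: L'}, 0 < σ * orient o a w → σ * orient o w g < 0 := by
      refine (eventually_all_finite (List.finite_toSet _)).2 fun w _ => ?_
      by_cases hw : 0 < σ * orient o a w
      · have : σ * orient o w g0 < 0 := by
          rw [hg0d, orient_lineMap, orient_left, orient_swap']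
          nlinarith
        filter_upwards [((continuous_const.mul (continuous_orient o w)).tendsto g0).eventually_lt_const this]
          with g hg _ using hg
      · exact Eventually.of_forall fun g hw' => absurd hw' hw
    have h2 : ∀ᶠ g in nhds g0, 0 < σ * orient o a g → 0 < σ * orient g a c := by
      rcases hoc with h3 | h3
      · have : 0 < σ * orient a c g0 := by
          have h4 : orient a c o = orient o a c := orient_cycle o a c
          rw [hg0d, orient_lineMap, orient_left, h4]
          nlinarith
        filter_upwards [((continuous_const.mul (continuous_orient a c)).tendsto g0).eventually_const_lt this]
          with g hg _
        rw [← orient_cycle g a c]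
        exact hg
      · obtain ⟨t, ht, htc⟩ := h.toPolyInt.collinear_beyond h3
        refine Eventually.of_forall fun g hg => ?_
        have h4 : orient g a o = - orient o a g := by unfold orient; ring
        rw [← htc, orient_lineMap, orient_right, h4]
        nlinarith
    obtain ⟨t, ht, hm⟩ := exists_shift_mem (p := o) (q := a)
      (inter_mem (Metric.isOpen_ball.mem_nhds hg0) (inter_mem h1 h2)) σ
    have hpos : 0 < σ * orient o a (shift o a g0 (σ * t)) := by
      have hs := scal_self_pos hoa
      have hσ2 : σ * σ = 1 := by rcases h.sign with h | h <;> rw [h] <;> norm_num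
      rw [orient_shift, hg0d, orient_lineMap, orient_left, orient_right]
      have : σ * (0 + (1 + δ) * (0 - 0) + σ * t * scal o a a) = (σ * σ) * t * scal o a a := by ring
      rw [this, hσ2]; positivity
    exact ⟨_, hm.1, hpos, hm.2.2 hpos, hm.2.1⟩
  obtain ⟨g, hgb, hgo, hgc, hgv⟩ := hex
  have hgG : g ∈ G := hball g hgb hgo
  have hog : o ≠ g := by rintro rfl; simp at hgo
  have hab : ∀ w ∈ segment ℝ a g, w = a ∨ w ∈ G := by
    intro w hw
    obtain ⟨t, h0, h1, rfl⟩ := mem_segment_iff.1 hw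
    rcases h0.eq_or_lt with rfl | h0
    · exact .inl (by simp)
    · refine .inr (hball _ ?_ ?_)
      · exact (convex_ball a ρ).segment_subset (Metric.mem_ball_self hρ) hgb hw
      · rw [orient_lineMap, orient_right]; simp only [sub_zero, zero_add]; nlinarith
  have ha_edge : ∀ e ∈ cycEdges (o :: a :: c :: L'), a ∈ segment ℝ e.1 e.2 → e = (o, a) ∨ e = (a, c) := by
    intro e he ha
    rcases h.vertex_endpoint (by simp) he ha with h3 | h3
    · exact .inr (cycEdges_fst_inj h.nodup he ((hed _).2 (.inr (.inl rfl))) h3.symm)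
    · exact .inl (cycEdges_snd_inj h.nodup he ((hed _).2 (.inl rfl)) h3.symm)
  have ho_edge : ∀ e ∈ cycEdges (o :: a :: c :: L'), o ∈ segment ℝ e.1 e.2 → e = (o, a) ∨ e = (y, o) := by
    intro e he ha
    rcases h.vertex_endpoint (by simp) he ha with h3 | h3
    · exact .inl (cycEdges_fst_inj h.nodup he ((hed _).2 (.inl rfl)) h3.symm)
    · exact .inr (cycEdges_snd_inj h.nodup he ((hed _).2 (.inr (.inr (.inr rfl)))) h3.symm)
  have hoa_edge : ∀ e ∈ cycEdges (o :: a :: c :: L'), ∀ w ∈ segment ℝ e.1 e.2, w ∈ segment ℝ o a →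
      e = (o, a) ∨ w = o ∨ w = a := by
    intro e he w hw hwoa
    by_cases h1 : e = (o, a)
    · exact .inl h1
    · exact .inr (h.graph.2 e he (o, a) ((hed _).2 (.inl rfl)) h1 w hw hwoa).2
  have hneg : ∀ x, (∀ w ∈ o :: a :: c :: L', 0 < σ * orient o a w → σ * orient o w x < 0) →
      ∀ w ∈ o :: a :: c :: L', w ∉ tri σ o a x := by
    intro x hx w hw hwt
    have h1 := hx w hw hwt.1
    have h2 : orient x o w = orient o w x := by unfold orient; ring
    have h3 := hwt.2.2
    rw [h2] at h3
    linarith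
  have hdis : ∀ x, ∀ e, e = (o, a) ∨ e = (a, c) → Disjoint (segment ℝ e.1 e.2) (tri σ o a x) := by
    rintro x e (rfl | rfl)
    · refine disjoint_left.2 fun w hw hwt => ?_
      have := hwt.1
      simp [orient_of_mem_segment hw] at this
    · refine disjoint_left.2 fun w hw hwt => ?_
      obtain ⟨t, h0, h1, rfl⟩ := mem_segment_iff.1 hw
      have := hwt.1
      rw [orient_lineMap, orient_right] at this
      simp only [sub_zero, zero_add] at this
      nlinarith
  have htg : tri σ o a g ⊆ G := by
    rw [← tri_cycle]
    refine h.toPolyInt.tri_subset (by rwa [orient_cycle]) ?_ ?_ ?_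
    · intro w hw; rw [tri_cycle]; exact hneg g hgv w hw
    · intro e he
      rw [tri_cycle]
      by_cases h1 : e = (o, a) ∨ e = (a, c)
      · exact .inl (hdis g e h1)
      refine .inr fun w hw hwo => ⟨fun hw2 => ?_, fun hw2 => ?_⟩
      · rcases hab w hw2 with rfl | h2
        · exact h1 (ha_edge e he hw)
        · exact h.segment_disjoint he hw h2
      · rw [segment_symm] at hw2
        rcases hoa_edge e he w hw hw2 with h2 | rfl | rfl
        · exact h1 (.inl h2)
        · simp [orient_right] at hwo
        · exact h1 (ha_edge e he hw)
    · rw [tri_cycle]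
      exact (h.sides _ ((hed _).2 (.inl rfl))).inter_tri_nonempty h.sign hgo
  have hogG : openSegment ℝ g o ⊆ G := by
    refine h.toPolyInt.openSegment_subset_of_tri (σ := σ) (p := a) (by rwa [orient_cycle]) (by rwa [tri_cycle]) ?_ ?_
    · intro w hw hwo
      obtain ⟨t, h0, h1, rfl⟩ := mem_openSegment_iff.1 hwo
      have h2 := hgv _ hw
      have h3 : orient o (AffineMap.lineMap g o t : Plane) g = 0 := by
        rw [orient_swap', orient_lineMap]; simp
      rw [h3, orient_lineMap] at h2
      simp only [orient_left] at h2
      have := h2 (by nlinarith)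
      simp at this
    · intro e he hge _
      exact h.segment_disjoint he hge hgG
  obtain ⟨x, hgx, hgxG, e, he, hxe⟩ := h.toPolyInt.first_hit hgG hog
  obtain ⟨s, hs, rfl⟩ := exists_lineMap_of_mem_openSegment hgx
  set x : Plane := AffineMap.lineMap o g s with hx
  have hoxG : openSegment ℝ o x ⊆ G := by
    intro w hw
    have hw' := openSegment_subset_segment _ _ _ hw
    obtain ⟨t, h0, h1, rfl⟩ := mem_openSegment_iff.1 hw
    have h2 : (AffineMap.lineMap o x t : Plane) = AffineMap.lineMap o g (t * s) := by
      refine plane_ext ?_ ?_ <;> simp only [hx, lineMap_coord] <;> ring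
    rw [h2]
    rcases lt_trichotomy (t * s) 1 with h3 | h3 | h3
    · refine hogG ?_
      rw [openSegment_symm]
      exact mem_openSegment_iff.2 ⟨_, by positivity, h3, rfl⟩
    · rw [h3]; simpa using hgG
    · refine hgxG (mem_openSegment_iff.2 ⟨(t * s - 1) / (s - 1), div_pos (by linarith) (by linarith),
        by rw [div_lt_one] <;> nlinarith, ?_⟩)
      have : s - 1 ≠ 0 := by linarith
      refine plane_ext ?_ ?_ <;> simp only [hx, lineMap_coord] <;> field_simp <;> ring
  have hox : 0 < σ * orient o a x := by
    rw [hx, orient_lineMap, orient_left]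
    nlinarith
  have hxv : ∀ w ∈ o :: a :: c :: L', 0 < σ * orient o a w → σ * orient o w x < 0 := by
    intro w hw hwo
    have := hgv w hw hwo
    rw [hx, orient_lineMap, orient_left]
    nlinarith
  have htx : tri σ o a x ⊆ G := by
    refine h.toPolyInt.tri_subset hox (hneg x hxv) ?_
      ((h.sides _ ((hed _).2 (.inl rfl))).inter_tri_nonempty h.sign hox)
    intro e he
    by_cases h1 : e = (o, a) ∨ e = (a, c)
    · exact .inl (hdis x e h1)
    by_cases h2 : e = (y, o)
    · subst h2
      refine .inl (disjoint_left.2 fun w hw hwt => ?_)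
      obtain ⟨t, h0, h3, rfl⟩ := mem_segment_iff.1 hw
      have h4 := hwt.1
      rw [orient_lineMap, orient_left] at h4
      have h5 := hxv y (by simp [List.mem_cons.1 hyL]) (by nlinarith)
      have h6 := hwt.2.2
      have h7 : orient x o y = orient o y x := by unfold orient; ring
      rw [orient_lineMap, orient_right, h7] at h6
      nlinarith
    refine .inr fun w hw hwo => ⟨fun hw2 => ?_, fun hw2 => ?_⟩
    · rcases hoa_edge e he w hw hw2 with h3 | rfl | rfl
      · exact h1 (.inl h3)
      · rcases ho_edge e he hw with h3 | h3
        · exact h1 (.inl h3)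
        · exact h2 h3
      · simp at hwo
    · rcases mem_segment_cases hw2 with rfl | rfl | h3
      · rcases ho_edge e he hw with h3 | h3
        · exact h1 (.inl h3)
        · exact h2 h3
      · simp [orient_right] at hwo
      · exact h.segment_disjoint he hw (hoxG h3)
  have hxL : x ∉ o :: a :: c :: L' := fun hm => by
    have := hxv x hm hox
    simp [orient_right] at this
  have hxo : x ∈ openSegment ℝ e.1 e.2 := by
    refine mem_openSegment_of_mem_segment hxe ?_ ?_
    · rintro h1; exact hxL (h1 ▸ fst_mem_of_mem_cycEdges he)
    · rintro h1; exact hxL (h1 ▸ snd_mem_of_mem_cycEdges he)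
  have hep : e ∈ pathEdges (c :: L') := by
    rcases (hed e).1 he with rfl | rfl | h1 | rfl
    · simp [orient_of_mem_segment hxe] at hox
    · obtain ⟨t, h0, h1, h2⟩ := mem_segment_iff.1 hxe
      rw [← h2, orient_lineMap, orient_right] at hox
      nlinarith
    · exact h1
    · exfalso
      have h3 : orient y o x = 0 := orient_of_mem_segment hxe
      obtain ⟨t, h0, h1, h2⟩ := mem_segment_iff.1 hxe
      have h4 : t < 1 := by
        refine lt_of_le_of_ne h1 ?_
        rintro rfl
        simp only [AffineMap.lineMap_apply_one] at h2
        exact hxL (by rw [← h2]; simp)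
      have h5 := hox
      rw [← h2, orient_lineMap, orient_left] at h5
      have h6 := hxv y (by simp [List.mem_cons.1 hyL]) (by nlinarith)
      have h7 : orient o y x = 0 := by rw [orient_swap, h3, neg_zero]
      simp [h7] at h6
  have hax : openSegment ℝ a x ⊆ G := by
    refine h.toPolyInt.openSegment_subset_of_tri hox htx ?_ ?_
    · intro w hw hwo
      obtain ⟨t, h0, h1, rfl⟩ := mem_openSegment_iff.1 hwo
      have h2 := hxv _ hw
      rw [orient_lineMap, orient_right] at h2
      have h3 := h2 (by nlinarith)
      rw [orient_swap', orient_lineMap, orient_right, orient_swap' o a x] at h3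
      nlinarith
    · intro f hf haf hxf
      have hfe : f = e := by
        by_contra hne
        obtain h1 | h1 := (h.graph.2 f hf e he hne x hxf hxe).2
        · exact hxL (h1 ▸ fst_mem_of_mem_cycEdges he)
        · exact hxL (h1 ▸ snd_mem_of_mem_cycEdges he)
      subst hfe
      rcases ha_edge f he haf with rfl | rfl
      · simp [orient_of_mem_segment hxe] at hox
      · simp only [List.nodup_cons] at hnd
        exact hnd.2.1 (fst_mem_of_mem_pathEdges hep)
  obtain ⟨A, B, hAB⟩ := exists_split_of_mem_pathEdges hep
  refine ⟨A, e.1, e.2, B, x, hAB, hxo, hoxG, hax, htx, hox, ?_, hxv⟩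
  have h1 : orient x a c = (1 - s) * orient o a c + s * orient g a c := by
    rw [hx]; unfold orient; simp only [lineMap_coord]; ring
  rw [h1]
  nlinarith

theorem orient_affine (p q r s t x : Plane) : orient p q r * orient s t x =
    orient q r x * orient s t p + orient r p x * orient s t q + orient p q x * orient s t r := by
  unfold orient; ring

theorem orient_pos_of_tri {σ τ : ℝ} {p q r s t x : Plane} (ho : 0 < τ * orient p q r)
    (hx : x ∈ tri τ p q r) (hp : 0 ≤ σ * orient s t p) (hq : 0 ≤ σ * orient s t q)
    (hr : 0 < σ * orient s t r) : 0 < σ * orient s t x := by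
  obtain ⟨h1, h2, h3⟩ := hx
  have h := orient_affine p q r s t x
  have h4 : (τ * orient p q r) * (σ * orient s t x) = (τ * orient q r x) * (σ * orient s t p) +
      (τ * orient r p x) * (σ * orient s t q) + (τ * orient p q x) * (σ * orient s t r) := by
    linear_combination (τ * σ) * h
  have h5 : 0 < (τ * orient p q r) * (σ * orient s t x) := by
    rw [h4]; positivity
  exact (pos_iff_pos_of_mul_pos h5).1 ho

theorem exists_sign_mul_pos {x : ℝ} (hx : x ≠ 0) : ∃ τ : ℝ, (τ = 1 ∨ τ = -1) ∧ 0 < τ * x := by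
  rcases lt_or_gt_of_ne hx with h | h
  · exact ⟨-1, .inr rfl, by linarith⟩
  · exact ⟨1, .inl rfl, by linarith⟩

theorem PolyInt.openSegment_subset_of_chain (h : PolyInt L G) {o z y : Plane} (hz : z ∈ G)
    (hoz : openSegment ℝ o z ⊆ G) (hzy : openSegment ℝ z y ⊆ G) (hoy : o ≠ y)
    (hv : ∀ τ : ℝ, 0 < τ * orient z o y → ∀ w ∈ L, w ∉ tri τ z o y ∧ w ∉ openSegment ℝ o y)
    (he : ∀ e ∈ cycEdges L, o ∈ segment ℝ e.1 e.2 → y ∈ segment ℝ e.1 e.2 → False) 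
    (hc : orient o z y = 0 → z = y ∨ ∃ t : ℝ, 0 < t ∧ AffineMap.lineMap o z t = y) :
    openSegment ℝ o y ⊆ G := by
  by_cases hD : orient o z y = 0
  · rcases hc hD with rfl | ⟨t, ht, rfl⟩
    · exact hoz
    intro w hw
    obtain ⟨s, h0, h1, rfl⟩ := mem_openSegment_iff.1 hw
    have h2 : (AffineMap.lineMap o (AffineMap.lineMap o z t : Plane) s : Plane) =
        AffineMap.lineMap o z (s * t) := by
      refine plane_ext ?_ ?_ <;> simp only [lineMap_coord] <;> ring
    rw [h2]
    rcases lt_trichotomy (s * t) 1 with h3 | h3 | h3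
    · exact hoz (mem_openSegment_iff.2 ⟨_, by positivity, h3, rfl⟩)
    · rw [h3]; simpa using hz
    · have h4 : 1 < t := by nlinarith
      refine hzy (mem_openSegment_iff.2 ⟨(s * t - 1) / (t - 1), div_pos (by linarith) (by linarith),
        by rw [div_lt_one] <;> nlinarith, ?_⟩)
      have : t - 1 ≠ 0 := by linarith
      refine plane_ext ?_ ?_ <;> simp only [lineMap_coord] <;> field_simp <;> ring
  · obtain ⟨τ, hτ, hpos⟩ := exists_sign_mul_pos (x := orient z o y) (by
      rw [orient_swap]; exact neg_ne_zero.2 hD)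
    have ht : tri τ z o y ⊆ G := by
      refine h.tri_subset hpos (fun w hw => (hv τ hpos w hw).1) ?_ ?_
      · intro e he
        refine .inr fun w hw hwo => ⟨fun hw2 => ?_, fun hw2 => ?_⟩
        · rcases mem_segment_cases hw2 with rfl | rfl | h3
          · exact h.segment_disjoint he hw hz
          · simp at hwo
          · rw [openSegment_symm] at h3
            exact h.segment_disjoint he hw (hoz h3)
        · rcases mem_segment_cases hw2 with rfl | rfl | h3
          · exact h.segment_disjoint he hw hz
          · simp [orient_right] at hwo
          · exact h.segment_disjoint he hw (hzy h3)
      · have h2 : z ∈ closure (tri τ z o y) := by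
          have hpos' : 0 < τ * orient o y z := by rwa [orient_cycle]
          obtain ⟨m, hm⟩ := openSegment_nonempty o y
          have h3 := openSegment_subset_tri hpos hm
          exact closure_mono h3 (segment_subset_closure_openSegment (left_mem_segment _ _ _))
        obtain ⟨w, hw, hw2⟩ := mem_closure_iff.1 h2 G h.isOpen hz
        exact ⟨w, hw2, hw⟩
    exact h.openSegment_subset_of_tri hpos ht (fun w hw => (hv τ hpos w hw).2) he

theorem PolyInt.sector_visible (h : PolyInt L G) {σ : ℝ} {o a x y z : Plane}
    (hox : 0 < σ * orient o a x) (htx : tri σ o a x ⊆ G) (hz : z ∈ openSegment ℝ a x) (hzG : z ∈ G)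
    (hzy : openSegment ℝ z y ⊆ G) (hy : 0 < σ * orient o a y) (hyx : 0 ≤ σ * orient o y x)
    (hv : ∀ w ∈ L, 0 < σ * orient o a w → σ * orient o w x < 0)
    (hoy : ∀ e ∈ cycEdges L, o ∈ segment ℝ e.1 e.2 → y ∈ segment ℝ e.1 e.2 → False) :
    openSegment ℝ o y ⊆ G := by
  have hoz : openSegment ℝ o z ⊆ G := (openSegment_subset_tri hox hz).trans htx
  obtain ⟨t, ht0, ht1, hzt⟩ := mem_openSegment_iff.1 hz
  have hza : 0 < σ * orient o a z := by
    rw [← hzt, orient_lineMap, orient_right]; nlinarith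
  have hzx : 0 ≤ σ * orient x o z := by
    have : orient x o a = orient o a x := by unfold orient; ring
    rw [← hzt, orient_lineMap, orient_left, this]; nlinarith
  have hyx' : 0 ≤ σ * orient x o y := by
    have : orient x o y = orient o y x := by unfold orient; ring
    rwa [this]
  have hvx : ∀ w ∈ L, 0 < σ * orient o a w → 0 ≤ σ * orient x o w → False := by
    intro w hw h1 h2
    have := hv w hw h1
    have h3 : orient x o w = orient o w x := by unfold orient; ring
    rw [h3] at h2; linarith
  refine h.openSegment_subset_of_chain hzG hoz hzy ?_ ?_ hoy ?_
  · rintro rfl; simp at hy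
  · intro τ hτ w hw
    constructor
    · intro hwt
      refine hvx w hw (orient_pos_of_tri hτ hwt hza.le (by simp) hy) ?_
      have h1 := orient_affine z o y x o w
      obtain ⟨h2, h3, h4⟩ := hwt
      have h5 : (τ * orient z o y) * (σ * orient x o w) = (τ * orient o y w) * (σ * orient x o z) +
        (τ * orient z o w) * (σ * orient x o y) := by
        rw [orient_right] at h1
        linear_combination (τ * σ) * h1
      have h6 : 0 ≤ (τ * orient z o y) * (σ * orient x o w) := by rw [h5]; positivity
      exact nonneg_of_mul_nonneg_right h6 hτ
    · intro hwt
      obtain ⟨s, h0, h1, rfl⟩ := mem_openSegment_iff.1 hwt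
      refine hvx _ hw ?_ ?_
      · rw [orient_lineMap, orient_left]; nlinarith
      · rw [orient_lineMap, orient_right]; nlinarith
  · intro h0
    have hne : o ≠ z := by rintro rfl; simp at hza
    have h1 := eq_lineMap_of_orient hne h0
    set s := scal o z y / scal o z z
    refine .inr ⟨s, ?_, h1.symm⟩
    rw [h1, orient_lineMap, orient_left] at hy
    by_contra! hs
    nlinarith

theorem openSegment_cases {p q m y : Plane} (hm : m ∈ openSegment ℝ p q)
    (hy : y ∈ openSegment ℝ p q) : y ∈ openSegment ℝ p m ∨ y = m ∨ y ∈ openSegment ℝ m q := by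
  obtain ⟨t, h0, h1, rfl⟩ := mem_openSegment_iff.1 hm
  obtain ⟨s, h0', h1', rfl⟩ := mem_openSegment_iff.1 hy
  rcases lt_trichotomy s t with h | h | h
  · refine .inl (mem_openSegment_iff.2 ⟨s / t, by positivity, (div_lt_one h0).2 h, ?_⟩)
    refine plane_ext ?_ ?_ <;> simp only [lineMap_coord] <;> field_simp <;> ring
  · exact .inr (.inl (by rw [h]))
  · have h2 : (0 : ℝ) < 1 - t := by linarith
    refine .inr (.inr (mem_openSegment_iff.2 ⟨(s - t) / (1 - t), div_pos (by linarith) h2,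
      (div_lt_one h2).2 (by linarith), ?_⟩))
    refine plane_ext ?_ ?_ <;> simp only [lineMap_coord] <;> field_simp <;> ring

theorem openSegment_subset_of_mem {p q m : Plane} (hm : m ∈ openSegment ℝ p q) (hmG : m ∈ G)
    (h1 : openSegment ℝ p m ⊆ G) (h2 : openSegment ℝ m q ⊆ G) : openSegment ℝ p q ⊆ G := by
  intro y hy
  rcases openSegment_cases hm hy with h | rfl | h
  exacts [h1 h, hmG, h2 h]

theorem exists_crossing {σ τ : ℝ} {p q a b : Plane} (hp : 0 < σ * orient a b p)
    (hq : σ * orient a b q < 0) (ha : 0 < τ * orient p q a) (hb : τ * orient p q b < 0) :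
    ∃ m ∈ openSegment ℝ p q, m ∈ openSegment ℝ a b := by
  have hD : orient p q a - orient p q b = -(orient a b p - orient a b q) := by
    unfold orient; ring
  have hσ : 0 < σ * (orient a b p - orient a b q) := by linarith
  have hτ : 0 < τ * (orient p q a - orient p q b) := by linarith
  have hσ0 : σ ≠ 0 := by rintro rfl; simp at hσ
  have hτ0 : τ ≠ 0 := by rintro rfl; simp at hτ
  have hD0 : orient a b p - orient a b q ≠ 0 := by rintro h; simp [h] at hσ
  have hE0 : orient p q a - orient p q b ≠ 0 := by rintro h; simp [h] at hτ
  refine ⟨_, mem_openSegment_iff.2 ⟨(σ * orient a b p) / (σ * (orient a b p - orient a b q)),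
    div_pos hp hσ, (div_lt_one hσ).2 (by linarith), rfl⟩,
    mem_openSegment_iff.2 ⟨(τ * orient p q a) / (τ * (orient p q a - orient p q b)),
    div_pos ha hτ, (div_lt_one hτ).2 (by linarith), ?_⟩⟩
  rw [mul_div_mul_left _ _ hσ0, mul_div_mul_left _ _ hτ0]
  rw [hD]
  have hD1 : -(orient a b p - orient a b q) ≠ 0 := neg_ne_zero.2 hD0
  refine plane_ext ?_ ?_ <;> simp only [lineMap_coord]
  · field_simp
    unfold orient; ring
  · field_simp
    unfold orient; ring

/-- The vertex list `L` starts with a vertex at which the chain turns away from the ray from `o`. -/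
def Alpha (σ : ℝ) (o : Plane) (L : List Plane) : Prop :=
  ∀ a c N, L = a :: c :: N → 0 < σ * orient o a c

theorem OPoly.pos_of_alpha {σ : ℝ} {o a c w : Plane} {L' : List Plane}
    (h : OPoly σ (o :: a :: c :: L') G) (hα : Alpha σ o (a :: c :: L'))
    (hw : openSegment ℝ a w ⊆ G ∨ w = c) : 0 < σ * orient o a w := by
  rcases hw with hw | rfl
  · exact h.convex_openSegment (hα _ _ _ rfl) hw
  · exact hα _ _ _ rfl

theorem OPoly.reverse_tail {σ : ℝ} {o : Plane} (h : OPoly σ (o :: L) G) :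
    OPoly (-σ) (o :: L.reverse) G := by
  have h1 := h.reverse
  rw [List.reverse_cons] at h1
  exact h1.rotate

theorem OPoly.exists_visible {σ : ℝ} {o : Plane} (h : OPoly σ (o :: L) G) (hL : 3 ≤ L.length)
    (h1 : Alpha σ o L) (h2 : Alpha (-σ) o L.reverse) :
    ∃ A w B, L = A ++ w :: B ∧ A ≠ [] ∧ B ≠ [] ∧ openSegment ℝ o w ⊆ G := by
  obtain ⟨a, B, y, rfl⟩ := List.exists_cons_concat (l := L) (by omega)
  have hB : B ≠ [] := by rintro rfl; simp at hL
  have hr : OPoly σ (a :: (B ++ [y]) ++ [o]) G := by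
    have := (show OPoly σ ([o] ++ (a :: B ++ [y])) G from h).rotate
    simpa using this
  have key : ∀ w ∈ B, openSegment ℝ o w ⊆ G → ∃ A w B', a :: B ++ [y] = A ++ w :: B' ∧ A ≠ [] ∧
      B' ≠ [] ∧ openSegment ℝ o w ⊆ G := by
    intro w hw hwG
    obtain ⟨X, Y, rfl⟩ := List.append_of_mem hw
    exact ⟨a :: X, w, Y ++ [y], by simp, by simp, by simp, hwG⟩
  have hyo : (y, o) ∈ cycEdges (a :: (B ++ [y]) ++ [o]) := by
    have := mem_cycEdges_mid (a :: B) [] y o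
    simpa using this
  obtain ⟨w, hw, hpos, htri, haw, hwo⟩ := hr.apex
  have hsymm : ∀ p q : Plane, openSegment ℝ p q ⊆ G → openSegment ℝ q p ⊆ G := fun p q hpq => by
    rwa [openSegment_symm]
  by_cases hwy : w = y
  · subst hwy
    obtain ⟨c, B, rfl⟩ := List.exists_cons_of_ne_nil hB
    have hac : openSegment ℝ a w ⊆ G := by
      refine haw.resolve_right fun he => ?_
      have := cycEdges_fst_inj hr.nodup he
        (f := (a, c)) (by simp [cycEdges_cons]) rfl
      have hnd := h.nodup
      simp only [Prod.mk.injEq, true_and] at this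
      subst this
      simp at hnd
    obtain ⟨G1, G2, hG1, -, hsub, -⟩ := OPoly.split (p := a) (q := w) (B := c :: B) (C := [o])
      (by simpa using hr) (by simp) (by simp) hac
    obtain ⟨w', hw', hpos', htri', h3, h4⟩ := hG1.apex
    refine key w' hw' ?_
    have e1 : 0 < σ * orient o a w' := by
      refine OPoly.pos_of_alpha (by simpa using h) h1 (h3.imp (fun h => h.trans hsub) fun he => ?_)
      have := cycEdges_fst_inj hG1.nodup he (f := (a, c)) (by simp [cycEdges_cons]) rfl
      simpa using this
    have e2 : 0 < -σ * orient o w w' := by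
      obtain ⟨N, d, hd⟩ := (List.eq_nil_or_concat (c :: B)).resolve_left (by simp)
      rw [List.concat_eq_append] at hd
      rw [hd] at h h2 hG1 h4
      have hrt := h.reverse_tail
      have hrev : (a :: (N ++ [d]) ++ [w]).reverse = w :: d :: (N.reverse ++ [a]) := by simp
      rw [hrev] at hrt h2
      refine OPoly.pos_of_alpha hrt h2 (h4.imp (fun h => ?_) fun he => ?_)
      · rw [openSegment_symm]; exact h.trans hsub
      · have hdw : (d, w) ∈ cycEdges (a :: (N ++ [d]) ++ [w]) := by
          have := mem_cycEdges_mid (a :: N) [] d w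
          simpa using this
        have := cycEdges_snd_inj hG1.nodup he hdw rfl
        simpa using this
    have q1 : orient o w' a = -orient o a w' := by unfold orient; ring
    have q2 : orient o w' w = -orient o w w' := by unfold orient; ring
    have q3 : orient a w w' = -orient w a w' := by unfold orient; ring
    have q4 : orient a w o = orient o a w := by unfold orient; ring
    obtain ⟨m, hm1, hm2⟩ := exists_crossing (σ := σ) (τ := -σ) (p := o) (q := w') (a := a) (b := w)
      (by rw [q4]; exact hpos) (by rw [q3]; linarith) (by rw [q1]; linarith) (by rw [q2]; linarith)
    have hom : openSegment ℝ o m ⊆ G := (openSegment_subset_tri hpos hm2).trans htri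
    have hmw : openSegment ℝ w' m ⊆ G := by
      have hpw : 0 < σ * orient w' w a := by
        have : orient w' w a = orient w a w' := by unfold orient; ring
        rwa [this]
      have := openSegment_subset_tri hpw (by rwa [openSegment_symm] at hm2 : m ∈ openSegment ℝ w a)
      rw [← tri_cycle] at this
      exact (this.trans htri').trans hsub
    rw [openSegment_symm] at hmw
    exact openSegment_subset_of_mem hm1 (hac (by assumption)) hom hmw
  · refine key w (by simpa [hwy] using hw) (hsymm _ _ (hwo.resolve_right fun he => hwy ?_))
    have := cycEdges_snd_inj hr.nodup he hyo rfl
    simpa using this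

theorem OPoly.orient_pos_of_openSegment {σ : ℝ} (h : OPoly σ L G) {e : Plane × Plane}
    (he : e ∈ cycEdges L) {p x : Plane} (hx : x ∈ openSegment ℝ e.1 e.2)
    (hp : openSegment ℝ p x ⊆ G) : 0 < σ * orient e.1 e.2 p := by
  obtain ⟨r, hr, hb⟩ := h.sides e he x hx
  obtain ⟨w, hw, hwb⟩ := exists_near (v := x) (q := p) hr
  rw [openSegment_symm] at hw
  obtain ⟨t, t0, t1, rfl⟩ := mem_openSegment_iff.1 hw
  have h1 : orient e.1 e.2 (AffineMap.lineMap p x t) = (1 - t) * orient e.1 e.2 p := by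
    rw [orient_lineMap, orient_of_mem_openSegment hx]; ring
  have hx' := orient_of_mem_openSegment hx
  rcases lt_trichotomy (σ * orient e.1 e.2 p) 0 with h2 | h2 | h2
  · exact absurd (hp hw) ((hb _ hwb).2 (by rw [h1]; nlinarith))
  · exfalso
    have hσ : σ ≠ 0 := by rcases h.sign with h | h <;> rw [h] <;> norm_num
    have h3 : orient e.1 e.2 p = 0 := (mul_eq_zero.1 h2).resolve_left hσ
    -- points of the segment near `x` lie on the edge
    have hne := h.ne he
    have hc : Continuous fun s : ℝ => (AffineMap.lineMap p x s : Plane) :=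
      AffineMap.lineMap_continuous
    have h0 : 0 < scal e.1 e.2 x ∧ scal e.1 e.2 x < scal e.1 e.2 e.2 := by
      obtain ⟨s, s0, s1, rfl⟩ := mem_openSegment_iff.1 hx
      have := scal_self_pos hne
      have h4 : scal e.1 e.2 (AffineMap.lineMap e.1 e.2 s) = s * scal e.1 e.2 e.2 := by
        unfold scal; simp only [lineMap_coord]; ring
      rw [h4]
      exact ⟨by positivity, by nlinarith⟩
    have hopen : IsOpen {z : Plane | 0 < scal e.1 e.2 z ∧ scal e.1 e.2 z < scal e.1 e.2 e.2} :=
      (isOpen_lt continuous_const (continuous_scal _ _)).inter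
        (isOpen_lt (continuous_scal _ _) continuous_const)
    obtain ⟨ρ, hρ, hρb⟩ := Metric.isOpen_iff.1 hopen x h0
    obtain ⟨w, hw, hwb⟩ := exists_near (v := x) (q := p) hρ
    rw [openSegment_symm] at hw
    refine h.segment_disjoint he ?_ (hp hw)
    refine openSegment_subset_segment _ _ _
      (mem_openSegment_of_orient hne ?_ (hρb hwb).1 (hρb hwb).2)
    obtain ⟨t, t0, t1, rfl⟩ := mem_openSegment_iff.1 hw
    rw [orient_lineMap, h3, hx']; ring
  · exact h2

/-- Points seen through a door and lying beyond the line of its pivot are seen from `o`. -/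
theorem PolyInt.visible_of_door (h : PolyInt L G) {σ : ℝ} {o a x y z : Plane}
    (hox : 0 < σ * orient o a x) (htx : tri σ o a x ⊆ G) (hx : x ∉ G) (hz : z ∈ openSegment ℝ a x)
    (hzG : z ∈ G) (hzy : openSegment ℝ z y ⊆ G) (hy : 0 < σ * orient o a y)
    (hya : 0 < σ * orient x a y)
    (hv : ∀ w ∈ L, 0 < σ * orient o a w → σ * orient o w x < 0)
    (hoy : ∀ e ∈ cycEdges L, o ∈ segment ℝ e.1 e.2 → y ∈ segment ℝ e.1 e.2 → False) :
    openSegment ℝ o y ⊆ G := by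
  by_cases hyx : 0 ≤ σ * orient o y x
  · exact h.sector_visible hox htx hz hzG hzy hy hyx hv hoy
  exfalso
  push Not at hyx
  obtain ⟨s, s0, s1, hs⟩ := mem_openSegment_iff.1 hz
  have hzx : 0 < σ * orient x o z := by
    have : orient x o a = orient o a x := by unfold orient; ring
    rw [← hs, orient_lineMap, orient_left, this]; nlinarith
  have hyx' : σ * orient x o y < 0 := by
    have : orient x o y = orient o y x := by unfold orient; ring
    rwa [this]
  have hza : 0 < σ * orient o a z := by
    rw [← hs, orient_lineMap, orient_right]; nlinarith
  set t := (σ * orient x o z) / (σ * orient x o z - σ * orient x o y) with ht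
  have hD : 0 < σ * orient x o z - σ * orient x o y := by linarith
  have t0 : 0 < t := div_pos hzx hD
  have t1 : t < 1 := (div_lt_one hD).2 (by linarith)
  have hm : (AffineMap.lineMap z y t : Plane) ∈ openSegment ℝ z y :=
    mem_openSegment_iff.2 ⟨t, t0, t1, rfl⟩
  have hmy : 0 < σ * orient o a (AffineMap.lineMap z y t) := by
    rw [orient_lineMap]; nlinarith
  have hσ0 : σ ≠ 0 := by rintro rfl; simp at hox
  have hm0 : orient x o (AffineMap.lineMap z y t) = 0 := by
    have : σ * orient x o (AffineMap.lineMap z y t) = 0 := by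
      have htD := div_mul_cancel₀ (σ * orient x o z) hD.ne'
      rw [← ht] at htD
      rw [orient_lineMap]; linear_combination -htD
    exact (mul_eq_zero.1 this).resolve_left hσ0
  have hma : 0 < σ * orient x a (AffineMap.lineMap z y t) := by
    have : orient x a z = 0 := by
      rw [← hs, orient_lineMap, orient_right]
      simp [orient]
    rw [orient_lineMap, this]; nlinarith
  set m : Plane := AffineMap.lineMap z y t
  have hsub : openSegment ℝ z m ⊆ openSegment ℝ z y := by
    intro w hw
    obtain ⟨r, r0, r1, rfl⟩ := mem_openSegment_iff.1 hw
    refine mem_openSegment_iff.2 ⟨r * t, by positivity, by nlinarith, ?_⟩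
    refine plane_ext ?_ ?_ <;> simp only [m, lineMap_coord] <;> ring
  have hvis := h.sector_visible hox htx hz hzG (hsub.trans hzy) hmy
    (by have : orient o m x = orient x o m := by unfold orient; ring
        rw [this, hm0]; simp) hv
    (fun e he _ h2 => h.segment_disjoint he h2 (hzy hm))
  have hxo : o ≠ x := by rintro rfl; simp at hox
  have hml := eq_lineMap_of_orient hxo (by
    have : orient o x m = -orient x o m := by unfold orient; ring
    rw [this, hm0, neg_zero])
  set l := scal o x m / scal o x x
  have hxa : orient x a o = -orient o a x := by unfold orient; ring
  rw [hml, orient_lineMap, orient_left, hxa] at hma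
  have hl : 1 < l := by nlinarith
  refine hx (hvis ?_)
  rw [hml]
  exact mem_openSegment_of_lineMap hl

/-- The points in the relative interiors of the segments of a polygonal path. -/
def openPath (L : List Plane) : Set Plane := {y | ∃ e ∈ pathEdges L, y ∈ openSegment ℝ e.1 e.2}

theorem openPath_append (A : List Plane) (x : Plane) (B : List Plane) :
    openPath (A ++ x :: B) = openPath (A ++ [x]) ∪ openPath (x :: B) := by
  ext y
  simp only [openPath, mem_union, mem_ofPred_eq, pathEdges_append A x B, List.mem_append, or_and_right,
    exists_or]

theorem openPath_reverse (L : List Plane) : openPath L.reverse = openPath L := by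
  ext y
  constructor
  · rintro ⟨e, he, hy⟩
    exact ⟨e.swap, mem_pathEdges_reverse.1 he, by rwa [openSegment_symm]⟩
  · rintro ⟨e, he, hy⟩
    exact ⟨e.swap, mem_pathEdges_reverse.2 (by simpa using he), by rwa [openSegment_symm]⟩

theorem openPath_pair (u v : Plane) : openPath [u, v] = openSegment ℝ u v := by
  ext y; simp [openPath]

theorem openPath_cons_cons (u v : Plane) (B : List Plane) :
    openPath (u :: v :: B) = openSegment ℝ u v ∪ openPath (v :: B) := by
  rw [← openPath_pair]; exact openPath_append [u] v B

theorem openPath_insert {A B : List Plane} {u v x : Plane} (hx : x ∈ openSegment ℝ u v) :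
    openPath (A ++ u :: v :: B) = openPath (A ++ [u] ++ [x]) ∪ {x} ∪ openPath (x :: v :: B) := by
  have h : openSegment ℝ u v = openSegment ℝ u x ∪ {x} ∪ openSegment ℝ x v := by
    ext y
    constructor
    · intro hy
      rcases openSegment_cases hx hy with h | h | h
      exacts [.inl (.inl h), .inl (.inr h), .inr h]
    · have hint : ∀ p ∈ segment ℝ u v, openSegment ℝ p x ⊆ openSegment ℝ u v := by
        intro p hp w hw
        obtain ⟨s, s0, s1, rfl⟩ := mem_openSegment_iff.1 hx
        obtain ⟨t, t0, t1, rfl⟩ := mem_segment_iff.1 hp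
        obtain ⟨r, r0, r1, rfl⟩ := mem_openSegment_iff.1 hw
        refine mem_openSegment_iff.2 ⟨(1 - r) * t + r * s, ?_, ?_, ?_⟩
        · have := mul_pos r0 s0
          have := mul_nonneg (sub_nonneg.2 r1.le) t0
          linarith
        · nlinarith
        · refine plane_ext ?_ ?_ <;> simp only [lineMap_coord] <;> ring
      rintro ((hy | rfl) | hy)
      · exact hint u (left_mem_segment _ _ _) hy
      · exact hx
      · rw [openSegment_symm] at hy
        exact hint v (right_mem_segment _ _ _) hy
  rw [openPath_append A u, openPath_cons_cons u v, h, openPath_cons_cons x v,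
    List.append_assoc, List.singleton_append, openPath_append A u [x], openPath_pair]
  ext y; simp only [mem_union]; tauto

/-- A region `H` with boundary `a, M, b` cut off by the segment `ab`. -/
structure Pkt where
  ε : ℝ
  a : Plane
  M : List Plane
  b : Plane
  H : Set Plane

/-- The boundary of the region without the cutting segment. -/
def Pkt.path (U : Pkt) : Set Plane := openPath (U.a :: U.M ++ [U.b])

/-- `U` is a pocket of `G` not seen from `o`, with free boundary contained in `C`. -/
structure PktOf (o : Plane) (C G : Set Plane) (U : Pkt) : Prop where
  poly : OPoly U.ε (U.a :: U.M ++ [U.b]) U.H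
  sub : U.H ⊆ G
  path : U.path ⊆ C
  mem : U.b ∈ C
  vis : openSegment ℝ o U.b ⊆ G
  door : openSegment ℝ U.a U.b ⊆ G
  ac : Alpha U.ε U.b (U.a :: U.M)
  pos : 0 < U.ε * orient o U.a U.b
  ll : ∀ y ∈ U.H ∪ U.path, ∀ z ∈ openSegment ℝ U.a U.b, openSegment ℝ z y ⊆ U.H →
    openSegment ℝ o y ⊆ G ∨ U.ε * orient o U.a y ≤ 0

theorem PktOf.mono {o : Plane} {C C' G' : Set Plane} {U : Pkt} (h : PktOf o C G U) (hC : C ⊆ C')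
    (hG : G ⊆ G') : PktOf o C' G' U where
  poly := h.poly
  sub := h.sub.trans hG
  path := h.path.trans hC
  mem := hC h.mem
  vis := h.vis.trans hG
  door := h.door.trans hG
  ac := h.ac
  pos := h.pos
  ll y hy z hz hzy := (h.ll y hy z hz hzy).imp (fun h => h.trans hG) id

theorem PolyInt.eq_of_mem_segment (h : PolyInt L G) {p y : Plane} {e f : Plane × Plane} (hp : p ∈ L)
    (he : e ∈ cycEdges L) (hf : f ∈ cycEdges L) (hy : y ∈ openSegment ℝ e.1 e.2)
    (hpf : p ∈ segment ℝ f.1 f.2) (hyf : y ∈ segment ℝ f.1 f.2) : p = e.1 ∨ p = e.2 := by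
  by_cases hef : e = f
  · subst hef; exact h.vertex_endpoint hp he hpf
  · have h1 := (h.graph.2 e he f hf hef y (openSegment_subset_segment _ _ _ hy) hyf).1
    have h2 := ne_of_mem_openSegment (h.ne he) hy
    tauto

theorem PolyInt.disjoint_openSegment (h : PolyInt L G) {p q : Plane}
    (hd : ∀ e ∈ cycEdges L, p ∉ segment ℝ e.1 e.2 ∧
      Disjoint (openSegment ℝ p q) (segment ℝ e.1 e.2)) (hp : p ∉ G) :
    Disjoint (openSegment ℝ p q) G := by
  have hf : Disjoint (openSegment ℝ p q) (frontier G) := by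
    refine disjoint_left.2 fun w hw hwf => ?_
    obtain ⟨e, he, hwe⟩ := mem_edgeUnion.1 (h.front hwf)
    exact disjoint_left.1 (hd e he).2 hw hwe
  refine ((convex_openSegment p q).isPreconnected.subset_or_disjoint_of_frontier hf).resolve_left
    fun hs => ?_
  have h1 : p ∈ closure G :=
    closure_mono hs (segment_subset_closure_openSegment (left_mem_segment _ _ _))
  have h2 : p ∈ frontier G := by rw [h.isOpen.frontier_eq]; exact ⟨h1, hp⟩
  obtain ⟨e, he, hwe⟩ := mem_edgeUnion.1 (h.front h2)
  exact (hd e he).1 hwe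

theorem openSegment_subset_tri_of_mem {σ : ℝ} {p q r x : Plane} (hx : x ∈ tri σ p q r) :
    openSegment ℝ p x ⊆ tri σ p q r := by
  intro y hy
  obtain ⟨t, t0, t1, rfl⟩ := mem_openSegment_iff.1 hy
  obtain ⟨h1, h2, h3⟩ := hx
  have h4 := orient_sum p q r x
  have h5 : orient q r p = orient p q r := by unfold orient; ring
  refine ⟨?_, ?_, ?_⟩
  · rw [orient_lineMap]; simp only [orient_left]; nlinarith
  · rw [orient_lineMap, h5, ← h4]; nlinarith
  · rw [orient_lineMap]; simp only [orient_right]; nlinarith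

theorem OPoly.chop_pocket {σ : ℝ} {o a c : Plane} {L' : List Plane}
    (h : OPoly σ (o :: a :: c :: L') G) (hβ : σ * orient o a c ≤ 0) :
    ∃ A u v B x H R, a :: c :: L' = a :: A ++ u :: v :: B ∧ x ∈ openSegment ℝ u v ∧
      PktOf o (openPath (a :: c :: L')) G ⟨σ, a, A ++ [u], x, H⟩ ∧ OPoly σ (o :: x :: v :: B) R ∧
      R ⊆ G ∧ Disjoint H R ∧ 0 < σ * orient o x v ∧
      ∀ y ∈ G, y ∈ H ∨ y ∈ R ∨ openSegment ℝ o y ⊆ G := by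
  obtain ⟨A, u, v, B, x, hL, hx, hox, hax, htri, hpos, hac, hnv⟩ := h.chop hβ
  have hL' : a :: c :: L' = a :: A ++ u :: v :: B := by rw [hL]; simp
  have h0 : OPoly σ ((o :: a :: A) ++ u :: v :: B) G := by rw [hL'] at h; simpa using h
  have h1 : OPoly σ (o :: (a :: A ++ [u]) ++ x :: (v :: B)) G := by simpa using h0.insert_vertex hx
  have huv : (u, v) ∈ cycEdges (o :: a :: c :: L') := by
    rw [hL']; exact mem_cycEdges_mid (o :: a :: A) B u v
  have hxG : x ∉ G := h.segment_disjoint huv (openSegment_subset_segment _ _ _ hx)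
  obtain ⟨G1, R, hG1, hR, hG1s, hRs, hdis, hcov, -, -⟩ := h1.split (by simp) (by simp) hox
  have hnd := h1.nodup
  have hd : Disjoint (openSegment ℝ a x) R := by
    refine hR.toPolyInt.disjoint_openSegment (fun e he => ?_)
      fun ha => h.vertex_notMem (v := a) (by simp) (hRs ha)
    rw [cycEdges_concat, List.mem_append, List.mem_singleton] at he
    rcases he with he | rfl
    · have he' : e ∈ cycEdges (o :: (a :: A ++ [u]) ++ x :: (v :: B)) := by
        rw [cycEdges_split]; exact List.mem_append_right _ he
      refine ⟨fun ha => ?_, disjoint_left.2 fun w hw hwe => h1.segment_disjoint he' hwe (hax hw)⟩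
      have h2 : a ∈ x :: (v :: B) ++ [o] := by
        rcases h1.vertex_endpoint (by simp) he' ha with h2 | h2
        · rw [h2]; exact fst_mem_of_mem_pathEdges he
        · rw [h2]; exact snd_mem_of_mem_pathEdges he
      simp at hnd h2
      grind
    · have key : ∀ t : ℝ, t < 1 → 0 < σ * orient o x (AffineMap.lineMap a x t) * (-1) := by
        intro t ht
        have : orient o x a = -orient o a x := by unfold orient; ring
        rw [orient_lineMap, orient_right, this]; nlinarith
      refine ⟨fun ha => ?_, disjoint_left.2 fun w hw hwe => ?_⟩
      · have := key 0 (by norm_num)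
        simp [orient_of_mem_segment ha] at this
      · obtain ⟨t, t0, t1, rfl⟩ := mem_openSegment_iff.1 hw
        have := key t t1
        simp [orient_of_mem_segment hwe] at this
  have hax1 : openSegment ℝ a x ⊆ G1 := by
    intro y hy
    rcases hcov y (hax hy) with h2 | h2 | h2
    · exact h2
    · exact absurd h2 (disjoint_left.1 hd hy)
    · obtain ⟨t, t0, t1, rfl⟩ := mem_openSegment_iff.1 hy
      have h3 := orient_of_mem_openSegment h2
      have : orient o x a = -orient o a x := by unfold orient; ring
      rw [orient_lineMap, orient_right, this] at h3
      have h4 : (1 - t) * orient o a x = 0 := by linarith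
      rcases mul_eq_zero.1 h4 with h4 | h4
      · linarith
      · rw [h4] at hpos; simp at hpos
  have hG1' : OPoly σ (a :: (A ++ [u]) ++ x :: [o]) G1 := by
    have : OPoly σ ([o] ++ (a :: (A ++ [u]) ++ [x])) G1 := by simpa using hG1
    simpa using this.rotate
  obtain ⟨H, T, hH, hT, hHs, hTs, -, hcov', -, -⟩ := hG1'.split (by simp) (by simp) hax1
  obtain ⟨-, hTt⟩ := PolyInt.triangle (p := x) (q := o) (r := a) hT.toPolyInt hT.sign
    (hT.sides _ (by simp [cycEdges_cons]))
  have hpath := openPath_insert (A := a :: A) (B := B) hx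
  have hpsub : openPath (a :: (A ++ [u]) ++ [x]) ⊆ openPath (a :: c :: L') := by
    rw [hL', hpath]; intro y hy; exact .inl (.inl (by simpa using hy))
  refine ⟨A, u, v, B, x, H, R, hL', hx, ⟨hH, hHs.trans hG1s, hpsub, ?_, hox, hax, ?_, hpos, ?_⟩, ?_,
    hRs, hdis.mono_left hHs, ?_, ?_⟩
  · rw [hL', hpath]; exact .inl (.inr rfl)
  · intro a' c' N he
    simp only [List.cons.injEq] at he
    obtain ⟨rfl, he⟩ := he
    obtain rfl : c = c' := by
      cases A with
      | nil => simp at he hL; rw [hL.1, he.1]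
      | cons d A => simp at he hL; rw [hL.1, he.1]
    exact hac
  · intro y hy z hz hzy
    by_cases hya : 0 < σ * orient o a y
    swap
    · exact .inr (not_lt.1 hya)
    refine .inl (h.visible_of_door hpos htri hxG hz (hax hz) (hzy.trans (hHs.trans hG1s)) hya ?_ hnv ?_)
    · refine hH.orient_pos_of_openSegment (e := (x, a)) (mem_cycEdges_last _ _ _) (x := z) ?_ ?_
      · rwa [openSegment_symm]
      · rwa [openSegment_symm]
    · intro e he hoe hye
      rcases hy with hy | hy
      · exact h.segment_disjoint he hye (hG1s (hHs hy))
      · obtain ⟨f, hf, hyf⟩ := hpsub hy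
        have hfL : f ∈ cycEdges (o :: a :: c :: L') :=
          pathEdges_subset_cycEdges (by rw [pathEdges_cons_cons]; exact List.mem_cons_of_mem _ hf)
        have hnd := h.nodup
        rw [List.nodup_cons] at hnd
        rcases h.eq_of_mem_segment (p := o) (by simp) hfL he hyf hoe hye with h2 | h2
        · exact hnd.1 (by rw [h2]; exact fst_mem_of_mem_pathEdges hf)
        · exact hnd.1 (by rw [h2]; exact snd_mem_of_mem_pathEdges hf)
  · have := (show OPoly σ ((x :: v :: B) ++ [o]) R from hR).rotate
    simpa using this
  · have h2 := h.orient_pos_of_openSegment huv hx hox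
    obtain ⟨t, t0, t1, rfl⟩ := mem_openSegment_iff.1 hx
    have : orient o (AffineMap.lineMap u v t) v = (1 - t) * orient u v o := by
      unfold orient; simp only [lineMap_coord]; ring
    rw [this]
    simp only at h2
    nlinarith
  · intro y hy
    rcases hcov y hy with h2 | h2 | h2
    · rcases hcov' y h2 with h3 | h3 | h3
      · exact .inl h3
      · rw [hTt, ← tri_cycle, ← tri_cycle] at h3
        have h4 : tri σ o a x ⊆ G := htri
        refine .inr (.inr ((openSegment_subset_tri_of_mem (q := a) (r := x) ?_).trans htri))
        simpa only [tri_cycle] using h3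
      · exact .inr (.inr ((openSegment_subset_tri hpos h3).trans htri))
    · exact .inr (.inl h2)
    · refine .inr (.inr ?_)
      obtain ⟨t, t0, t1, rfl⟩ := mem_openSegment_iff.1 h2
      refine subset_trans ?_ hox
      intro w hw
      obtain ⟨s, s0, s1, rfl⟩ := mem_openSegment_iff.1 hw
      refine mem_openSegment_iff.2 ⟨s * t, by positivity, by nlinarith, ?_⟩
      refine plane_ext ?_ ?_ <;> simp only [lineMap_coord] <;> ring

theorem openSegment_subset_left {p q m : Plane} (hm : m ∈ openSegment ℝ p q) :
    openSegment ℝ p m ⊆ openSegment ℝ p q := by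
  obtain ⟨t, t0, t1, rfl⟩ := mem_openSegment_iff.1 hm
  intro w hw
  obtain ⟨s, s0, s1, rfl⟩ := mem_openSegment_iff.1 hw
  refine mem_openSegment_iff.2 ⟨s * t, by positivity, by nlinarith, ?_⟩
  refine plane_ext ?_ ?_ <;> simp only [lineMap_coord] <;> ring

/-- Every point of `G` and of `C` is seen from `o` or belongs to one of the pockets `𝒰`. -/
structure Out (o : Plane) (C G : Set Plane) (𝒰 : List Pkt) : Prop where
  pkt : ∀ U ∈ 𝒰, PktOf o C G U
  inner : ∀ y ∈ G, openSegment ℝ o y ⊆ G ∨ ∃ U ∈ 𝒰, y ∈ U.H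
  outer : ∀ y ∈ C, openSegment ℝ o y ⊆ G ∨ ∃ U ∈ 𝒰, y ∈ U.path

/-- The number of hidden vertices in a list of pockets. -/
def wt (𝒰 : List Pkt) : ℕ := (𝒰.map fun U => U.M.length).sum

@[simp] theorem wt_nil : wt [] = 0 := rfl
@[simp] theorem wt_cons (U : Pkt) (𝒰 : List Pkt) : wt (U :: 𝒰) = U.M.length + wt 𝒰 := rfl
@[simp] theorem wt_append (𝒰 𝒱 : List Pkt) : wt (𝒰 ++ 𝒱) = wt 𝒰 + wt 𝒱 := by simp [wt]

theorem Out.append {o : Plane} {C C₁ C₂ G₁ G₂ : Set Plane} {𝒰 𝒱 : List Pkt} (h₁ : Out o C₁ G₁ 𝒰)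
    (h₂ : Out o C₂ G₂ 𝒱) (hG₁ : G₁ ⊆ G) (hG₂ : G₂ ⊆ G)
    (hG : ∀ y ∈ G, y ∈ G₁ ∨ y ∈ G₂ ∨ openSegment ℝ o y ⊆ G) (hC : C = C₁ ∪ C₂) :
    Out o C G (𝒰 ++ 𝒱) := by
  subst hC
  refine ⟨fun U hU => ?_, fun y hy => ?_, fun y hy => ?_⟩
  · rcases List.mem_append.1 hU with h | h
    · exact (h₁.pkt U h).mono subset_union_left hG₁
    · exact (h₂.pkt U h).mono subset_union_right hG₂
  · rcases hG y hy with h | h | h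
    · rcases h₁.inner y h with h | ⟨U, hU, h⟩
      exacts [.inl (h.trans hG₁), .inr ⟨U, List.mem_append_left _ hU, h⟩]
    · rcases h₂.inner y h with h | ⟨U, hU, h⟩
      exacts [.inl (h.trans hG₂), .inr ⟨U, List.mem_append_right _ hU, h⟩]
    · exact .inl h
  · rcases hy with h | h
    · rcases h₁.outer y h with h | ⟨U, hU, h⟩
      exacts [.inl (h.trans hG₁), .inr ⟨U, List.mem_append_left _ hU, h⟩]
    · rcases h₂.outer y h with h | ⟨U, hU, h⟩
      exacts [.inl (h.trans hG₂), .inr ⟨U, List.mem_append_right _ hU, h⟩]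

theorem OPoly.chop_out {σ : ℝ} {o : Plane} (h : OPoly σ (o :: L) G) (hα : ¬ Alpha σ o L) :
    ∃ a A u v B x H R, L = a :: A ++ u :: v :: B ∧ x ∈ openSegment ℝ u v ∧
      OPoly σ (o :: x :: v :: B) R ∧ R ⊆ G ∧ Disjoint H R ∧ Alpha σ o (x :: v :: B) ∧ u ≠ v ∧
      ∀ 𝒰, Out o (openPath (x :: v :: B)) R 𝒰 →
        Out o (openPath L) G (⟨σ, a, A ++ [u], x, H⟩ :: 𝒰) := by
  simp only [Alpha, not_forall, not_lt] at hα
  obtain ⟨a, c, L', rfl, hβ⟩ := hα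
  obtain ⟨A, u, v, B, x, H, R, hL, hx, hP, hR, hRs, hd, hxv, hcov⟩ := h.chop_pocket hβ
  refine ⟨a, A, u, v, B, x, H, R, hL, hx, hR, hRs, hd, ?_, ?_, fun 𝒰 hU => ?_⟩
  · intro a' c' N he
    simp only [List.cons.injEq] at he
    rw [← he.1, ← he.2.1]; exact hxv
  · rw [hL] at h
    exact h.ne (mem_cycEdges_mid (o :: a :: A) B u v)
  · have hpath := openPath_insert (A := a :: A) (B := B) hx
    rw [← hL] at hpath
    refine ⟨fun U hU' => ?_, fun y hy => ?_, fun y hy => ?_⟩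
    · rcases List.mem_cons.1 hU' with rfl | h'
      · exact hP
      · exact (hU.pkt U h').mono (by rw [hpath]; exact subset_union_right) hRs
    · rcases hcov y hy with h' | h' | h'
      · exact .inr ⟨_, List.mem_cons_self, h'⟩
      · rcases hU.inner y h' with h' | ⟨V, hV, h'⟩
        exacts [.inl (h'.trans hRs), .inr ⟨V, List.mem_cons_of_mem _ hV, h'⟩]
      · exact .inl h'
    · rw [hpath] at hy
      rcases hy with (hy | rfl) | hy
      · exact .inr ⟨_, List.mem_cons_self, by simpa [Pkt.path] using hy⟩
      · exact .inl hP.vis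
      · rcases hU.outer y hy with h' | ⟨V, hV, h'⟩
        exacts [.inl (h'.trans hRs), .inr ⟨V, List.mem_cons_of_mem _ hV, h'⟩]

theorem OPoly.split_out {σ : ℝ} {o w : Plane} {A B : List Plane} (h : OPoly σ (o :: (A ++ w :: B)) G)
    (hA : A ≠ []) (hB : B ≠ []) (hw : openSegment ℝ o w ⊆ G) :
    ∃ G₁ G₂, OPoly σ (o :: (A ++ [w])) G₁ ∧ OPoly σ (o :: w :: B) G₂ ∧ G₁ ⊆ G ∧ G₂ ⊆ G ∧
      Disjoint G₁ G₂ ∧ (∀ y ∈ G, y ∈ G₁ ∨ y ∈ G₂ ∨ y ∈ openSegment ℝ o w) ∧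
      ∀ 𝒰 𝒱, Out o (openPath (A ++ [w])) G₁ 𝒰 → Out o (openPath (w :: B)) G₂ 𝒱 →
        Out o (openPath (A ++ w :: B)) G (𝒰 ++ 𝒱) := by
  obtain ⟨G₁, G₂, h1, h2, hs1, hs2, hd, hcov, -, -⟩ := OPoly.split (p := o) (q := w) h hA hB hw
  refine ⟨G₁, G₂, h1, ?_, hs1, hs2, hd, hcov, fun 𝒰 𝒱 hU hV => ?_⟩
  · exact (show OPoly σ ((w :: B) ++ [o]) G₂ from h2).rotate
  · refine hU.append hV hs1 hs2 (fun y hy => ?_) (openPath_append A w B)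
    exact (hcov y hy).imp_right (Or.imp_right fun h => (openSegment_subset_left h).trans hw)

theorem OPoly.triangle_out {σ : ℝ} {o : Plane} (h : OPoly σ (o :: L) G) (hL : L.length = 2) :
    Out o (openPath L) G [] := by
  obtain ⟨a, y, rfl⟩ := List.length_eq_two.1 hL
  obtain ⟨hpos, rfl⟩ := h.toPolyInt.triangle h.sign (h.sides _ (by simp [cycEdges_cons]))
  refine ⟨by simp, fun y hy => .inl (openSegment_subset_tri_of_mem hy), fun y hy => .inl ?_⟩
  rw [openPath_pair] at hy
  exact openSegment_subset_tri hpos hy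

theorem OPoly.exists_out {σ : ℝ} {o : Plane} (h : OPoly σ (o :: L) G) (hL : 2 ≤ L.length) :
    ∃ 𝒰, Out o (openPath L) G 𝒰 ∧ wt 𝒰 + 2 ≤ L.length := by
  induction hn : L.length using Nat.strong_induction_on generalizing σ L G with
  | _ n ih =>
  subst hn
  have chop : ∀ {τ L'}, L'.length = L.length → OPoly τ (o :: L') G → ¬ Alpha τ o L' →
      ∃ 𝒰, Out o (openPath L') G 𝒰 ∧ wt 𝒰 + 2 ≤ L.length := by
    intro τ L' hlen h' hα
    obtain ⟨a, A, u, v, B, x, H, R, rfl, hx, hR, -, -, -, -, hout⟩ := h'.chop_out hα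
    simp at hlen
    obtain ⟨𝒰, hU, hw⟩ := ih _ (by simp; omega) hR (by simp) rfl
    refine ⟨_, hout 𝒰 hU, ?_⟩
    simp at hw ⊢; omega
  by_cases h1 : Alpha σ o L
  swap
  · exact chop rfl h h1
  by_cases h2 : Alpha (-σ) o L.reverse
  swap
  · simpa [openPath_reverse] using chop (by simp) h.reverse_tail h2
  rcases hL.eq_or_lt with h3 | h3
  · exact ⟨[], h.triangle_out h3.symm, by simp [← h3]⟩
  obtain ⟨A, w, B, rfl, hA, hB, hw⟩ := h.exists_visible h3 h1 h2
  obtain ⟨G₁, G₂, hG₁, hG₂, -, -, -, -, hout⟩ := h.split_out hA hB hw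
  have := List.length_pos_iff.2 hA
  have := List.length_pos_iff.2 hB
  obtain ⟨𝒰, hU, hw1⟩ := ih _ (by simp; omega) hG₁ (by simp; omega) rfl
  obtain ⟨𝒱, hV, hw2⟩ := ih _ (by simp; omega) hG₂ (by simp; omega) rfl
  refine ⟨_, hout 𝒰 𝒱 hU hV, ?_⟩
  simp at hw1 hw2 ⊢; omega

theorem OPoly.exists_out_of_alpha_alpha {σ : ℝ} {o : Plane} (h : OPoly σ (o :: L) G)
    (hL : 3 ≤ L.length) (h1 : Alpha σ o L) (h2 : Alpha (-σ) o L.reverse) :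
    ∃ 𝒰, Out o (openPath L) G 𝒰 ∧ wt 𝒰 + 3 ≤ L.length := by
  obtain ⟨A, w, B, rfl, hA, hB, hw⟩ := h.exists_visible hL h1 h2
  obtain ⟨G₁, G₂, hG₁, hG₂, -, -, -, -, hout⟩ := h.split_out hA hB hw
  have := List.length_pos_iff.2 hA
  have := List.length_pos_iff.2 hB
  obtain ⟨𝒰, hU, hw1⟩ := hG₁.exists_out (by simp; omega)
  obtain ⟨𝒱, hV, hw2⟩ := hG₂.exists_out (by simp; omega)
  refine ⟨_, hout 𝒰 𝒱 hU hV, ?_⟩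
  simp at hw1 hw2 ⊢; omega

theorem OPoly.exists_out_of_alpha {σ : ℝ} {o : Plane} (h : OPoly σ (o :: L) G)
    (hL : 2 ≤ L.length) (h1 : Alpha σ o L) :
    (∃ 𝒰, Out o (openPath L) G 𝒰 ∧ wt 𝒰 + 3 ≤ L.length) ∨ (L.length = 2 ∧ Out o (openPath L) G []) ∨
    ∃ U A u v N, Out o (openPath L) G [U] ∧ U.M.length + 2 = L.length ∧ U.ε = -σ ∧
      L.getLast? = some U.a ∧ L = v :: u :: N ∧ U.M = A ++ [u] ∧ U.b ∈ openSegment ℝ u v := by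
  by_cases h2 : Alpha (-σ) o L.reverse
  · rcases hL.eq_or_lt with h3 | h3
    · exact .inr (.inl ⟨h3.symm, h.triangle_out h3.symm⟩)
    · exact .inl (h.exists_out_of_alpha_alpha h3 h1 h2)
  obtain ⟨y, A, u, v, B, x, H, R, hLr, hx, hR, -, -, hα, -, hout⟩ := h.reverse_tail.chop_out h2
  rw [openPath_reverse] at hout
  have hL' : L = B.reverse ++ v :: u :: A.reverse ++ [y] := by
    rw [← List.reverse_reverse L, hLr]; simp
  rcases B with _ | ⟨b, B⟩
  · refine .inr (.inr ⟨_, A, u, v, A.reverse ++ [y], hout [] (hR.triangle_out rfl), ?_, rfl, ?_, ?_,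
      rfl, hx⟩)
    · simp [hL']
    · rw [hL', List.getLast?_concat]
    · rw [hL']; simp
  · obtain ⟨𝒰, hU, hw⟩ := hR.exists_out_of_alpha_alpha (by simp) hα (by
      rw [neg_neg]
      obtain ⟨d, D, hd⟩ := List.exists_cons_of_ne_nil (l := (b :: B).reverse) (by simp)
      intro a' c' N he
      have he' : (x :: v :: b :: B).reverse = (b :: B).reverse ++ [v, x] := by simp
      rw [he', hd] at he
      rw [hd] at hL'
      rcases D with _ | ⟨e, D⟩
      · simp at he hL'
        rw [← he.1, ← he.2.1]
        exact h1 _ _ _ hL'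
      · simp at he hL'
        rw [← he.1, ← he.2.1]
        exact h1 _ _ _ hL')
    refine .inl ⟨_, hout 𝒰 hU, ?_⟩
    have := congrArg List.length hL'
    simp at hw this ⊢; omega

/-- Two pockets of opposite sense reaching the same edge `uv`. -/
def EShape (𝒰 : List Pkt) : Prop := ∃ U V A B u v, 𝒰 = [U, V] ∧ U.M = A ++ [u] ∧ V.M = B ++ [v] ∧
  u ≠ v ∧ U.b ∈ openSegment ℝ u v ∧ V.b ∈ openSegment ℝ v U.b ∧ V.ε = -U.ε ∧ Disjoint U.H V.H

theorem OPoly.exists_out_tight {σ : ℝ} {o : Plane} (h : OPoly σ (o :: L) G) (hL : 2 ≤ L.length) :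
    (∃ 𝒰, Out o (openPath L) G 𝒰 ∧ wt 𝒰 + 3 ≤ L.length) ∨
    ∃ 𝒰, Out o (openPath L) G 𝒰 ∧ wt 𝒰 + 2 ≤ L.length ∧ (𝒰 = [] ∨
      (∃ U, 𝒰 = [U] ∧ (U.ε = σ ∧ L.head? = some U.a ∨ U.ε = -σ ∧ L.getLast? = some U.a)) ∨
      EShape 𝒰) := by
  by_cases h1 : Alpha σ o L
  · rcases h.exists_out_of_alpha hL h1 with h2 | ⟨h2, h3⟩ | ⟨U, A, u, v, N, h2, h3, h4, h5, -⟩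
    · exact .inl h2
    · exact .inr ⟨_, h3, by simp [h2], .inl rfl⟩
    · exact .inr ⟨_, h2, by simp [h3], .inr (.inl ⟨U, rfl, .inr ⟨h4, h5⟩⟩)⟩
  · obtain ⟨a, A, u, v, B, x, H, R, rfl, hx, hR, -, hd, hα, huv, hout⟩ := h.chop_out h1
    rcases hR.exists_out_of_alpha (by simp) hα with ⟨𝒰, hU, hw⟩ | ⟨h2, h3⟩ |
      ⟨U, A', u', v', N, h2, h3, h4, h5, h6, h7, h8⟩
    · refine .inl ⟨_, hout 𝒰 hU, ?_⟩
      simp at hw ⊢; omega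
    · refine .inr ⟨_, hout _ h3, by simp at h2; simp [h2], .inr (.inl ⟨_, rfl, .inl ⟨rfl, by simp⟩⟩)⟩
    · refine .inr ⟨_, hout _ h2, by simp at h3 ⊢; omega, .inr (.inr ?_)⟩
      simp only [List.cons.injEq] at h6
      obtain ⟨rfl, rfl, -⟩ := h6
      exact ⟨_, U, A, A', u, v, rfl, rfl, h7, huv, hx, h8, h4,
        hd.mono_right (h2.pkt U (by simp)).sub⟩

theorem PolyInt.eventually_visible (h : PolyInt L G) {y z a : Plane} (hy : y ∉ L) (hz : z ∈ G)
    (hyz : openSegment ℝ y z ⊆ G) (ho : orient y z a ≠ 0) :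
    ∀ᶠ t in nhdsWithin (0 : ℝ) (Ioi 0), openSegment ℝ y (AffineMap.lineMap z a t) ⊆ G ∧
      AffineMap.lineMap z a t ∈ G ∧ ∀ x ∈ L, orient y (AffineMap.lineMap z a t) x ≠ 0 := by
  have hc : Tendsto (fun t : ℝ => (AffineMap.lineMap z a t : Plane)) (nhdsWithin 0 (Ioi 0)) (nhds z) := by
    have : Continuous fun t : ℝ => (AffineMap.lineMap z a t : Plane) := AffineMap.lineMap_continuous
    simpa using (this.tendsto 0).mono_left nhdsWithin_le_nhds
  obtain ⟨ρ, hρ, hball⟩ := Metric.isOpen_iff.1 h.isOpen z hz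
  have ev1 := hc (Metric.ball_mem_nhds z hρ)
  have ev2 : ∀ᶠ t in nhdsWithin (0 : ℝ) (Ioi 0), ∀ x ∈ {x | x ∈ L},
      orient y (AffineMap.lineMap z a t) x ≠ 0 ∧
      ¬ (0 < -orient y z x * orient y (AffineMap.lineMap z a t) x) := by
    refine (eventually_all_finite (List.finite_toSet _)).2 fun x hx => ?_
    have hsw : ∀ w, orient y w x = -orient y x w := fun w => by unfold orient; ring
    rcases eq_or_ne (orient y z x) 0 with h0 | h0
    · filter_upwards [self_mem_nhdsWithin] with t ht
      simp only [h0, neg_zero, zero_mul, lt_irrefl, not_false_eq_true, and_true]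
      rw [hsw, orient_lineMap]
      have h1 : orient y x z = 0 := by rw [hsw] at h0; linarith
      have h2 : orient y x a ≠ 0 := by
        intro h2
        rcases eq_or_ne y x with rfl | hne
        · exact hy hx
        · have e1 := eq_lineMap_of_orient hne h1
          have e2 := eq_lineMap_of_orient hne h2
          apply ho
          rw [e1, e2]; unfold orient; simp only [lineMap_coord]; ring
      have ht : (0:ℝ) < t := ht
      rw [h1]
      simp [ht.ne', h2]
    · have hcc : Continuous fun w => orient y w x := by
        have : (fun w => orient y w x) = fun w => -orient y x w := funext hsw
        rw [this]; exact (continuous_orient y x).neg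
      have hmul : 0 < orient y z x * orient y z x := mul_self_pos.2 h0
      have := (((hcc.tendsto z).const_mul (orient y z x)).comp hc).eventually_const_lt hmul
      filter_upwards [this] with t ht
      simp only [Function.comp] at ht
      exact ⟨by intro h'; rw [h'] at ht; simp at ht, by linarith⟩
  filter_upwards [ev1, ev2, self_mem_nhdsWithin] with t h1 h2 h3
  have h3 : (0:ℝ) < t := h3
  refine ⟨?_, hball h1, fun x hx => (h2 x hx).1⟩
  have hyt : y ≠ AffineMap.lineMap z a t := by
    intro h'
    have : orient y z (AffineMap.lineMap z a t) = 0 := by rw [← h']; unfold orient; ring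
    rw [orient_lineMap, orient_right] at this
    simp [h3.ne', ho] at this
  refine h.openSegment_subset_of_chain hz hyz (fun w hw => hball
    ((convex_ball z ρ).openSegment_subset (Metric.mem_ball_self hρ) h1 hw)) hyt ?_ ?_ ?_
  · intro τ hτ x hx
    refine ⟨fun hxt => (h2 x hx).2 ?_, fun hxt => (h2 x hx).1 ?_⟩
    · obtain ⟨ha, hb, -⟩ := hxt
      have : orient z y x = -orient y z x := by unfold orient; ring
      have h4 := mul_pos ha hb
      rw [this] at h4
      have : 0 < τ * τ := mul_self_pos.2 (by rintro rfl; simp at hτ)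
      by_contra h5
      nlinarith
    · exact orient_of_mem_openSegment hxt
  · intro e he' _ h5
    exact h.segment_disjoint he' h5 (hball h1)
  · intro h0
    exfalso
    rw [orient_lineMap, orient_right] at h0
    simp [h3.ne', ho] at h0

theorem mem_pathEdges_of_mem_cycEdges {o : Plane} {e : Plane × Plane} (h : e ∈ cycEdges (o :: L))
    (h1 : e.1 ≠ o) (h2 : e.2 ≠ o) : e ∈ pathEdges L := by
  rcases L.eq_nil_or_concat with rfl | ⟨N, y, rfl⟩
  · simp [cycEdges_cons, pathEdges] at h
    simp [h] at h1
  rw [List.concat_eq_append] at *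
  rcases hN : N ++ [y] with _ | ⟨f, N'⟩
  · simp at hN
  have h3 : o :: (N ++ [y]) ++ [o] = o :: (N ++ [y, o]) := by simp
  rw [cycEdges_cons, h3] at h
  have h4 : pathEdges (o :: (N ++ [y, o])) = (o, f) :: pathEdges (N ++ [y, o]) := by
    have : N ++ [y, o] = f :: (N' ++ [o]) := by
      rw [← List.cons_append, ← hN]; simp
    rw [this]; rfl
  rw [h4, pathEdges_append_two] at h
  rcases List.mem_cons.1 h with rfl | h
  · exact absurd rfl h1
  rcases List.mem_append.1 h with h | h
  · rwa [← hN]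
  · rw [List.mem_singleton.1 h] at h2
    exact absurd rfl h2

/-- Every point of the last edge is seen from a free boundary point seen from the first vertex. -/
theorem OPoly.exists_relay {σ : ℝ} {o y t : Plane} {A : List Plane} (h : OPoly σ (o :: A ++ [y]) G)
    (ht : t ∈ openSegment ℝ y o) :
    ∃ x ∈ openPath (A ++ [y]), openSegment ℝ o x ⊆ G ∧ openSegment ℝ x t ⊆ G := by
  obtain ⟨w, -, ho, htri, -⟩ := h.apex
  have hs0 : 0 < σ * σ := mul_self_pos.2 (ne_of_sign h.sign)
  obtain ⟨r, r0, r1, rfl⟩ := mem_openSegment_iff.1 ht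
  set t : Plane := AffineMap.lineMap y o r with ht'
  have hot : ∀ v, orient o t v = -(1 - r) * orient y o v := fun v => by
    rw [ht']; unfold orient; simp only [lineMap_coord]; ring
  have hct : orient y o t = 0 := orient_of_mem_openSegment ht
  have hev : ∀ᶠ s in nhdsWithin (0:ℝ) (Ioi 0), ∀ v ∈ {v | v ∈ o :: A ++ [y]},
      0 < σ * orient y o v → σ * orient o (AffineMap.lineMap t w s) v < 0 := by
    refine (eventually_all_finite (List.finite_toSet _)).2 fun v hv => ?_
    by_cases hv0 : 0 < σ * orient y o v
    · have hc : Continuous fun s : ℝ => σ * orient o (AffineMap.lineMap t w s) v := by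
        have : (fun s : ℝ => σ * orient o (AffineMap.lineMap t w s) v) =
            fun s : ℝ => -(σ * (orient o v t + s * (orient o v w - orient o v t))) := by
          ext s; rw [← orient_lineMap]; unfold orient; ring
        rw [this]; fun_prop
      have h1 : σ * orient o (AffineMap.lineMap t w (0:ℝ)) v < 0 := by
        rw [AffineMap.lineMap_apply_zero, hot]; nlinarith
      filter_upwards [((hc.tendsto 0).mono_left nhdsWithin_le_nhds).eventually_lt_const h1] with s hs _
      exact hs
    · exact Eventually.of_forall fun _ h' => absurd h' hv0
  obtain ⟨s, hs, s0, s1⟩ := (hev.and (Ioo_mem_nhdsGT (zero_lt_one' ℝ))).exists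
  set g : Plane := AffineMap.lineMap t w s with hg
  have hgtw : g ∈ openSegment ℝ t w := mem_openSegment_iff.2 ⟨s, s0, s1, rfl⟩
  have htw : openSegment ℝ t w ⊆ tri σ y o w := by
    have := openSegment_subset_tri (p := w) (q := y) (r := o) (σ := σ)
      (by have : orient w y o = orient y o w := by unfold orient; ring
          rwa [this]) ht
    rwa [openSegment_symm, ← tri_cycle] at this
  have hgt := htw hgtw
  have hcg : 0 < σ * orient y o g := hgt.1
  have hog : openSegment ℝ o g ⊆ G := by
    refine (openSegment_subset_tri_of_mem (σ := σ) (q := w) (r := y) ?_).trans ?_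
    · rwa [tri_cycle]
    · rwa [tri_cycle]
  have hne : o ≠ g := by rintro h'; rw [← h', orient_right] at hcg; simp at hcg
  obtain ⟨x, hgx, hgxG, e, he, hxe⟩ := h.first_hit (htri hgt) hne
  obtain ⟨l, l1, hl⟩ := exists_lineMap_of_mem_openSegment hgx
  have hcx : 0 < σ * orient y o x := by
    rw [← hl, orient_lineMap, orient_right]; nlinarith
  have hogx : orient o g x = 0 := by rw [← hl, orient_lineMap]; simp
  have hxv : x ∉ o :: A ++ [y] := fun hx => by
    have := hs x hx hcx
    rw [hogx] at this; simp at this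
  have hx1 : x ≠ e.1 := by rintro rfl; exact hxv (fst_mem_of_mem_cycEdges he)
  have hx2 : x ≠ e.2 := by rintro rfl; exact hxv (snd_mem_of_mem_cycEdges he)
  have hxo := mem_openSegment_of_mem_segment hxe hx1 hx2
  have key : ∀ f ∈ o :: A ++ [y], x ∉ openSegment ℝ o f := by
    intro f hf hxf
    obtain ⟨m, m1, hm⟩ := exists_lineMap_of_mem_openSegment hxf
    have h1 : 0 < σ * orient y o f := by rw [← hm, orient_lineMap, orient_right]; nlinarith
    have h2 := hs f hf h1
    rw [← hm, orient_lineMap, hogx] at h2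
    simp at h2
  have htg : 0 < σ * orient o g t := by
    have : orient o g t = -orient o t g := by unfold orient; ring
    rw [this, hot]; nlinarith
  refine ⟨x, ⟨e, mem_pathEdges_of_mem_cycEdges he ?_ ?_, hxo⟩,
    openSegment_subset_of_mem hgx (htri hgt) hog hgxG, ?_⟩
  · intro h1
    rw [h1] at hxo
    exact key _ (snd_mem_of_mem_cycEdges he) hxo
  · intro h1
    rw [h1, openSegment_symm] at hxo
    exact key _ (fst_mem_of_mem_cycEdges he) hxo
  rw [openSegment_symm]
  have hneg : ∀ v ∈ o :: A ++ [y], 0 < σ * orient y o v → ¬ 0 < σ * orient o g v :=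
    fun v hv h1 => not_lt.2 (hs v hv h1).le
  refine h.openSegment_subset_of_chain (htri hgt)
    ((openSegment_subset_left hgtw).trans (htw.trans htri)) hgxG ?_ ?_ ?_ ?_
  · intro h'; rw [← h', hct] at hcx; simp at hcx
  · intro τ hτ v hv
    refine ⟨fun hvt => hneg v hv ?_ ?_, fun hvt => hneg v hv ?_ ?_⟩
    · exact orient_pos_of_tri hτ hvt hcg.le (by rw [hct]; simp) hcx
    · refine orient_pos_of_tri (p := x) (q := g) (r := t) (τ := τ) ?_ ?_ (by rw [hogx]; simp)
        (by rw [orient_right]; simp) htg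
      · have : orient x g t = orient g t x := by unfold orient; ring
        rwa [this]
      · rwa [← tri_cycle]
    · exact orient_pos_of_mem_openSegment (by rw [hct]; simp) hcx hvt
    · rw [openSegment_symm] at hvt
      exact orient_pos_of_mem_openSegment (by rw [hogx]; simp) htg hvt
  · intro f hf h1 h2
    have hyo : (y, o) ∈ cycEdges (o :: A ++ [y]) := mem_cycEdges_last A o y
    have : f = (y, o) := by
      by_contra hne
      have h6 := (h.graph.2 _ hyo f hf (Ne.symm hne) _ (openSegment_subset_segment _ _ _ ht) h1).1
      have h7 := ne_of_mem_openSegment (h.ne hyo) ht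
      exact h6.elim h7.1 h7.2
    rw [this] at h2
    rw [orient_of_mem_segment h2] at hcx; simp at hcx
  · intro h0
    exfalso
    have : orient t g x = (l - 1) * orient o g t := by
      rw [← hl]; unfold orient; simp only [lineMap_coord]; ring
    rw [this] at h0
    rcases mul_eq_zero.1 h0 with h0 | h0
    · linarith
    · rw [h0] at htg; simp at htg

/-- Near a convex corner, every point of one edge sees a point of the other. -/
theorem OPoly.exists_corner {ε : ℝ} {a b c y : Plane} {A : List Plane} {H : Set Plane}
    (h : OPoly ε (a :: A ++ [c, b]) H) (hc : 0 < ε * orient b a c) (hy : y ∈ openSegment ℝ c b) :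
    ∃ z ∈ openSegment ℝ a b, openSegment ℝ z y ⊆ H := by
  have h' : OPoly ε (b :: a :: A ++ [c]) H := by
    have := OPoly.rotate (A := a :: A ++ [c]) (B := [b]) (by simpa using h)
    simpa using this
  have hev : ∀ᶠ s in nhdsWithin (0:ℝ) (Ioi 0), ∀ x ∈ {x | x ∈ b :: a :: A ++ [c]},
      x ∉ tri ε b (AffineMap.lineMap b a s) c := by
    refine (eventually_all_finite (List.finite_toSet _)).2 fun x hx => ?_
    by_cases hx0 : 0 < ε * orient c b x
    · have hcont : Continuous fun s : ℝ => ε * orient (AffineMap.lineMap b a s) c x := by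
        have : (fun s : ℝ => ε * orient (AffineMap.lineMap b a s) c x) =
            fun s : ℝ => (ε * (orient c x b + s * (orient c x a - orient c x b))) := by
          ext s; rw [← orient_lineMap]; unfold orient; ring
        rw [this]; fun_prop
      have h1 : ε * orient (AffineMap.lineMap b a (0:ℝ)) c x < 0 := by
        rw [AffineMap.lineMap_apply_zero]
        have : orient b c x = -orient c b x := by unfold orient; ring
        rw [this]; linarith
      filter_upwards [((hcont.tendsto 0).mono_left nhdsWithin_le_nhds).eventually_lt_const h1]
        with s hs hx'
      exact hs.not_gt hx'.2.1
    · exact Eventually.of_forall fun _ h' => hx0 h'.2.2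
  obtain ⟨s, hs, s0, s1⟩ := (hev.and (Ioo_mem_nhdsGT (zero_lt_one' ℝ))).exists
  have htri := h'.corner_tri h.sign (h'.sides _ (by simp [cycEdges_cons])) hc s0 s1.le
    zero_lt_one le_rfl (by simpa using hs)
  rw [AffineMap.lineMap_apply_one] at htri
  set p : Plane := AffineMap.lineMap b a s with hp
  have hpa : p ∈ openSegment ℝ b a := mem_openSegment_iff.2 ⟨s, s0, s1, rfl⟩
  have hpo : 0 < ε * orient b p c := by
    have := orient_corner b a c s 1
    rw [AffineMap.lineMap_apply_one] at this
    rw [hp, this]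
    nlinarith
  obtain ⟨z, hz⟩ := openSegment_nonempty b p
  refine ⟨z, by rw [openSegment_symm]; exact openSegment_subset_left hpa hz, fun m hm => htri ?_⟩
  have e1 : orient p c b = orient b p c := by unfold orient; ring
  have e2 : orient c b p = orient b p c := by unfold orient; ring
  have hbp : orient b p z = 0 := orient_of_mem_openSegment hz
  have hcb : orient c b y = 0 := orient_of_mem_openSegment hy
  have hy1 : 0 < ε * orient b p y :=
    orient_pos_of_mem_openSegment (x := b) (y := c) (by rw [orient_left, mul_zero]) hpo
      (by rwa [openSegment_symm])
  have hy2 : 0 < ε * orient p c y :=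
    orient_pos_of_mem_openSegment (x := c) (y := b) (by rw [orient_right, mul_zero]) (by rwa [e1]) hy
  have hz2 : 0 < ε * orient p c z :=
    orient_pos_of_mem_openSegment (x := p) (y := b) (by rw [orient_left, mul_zero]) (by rwa [e1])
      (by rwa [openSegment_symm])
  have hz3 : 0 < ε * orient c b z :=
    orient_pos_of_mem_openSegment (x := b) (y := p) (by rw [orient_right, mul_zero]) (by rwa [e2]) hz
  refine ⟨orient_pos_of_mem_openSegment (by rw [hbp, mul_zero]) hy1 hm,
    orient_pos_of_mem_openSegment hz2.le hy2 hm,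
    orient_pos_of_mem_openSegment (by rw [hcb, mul_zero]) hz3 (by rwa [openSegment_symm])⟩

theorem OPoly.corner_convex {σ ε : ℝ} {a b c : Plane} {A : List Plane} {H : Set Plane}
    (h : OPoly σ L G) (hH : OPoly ε (a :: A ++ [c, b]) H) (hHG : H ⊆ G) {f : Plane × Plane}
    (hf : f ∈ cycEdges L) (hb : b ∈ openSegment ℝ f.1 f.2) (hab : openSegment ℝ a b ⊆ G) :
    0 < ε * orient b a c := by
  by_contra! hle
  have h1 : OPoly (-ε) (a :: b :: c :: A.reverse) H := by
    have := OPoly.rotate (A := b :: c :: A.reverse) (B := [a]) (by simpa using hH.reverse)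
    simpa using this
  have e0 : ∀ x, orient a b x = -orient b a x := fun x => by unfold orient; ring
  obtain ⟨ρ, hρ, hball⟩ := h1.halfBall (by rw [e0]; linarith)
  have hfa := h.orient_pos_of_openSegment hf hb hab
  have key : ∀ p, (∀ x ∈ openSegment ℝ b p, x ∉ G) → -ε * orient a b p ≤ 0 := by
    intro p hp
    by_contra! h0
    obtain ⟨z, hz, hzb⟩ := exists_near (v := b) (q := p) hρ
    exact hp z hz (hHG (hball z hzb (orient_pos_of_mem_openSegment (x := b)
      (by rw [orient_right, mul_zero]) h0 hz)))
  have k1 := key f.1 fun x hx => h.openSegment_disjoint hf (by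
    rw [openSegment_symm] at hx
    exact openSegment_subset_left hb hx)
  have k2 := key f.2 fun x hx => h.openSegment_disjoint hf (by
    rw [openSegment_symm] at hx ⊢ hb
    exact openSegment_subset_left hb hx)
  obtain ⟨t, t0, t1, ht⟩ := mem_openSegment_iff.1 hb
  have k3 : orient a b b = 0 := orient_right _ _
  rw [← ht, orient_lineMap, ht] at k3
  have hε := ne_of_sign h1.sign
  have k3' : (1 - t) * (-ε * orient a b f.1) + t * (-ε * orient a b f.2) = 0 := by
    linear_combination -ε * k3
  have k4 : -ε * orient a b f.1 = 0 := by nlinarith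
  have k5 : -ε * orient a b f.2 = 0 := by nlinarith
  have k6 := (mul_eq_zero.1 k4).resolve_left hε
  have k7 := (mul_eq_zero.1 k5).resolve_left hε
  have hab' : a ≠ b := h1.ne (e := (a, b)) (by simp [cycEdges_cons, pathEdges])
  have e1 := eq_lineMap_of_orient hab' k6
  have e2 := eq_lineMap_of_orient hab' k7
  have : orient f.1 f.2 a = 0 := by
    rw [e1, e2]; unfold orient; simp only [lineMap_coord]; ring
  rw [this] at hfa; simp at hfa

/-- The union of the open edges of a closed polygonal line. -/
def openCycle (L : List Plane) : Set Plane := {y | ∃ e ∈ cycEdges L, y ∈ openSegment ℝ e.1 e.2}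

theorem PolyInt.openCycle_notMem (h : PolyInt L G) {y : Plane} (hy : y ∈ openCycle L) : y ∉ G := by
  obtain ⟨e, he, hy⟩ := hy
  exact h.openSegment_disjoint he hy

theorem PolyInt.notMem_of_openCycle (h : PolyInt L G) {y : Plane} (hy : y ∈ openCycle L) : y ∉ L := by
  obtain ⟨e, he, hy⟩ := hy
  exact fun hyL => h.vertex_notMem_openSegment hyL he hy

/-- A point sees an edge of a subpolygon contained in the boundary only from the inner side. -/
theorem OPoly.enter {σ ε : ℝ} {K : List Plane} {H : Set Plane} {z q : Plane} {e : Plane × Plane}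
    (h : OPoly σ L G) (hH : OPoly ε K H) (hHG : H ⊆ G) (he : e ∈ cycEdges K)
    (heC : openSegment ℝ e.1 e.2 ⊆ openCycle L) (hq : q ∈ openSegment ℝ e.1 e.2)
    (hz : openSegment ℝ z q ⊆ G) :
    0 < ε * orient e.1 e.2 z ∧ ∃ m ∈ openSegment ℝ z q, m ∈ H ∧ openSegment ℝ m q ⊆ H := by
  obtain ⟨f, hf, hqf⟩ := heC hq
  have hfz := h.orient_pos_of_openSegment hf hqf hz
  obtain ⟨r, hr, hside⟩ := hH.sides e he q hq
  have hoq : orient e.1 e.2 q = 0 := orient_of_mem_openSegment hq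
  have hofq : orient f.1 f.2 q = 0 := orient_of_mem_openSegment hqf
  have hpos : 0 < ε * orient e.1 e.2 z := by
    rcases lt_trichotomy (ε * orient e.1 e.2 z) 0 with h0 | h0 | h0
    · exfalso
      obtain ⟨r', hr', hside'⟩ := h.sides f hf q hqf
      obtain ⟨w, hw, hwb⟩ := exists_near (v := q) (q := AffineMap.lineMap q z (-1 : ℝ))
        (lt_min hr hr')
      obtain ⟨t, t0, t1, rfl⟩ := mem_openSegment_iff.1 hw
      refine (hside' _ (Metric.ball_subset_ball (min_le_right _ _) hwb)).2 ?_
        (hHG ((hside _ (Metric.ball_subset_ball (min_le_left _ _) hwb)).1 ?_))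
      · rw [orient_lineMap, orient_lineMap, hofq]; nlinarith
      · rw [orient_lineMap, orient_lineMap, hoq]; nlinarith
    · exfalso
      have hne := hH.ne he
      have hz0 := (mul_eq_zero.1 h0).resolve_left (ne_of_sign hH.sign)
      obtain ⟨t, t0, t1, ht⟩ := mem_openSegment_iff.1 hq
      set τ := scal e.1 e.2 z / scal e.1 e.2 e.2 with hτ
      have hzl : z = AffineMap.lineMap e.1 e.2 τ := eq_lineMap_of_orient hne hz0
      have hc : Continuous fun δ : ℝ => t + δ * (τ - t) := by fun_prop
      have e1 := ((hc.tendsto 0).mono_left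
        (nhdsWithin_le_nhds (s := Ioi 0))).eventually_const_lt (u := 0) (by simpa)
      have e2 := ((hc.tendsto 0).mono_left
        (nhdsWithin_le_nhds (s := Ioi 0))).eventually_lt_const (u := 1) (by simpa)
      obtain ⟨δ, h1, h2, h3⟩ := (e1.and (e2.and (Ioo_mem_nhdsGT (zero_lt_one' ℝ)))).exists
      refine h.openCycle_notMem (heC (mem_openSegment_iff.2 ⟨_, h1, h2, ?_⟩))
        (hz (openSegment_symm ℝ q z ▸ mem_openSegment_iff.2 ⟨δ, h3.1, h3.2, rfl⟩))
      rw [← ht, hzl]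
      refine plane_ext ?_ ?_ <;> simp only [lineMap_coord] <;> ring
    · exact h0
  obtain ⟨m, hm, hmb⟩ := exists_near (v := q) (q := z) hr
  have hmo : 0 < ε * orient e.1 e.2 m :=
    orient_pos_of_mem_openSegment (by rw [hoq, mul_zero]) hpos hm
  refine ⟨hpos, m, by rwa [openSegment_symm], (hside m hmb).1 hmo, fun w hw => (hside w ?_).1 ?_⟩
  · exact (convex_ball q r).openSegment_subset hmb (Metric.mem_ball_self hr) hw
  · rw [openSegment_symm] at hw
    exact orient_pos_of_mem_openSegment (by rw [hoq, mul_zero]) hmo hw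

section
variable {σ : ℝ} {o : Plane} {U : Pkt}

theorem PktOf.edges (hU : PktOf o (openCycle L) G U) {e : Plane × Plane}
    (he : e ∈ pathEdges (U.a :: U.M ++ [U.b])) : openSegment ℝ e.1 e.2 ⊆ openCycle L :=
  fun _ hx => hU.path ⟨e, he, hx⟩

theorem Pkt.cases {e : Plane × Plane}
    (he : e ∈ cycEdges (U.a :: U.M ++ [U.b])) :
    e ∈ pathEdges (U.a :: U.M ++ [U.b]) ∨ e = (U.b, U.a) := by
  rw [cycEdges_concat] at he
  simpa using he

theorem Pkt.mem_cycEdges {e : Plane × Plane}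
    (he : e ∈ pathEdges (U.a :: U.M ++ [U.b])) : e ∈ cycEdges (U.a :: U.M ++ [U.b]) := by
  rw [cycEdges_concat]
  exact List.mem_append_left _ he

theorem Pkt.door_mem :
    (U.b, U.a) ∈ cycEdges (U.a :: U.M ++ [U.b]) := mem_cycEdges_last _ _ _

theorem PktOf.notMem_of_segment (h : PolyInt L G) (hU : PktOf o (openCycle L) G U)
    {e : Plane × Plane} (he : e ∈ pathEdges (U.a :: U.M ++ [U.b])) {x : Plane}
    (hx : x ∈ segment ℝ e.1 e.2) : x ∉ G := by
  intro hxG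
  rw [← closure_openSegment] at hx
  obtain ⟨w, hwG, hw⟩ := mem_closure_iff.1 hx G h.isOpen hxG
  exact h.openCycle_notMem (hU.edges he hw) hwG

theorem PktOf.a_notMem (h : PolyInt L G) (hU : PktOf o (openCycle L) G U) : U.a ∉ G := by
  obtain ⟨x, N, hx⟩ := List.exists_cons_of_ne_nil (l := U.M ++ [U.b]) (by simp)
  refine hU.notMem_of_segment h (e := (U.a, x)) ?_ (left_mem_segment _ _ _)
  rw [List.cons_append, hx]; simp [pathEdges]

theorem PktOf.mem_door (h : PolyInt L G) (hU : PktOf o (openCycle L) G U) {e : Plane × Plane}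
    (he : e ∈ cycEdges (U.a :: U.M ++ [U.b])) {x : Plane} (hx : x ∈ segment ℝ e.1 e.2)
    (hxG : x ∈ G) : x ∈ openSegment ℝ U.a U.b := by
  rcases Pkt.cases he with he | rfl
  · exact absurd hxG (hU.notMem_of_segment h he hx)
  · rw [openSegment_symm]
    refine mem_openSegment_of_mem_segment hx ?_ ?_
    · rintro rfl; exact h.openCycle_notMem hU.mem hxG
    · rintro rfl; exact hU.a_notMem h hxG

theorem PktOf.ahead (hU : PktOf o (openCycle L) G U) {y z : Plane}
    (hz : z ∈ openSegment ℝ U.a U.b) (hy : openSegment ℝ z y ⊆ U.H) :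
    0 < U.ε * orient U.b U.a y :=
  hU.poly.orient_pos_of_openSegment Pkt.door_mem (x := z) (by rwa [openSegment_symm])
    (by rwa [openSegment_symm])

theorem PktOf.pos_door (hU : PktOf o (openCycle L) G U) {z : Plane}
    (hz : z ∈ openSegment ℝ U.a U.b) : 0 < U.ε * orient o U.a z :=
  orient_pos_of_mem_openSegment (by rw [orient_right, mul_zero]) hU.pos hz

/-- A segment ending on the boundary of a pocket enters the pocket through its door. -/
theorem PktOf.exists_door (h : OPoly σ L G) (hU : PktOf o (openCycle L) G U) {q z : Plane}
    (hq : q ∈ U.path) (hz : z ∈ G) (hzH : z ∉ U.H) (hzq : openSegment ℝ z q ⊆ G) :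
    ∃ c ∈ openSegment ℝ U.a U.b, (c = z ∨ c ∈ openSegment ℝ z q) ∧ openSegment ℝ c q ⊆ U.H := by
  obtain ⟨e, he, hqe⟩ := hq
  obtain ⟨-, m, hm, hmH, hmq⟩ :=
    h.enter hU.poly hU.sub (Pkt.mem_cycEdges he) (hU.edges he) hqe hzq
  have hqm : q ≠ m := by
    rintro rfl
    exact h.openCycle_notMem (hU.edges he hqe) (hU.sub hmH)
  obtain ⟨x, hx, hmx, f, hf, hxf⟩ := hU.poly.first_hit hmH hqm
  have hqx : openSegment ℝ q x ⊆ U.H := openSegment_subset_of_mem hx hmH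
    (by rwa [openSegment_symm]) hmx
  have hxz : x = z ∨ x ∈ openSegment ℝ z q := by
    obtain ⟨l, l1, rfl⟩ := exists_lineMap_of_mem_openSegment hx
    rw [openSegment_symm] at hm ⊢
    obtain ⟨r, r1, rfl⟩ := exists_lineMap_of_mem_openSegment hm
    rcases lt_trichotomy l r with hlr | rfl | hlr
    · right
      have : (AffineMap.lineMap q (AffineMap.lineMap q m r) (l / r) : Plane) =
          AffineMap.lineMap q m l := by
        refine plane_ext ?_ ?_ <;> simp only [lineMap_coord] <;> field_simp <;> ring
      exact mem_openSegment_iff.2 ⟨l / r, by positivity, (div_lt_one (by linarith)).2 hlr, this⟩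
    · exact .inl rfl
    · refine absurd (hqx (mem_openSegment_iff.2 ⟨r / l, by positivity,
        (div_lt_one (by linarith)).2 hlr, ?_⟩)) hzH
      refine plane_ext ?_ ?_ <;> simp only [lineMap_coord] <;> field_simp <;> ring
  refine ⟨x, hU.mem_door h.toPolyInt hf hxf ?_, hxz, by rwa [openSegment_symm]⟩
  rcases hxz with rfl | hx'
  exacts [hz, hzq hx']

/-- A segment through the door of the pocket `U`, from a point `y` of the pocket to a point `q` of the
boundary outside. -/
structure Chord (L : List Plane) (G : Set Plane) (U : Pkt) (y z q : Plane) : Prop where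
  y_mem : y ∈ U.H ∪ U.path
  z_mem : z ∈ openSegment ℝ U.a U.b
  q_mem : q ∈ openCycle L
  between : z ∈ openSegment ℝ y q
  inside : openSegment ℝ z y ⊆ U.H
  sub : openSegment ℝ y q ⊆ G
  notMem : q ∉ U.path

theorem PktOf.subset_of_pos (h : PolyInt L G) (hU : PktOf o (openCycle L) G U) {S : Set Plane}
    (hS : IsPreconnected S) (hSG : S ⊆ G) {w : Plane} (hw : w ∈ S) (hwH : w ∈ U.H)
    (ho : ∀ x ∈ S, orient U.b U.a x ≠ 0) : S ⊆ U.H := by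
  refine (hS.subset_or_disjoint_of_frontier ?_).resolve_right
    fun hd => Set.disjoint_left.1 hd hw hwH
  rw [Set.disjoint_right]
  intro x hx hxS
  obtain ⟨e, he, hxe⟩ := mem_edgeUnion.1 (hU.poly.front hx)
  refine ho x hxS ?_
  have := orient_of_mem_openSegment (hU.mem_door h he hxe (hSG hxS))
  have e1 : orient U.b U.a x = -orient U.a U.b x := by unfold orient; ring
  rw [e1, this, neg_zero]

theorem PktOf.exists_chord (h : OPoly σ L G) (hU : PktOf o (openCycle L) G U) {y z : Plane}
    (hy : y ∈ U.H ∪ U.path) (hz : z ∈ openSegment ℝ U.a U.b) (hzy : openSegment ℝ z y ⊆ U.H) :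
    ∃ z' q, Chord L G U y z' q := by
  have hyp := hU.ahead hz hzy
  have hne : U.b ≠ U.a := hU.poly.ne Pkt.door_mem
  have hyL : y ∉ L := by
    rcases hy with hy | hy
    · exact fun h' => h.vertex_notMem h' (hU.sub hy)
    · exact h.notMem_of_openCycle (hU.path hy)
  obtain ⟨r, r0, r1, hr⟩ := mem_openSegment_iff.1 hz
  have ho : orient y z U.a ≠ 0 := by
    have : orient y z U.a = r * orient U.b U.a y := by
      rw [← hr]; unfold orient; simp only [lineMap_coord]; ring
    rw [this]
    refine mul_ne_zero r0.ne' ?_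
    intro h0; rw [h0] at hyp; simp at hyp
  obtain ⟨m, hm⟩ := openSegment_nonempty y z
  obtain ⟨u, u0, u1, hu⟩ := mem_openSegment_iff.1 hm
  have ev2 : ∀ᶠ t in nhdsWithin (0 : ℝ) (Ioi 0),
      AffineMap.lineMap y (AffineMap.lineMap z U.a t) u ∈ U.H := by
    have hc : Continuous fun t : ℝ =>
        (AffineMap.lineMap y (AffineMap.lineMap z U.a t : Plane) u : Plane) := by
      have e1 : Continuous fun t : ℝ => (AffineMap.lineMap z U.a t : Plane) :=
        AffineMap.lineMap_continuous
      simp only [AffineMap.lineMap_apply_module] at *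
      fun_prop
    refine ((hc.tendsto 0).mono_left nhdsWithin_le_nhds).eventually
      (hU.poly.isOpen.mem_nhds ?_)
    rw [AffineMap.lineMap_apply_zero, hu]
    exact hzy (by rwa [openSegment_symm])
  obtain ⟨t, ⟨hv, hz'G, hvx⟩, hmH, t0, t1⟩ := ((h.eventually_visible hyL (hU.door hz)
    (by rw [openSegment_symm]; exact hzy.trans hU.sub) ho).and
    (ev2.and (Ioo_mem_nhdsGT (zero_lt_one' ℝ)))).exists
  set z' : Plane := AffineMap.lineMap z U.a t with hz'
  have hz'd : z' ∈ openSegment ℝ U.a U.b := by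
    refine openSegment_subset_left hz ?_
    rw [openSegment_symm]
    exact mem_openSegment_iff.2 ⟨t, t0, t1, rfl⟩
  have hoz' : orient U.b U.a z' = 0 :=
    orient_of_mem_openSegment (by rwa [openSegment_symm])
  have hin : openSegment ℝ y z' ⊆ U.H := by
    refine hU.subset_of_pos h.toPolyInt (convex_openSegment y z').isPreconnected hv
      (mem_openSegment_iff.2 ⟨u, u0, u1, rfl⟩) hmH fun x hx h0 => ?_
    rw [openSegment_symm] at hx
    have := orient_pos_of_mem_openSegment (by rw [hoz', mul_zero]) hyp hx
    rw [h0] at this; simp at this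
  have hyz' : y ≠ z' := by rintro h'; rw [h', hoz'] at hyp; simp at hyp
  obtain ⟨q, hq, hz'q, e, he, hqe⟩ := h.first_hit hz'G hyz'
  have hyq : openSegment ℝ y q ⊆ G := openSegment_subset_of_mem hq hz'G hv hz'q
  obtain ⟨l, l1, hl⟩ := exists_lineMap_of_mem_openSegment hq
  have hoq : orient y z' q = 0 := by rw [← hl, orient_lineMap]; simp
  have hqC : q ∈ openCycle L := by
    refine ⟨e, he, mem_openSegment_of_mem_segment hqe ?_ ?_⟩
    · rintro rfl; exact hvx _ (fst_mem_of_mem_cycEdges he) hoq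
    · rintro rfl; exact hvx _ (snd_mem_of_mem_cycEdges he) hoq
  refine ⟨z', q, hy, hz'd, hqC, hq, by rwa [openSegment_symm], hyq, ?_⟩
  rintro ⟨f, hf, hqf⟩
  obtain ⟨-, w, hw, hwH, -⟩ := h.enter hU.poly hU.sub (Pkt.mem_cycEdges hf) (hU.edges hf) hqf hz'q
  have hqn : U.ε * orient U.b U.a q < 0 := by
    rw [← hl, orient_lineMap, hoz']; nlinarith
  have hneg : ∀ x ∈ openSegment ℝ z' q, U.ε * orient U.b U.a x < 0 := by
    intro x hx
    obtain ⟨v, v0, v1, rfl⟩ := mem_openSegment_iff.1 hx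
    rw [orient_lineMap, hoz']; nlinarith
  have hsub := hU.subset_of_pos h.toPolyInt (convex_openSegment z' q).isPreconnected hz'q hw hwH
    fun x hx h0 => by have := hneg x hx; rw [h0] at this; simp at this
  obtain ⟨ρ, hρ, hside⟩ := hU.poly.sides _ Pkt.door_mem z' (by rwa [openSegment_symm])
  obtain ⟨x, hx, hxb⟩ := exists_near (v := z') (q := q) hρ
  exact (hside x hxb).2 (hneg x hx) (hsub hx)

theorem Chord.pos (hU : PktOf o (openCycle L) G U) {y z q : Plane} (hc : Chord L G U y z q)
    (hy : U.ε * orient o U.a y ≤ 0) : 0 < U.ε * orient o U.a q := by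
  have h1 := hU.pos_door hc.z_mem
  obtain ⟨t, t0, t1, ht⟩ := mem_openSegment_iff.1 hc.between
  rw [← ht, orient_lineMap] at h1
  by_contra! h3
  nlinarith [mul_nonneg (sub_pos.2 t1).le (neg_nonneg.2 hy)]

end

/-- The points reached from `s` with at most `k` reflections on the open edges of `L`. -/
def Lit (L : List Plane) (G : Set Plane) (s : Plane) : ℕ → Set Plane
  | 0 => {y | openSegment ℝ s y ⊆ G}
  | k + 1 => Lit L G s k ∪ {y | ∃ x ∈ openCycle L, x ∈ Lit L G s k ∧ openSegment ℝ x y ⊆ G}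

section
variable {s o : Plane} {k : ℕ} {σ : ℝ} {U V : Pkt}

theorem Lit.succ {y : Plane} (h : y ∈ Lit L G s k) : y ∈ Lit L G s (k + 1) := .inl h

theorem Lit.reflect {x y : Plane} (h : x ∈ Lit L G s k) (hx : x ∈ openCycle L)
    (hxy : openSegment ℝ x y ⊆ G) : y ∈ Lit L G s (k + 1) := .inr ⟨x, hx, h, hxy⟩

/-- `U` is a pocket of a part of `G` in which all points seen from `o` are lit. -/
def GoodAt (L : List Plane) (G : Set Plane) (s : Plane) (k : ℕ) (o : Plane) (U : Pkt) : Prop :=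
  ∃ C' G', C' ⊆ openCycle L ∧ G' ⊆ G ∧ PktOf o C' G' U ∧
    ∀ y ∈ C' ∪ G', openSegment ℝ o y ⊆ G' → y ∈ Lit L G s k

theorem GoodAt.pkt (h : GoodAt L G s k o U) : PktOf o (openCycle L) G U := by
  obtain ⟨C', G', hC, hG, hU, -⟩ := h
  exact hU.mono hC hG

theorem GoodAt.lit (h : GoodAt L G s k o U) : U.b ∈ Lit L G s k := by
  obtain ⟨C', G', hC, hG, hU, hl⟩ := h
  exact hl _ (.inl hU.mem) hU.vis

theorem GoodAt.ll (h : GoodAt L G s k o U) {y z : Plane} (hy : y ∈ U.H ∪ U.path)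
    (hz : z ∈ openSegment ℝ U.a U.b) (hzy : openSegment ℝ z y ⊆ U.H) :
    y ∈ Lit L G s k ∨ U.ε * orient o U.a y ≤ 0 := by
  obtain ⟨C', G', hC, hG, hU, hl⟩ := h
  refine (hU.ll y hy z hz hzy).imp_left (hl y ?_)
  exact hy.elim (fun h => .inr (hU.sub h)) fun h => .inl (hU.path h)

theorem PktOf.goodAt {C' G' : Set Plane} (hU : PktOf o C' G' U) (hC : C' ⊆ openCycle L)
    (hG : G' ⊆ G) (hl : ∀ y ∈ C' ∪ G', openSegment ℝ o y ⊆ G' → y ∈ Lit L G s k) :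
    GoodAt L G s k o U := ⟨C', G', hC, hG, hU, hl⟩

/-- One more reflection lights all points seen inside the pocket from its door. -/
def Lum (L : List Plane) (G : Set Plane) (s : Plane) (k : ℕ) (U : Pkt) : Prop :=
  ∀ y ∈ U.H ∪ U.path, ∀ z ∈ openSegment ℝ U.a U.b, openSegment ℝ z y ⊆ U.H → y ∈ Lit L G s (k + 1)

theorem GoodAt.lum_of_chord (h : OPoly σ L G) (hU : GoodAt L G s k o U)
    (hq : ∀ y z q, Chord L G U y z q → U.ε * orient o U.a y ≤ 0 → q ∈ Lit L G s k) :
    Lum L G s k U := by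
  intro y hy z hz hzy
  obtain ⟨z', q, hc⟩ := hU.pkt.exists_chord h hy hz hzy
  rcases hU.ll hy hc.z_mem hc.inside with h1 | h1
  · exact Lit.succ h1
  · exact Lit.reflect (hq y z' q hc h1) hc.q_mem (by rw [openSegment_symm]; exact hc.sub)

theorem Chord.exists_cross (h : OPoly σ L G) (hU : PktOf o (openCycle L) G U) {o' : Plane}
    (hV : GoodAt L G s k o' V) (hd : Disjoint U.H V.H) {y z q : Plane} (hc : Chord L G U y z q)
    (hq : q ∈ V.path) (hn : q ∉ Lit L G s k) :
    ∃ c ∈ openSegment ℝ V.a V.b, (c = z ∨ c ∈ openSegment ℝ z q) ∧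
      V.ε * orient o' V.a q ≤ 0 ∧ 0 < V.ε * orient V.b V.a q := by
  have hzq : openSegment ℝ z q ⊆ G := by
    have h1 := hc.between
    rw [openSegment_symm] at h1
    have := openSegment_subset_left h1
    rw [openSegment_symm, openSegment_symm ℝ q y] at this
    exact this.trans hc.sub
  have hzV : z ∉ V.H := by
    intro hzV
    have : z ∈ closure U.H := hU.poly.segment_subset_closure Pkt.door_mem
      (openSegment_subset_segment _ _ _ (by rw [openSegment_symm]; exact hc.z_mem))
    obtain ⟨w, hw, hw'⟩ := mem_closure_iff.1 this V.H hV.pkt.poly.isOpen hzV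
    exact Set.disjoint_left.1 hd hw' hw
  obtain ⟨c, hcd, hcz, hcq⟩ := hV.pkt.exists_door h hq (hU.door hc.z_mem) hzV hzq
  exact ⟨c, hcd, hcz, (hV.ll (.inr hq) hcd hcq).resolve_left hn, hV.pkt.ahead hcd hcq⟩

end

theorem openSegment_between {y z c q : Plane} (hz : z ∈ openSegment ℝ y q)
    (hc : c = z ∨ c ∈ openSegment ℝ z q) :
    c ∈ openSegment ℝ q y ∧ (z = c ∨ z ∈ openSegment ℝ c y) := by
  rw [openSegment_symm ℝ q y]
  rcases hc with rfl | hc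
  · exact ⟨hz, .inl rfl⟩
  rw [openSegment_symm ℝ c y]
  obtain ⟨t, t0, t1, rfl⟩ := mem_openSegment_iff.1 hz
  obtain ⟨r, r0, r1, rfl⟩ := mem_openSegment_iff.1 hc
  have hp : 0 < t + r * (1 - t) := by nlinarith
  refine ⟨mem_openSegment_iff.2 ⟨t + r * (1 - t), hp, by nlinarith, ?_⟩,
    .inr (mem_openSegment_iff.2 ⟨t / (t + r * (1 - t)), by positivity,
      (div_lt_one hp).2 (by nlinarith), ?_⟩)⟩ <;>
  refine plane_ext ?_ ?_ <;> simp only [lineMap_coord] <;> field_simp <;> ring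

theorem orient_pos_of_cross {ε ε' : ℝ} {o a a' b' y z c q : Plane}
    (hp : 0 < ε' * orient o a' b') (hc : c ∈ openSegment ℝ a' b') (hy : ε * orient o a y ≤ 0)
    (hz : 0 < ε * orient o a z) (hzq : z ∈ openSegment ℝ y q) (hcz : c = z ∨ c ∈ openSegment ℝ z q)
    (hq : ε' * orient o a' q ≤ 0) (hq' : 0 < ε' * orient b' a' q) : 0 < ε * orient o a a' := by
  have hfq : 0 < ε * orient o a q := by
    obtain ⟨t, t0, t1, rfl⟩ := mem_openSegment_iff.1 hzq
    rw [orient_lineMap] at hz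
    by_contra! h3
    nlinarith [mul_nonneg (sub_pos.2 t1).le (neg_nonneg.2 hy)]
  have hfc : 0 < ε * orient o a c := by
    rcases hcz with rfl | h
    · exact hz
    · exact orient_pos_of_mem_openSegment hz.le hfq h
  have hgc : 0 < ε' * orient o a' c :=
    orient_pos_of_mem_openSegment (by rw [orient_right, mul_zero]) hp hc
  have hbc : orient b' a' c = 0 := orient_of_mem_openSegment (by rwa [openSegment_symm])
  set u := ε' * orient o a' c
  set v := ε' * orient o a' q
  have huv : 0 < u - v := by linarith
  have hs0 : 0 < u / (u - v) := by positivity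
  have hs1 : u / (u - v) ≤ 1 := (div_le_one huv).2 (by linarith)
  set r := u / (u - v) with hr
  have hr' : r * (u - v) = u := by rw [hr]; field_simp
  set p : Plane := AffineMap.lineMap c q r with hpd
  have hop : orient o a' p = 0 := by
    have : ε' * orient o a' p = 0 := by
      rw [hpd, orient_lineMap]; simp only [u, v] at hr'; linarith
    refine (mul_eq_zero.1 this).resolve_left ?_
    rintro rfl; simp at hp
  have hbp : 0 < ε' * orient b' a' p := by
    rw [hpd, orient_lineMap, hbc]; nlinarith
  have hap : 0 < ε * orient o a p := by
    rw [hpd, orient_lineMap]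
    rcases hs1.lt_or_eq with h | h
    · nlinarith [mul_pos hs0 hfq, mul_pos (sub_pos.2 h) hfc]
    · rw [h]; linarith
  have hne : o ≠ a' := by rintro rfl; unfold orient at hp; simp at hp
  have hpl := eq_lineMap_of_orient hne hop
  set l := scal o a' p / scal o a' a'
  have h1 : ε' * orient b' a' p = (l - 1) * (ε' * orient o a' b') := by
    rw [hpl]; unfold orient; simp only [lineMap_coord]; ring
  have h2 : ε * orient o a p = l * (ε * orient o a a') := by
    rw [hpl]; unfold orient; simp only [lineMap_coord]; ring
  have hl : 0 < l := by
    by_contra! hl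
    rw [h1] at hbp
    nlinarith
  rw [h2] at hap
  exact (pos_iff_pos_of_mul_pos hap).1 hl

section
variable {s o : Plane} {k : ℕ} {σ : ℝ} {U V : Pkt}

theorem GoodAt.orient_pos (h : OPoly σ L G) (hU : GoodAt L G s k o U) (hV : GoodAt L G s k o V)
    (hd : Disjoint U.H V.H) {y z q : Plane} (hc : Chord L G U y z q)
    (hy : U.ε * orient o U.a y ≤ 0) (hq : q ∈ V.path) (hn : q ∉ Lit L G s k) :
    0 < U.ε * orient o U.a V.a ∧ 0 < V.ε * orient o V.a U.a := by
  obtain ⟨c, hcd, hcz, h1, h2⟩ := hc.exists_cross h hU.pkt hV hd hq hn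
  obtain ⟨h3, h4⟩ := openSegment_between hc.between hcz
  exact ⟨orient_pos_of_cross hV.pkt.pos hcd hy (hU.pkt.pos_door hc.z_mem) hc.between hcz h1 h2,
    orient_pos_of_cross hU.pkt.pos hc.z_mem h1 (hV.pkt.pos_door hcd) h3 h4 hy
      (hU.pkt.ahead hc.z_mem hc.inside)⟩

/-- All boundary points are lit or belong to the given pockets. -/
def Full (L : List Plane) (G : Set Plane) (s : Plane) (k : ℕ) (𝒰 : List Pkt) : Prop :=
  ∀ y ∈ openCycle L, y ∈ Lit L G s k ∨ ∃ U ∈ 𝒰, y ∈ U.path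

theorem GoodAt.lum_of_full (h : OPoly σ L G) (hU : GoodAt L G s k o U) {𝒰 : List Pkt}
    (hf : Full L G s k 𝒰) (hV : ∀ V ∈ 𝒰, V = U ∨ GoodAt L G s k o V ∧ Disjoint U.H V.H ∧
      ¬(0 < U.ε * orient o U.a V.a ∧ 0 < V.ε * orient o V.a U.a)) : Lum L G s k U := by
  refine hU.lum_of_chord h fun y z q hc hy => ?_
  rcases hf q hc.q_mem with h1 | ⟨V, hV', hq⟩
  · exact h1
  by_contra hn
  rcases hV V hV' with rfl | ⟨h1, h2, h3⟩
  · exact hc.notMem hq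
  · exact h3 (hU.orient_pos h h1 h2 hc hy hq hn)

/-- Everything outside the pockets `𝒰` is lit. -/
structure Base (L : List Plane) (G : Set Plane) (s : Plane) (k : ℕ) (𝒰 : List Pkt) : Prop where
  good : ∀ U ∈ 𝒰, ∃ o, GoodAt L G s k o U
  inner : ∀ y ∈ G, y ∈ Lit L G s k ∨ ∃ U ∈ 𝒰, y ∈ U.H
  outer : Full L G s (k + 1) 𝒰

/-- The pockets `𝒱` contain the unlit part of the pocket `U`, with boundary points at level `l`. -/
structure Emit (L : List Plane) (G : Set Plane) (s : Plane) (k l : ℕ) (U : Pkt) (𝒱 : List Pkt) :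
    Prop where
  good : ∀ V ∈ 𝒱, ∃ o, GoodAt L G s (k + 1) o V
  inner : ∀ y ∈ U.H, y ∈ Lit L G s (k + 1) ∨ ∃ V ∈ 𝒱, y ∈ V.H
  outer : ∀ y ∈ U.path, y ∈ Lit L G s l ∨ ∃ V ∈ 𝒱, y ∈ V.path

theorem Emit.mono {𝒱 : List Pkt} (h : Emit L G s k (k + 1) U 𝒱) : Emit L G s k (k + 2) U 𝒱 :=
  ⟨h.good, h.inner, fun y hy => (h.outer y hy).imp_left Lit.succ⟩

theorem Base.emit {𝒰 : List Pkt} (h : Base L G s k 𝒰) {E : Pkt → List Pkt}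
    (hE : ∀ U ∈ 𝒰, Emit L G s k (k + 2) U (E U)) : Base L G s (k + 1) (𝒰.flatMap E) := by
  refine ⟨fun V hV => ?_, fun y hy => ?_, fun y hy => ?_⟩
  · obtain ⟨U, hU, hV⟩ := List.mem_flatMap.1 hV
    exact (hE U hU).good V hV
  · rcases h.inner y hy with h1 | ⟨U, hU, hy⟩
    · exact .inl (Lit.succ h1)
    · rcases (hE U hU).inner y hy with h1 | ⟨V, hV, hy⟩
      exacts [.inl h1, .inr ⟨V, List.mem_flatMap.2 ⟨U, hU, hV⟩, hy⟩]
  · rcases h.outer y hy with h1 | ⟨U, hU, hy⟩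
    · exact .inl (Lit.succ h1)
    · rcases (hE U hU).outer y hy with h1 | ⟨V, hV, hy⟩
      exacts [.inl h1, .inr ⟨V, List.mem_flatMap.2 ⟨U, hU, hV⟩, hy⟩]

theorem wt_flatMap {𝒰 : List Pkt} {E : Pkt → List Pkt}
    (hE : ∀ U ∈ 𝒰, wt (E U) + 1 ≤ U.M.length) : wt (𝒰.flatMap E) + 𝒰.length ≤ wt 𝒰 := by
  induction 𝒰 with
  | nil => simp
  | cons U 𝒰 ih =>
    have h1 := hE U (by simp)
    have h2 := ih fun V hV => hE V (by simp [hV])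
    simp only [List.flatMap_cons, wt_append, List.length_cons, wt_cons]
    omega

end

section
variable {s o : Plane} {k : ℕ} {σ : ℝ} {U V : Pkt} {𝒰 𝒱 : List Pkt}

theorem Base.full (hB : Base L G s k [U]) (hE : Emit L G s k (k + 1) U 𝒱) :
    Full L G s (k + 1) 𝒱 := by
  intro y hy
  rcases hB.outer y hy with h1 | ⟨W, hW, hy⟩
  · exact .inl h1
  · rw [List.mem_singleton.1 hW] at hy
    exact hE.outer y hy

theorem PktOf.rotate {C : Set Plane} (hU : PktOf o C G U) :
    OPoly U.ε (U.b :: (U.a :: U.M)) U.H := by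
  have := OPoly.rotate (A := U.a :: U.M) (B := [U.b]) hU.poly
  simpa using this

theorem PktOf.exists_concat {C : Set Plane} (hU : PktOf o C G U) : ∃ N m, U.M = N ++ [m] := by
  rcases U.M.eq_nil_or_concat with h | ⟨N, m, h⟩
  · have := hU.poly.len
    rw [h] at this
    simp at this
  · exact ⟨N, m, by rw [h, List.concat_eq_append]⟩

theorem Pkt.path_eq {N : List Plane} {m : Plane} (h : U.M = N ++ [m]) :
    U.path = openPath (U.a :: U.M) ∪ openSegment ℝ m U.b := by
  have := openPath_append (U.a :: N) m [U.b]
  rw [openPath_pair] at this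
  rw [Pkt.path, h, ← List.cons_append, ← this]
  simp

theorem PktOf.tail_subset {C : Set Plane} (hU : PktOf o C G U) : openPath (U.a :: U.M) ⊆ C := by
  obtain ⟨N, m, h⟩ := hU.exists_concat
  exact fun y hy => hU.path (by rw [Pkt.path_eq h]; exact .inl hy)

theorem GoodAt.lit_succ (hU : GoodAt L G s k o U) {y : Plane} (hy : openSegment ℝ U.b y ⊆ U.H) :
    y ∈ Lit L G s (k + 1) :=
  Lit.reflect hU.lit hU.pkt.mem (hy.trans hU.pkt.sub)

theorem GoodAt.goodAt (hU : GoodAt L G s k o U)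
    (hO : Out U.b (openPath (U.a :: U.M)) U.H 𝒱) (hV : V ∈ 𝒱) : GoodAt L G s (k + 1) U.b V :=
  (hO.pkt V hV).goodAt hU.pkt.tail_subset hU.pkt.sub fun _ _ hy => hU.lit_succ hy

theorem GoodAt.emit (hU : GoodAt L G s k o U)
    (hO : Out U.b (openPath (U.a :: U.M)) U.H 𝒱) : Emit L G s k (k + 2) U 𝒱 := by
  refine ⟨fun V hV => ⟨_, hU.goodAt hO hV⟩, fun y hy => (hO.inner y hy).imp_left hU.lit_succ,
    fun y hy => ?_⟩
  obtain ⟨N, m, h⟩ := hU.pkt.exists_concat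
  rw [Pkt.path_eq h] at hy
  rcases hy with hy | hy
  · exact (hO.outer y hy).imp_left fun h1 => Lit.succ (hU.lit_succ h1)
  · have hp := hU.pkt.rotate
    rw [h] at hp
    obtain ⟨x, hx, hbx, hxy⟩ := OPoly.exists_relay (A := U.a :: N) (by simpa using hp) hy
    rw [List.cons_append, ← h] at hx
    exact .inl (Lit.reflect (hU.lit_succ hbx) (hU.pkt.tail_subset hx) (hxy.trans hU.pkt.sub))

theorem GoodAt.exists_emit (hU : GoodAt L G s k o U) :
    ∃ 𝒱, Emit L G s k (k + 2) U 𝒱 ∧ wt 𝒱 + 1 ≤ U.M.length := by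
  obtain ⟨N, m, h⟩ := hU.pkt.exists_concat
  obtain ⟨𝒱, hO, hw⟩ := hU.pkt.rotate.exists_out (by simp [h])
  exact ⟨𝒱, hU.emit hO, by simpa using hw⟩

theorem GoodAt.exists_out (hU : GoodAt L G s k o U) :
    ∃ 𝒱, Out U.b (openPath (U.a :: U.M)) U.H 𝒱 ∧ wt 𝒱 + 1 ≤ U.M.length ∧
      (wt 𝒱 + 2 ≤ U.M.length ∨ 𝒱 = [] ∨ ∃ V N, 𝒱 = [V] ∧ V.ε = -U.ε ∧ U.M = N ++ [V.a]) := by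
  obtain ⟨N, m, h⟩ := hU.pkt.exists_concat
  rcases hU.pkt.rotate.exists_out_of_alpha (by simp [h]) hU.pkt.ac with
    ⟨𝒱, hO, hw⟩ | ⟨h1, hO⟩ | ⟨V, -, -, -, -, hO, h1, h2, h3, -⟩
  · simp only [List.length_cons] at hw
    exact ⟨𝒱, hO, by omega, .inl (by omega)⟩
  · exact ⟨[], hO, by simp [h], .inr (.inl rfl)⟩
  · refine ⟨[V], hO, by simp at h1 ⊢; omega, .inr (.inr ⟨V, N, rfl, h2, ?_⟩)⟩
    rw [h, ← List.cons_append, List.getLast?_append] at h3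
    simp at h3
    rw [h, h3]

/-- The points of the last edge of `U` are not hit by a chord of a pocket with pivot at its end. -/
theorem GoodAt.lum_of_last (h : OPoly σ L G) (hU : GoodAt L G s k o U)
    (hO : Out U.b (openPath (U.a :: U.M)) U.H [V]) {N : List Plane} (hN : U.M = N ++ [V.a])
    (hq : ∀ y z q, Chord L G V y z q → V.ε * orient U.b V.a y ≤ 0 → q ∉ U.path →
      q ∈ Lit L G s (k + 1)) : Lum L G s (k + 1) V := by
  have hV := hU.goodAt hO (V := V) (by simp)
  refine hV.lum_of_chord h fun y z q hc hy => ?_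
  by_cases hqU : q ∈ U.path
  · rw [Pkt.path_eq hN] at hqU
    rcases hqU with h1 | h1
    · rcases hO.outer q h1 with h2 | ⟨W, hW, hq⟩
      · exact hU.lit_succ h2
      · rw [List.mem_singleton.1 hW] at hq
        exact absurd hq hc.notMem
    · have := hc.pos hV.pkt hy
      rw [orient_of_mem_openSegment (by rwa [openSegment_symm])] at this
      simp at this
  · exact hq y z q hc hy hqU

/-- The pockets fit for a budget which is smaller by one than that of arbitrary pockets. -/
def Tight (L : List Plane) (G : Set Plane) (s : Plane) (k : ℕ) (𝒰 : List Pkt) : Prop :=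
  𝒰 = [] ∨ 3 ≤ 𝒰.length ∨ (∃ U ∈ 𝒰, Lum L G s k U) ∨ EShape 𝒰 ∧ Full L G s k 𝒰

/-- The state `𝒰` after `k` reflections can be completed with `d` more reflections. -/
def Ready (L : List Plane) (G : Set Plane) (s : Plane) (k d : ℕ) (𝒰 : List Pkt) : Prop :=
  Base L G s k 𝒰 ∧ (wt 𝒰 + 1 ≤ 2 * d ∨ Tight L G s k 𝒰 ∧ wt 𝒰 ≤ 2 * d)

theorem Base.ready_nil (h : Base L G s k []) (d : ℕ) : Ready L G s k d [] :=
  ⟨h, .inr ⟨.inl rfl, by simp⟩⟩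

theorem Base.exists_emit (h : Base L G s k 𝒰) :
    ∃ 𝒱, Base L G s (k + 1) 𝒱 ∧ wt 𝒱 + 𝒰.length ≤ wt 𝒰 := by
  have : ∀ U, ∃ 𝒱, U ∈ 𝒰 → Emit L G s k (k + 2) U 𝒱 ∧ wt 𝒱 + 1 ≤ U.M.length := by
    intro U
    by_cases hU : U ∈ 𝒰
    · obtain ⟨o, ho⟩ := h.good U hU
      obtain ⟨𝒱, h𝒱⟩ := ho.exists_emit
      exact ⟨𝒱, fun _ => h𝒱⟩
    · exact ⟨[], fun h' => absurd h' hU⟩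
  choose E hE using this
  exact ⟨_, h.emit fun U hU => (hE U hU).1, wt_flatMap fun U hU => (hE U hU).2⟩

theorem Base.ready (h : OPoly σ L G) (hB : Base L G s k 𝒰) {d : ℕ} (hd : wt 𝒰 ≤ 2 * d + 1) :
    ∃ 𝒱, Ready L G s (k + 1) d 𝒱 := by
  rcases 𝒰 with _ | ⟨U, _ | ⟨V, 𝒰⟩⟩
  · exact ⟨_, (hB.emit (E := fun _ => []) (by simp)).ready_nil d⟩
  · obtain ⟨o, ho⟩ := hB.good U (by simp)
    obtain ⟨𝒱, hO, hw, h1⟩ := ho.exists_out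
    have hB' : Base L G s (k + 1) 𝒱 := by
      have := hB.emit (E := fun _ => 𝒱) (by simpa using ho.emit hO)
      simpa using this
    simp only [wt_cons, wt_nil] at hd
    rcases h1 with h1 | rfl | ⟨V, N, rfl, -, hN⟩
    · exact ⟨𝒱, hB', .inl (by omega)⟩
    · exact ⟨_, hB'.ready_nil d⟩
    · refine ⟨_, hB', .inr ⟨.inr (.inr (.inl ⟨V, by simp, ho.lum_of_last h hO hN ?_⟩)), by omega⟩⟩
      intro y z q hc _ hq
      rcases hB.outer q hc.q_mem with h1 | ⟨W, hW, hq'⟩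
      · exact h1
      · rw [List.mem_singleton.1 hW] at hq'
        exact absurd hq' hq
  · obtain ⟨𝒱, hB', hw⟩ := hB.exists_emit
    simp only [List.length_cons] at hw
    exact ⟨𝒱, hB', .inl (by omega)⟩

end

theorem exists_door_point {ε : ℝ} {a b m v : Plane} {H : Set Plane} (hm : 0 < ε * orient b a m)
    (hv : 0 < ε * orient m a v) (hav : 0 < ε * orient b a v) (h1 : tri ε b a m ⊆ H)
    (h2 : tri ε m a v ⊆ H) (ham : openSegment ℝ a m ⊆ H) :
    ∃ z ∈ openSegment ℝ a b, openSegment ℝ z m ⊆ H ∧ openSegment ℝ z v ⊆ H ∧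
      ε * orient z m v < 0 := by
  set D := ε * orient b a m with hD
  set B := ε * orient m a v with hB
  set A := ε * orient b a v with hA
  set r := B / (B + A + D) with hr
  have r0 : 0 < r := by positivity
  have r1 : r < 1 := (div_lt_one (by positivity)).2 (by linarith)
  have hrr : r * (B + A + D) = B := by rw [hr]; field_simp
  set z : Plane := AffineMap.lineMap a b r with hz
  have hzd : z ∈ openSegment ℝ a b := mem_openSegment_iff.2 ⟨r, r0, r1, rfl⟩
  set u := r * D / (r * D + B) with hu
  have hp : 0 < r * D + B := by positivity
  have u0 : 0 < u := by positivity
  have u1 : u < 1 := (div_lt_one hp).2 (by linarith)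
  have huu : u * (r * D + B) = r * D := by rw [hu]; field_simp
  set x : Plane := AffineMap.lineMap z v u with hx
  have hzm : ε * orient a m z = r * D := by
    rw [hz, hD]; unfold orient; simp only [lineMap_coord]; ring
  have hvm : ε * orient a m v = -B := by rw [hB]; unfold orient; ring
  have hxm : orient a m x = 0 := by
    have : ε * orient a m x = 0 := by
      rw [hx, orient_lineMap]; linear_combination (1 - u) * hzm + u * hvm - huu
    refine (mul_eq_zero.1 this).resolve_left ?_
    intro h0; rw [hD, h0] at hm; simp at hm
  have hbz : orient b a z = 0 := orient_of_mem_openSegment (by rwa [openSegment_symm])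
  have hbx : ε * orient b a x = u * A := by rw [hx, orient_lineMap, hbz, hA]; ring
  have ham' : a ≠ m := by rintro rfl; rw [hD, orient_right] at hm; simp at hm
  have hxl := eq_lineMap_of_orient ham' hxm
  set l := scal a m x / scal a m m
  have hl : ε * orient b a x = l * D := by
    rw [hxl, orient_lineMap, orient_right, hD]; ring
  have huA : u * A < D := by
    have : u * A * (r * D + B) < D * (r * D + B) := by
      have : u * A * (r * D + B) = r * A * D := by linear_combination A * huu
      rw [this]
      nlinarith [mul_pos r0 hm, mul_pos r0 hv]
    exact lt_of_mul_lt_mul_right this hp.le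
  have l0 : 0 < l := by
    have : 0 < l * D := by rw [← hl, hbx]; positivity
    exact (pos_iff_pos_of_mul_pos this).2 hm
  have l1 : l < 1 := by
    rw [hbx] at hl
    by_contra! h0
    nlinarith
  have hxam : x ∈ openSegment ℝ a m := mem_openSegment_iff.2 ⟨l, l0, l1, hxl.symm⟩
  have hxzv : x ∈ openSegment ℝ z v := mem_openSegment_iff.2 ⟨u, u0, u1, rfl⟩
  refine ⟨z, hzd, ?_, openSegment_subset_of_mem hxzv (ham hxam) ?_ ?_, ?_⟩
  · rw [openSegment_symm]
    refine (openSegment_subset_tri (σ := ε) (q := b) (r := a) ?_ (by rwa [openSegment_symm])).trans ?_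
    · have : orient m b a = orient b a m := by unfold orient; ring
      rwa [this]
    · rwa [← tri_cycle]
  · refine fun w hw => h1 ⟨?_, ?_, ?_⟩
    · exact orient_pos_of_mem_openSegment (by rw [hbz, mul_zero])
        (by rw [hbx]; positivity) hw
    · rw [openSegment_symm] at hw
      exact orient_pos_of_mem_openSegment (by rw [hxm, mul_zero])
        (by rw [hzm]; positivity) hw
    · have e1 : ∀ c : ℝ, ε * orient m b (AffineMap.lineMap a b c) = (1 - c) * D := fun c => by
        rw [hD]; unfold orient; simp only [lineMap_coord]; ring
      have e2 : ε * orient m b (AffineMap.lineMap a m l) = (1 - l) * D := by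
        rw [hD]; unfold orient; simp only [lineMap_coord]; ring
      refine orient_pos_of_mem_openSegment (x := z) (y := x) ?_ ?_ hw
      · rw [hz, e1]; nlinarith
      · rw [hxl, e2]; nlinarith
  · rw [openSegment_symm]
    refine (openSegment_subset_tri (σ := ε) (q := m) (r := a) ?_ (by rwa [openSegment_symm])).trans ?_
    · have : orient v m a = orient m a v := by unfold orient; ring
      rwa [this]
    · rwa [← tri_cycle]
  · have e1 : ε * orient z m x = -((1 - l) * ((1 - r) * 0 + r * D)) := by
      rw [hxl, hz, hD]; unfold orient; simp only [lineMap_coord]; ring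
    have e2 : ε * orient z m x = u * (ε * orient z m v) := by
      rw [hx, orient_lineMap]; unfold orient; ring
    have : ε * orient z m x < 0 := by
      rw [e1]; nlinarith [mul_pos (sub_pos.2 l1) (mul_pos r0 hm)]
    rw [e2] at this
    by_contra! h0
    nlinarith [mul_nonneg u0.le h0]

section
variable {s o : Plane} {k : ℕ} {σ τ : ℝ}

theorem exists_out_pair (h : OPoly σ L G) {w : Plane} {A B : List Plane} {G₁ G₂ : Set Plane}
    (h₁ : OPoly τ (o :: (A ++ [w])) G₁) (hα : Alpha τ o (A ++ [w])) (hA : A ≠ [])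
    (h₂ : OPoly τ (o :: w :: B) G₂) (hB : B ≠ []) (hC₁ : openPath (A ++ [w]) ⊆ openCycle L)
    (hC₂ : openPath (w :: B) ⊆ openCycle L) (hG₁ : G₁ ⊆ G) (hG₂ : G₂ ⊆ G) (hd : Disjoint G₁ G₂)
    (hl₁ : ∀ y ∈ openPath (A ++ [w]) ∪ G₁, openSegment ℝ o y ⊆ G₁ → y ∈ Lit L G s k)
    (hl₂ : ∀ y ∈ openPath (w :: B) ∪ G₂, openSegment ℝ o y ⊆ G₂ → y ∈ Lit L G s k) :
    ∃ 𝒰 𝒱, Out o (openPath (A ++ [w])) G₁ 𝒰 ∧ Out o (openPath (w :: B)) G₂ 𝒱 ∧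
      wt (𝒰 ++ 𝒱) + 2 ≤ A.length + B.length ∧ (wt (𝒰 ++ 𝒱) + 3 ≤ A.length + B.length ∨
        (Full L G s k (𝒰 ++ 𝒱) → Tight L G s k (𝒰 ++ 𝒱))) := by
  have hA' := List.length_pos_iff.2 hA
  have hB' := List.length_pos_iff.2 hB
  rcases h₂.exists_out_tight (by simp; omega) with ⟨𝒱, hV, hw₂⟩ | ⟨𝒱, hV, hw₂, hcase⟩
  · obtain ⟨𝒰, hU, hw₁⟩ := h₁.exists_out (by simp; omega)
    refine ⟨𝒰, 𝒱, hU, hV, ?_, .inl ?_⟩ <;> simp at hw₁ hw₂ ⊢ <;> omega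
  rcases h₁.exists_out_of_alpha (by simp; omega) hα with
    ⟨𝒰, hU, hw₁⟩ | ⟨hlen, hU⟩ | ⟨U, -, -, -, -, hU, hw₁, hε, hlast, -⟩
  · refine ⟨𝒰, 𝒱, hU, hV, ?_, .inl ?_⟩ <;> simp at hw₁ hw₂ ⊢ <;> omega
  · refine ⟨[], 𝒱, hU, hV, by simp at hw₂ ⊢; omega, .inr fun hf => ?_⟩
    rw [List.nil_append] at hf ⊢
    rcases hcase with rfl | ⟨V, rfl, -⟩ | hE
    · exact .inl rfl
    · refine .inr (.inr (.inl ⟨V, by simp, ((hV.pkt V (by simp)).goodAt hC₂ hG₂ hl₂).lum_of_full h hf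
        fun W hW => .inl (by simpa using hW)⟩))
    · exact .inr (.inr (.inr ⟨hE, hf⟩))
  · refine ⟨[U], 𝒱, hU, hV, by simp at hw₁ hw₂ ⊢; omega, .inr fun hf => ?_⟩
    have hUg := (hU.pkt U (by simp)).goodAt hC₁ hG₁ hl₁
    rcases hcase with rfl | ⟨V, rfl, hV'⟩ | ⟨V₁, V₂, -, -, -, -, rfl, -⟩
    · refine .inr (.inr (.inl ⟨U, by simp, hUg.lum_of_full h hf
        fun W hW => .inl (by simpa using hW)⟩))
    · have hVg := (hV.pkt V (by simp)).goodAt hC₂ hG₂ hl₂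
      refine .inr (.inr (.inl ⟨U, by simp, hUg.lum_of_full h hf fun W hW => ?_⟩))
      simp only [List.cons_append, List.nil_append, List.mem_cons, List.not_mem_nil, or_false] at hW
      refine hW.imp_right ?_
      rintro rfl
      refine ⟨hVg, (hd.mono (hU.pkt U (by simp)).sub (hV.pkt W (by simp)).sub), ?_⟩
      rintro ⟨h3, h4⟩
      rcases hV' with ⟨-, h5⟩ | ⟨h5, -⟩
      · simp at hlast h5
        rw [← h5, ← hlast, orient_right] at h3
        simp at h3
      · have : orient o W.a U.a = -orient o U.a W.a := by unfold orient; ring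
        rw [h5, this] at h4
        rw [hε] at h3
        linarith
    · exact .inr (.inl (by simp))

end

theorem Alpha.take {τ : ℝ} {o w : Plane} {A B : List Plane} (h : Alpha τ o (A ++ w :: B)) :
    Alpha τ o (A ++ [w]) := by
  intro a c N hN
  refine h a c (N ++ B) ?_
  have : A ++ w :: B = (A ++ [w]) ++ B := by simp
  rw [this, hN]
  rfl

section
variable {s o : Plane} {k : ℕ} {σ : ℝ} {U V : Pkt} {𝒰 𝒱 : List Pkt}

theorem GoodAt.emit_of_lum (h : OPoly σ L G) (hU : GoodAt L G s k o U) (hl : Lum L G s k U)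
    (hO : Out U.b (openPath (U.a :: U.M)) U.H 𝒱) : Emit L G s k (k + 1) U 𝒱 := by
  refine ⟨(hU.emit hO).good, (hU.emit hO).inner, fun y hy => ?_⟩
  obtain ⟨N, m, hM⟩ := hU.pkt.exists_concat
  have hy' := hy
  rw [Pkt.path_eq hM] at hy
  rcases hy with hy | hy
  · exact (hO.outer y hy).imp_left hU.lit_succ
  · have hp := hU.pkt.poly
    rw [hM] at hp
    have hp : OPoly U.ε (U.a :: N ++ [m, U.b]) U.H := by simpa using hp
    obtain ⟨f, hf, hb⟩ := hU.pkt.mem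
    obtain ⟨z, hz, hzy⟩ := hp.exists_corner (h.corner_convex hp hU.pkt.sub hf hb hU.pkt.door) hy
    exact .inl (hl y (.inr hy') z hz hzy)

theorem GoodAt.emit_nil (h : OPoly σ L G) (hU : GoodAt L G s k o U) (hl : Lum L G s k U)
    (hM : U.M.length = 1) : Emit L G s k (k + 1) U [] :=
  hU.emit_of_lum h hl (hU.pkt.rotate.triangle_out (by simp [hM]))

theorem GoodAt.exists_emit_of_lum (h : OPoly σ L G) (hU : GoodAt L G s k o U) (hl : Lum L G s k U)
    (hM : 2 ≤ U.M.length) : ∃ 𝒱, Emit L G s k (k + 1) U 𝒱 ∧ wt 𝒱 + 2 ≤ U.M.length ∧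
      (wt 𝒱 + 3 ≤ U.M.length ∨ (Full L G s (k + 1) 𝒱 → Tight L G s (k + 1) 𝒱)) := by
  obtain ⟨N, m, hN⟩ := hU.pkt.exists_concat
  have hN0 : N ≠ [] := by rintro rfl; simp [hN] at hM
  have hp := hU.pkt.poly
  have hr := hU.pkt.rotate
  have hac := hU.pkt.ac
  obtain ⟨w, hw, hw0, hwt, hw1, hw2⟩ := hp.apex
  by_cases hwm : w = m
  · subst hwm
    obtain ⟨n, N', rfl⟩ := List.exists_cons_of_ne_nil hN0
    have hedge : (U.a, n) ∈ cycEdges (U.a :: U.M ++ [U.b]) := by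
      rw [hN]
      simpa using mem_cycEdges_mid [] (N' ++ [w, U.b]) U.a n
    have hnd := hp.nodup
    have haw : openSegment ℝ U.a w ⊆ U.H := by
      refine hw1.resolve_right fun h1 => ?_
      have h2 := cycEdges_fst_inj hnd h1 hedge rfl
      rw [hN] at hnd
      simp at h2 hnd
      exact hnd.2.1.2.1 h2.symm
    have hp' : OPoly U.ε (U.a :: (n :: N') ++ w :: [U.b]) U.H := by
      rw [hN] at hp; simpa using hp
    obtain ⟨G₁, -, h₁, -, hG₁, -⟩ := hp'.split (by simp) (by simp) haw
    obtain ⟨v, hv, hv0, hvt, hv1, -⟩ := h₁.apex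
    have hvn : openSegment ℝ U.a v ⊆ U.H ∨ v = n := by
      refine hv1.imp (·.trans hG₁) fun h1 => ?_
      have := cycEdges_fst_inj h₁.nodup h1 (f := (U.a, n))
        (by simpa using mem_cycEdges_mid [] (N' ++ [w]) U.a n) rfl
      exact congrArg Prod.snd this
    rw [hN] at hr hac
    have hav := OPoly.pos_of_alpha hr hac hvn
    obtain ⟨z, hz, hzw, hzv, hneg⟩ := exists_door_point hw0 hv0 hav hwt (hvt.trans hG₁) haw
    have hz' : OPoly U.ε (z :: ((U.a :: n :: N') ++ w :: [U.b])) U.H := by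
      have h1 := OPoly.insert_vertex (A := []) hr (x := z) (by rwa [openSegment_symm])
      have h2 := OPoly.rotate (A := [U.b]) (B := z :: U.a :: (n :: N' ++ [w])) h1
      simpa using h2
    have hpath : openPath ((U.a :: n :: N') ++ w :: [U.b]) = U.path := by
      rw [Pkt.path, hN]; simp
    obtain ⟨K₁, K₂, k₁, k₂, hK₁, -, -, hcov, happ⟩ := hz'.split_out (by simp) (by simp) hzw
    have hzv' : openSegment ℝ z v ⊆ K₁ := by
      intro x hx
      have hxn : U.ε * orient z w x < 0 := by
        have := orient_pos_of_mem_openSegment (p := z) (q := w) (σ := -U.ε) (x := z) (y := v)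
          (by simp) (by linarith) hx
        linarith
      rcases hcov x (hzv hx) with h1 | h1 | h1
      · exact h1
      · have := (k₂.toPolyInt.triangle k₂.sign (k₂.sides _ (mem_cycEdges_mid [] [U.b] z w))).2
        rw [this] at h1
        linarith [h1.1]
      · rw [orient_of_mem_openSegment h1] at hxn
        simp at hxn
    obtain ⟨N₁, N₂, hNv⟩ := List.append_of_mem hv
    rw [hNv] at k₁ happ hN hac hpath
    have k₁' : OPoly U.ε (z :: ((U.a :: N₁) ++ v :: (N₂ ++ [w]))) K₁ := by simpa using k₁
    obtain ⟨H₁, H₂, h₁, h₂, hH₁, hH₂, hd, -, happ'⟩ := k₁'.split_out (by simp) (by simp) hzv'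
    have hα : Alpha U.ε z ((U.a :: N₁) ++ [v]) := by
      refine Alpha.take (B := N₂ ++ [w]) ?_
      intro a c N hN'
      have h1 := hac a c N (by rw [← hN']; simp)
      obtain rfl : U.a = a := by simp at hN'; exact hN'.1
      have := orient_pos_of_mem_openSegment (p := U.a) (q := c) (σ := U.ε) (x := U.a) (y := U.b)
          (by simp) (by
            have : orient U.a c U.b = orient U.b U.a c := by unfold orient; ring
            rwa [this]) hz
      have h2 : orient z U.a c = orient U.a c z := by unfold orient; ring
      rwa [h2]
    have hsub : openPath ((U.a :: N₁) ++ v :: (N₂ ++ [w])) ⊆ U.path := by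
      rw [← hpath]
      have := openPath_append (U.a :: (N₁ ++ v :: N₂)) w [U.b]
      intro y hy
      rw [this]
      left
      simpa using hy
    have hs₁ : openPath ((U.a :: N₁) ++ [v]) ⊆ U.path := fun y hy =>
      hsub (by rw [openPath_append]; exact .inl hy)
    have hs₂ : openPath (v :: (N₂ ++ [w])) ⊆ U.path := fun y hy =>
      hsub (by rw [openPath_append]; exact .inr hy)
    have hlit : ∀ y ∈ U.path ∪ U.H, openSegment ℝ z y ⊆ U.H → y ∈ Lit L G s (k + 1) :=
      fun y hy h1 => hl y hy.symm z hz h1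
    obtain ⟨𝒰, 𝒱, hO₁, hO₂, hwt, hcase⟩ := exists_out_pair h h₁ hα (by simp) h₂ (by simp)
      (hs₁.trans hU.pkt.path) (hs₂.trans hU.pkt.path) ((hH₁.trans hK₁).trans hU.pkt.sub)
      ((hH₂.trans hK₁).trans hU.pkt.sub) hd
      (fun y hy h1 => hlit y (union_subset_union hs₁ (hH₁.trans hK₁) hy) (h1.trans (hH₁.trans hK₁)))
      (fun y hy h1 => hlit y (union_subset_union hs₂ (hH₂.trans hK₁) hy) (h1.trans (hH₂.trans hK₁)))
    have hO := happ _ _ (by simpa using happ' _ _ hO₁ hO₂) (k₂.triangle_out rfl)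
    rw [List.append_nil] at hO
    have hOp : Out z U.path U.H (𝒰 ++ 𝒱) := by rwa [← hpath]
    refine ⟨𝒰 ++ 𝒱, ⟨fun V hV => ⟨z, (hOp.pkt V hV).goodAt hU.pkt.path hU.pkt.sub hlit⟩,
      fun y hy => (hOp.inner y hy).imp_left (hlit y (.inr hy)),
      fun y hy => (hOp.outer y hy).imp_left (hlit y (.inl hy))⟩, ?_, ?_⟩
    · rw [hN]; simp at hwt ⊢; omega
    · refine hcase.imp_left fun h1 => ?_
      rw [hN]; simp at h1 ⊢; omega
  · have hwb : openSegment ℝ U.b w ⊆ U.H := by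
      rw [openSegment_symm]
      refine hw2.resolve_right fun h1 => hwm ?_
      have := cycEdges_snd_inj hp.nodup h1 (f := (m, U.b)) (by
        rw [hN]
        simpa using mem_cycEdges_mid (U.a :: N) [] m U.b) rfl
      exact congrArg Prod.fst this
    obtain ⟨A, B, hAB⟩ := List.append_of_mem hw
    have hB : B ≠ [] := by
      rintro rfl
      rw [hN] at hAB
      exact hwm (by simpa using (List.append_inj' hAB rfl).2.symm)
    have hr' : OPoly U.ε (U.b :: ((U.a :: A) ++ w :: B)) U.H := by rw [hAB] at hr; simpa using hr
    obtain ⟨H₁, H₂, h₁, h₂, hH₁, hH₂, hd, -, happ⟩ := hr'.split_out (by simp) hB hwb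
    have hsub := hU.pkt.tail_subset
    have hcons : U.a :: U.M = (U.a :: A) ++ w :: B := by rw [hAB]; simp
    rw [hcons] at hac hsub
    rw [openPath_append] at hsub
    obtain ⟨𝒰, 𝒱, hO₁, hO₂, hwt, hcase⟩ := exists_out_pair h h₁ hac.take (by simp) h₂ hB
      (subset_union_left.trans hsub) (subset_union_right.trans hsub) (hH₁.trans hU.pkt.sub)
      (hH₂.trans hU.pkt.sub) hd
      (fun y _ h1 => hU.lit_succ (h1.trans hH₁)) (fun y _ h1 => hU.lit_succ (h1.trans hH₂))
    have hO := happ _ _ hO₁ hO₂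
    rw [← hcons] at hO
    refine ⟨_, hU.emit_of_lum h hl hO, ?_, hcase.imp_left fun h1 => ?_⟩
    · rw [hAB]; simp at hwt ⊢; omega
    · rw [hAB]; simp at h1 ⊢; omega

end

section
variable {s o o' : Plane} {k d : ℕ} {σ : ℝ} {U V W : Pkt} {𝒰 𝒱 : List Pkt}

theorem Base.swap (h : Base L G s k [U, V]) : Base L G s k [V, U] := by
  have : ∀ W, W ∈ [U, V] → W ∈ [V, U] := fun W hW => by simpa [or_comm] using hW
  exact ⟨fun W hW => h.good W (by simpa [or_comm] using hW),
    fun y hy => (h.inner y hy).imp_right fun ⟨W, hW, h1⟩ => ⟨W, this W hW, h1⟩,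
    fun y hy => (h.outer y hy).imp_right fun ⟨W, hW, h1⟩ => ⟨W, this W hW, h1⟩⟩

theorem Base.emit_pair (h : Base L G s k [U, V]) (hU : Emit L G s k (k + 2) U 𝒰)
    (hV : Emit L G s k (k + 2) V 𝒱) : Base L G s (k + 1) (𝒰 ++ 𝒱) := by
  refine ⟨fun W hW => (List.mem_append.1 hW).elim (hU.good W) (hV.good W), fun y hy => ?_,
    fun y hy => ?_⟩
  · rcases h.inner y hy with h1 | ⟨W, hW, h1⟩
    · exact .inl (Lit.succ h1)
    · rcases List.mem_pair.1 hW with rfl | rfl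
      · exact (hU.inner y h1).imp_right fun ⟨T, hT, h2⟩ => ⟨T, List.mem_append_left _ hT, h2⟩
      · exact (hV.inner y h1).imp_right fun ⟨T, hT, h2⟩ => ⟨T, List.mem_append_right _ hT, h2⟩
  · rcases h.outer y hy with h1 | ⟨W, hW, h1⟩
    · exact .inl (Lit.succ h1)
    · rcases List.mem_pair.1 hW with rfl | rfl
      · exact (hU.outer y h1).imp_right fun ⟨T, hT, h2⟩ => ⟨T, List.mem_append_left _ hT, h2⟩
      · exact (hV.outer y h1).imp_right fun ⟨T, hT, h2⟩ => ⟨T, List.mem_append_right _ hT, h2⟩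

theorem Base.emit_single (h : Base L G s k [U]) (hU : Emit L G s k (k + 2) U 𝒱) :
    Base L G s (k + 1) 𝒱 := by
  simpa using h.emit (E := fun _ => 𝒱) (by simpa using hU)

theorem GoodAt.length_pos (hU : GoodAt L G s k o U) : 1 ≤ U.M.length := by
  obtain ⟨N, m, h⟩ := hU.pkt.exists_concat
  simp [h]

theorem Base.ready_of_lum_single (h : OPoly σ L G) (hB : Base L G s k [U]) (hl : Lum L G s k U)
    (hd : U.M.length ≤ 2 * (d + 1)) : ∃ 𝒱, Ready L G s (k + 1) d 𝒱 := by
  obtain ⟨o, hU⟩ := hB.good U (by simp)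
  rcases hU.length_pos.eq_or_lt with h1 | h1
  · exact ⟨_, (hB.emit_single (hU.emit_nil h hl h1.symm).mono).ready_nil d⟩
  · obtain ⟨𝒱, hE, hw, h2⟩ := hU.exists_emit_of_lum h hl h1
    refine ⟨𝒱, hB.emit_single hE.mono, ?_⟩
    rcases h2 with h2 | h2
    · exact .inl (by omega)
    · exact .inr ⟨h2 (hB.full hE), by omega⟩

theorem Base.ready_of_lum_pair (h : OPoly σ L G) (hB : Base L G s k [U, V]) (hl : Lum L G s k U)
    (hd : U.M.length + V.M.length ≤ 2 * (d + 1)) : ∃ 𝒱, Ready L G s (k + 1) d 𝒱 := by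
  obtain ⟨o, hU⟩ := hB.good U (by simp)
  obtain ⟨o', hV⟩ := hB.good V (by simp)
  rcases hU.length_pos.eq_or_lt with h1 | h1
  · have hE := hU.emit_nil h hl h1.symm
    obtain ⟨𝒱, hO, hw, hcase⟩ := hV.exists_out
    have hB' := hB.emit_pair hE.mono (hV.emit hO)
    rw [List.nil_append] at hB'
    rcases hcase with h2 | rfl | ⟨W, N, rfl, -, hN⟩
    · exact ⟨𝒱, hB', .inl (by omega)⟩
    · exact ⟨_, hB'.ready_nil d⟩
    · refine ⟨_, hB', .inr ⟨.inr (.inr (.inl ⟨W, by simp, hV.lum_of_last h hO hN ?_⟩)), by omega⟩⟩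
      intro y z q hc _ hq
      rcases hB.outer q hc.q_mem with h3 | ⟨T, hT, h3⟩
      · exact h3
      · rcases List.mem_pair.1 hT with rfl | rfl
        · exact (hE.outer q h3).resolve_right (by simp)
        · exact absurd h3 hq
  · obtain ⟨𝒰, hE, hw, -⟩ := hU.exists_emit_of_lum h hl h1
    obtain ⟨𝒱, hE', hw'⟩ := hV.exists_emit
    exact ⟨_, hB.emit_pair hE.mono hE', .inl (by rw [wt_append]; omega)⟩

theorem GoodAt.lum_of_pair (h : OPoly σ L G) (hU : GoodAt L G s k o U) (hV : GoodAt L G s k o' V)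
    (hd : Disjoint U.H V.H) (hf : ∀ y ∈ openCycle L, y ∈ Lit L G s k ∨ y ∈ U.path ∨ y ∈ V.path)
    (hO : Out U.b (openPath (U.a :: U.M)) U.H [W]) (hW : W.ε = -U.ε) {N N' : List Plane} {v : Plane}
    (hN : U.M = N ++ [W.a]) (hO' : Out V.b (openPath (V.a :: V.M)) V.H 𝒱) (hN' : V.M = N' ++ [v])
    (h𝒱 : ∀ T ∈ 𝒱, T.ε = -V.ε ∧ T.a = v)
    (hc : ∃ c > 0, ∀ q, U.ε * orient U.b W.a q = c * (V.ε * orient V.b v q)) :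
    Lum L G s (k + 1) W := by
  obtain ⟨c, c0, hc⟩ := hc
  refine hU.lum_of_last h hO hN fun y z q hch hy hq => ?_
  have hWg := hU.goodAt hO (V := W) (by simp)
  have hpos := hch.pos hWg.pkt hy
  rw [hW, neg_mul, hc] at hpos
  rcases hf q hch.q_mem with h1 | h1 | h1
  · exact Lit.succ h1
  · exact absurd h1 hq
  rw [Pkt.path_eq hN'] at h1
  rcases h1 with h1 | h1
  · rcases hO'.outer q h1 with h2 | ⟨T, hT, h2⟩
    · exact hV.lit_succ h2
    · by_contra hn
      have hTg := hV.goodAt hO' hT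
      obtain ⟨-, -, -, h3, -⟩ := hch.exists_cross h hWg.pkt hTg
        (hd.mono (hO.pkt W (by simp)).sub (hO'.pkt T hT).sub) h2 hn
      rw [(h𝒱 T hT).1, (h𝒱 T hT).2] at h3
      nlinarith
  · rw [orient_of_mem_openSegment (by rwa [openSegment_symm])] at hpos
    simp at hpos

theorem Base.ready_of_eShape (h : OPoly σ L G) (hB : Base L G s k 𝒰) (hE : EShape 𝒰)
    (hf : Full L G s k 𝒰) (hd : wt 𝒰 ≤ 2 * (d + 1)) : ∃ 𝒱, Ready L G s (k + 1) d 𝒱 := by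
  obtain ⟨U, V, A, B, u, v, rfl, hA, hB', huv, hUb, hVb, hε, hdis⟩ := hE
  obtain ⟨o, hU⟩ := hB.good U (by simp)
  obtain ⟨o', hV⟩ := hB.good V (by simp)
  obtain ⟨𝒲, hO, hw, hcase⟩ := hU.exists_out
  obtain ⟨𝒳, hO', hw', hcase'⟩ := hV.exists_out
  have hB1 := hB.emit_pair (hU.emit hO) (hV.emit hO')
  simp only [wt_cons, wt_nil] at hd
  have hc : ∃ c > 0, ∀ q, U.ε * orient U.b u q = c * (V.ε * orient V.b v q) := by
    obtain ⟨r, r0, r1, hr⟩ := mem_openSegment_iff.1 hUb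
    obtain ⟨t, t0, t1, ht⟩ := mem_openSegment_iff.1 hVb
    have : 0 < t * (1 - r) := mul_pos t0 (by linarith)
    refine ⟨r / (t * (1 - r)), by positivity, fun q => ?_⟩
    have e1 : orient U.b u q = -r * orient u v q := by
      rw [← hr]; unfold orient; simp only [lineMap_coord]; ring
    have e2 : orient V.b v q = t * (1 - r) * orient u v q := by
      rw [← ht, ← hr]; unfold orient; simp only [lineMap_coord]; ring
    rw [e1, e2, hε]
    have h1 : (1 - r) ≠ 0 := by linarith
    field_simp
  have hf' : ∀ y ∈ openCycle L, y ∈ Lit L G s k ∨ y ∈ U.path ∨ y ∈ V.path := fun y hy =>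
    (hf y hy).imp_right fun ⟨T, hT, h1⟩ => by
      rcases List.mem_pair.1 hT with rfl | rfl
      exacts [.inl h1, .inr h1]
  have hlast : ∀ {T : Pkt} {M N C : List Plane} {w : Plane}, M = C ++ [w] → M = N ++ [T.a] →
      T.a = w := fun h1 h2 => by simpa using (List.append_inj' (h2.symm.trans h1) rfl).2
  rcases hcase with h1 | hcase
  · exact ⟨_, hB1, .inl (by rw [wt_append]; omega)⟩
  rcases hcase' with h2 | hcase'
  · exact ⟨_, hB1, .inl (by rw [wt_append]; omega)⟩
  refine ⟨_, hB1, .inr ⟨?_, by rw [wt_append]; omega⟩⟩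
  have h𝒲 : ∀ T ∈ 𝒲, T.ε = -U.ε ∧ T.a = u := by
    rcases hcase with rfl | ⟨T, N, rfl, h3, h4⟩
    · simp
    · simpa using ⟨h3, hlast hA h4⟩
  have h𝒳 : ∀ T ∈ 𝒳, T.ε = -V.ε ∧ T.a = v := by
    rcases hcase' with rfl | ⟨T, N, rfl, h3, h4⟩
    · simp
    · simpa using ⟨h3, hlast hB' h4⟩
  rcases hcase with rfl | ⟨T, N, rfl, h3, h4⟩
  · rcases hcase' with rfl | ⟨T, N, rfl, h3, h4⟩
    · exact .inl rfl
    · refine .inr (.inr (.inl ⟨T, by simp, hV.lum_of_pair h hU hdis.symm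
        (fun y hy => (hf' y hy).imp_right Or.symm) hO' h3 h4 hO hA h𝒲 ?_⟩))
      obtain ⟨c, c0, hc⟩ := hc
      refine ⟨c⁻¹, by positivity, fun q => ?_⟩
      rw [hlast hB' h4, hc]
      field_simp
  · refine .inr (.inr (.inl ⟨T, by simp, hU.lum_of_pair h hV hdis hf' hO h3 h4 hO' hB' h𝒳 ?_⟩))
    rwa [hlast hA h4]

theorem Ready.step (h : OPoly σ L G) (hR : Ready L G s k (d + 1) 𝒰) :
    ∃ 𝒱, Ready L G s (k + 1) d 𝒱 := by
  obtain ⟨hB, hw | ⟨rfl | h3 | ⟨U, hU, hl⟩ | ⟨hE, hf⟩, hw⟩⟩ := hR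
  · exact hB.ready h (by omega)
  · exact hB.ready h (by simp)
  · obtain ⟨𝒱, hB', hw'⟩ := hB.exists_emit
    exact ⟨𝒱, hB', .inl (by omega)⟩
  · match 𝒰, hB, hU, hw with
    | [T], hB, hU, hw =>
      obtain rfl : U = T := by simpa using hU
      exact hB.ready_of_lum_single h hl (by simpa using hw)
    | [T, T'], hB, hU, hw =>
      simp only [wt_cons, wt_nil] at hw
      rcases List.mem_pair.1 hU with rfl | rfl
      · exact hB.ready_of_lum_pair h hl (by omega)
      · exact hB.swap.ready_of_lum_pair h hl (by omega)
    | T :: T' :: T'' :: 𝒰', hB, hU, hw =>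
      obtain ⟨𝒱, hB', hw'⟩ := hB.exists_emit
      simp only [List.length_cons] at hw'
      exact ⟨𝒱, hB', .inl (by omega)⟩
  · exact hB.ready_of_eShape h hE hf hw

theorem Ready.lit (h : OPoly σ L G) (hR : Ready L G s k d 𝒰) {y : Plane} (hy : y ∈ G) :
    y ∈ Lit L G s (k + d) := by
  induction d generalizing k 𝒰 with
  | zero =>
    obtain ⟨hB, hw⟩ := hR
    refine (hB.inner y hy).resolve_right ?_
    rintro ⟨U, hU, -⟩
    obtain ⟨o, ho⟩ := hB.good U hU
    have h1 := ho.length_pos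
    have h2 : U.M.length ≤ wt 𝒰 := List.single_le_sum (by simp) _ (List.mem_map_of_mem hU)
    omega
  | succ d ih =>
    obtain ⟨𝒱, hR'⟩ := hR.step h
    have := ih hR'
    rwa [Nat.add_right_comm] at this

end

section
variable {s p q x : Plane} {σ τ : ℝ} {X Y : List Plane} {K : Set Plane} {C : Set Plane} {𝒰 : List Pkt}

theorem Out.base (hO : Out s C G 𝒰) (hC : C ⊆ openCycle L)
    (hC' : ∀ y ∈ openCycle L, y ∈ C ∨ openSegment ℝ s y ⊆ G) :
    Base L G s 0 𝒰 ∧ Full L G s 0 𝒰 := by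
  have hf : Full L G s 0 𝒰 := fun y hy => (hC' y hy).elim (hO.outer y) .inl
  exact ⟨⟨fun U hU => ⟨s, (hO.pkt U hU).goodAt hC subset_rfl fun _ _ h => h⟩, hO.inner,
    fun y hy => (hf y hy).imp_left Lit.succ⟩, hf⟩

theorem OPoly.insert_last (h : OPoly τ (p :: X ++ [q]) K) (hs : s ∈ openSegment ℝ p q) :
    OPoly τ (s :: (p :: X ++ [q])) K := by
  have h1 := OPoly.rotate (A := p :: X) (B := [q]) h
  have h2 := OPoly.insert_vertex (A := []) (B := X) (u := q) (v := p) (by simpa using h1)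
    (x := s) (by rwa [openSegment_symm])
  have h3 := OPoly.rotate (A := [q]) (B := s :: p :: X) h2
  simpa using h3

theorem OPoly.exists_out_of_mem_last (h : OPoly τ (p :: X ++ [q]) K) (hs : s ∈ openSegment ℝ p q) :
    ∃ 𝒰, Out s (openPath (p :: X ++ [q])) K 𝒰 ∧ wt 𝒰 + 1 ≤ X.length := by
  obtain ⟨w, hw, h0, hwt, -⟩ := h.apex
  have hsw : openSegment ℝ s w ⊆ K := by
    rw [openSegment_symm]
    refine (openSegment_subset_tri (σ := τ) (p := w) (q := q) (r := p) ?_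
      (by rwa [openSegment_symm])).trans ?_
    · have : orient w q p = orient q p w := by unfold orient; ring
      rwa [this]
    · rwa [← tri_cycle]
  obtain ⟨A, B, rfl⟩ := List.append_of_mem hw
  have h' : OPoly τ (s :: ((p :: A) ++ w :: (B ++ [q]))) K := by simpa using h.insert_last hs
  obtain ⟨G₁, G₂, h₁, h₂, -, -, -, -, happ⟩ := h'.split_out (by simp) (by simp) hsw
  obtain ⟨𝒰, hU, hw₁⟩ := h₁.exists_out (by simp)
  obtain ⟨𝒱, hV, hw₂⟩ := h₂.exists_out (by simp)
  refine ⟨_, by simpa using happ _ _ hU hV, ?_⟩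
  simp at hw₁ hw₂ ⊢
  omega

/-- The pockets of a region with a vertex `x` in the relative interior of an edge. -/
theorem OPoly.exists_out_half {X₁ X₂ : List Plane} (h : OPoly σ L G)
    (hK : OPoly τ (s :: (p :: X₁ ++ q :: (X₂ ++ [x]))) K) (hKG : K ⊆ G)
    (hC : openPath (p :: X₁ ++ q :: (X₂ ++ [x])) ⊆ openCycle L) (hx : x ∈ openCycle L)
    (hq : openSegment ℝ s q ⊆ K) (hsx : openSegment ℝ s x ⊆ G) :
    ∃ 𝒰, Out s (openPath (p :: X₁ ++ q :: (X₂ ++ [x]))) K 𝒰 ∧ wt 𝒰 ≤ X₁.length + X₂.length ∧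
      (wt 𝒰 + 1 ≤ X₁.length + X₂.length ∨ 𝒰 = [] ∨
      (∃ U, 𝒰 = [U] ∧ (U.ε = τ ∧ U.a = p ∨ U.ε = -τ ∧ U.a = q ∨ U.ε = τ ∧ U.a = q ∧
        ∃ A u N, U.M = A ++ [u] ∧ X₂.reverse ++ [q] = u :: N ∧ U.b ∈ openSegment ℝ u x)) ∨
      2 ≤ 𝒰.length ∧ (Full L G s 0 𝒰 → Tight L G s 0 𝒰)) := by
  have hα : Alpha (-τ) s (x :: (X₂.reverse ++ [q])) := by
    intro a c N hN
    obtain ⟨rfl, hN'⟩ := List.cons.inj hN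
    have hrev : q :: X₂ = N.reverse ++ [c] := by simpa using congrArg List.reverse hN'
    obtain ⟨f, hf, hxf⟩ := hx
    have hK' : OPoly τ (s :: (p :: X₁ ++ N.reverse) ++ [c, x]) K := by
      have : p :: X₁ ++ q :: (X₂ ++ [x]) = p :: X₁ ++ N.reverse ++ [c, x] := by
        have : q :: (X₂ ++ [x]) = (q :: X₂) ++ [x] := rfl
        rw [this, hrev]; simp
      rw [this] at hK
      simpa using hK
    have := h.corner_convex hK' hKG hf hxf hsx
    have e : orient s x c = -orient x s c := by unfold orient; ring
    rw [e]
    linarith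
  obtain ⟨G₁, G₂, h₁, h₂, hG₁, hG₂, hd, -, happ⟩ := hK.split_out (by simp) (by simp) hq
  have hr := OPoly.reverse_tail h₂
  have hrev : (q :: (X₂ ++ [x])).reverse = x :: (X₂.reverse ++ [q]) := by simp
  rw [hrev] at hr
  have hOr : ∀ {𝒱}, Out s (openPath (x :: (X₂.reverse ++ [q]))) G₂ 𝒱 →
      Out s (openPath (q :: (X₂ ++ [x]))) G₂ 𝒱 := fun h1 => by
    rwa [← hrev, openPath_reverse] at h1
  rw [openPath_append] at hC
  have hgood₁ : ∀ {𝒰 : List Pkt} {U}, Out s (openPath (p :: X₁ ++ [q])) G₁ 𝒰 → U ∈ 𝒰 →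
      GoodAt L G s 0 s U := fun hO hU => (hO.pkt _ hU).goodAt (subset_union_left.trans hC)
    (hG₁.trans hKG) fun _ _ h1 => h1.trans (hG₁.trans hKG)
  have hgood₂ : ∀ {𝒰 : List Pkt} {U}, Out s (openPath (q :: (X₂ ++ [x]))) G₂ 𝒰 → U ∈ 𝒰 →
      GoodAt L G s 0 s U := fun hO hU => (hO.pkt _ hU).goodAt (subset_union_right.trans hC)
    (hG₂.trans hKG) fun _ _ h1 => h1.trans (hG₂.trans hKG)
  have hql : (p :: X₁ ++ [q]).getLast? = some q := by rw [List.getLast?_append]; simp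
  rcases h₁.exists_out_tight (by simp) with ⟨𝒰, hU, hw₁⟩ | ⟨𝒰, hU, hw₁, hcase⟩
  · obtain ⟨𝒱, hV, hw₂⟩ := h₂.exists_out (by simp)
    refine ⟨_, happ _ _ hU hV, ?_, .inl ?_⟩ <;> simp at hw₁ hw₂ ⊢ <;> omega
  rcases hr.exists_out_of_alpha (by simp) hα with
    ⟨𝒱, hV, hw₂⟩ | ⟨hlen, hV⟩ | ⟨V, A, u, v, N, hV, hw₂, hε, hlast, hhead, hM, hVb⟩
  · refine ⟨_, happ _ _ hU (hOr hV), ?_, .inl ?_⟩ <;> simp at hw₁ hw₂ ⊢ <;> omega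
  · refine ⟨_, happ _ _ hU (hOr hV), by simp at hw₁ hlen ⊢; omega, ?_⟩
    rw [List.append_nil]
    rcases hcase with rfl | ⟨U, rfl, hU'⟩ | hE
    · exact .inr (.inl rfl)
    · exact .inr (.inr (.inl ⟨U, rfl, by
      rw [hql] at hU'; exact (show _ ∨ _ by simpa [eq_comm] using hU').imp_right .inl⟩))
    · refine .inr (.inr (.inr ⟨?_, fun hf => .inr (.inr (.inr ⟨hE, hf⟩))⟩))
      obtain ⟨_, _, -, -, -, -, rfl, -⟩ := hE
      simp
  · refine ⟨_, happ _ _ hU (hOr hV), by simp at hw₁ hw₂ ⊢; omega, ?_⟩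
    obtain ⟨rfl, hhead'⟩ := List.cons.inj hhead
    have hVa : V.a = q := by
      rw [← List.cons_append, List.getLast?_append] at hlast
      simpa [eq_comm] using hlast
    rw [neg_neg] at hε
    rcases hcase with rfl | ⟨U, rfl, hU'⟩ | ⟨_, _, -, -, -, -, rfl, -⟩
    · exact .inr (.inr (.inl ⟨V, rfl, .inr (.inr ⟨hε, hVa, A, u, N, hM, hhead', hVb⟩)⟩))
    · refine .inr (.inr (.inr ⟨by simp, fun hf => .inr (.inr (.inl ⟨U, by simp, ?_⟩))⟩))
      refine (hgood₁ hU (by simp)).lum_of_full h hf fun W hW => ?_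
      rcases List.mem_pair.1 hW with rfl | rfl
      · exact .inl rfl
      refine .inr ⟨hgood₂ (hOr hV) (by simp), hd.mono (hU.pkt U (by simp)).sub
        (hV.pkt W (by simp)).sub, ?_⟩
      rintro ⟨h3, h4⟩
      have e : orient s W.a U.a = -orient s U.a W.a := by unfold orient; ring
      rcases hU' with ⟨h5, -⟩ | ⟨-, h5⟩
      · rw [hε, e] at h4
        rw [h5] at h3
        linarith
      · have : U.a = q := by rw [hql] at h5; simpa [eq_comm] using h5
        rw [this, hVa, orient_right] at h3
        simp at h3
    · exact .inr (.inr (.inr ⟨by simp, fun _ => .inr (.inl (by simp))⟩))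

/-- A chord separates the vertices seen from one of its points. -/
theorem OPoly.mem_of_visible {w : Plane} {K₁ K₂ : Set Plane} (h : OPoly σ (p :: X ++ x :: Y) G)
    (h₁ : OPoly σ (p :: X ++ [x]) K₁) (h₂ : OPoly σ (x :: Y ++ [p]) K₂) (hK₁ : K₁ ⊆ G)
    (hd : Disjoint K₁ K₂) (hcov : ∀ y ∈ G, y ∈ K₁ ∨ y ∈ K₂ ∨ y ∈ openSegment ℝ p x)
    (hpx : openSegment ℝ p x ⊆ G) (hs : s ∈ openSegment ℝ p x) (hw : w ∈ p :: X ++ x :: Y)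
    (hsw : openSegment ℝ s w ⊆ G) (ho : 0 < σ * orient x p w) : w ∈ X ∧ openSegment ℝ s w ⊆ K₁ := by
  have hpos : ∀ y ∈ openSegment ℝ s w, 0 < σ * orient x p y := fun y hy =>
    orient_pos_of_mem_openSegment (x := s) (y := w)
      (by rw [orient_of_mem_openSegment (by rwa [openSegment_symm]), mul_zero]) ho hy
  have hwp : w ≠ p := by rintro rfl; simp at ho
  have hwx : w ≠ x := by rintro rfl; simp at ho
  have hsub : openSegment ℝ s w ⊆ K₁ ∪ K₂ := by
    intro y hy
    rcases hcov y (hsw hy) with h1 | h1 | h1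
    · exact .inl h1
    · exact .inr h1
    · have := hpos y hy
      rw [orient_of_mem_openSegment (by rwa [openSegment_symm])] at this
      simp at this
  have hK : openSegment ℝ s w ⊆ K₁ := by
    refine (IsPreconnected.subset_or_subset h₁.isOpen h₂.isOpen hd hsub
      (_root_.convex_openSegment s w).isPreconnected).resolve_right fun h3 => ?_
    have := h₂.orient_pos_of_openSegment (mem_cycEdges_last Y x p) hs (p := w)
      (by rwa [openSegment_symm])
    have e : orient p x w = -orient x p w := by unfold orient; ring
    simp only [e] at this
    linarith
  refine ⟨?_, hK⟩
  have hwG : w ∉ G := h.vertex_notMem hw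
  have hwc : w ∈ closure K₁ := closure_mono hK (by
    rw [closure_openSegment]; exact right_mem_segment ℝ s w)
  obtain ⟨e, he, hwe⟩ := mem_edgeUnion.1 (h₁.front
    ⟨hwc, by rw [h₁.isOpen.interior_eq]; exact fun h3 => hwG (hK₁ h3)⟩)
  replace he : e ∈ cycEdges (p :: X ++ [x]) := he
  rw [cycEdges_concat, List.mem_append, List.mem_singleton] at he
  rcases he with he | rfl
  · have heL : e ∈ cycEdges (p :: X ++ x :: Y) := by
      rw [cycEdges_split]
      exact List.mem_append_left _ he
    have hm : w ∈ p :: X ++ [x] := by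
      rcases h.vertex_endpoint hw heL hwe with rfl | rfl
      exacts [fst_mem_of_mem_pathEdges he, snd_mem_of_mem_pathEdges he]
    simpa [hwp, hwx] using hm
  · rcases mem_segment_cases hwe with h3 | h3 | h3
    · exact absurd h3 hwx
    · exact absurd h3 hwp
    · exact absurd (hpx (by rwa [openSegment_symm])) hwG

end

section
variable {s p q r x u v : Plane} {σ : ℝ} {X Y : List Plane}

/-- The point `s` lies on a diagonal or in a triangle of diagonals and sides of `L`. -/
def Spot (σ : ℝ) (L : List Plane) (G : Set Plane) (s : Plane) : Prop :=
  (∃ p ∈ L, ∃ q ∈ L, p ≠ q ∧ s ∈ openSegment ℝ p q ∧ openSegment ℝ p q ⊆ G) ∨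
    ∃ p ∈ L, ∃ q ∈ L, ∃ r ∈ L, s ∈ tri σ p q r ∧ tri σ p q r ⊆ G

theorem Spot.mono {L' : List Plane} {G' : Set Plane} (h : Spot σ L G s) (hL : L ⊆ L')
    (hG : G ⊆ G') : Spot σ L' G' s := by
  rcases h with ⟨a, ha, b, hb, h1, h2, h3⟩ | ⟨a, ha, b, hb, c, hc, h2, h3⟩
  · exact .inl ⟨a, hL ha, b, hL hb, h1, h2, h3.trans hG⟩
  · exact .inr ⟨a, hL ha, b, hL hb, c, hL hc, h2, h3.trans hG⟩

theorem OPoly.spot (h : OPoly σ L G) (hs : s ∈ G) : Spot σ L G s := by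
  induction hn : L.length using Nat.strong_induction_on generalizing L G with
  | _ n ih =>
    subst hn
    by_cases hL : 4 ≤ L.length
    · obtain ⟨p, q, hpq⟩ := h.exists_isDiag hL
      obtain ⟨p, q, X, B, C, hd, rfl, hB, hC⟩ := hpq.exists_split
      have h' : OPoly σ (p :: B ++ q :: (C ++ X)) G := by
        have := OPoly.rotate (A := X) (B := p :: B ++ q :: C) (by simpa using h)
        simpa using this
      obtain ⟨G₁, G₂, h₁, h₂, hG₁, hG₂, -, hcov, -⟩ := h'.split hB hC hd.2.2.2.2.2
      have hB' := List.length_pos_of_ne_nil hB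
      have hC' := List.length_pos_of_ne_nil hC
      rcases hcov s hs with h1 | h1 | h1
      · exact (ih _ (by simp at hC' ⊢; omega) h₁ h1 rfl).mono (fun y => by simp; tauto) hG₁
      · exact (ih _ (by simp at hC' ⊢; omega) h₂ h1 rfl).mono (fun y => by simp; tauto) hG₂
      · exact .inl ⟨p, hd.1, q, hd.2.1, hd.2.2.1, h1, hd.2.2.2.2.2⟩
    · have h3 := h.len
      obtain ⟨p, q, r, rfl⟩ := List.length_eq_three.1 (show L.length = 3 by omega)
      have := (h.triangle h.sign (h.sides (p, q) (by simp [cycEdges_cons]))).2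
      exact .inr ⟨p, by simp, q, by simp, r, by simp, this ▸ hs, this ▸ subset_rfl⟩

theorem openCycle_append_comm (A B : List Plane) : openCycle (A ++ B) = openCycle (B ++ A) := by
  ext y
  simp only [openCycle, mem_ofPred_eq, mem_cycEdges_append_comm (A := A)]

theorem Lit.congr {L' : List Plane} (hL : openCycle L = openCycle L') (k : ℕ) :
    Lit L G s k = Lit L' G s k := by
  induction k with
  | zero => rfl
  | succ k ih => simp only [Lit, ih, hL]

theorem exists_append_of_mem_of_mem (hp : p ∈ L) (hq : q ∈ L) (hpq : q ≠ p) :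
    ∃ A B X Y, L = A ++ B ∧ B ++ A = p :: X ++ q :: Y := by
  obtain ⟨A, B, rfl⟩ := List.append_of_mem hp
  obtain ⟨X, Y, hXY⟩ := List.append_of_mem (show q ∈ B ++ A by simpa [hpq, or_comm] using hq)
  exact ⟨A, p :: B, X, Y, rfl, by simp [hXY]⟩

theorem openCycle_split (p : Plane) (X : List Plane) (q : Plane) (Y : List Plane) :
    openCycle (p :: X ++ q :: Y) = openPath (p :: X ++ [q]) ∪ openPath (q :: Y ++ [p]) := by
  ext y
  simp only [openCycle, openPath, mem_union, mem_ofPred_eq, cycEdges_split, List.mem_append,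
    or_and_right, exists_or]

theorem OPoly.exists_ready_of_diag (h : OPoly σ (p :: X ++ q :: Y) G) (hs : s ∈ openSegment ℝ p q)
    (hpq : openSegment ℝ p q ⊆ G) :
    ∃ 𝒰, Ready (p :: X ++ q :: Y) G s 0 ((p :: X ++ q :: Y).length / 2 - 1) 𝒰 := by
  have hX : X ≠ [] := by
    rintro rfl
    exact h.openSegment_disjoint (e := (p, q)) (by simp [cycEdges_cons]) hs (hpq hs)
  have hY : Y ≠ [] := by
    rintro rfl
    exact h.openSegment_disjoint (mem_cycEdges_last X p q) (by rwa [openSegment_symm]) (hpq hs)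
  obtain ⟨G₁, G₂, h₁, h₂, hG₁, hG₂, -, hcov, -⟩ := h.split hX hY hpq
  obtain ⟨𝒰, hU, hw₁⟩ := h₁.exists_out_of_mem_last hs
  obtain ⟨𝒱, hV, hw₂⟩ := h₂.exists_out_of_mem_last (s := s) (by rwa [openSegment_symm])
  have hO := hU.append hV hG₁ hG₂ (fun y hy => (hcov y hy).imp_right (Or.imp_right fun h1 =>
    ((_root_.convex_openSegment p q).openSegment_subset hs h1).trans hpq)) rfl
  have hB := (Out.base hO (openCycle_split p X q Y).ge
    fun y hy => .inl ((openCycle_split p X q Y).le hy)).1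
  refine ⟨_, hB, .inl ?_⟩
  simp at hw₁ hw₂ ⊢
  omega

end

section
variable {s p q r x u v : Plane} {σ : ℝ} {X Y : List Plane}

theorem OPoly.exists_ready_of_hit (h : OPoly σ (p :: X ++ u :: v :: Y) G)
    (hx : x ∈ openSegment ℝ u v) (hpx : openSegment ℝ p x ⊆ G) (hs : s ∈ openSegment ℝ p x)
    (hq : q ∈ p :: X ++ u :: v :: Y) (hr : r ∈ p :: X ++ u :: v :: Y)
    (hsq : openSegment ℝ s q ⊆ G) (hsr : openSegment ℝ s r ⊆ G) (hpq : 0 < σ * orient s p q)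
    (hqr : 0 < σ * orient s q r) (hrp : 0 < σ * orient s r p) :
    ∃ 𝒰, Ready (p :: X ++ u :: v :: Y) G s 0 ((p :: X ++ u :: v :: Y).length / 2 - 1) 𝒰 := by
  have hxC : x ∈ openCycle (p :: X ++ u :: v :: Y) := ⟨(u, v), mem_cycEdges_mid _ _ _ _, hx⟩
  have h' : OPoly σ (p :: (X ++ [u]) ++ x :: (v :: Y)) G := by simpa using h.insert_vertex hx
  have hcyc : openCycle (p :: X ++ u :: v :: Y) =
      openPath (p :: (X ++ [u]) ++ [x]) ∪ {x} ∪ openPath (x :: (v :: Y) ++ [p]) := by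
    have := openPath_insert (A := p :: X) (B := Y ++ [p]) hx
    rw [List.cons_append, openCycle, cycEdges_cons]
    simpa [openPath] using this
  have hsx : openSegment ℝ s x ⊆ G := by
    rw [openSegment_symm]
    exact (openSegment_subset_left (by rwa [openSegment_symm])).trans
      (by rwa [openSegment_symm])
  obtain ⟨K₁, K₂, h₁, h₂, hK₁, hK₂, hd, hcov, -⟩ := h'.split (by simp) (by simp) hpx
  obtain ⟨t, ht, -, hts⟩ := mem_openSegment_iff.1 hs
  have hxpq : 0 < σ * orient x p q := by
    have : orient s p q = t * orient x p q := by
      rw [← hts]; unfold orient; simp only [lineMap_coord]; ring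
    rw [this] at hpq
    nlinarith
  have hpxr : 0 < σ * orient p x r := by
    have : orient s r p = t * orient p x r := by
      rw [← hts]; unfold orient; simp only [lineMap_coord]; ring
    rw [this] at hrp
    nlinarith
  obtain ⟨hqX, hq₁⟩ := h'.mem_of_visible h₁ h₂ hK₁ hd hcov hpx hs (w := q)
    (by simp at hq ⊢; tauto) hsq hxpq
  obtain ⟨hrY, hr₂⟩ := (OPoly.rotate h').mem_of_visible h₂ h₁ hK₂ hd.symm
    (fun y hy => by rw [openSegment_symm]; have := hcov y hy; tauto)
    (by rwa [openSegment_symm]) (by rwa [openSegment_symm]) (w := r)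
    (by simp at hr ⊢; tauto) hsr hpxr
  obtain ⟨X₁, X₂, hX⟩ := List.append_of_mem hqX
  obtain ⟨Y₁, Y₂, hY⟩ := List.append_of_mem hrY
  have hi₁ := h₁.insert_last hs
  have hi₂ := OPoly.reverse_tail (h₂.insert_last (s := s) (by rwa [openSegment_symm]))
  have hc₁ : openPath (p :: (X ++ [u]) ++ [x]) ⊆ openCycle (p :: X ++ u :: v :: Y) := by
    rw [hcyc]; exact subset_union_left.trans subset_union_left
  have hc₂ : openPath (x :: (v :: Y) ++ [p]) ⊆ openCycle (p :: X ++ u :: v :: Y) := by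
    rw [hcyc]; exact subset_union_right
  have e₁ : p :: (X ++ [u]) ++ [x] = p :: X₁ ++ q :: (X₂ ++ [x]) := by simp [hX]
  have e₂ : (x :: (v :: Y) ++ [p]).reverse = p :: Y₂.reverse ++ r :: (Y₁.reverse ++ [x]) := by
    rw [hY]; simp
  rw [← openPath_reverse, e₂] at hc₂
  rw [e₂] at hi₂
  rw [e₁] at hi₁ hc₁
  obtain ⟨𝒰, hU, hw₁, hU'⟩ := h.exists_out_half hi₁ hK₁ hc₁ hxC hq₁ hsx
  obtain ⟨𝒱, hV, hw₂, hV'⟩ := h.exists_out_half hi₂ hK₂ hc₂ hxC hr₂ hsx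
  have hO := hU.append hV hK₁ hK₂ (fun y hy => (hcov y hy).imp_right (Or.imp_right fun h1 =>
    ((_root_.convex_openSegment p x).openSegment_subset hs h1).trans hpx)) rfl
  obtain ⟨hB, hf⟩ := Out.base hO (union_subset hc₁ hc₂) fun y hy => by
    rw [← e₁, ← e₂, openPath_reverse]
    rw [hcyc] at hy
    rcases hy with (hy | rfl) | hy
    exacts [.inl (.inl hy), .inr hsx, .inl (.inr hy)]
  have l₁ := congrArg List.length hX
  have l₂ := congrArg List.length hY
  simp only [List.length_append, List.length_cons, List.length_nil, List.length_reverse]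
    at l₁ l₂ hw₁ hw₂ hU' hV'
  refine ⟨_, hB, ?_⟩
  rw [wt_append]
  simp only [List.length_append, List.length_cons]
  by_cases hlt : wt 𝒰 + wt 𝒱 + 1 ≤ X.length + Y.length
  · exact .inl (by omega)
  refine .inr ⟨?_, by omega⟩
  have hgood : ∀ W ∈ 𝒰 ++ 𝒱, GoodAt (p :: X ++ u :: v :: Y) G s 0 s W := fun W hW =>
    (hO.pkt W hW).goodAt (union_subset hc₁ hc₂) subset_rfl fun _ _ h1 => h1
  replace hU' := hU'.resolve_left (by omega)
  replace hV' := hV'.resolve_left (by omega)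
  have hsingle : ∀ {W}, 𝒰 ++ 𝒱 = [W] → Tight (p :: X ++ u :: v :: Y) G s 0 (𝒰 ++ 𝒱) := by
    intro W hW
    rw [hW] at hgood hf ⊢
    exact .inr (.inr (.inl ⟨W, by simp, (hgood W (by simp)).lum_of_full h hf
      fun V hV => .inl (by simpa using hV)⟩))
  rcases hU' with rfl | ⟨U, rfl, hUt⟩ | ⟨hUl, hUt⟩ <;>
    rcases hV' with rfl | ⟨V, rfl, hVt⟩ | ⟨hVl, hVt⟩
  · exact .inl rfl
  · exact hsingle rfl
  · exact hVt hf
  · exact hsingle rfl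
  · have hdUV : Disjoint U.H V.H := hd.mono (hU.pkt U (by simp)).sub (hV.pkt V (by simp)).sub
    have htight : ¬(0 < U.ε * orient s U.a V.a ∧ 0 < V.ε * orient s V.a U.a) →
        Tight (p :: X ++ u :: v :: Y) G s 0 ([U] ++ [V]) := fun hn => by
      refine .inr (.inr (.inl ⟨U, by simp, (hgood U (by simp)).lum_of_full h hf fun W hW => ?_⟩))
      rcases List.mem_pair.1 hW with rfl | rfl
      exacts [.inl rfl, .inr ⟨hgood W (by simp), hdUV, hn⟩]
    rcases hUt with ⟨h1, h2⟩ | ⟨h1, h2⟩ | ⟨h1, h2, A, u₁, N, hUM, hun, hUb⟩ <;>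
      rcases hVt with ⟨h3, h4⟩ | ⟨h3, h4⟩ | ⟨h3, h4, B, v₁, N', hVM, hvn, hVb⟩
    on_goal 9 =>
      have hu₁ : u₁ = u := by
        have e := congrArg List.getLast? hX
        have := congrArg List.reverse hun
        simp only [List.reverse_append, List.reverse_reverse, List.reverse_cons, List.reverse_nil,
          List.nil_append, List.singleton_append] at this
        rw [this, ← List.append_assoc] at e
        simpa [eq_comm] using e
      have hv₁ : v₁ = v := by
        have e := congrArg List.head? hY
        have : Y₁ ++ r :: Y₂ = v₁ :: N' ++ Y₂ := by rw [← hvn]; simp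
        rw [this] at e
        simpa [eq_comm] using e
      subst hu₁ hv₁
      rw [openSegment_symm] at hx
      obtain ⟨h5, h6⟩ := openSegment_between hx (.inr (by rwa [openSegment_symm]))
      refine .inr (.inr (.inr ⟨⟨U, V, A, B, u₁, v₁, rfl, hUM, hVM,
        h.ne (mem_cycEdges_mid (p :: X) Y u₁ v₁), h5, ?_, by rw [h1, h3], hdUV⟩, hf⟩))
      rcases h6 with rfl | h6
      · exact hVb
      · exact openSegment_subset_left (by rwa [openSegment_symm]) hVb
    all_goals
      refine htight fun ⟨h5, h6⟩ => ?_
      rw [h1, h2, h4] at h5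
      rw [h2, h3, h4] at h6
      unfold orient at *
      linarith
  · exact .inr (.inl (by simp; omega))
  · rw [List.append_nil] at hf ⊢
    exact hUt hf
  · exact .inr (.inl (by simp; omega))
  · exact .inr (.inl (by simp; omega))

end

section
variable {s p q : Plane} {σ : ℝ}

theorem OPoly.mem_lit_of_diag (h : OPoly σ L G) (hp : p ∈ L) (hq : q ∈ L) (hne : q ≠ p)
    (hs : s ∈ openSegment ℝ p q) (hpq : openSegment ℝ p q ⊆ G) {y : Plane} (hy : y ∈ G) :
    y ∈ Lit L G s (L.length / 2 - 1) := by
  obtain ⟨A, B, X, Y, rfl, hXY⟩ := exists_append_of_mem_of_mem hp hq hne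
  have hr := OPoly.rotate h
  rw [Lit.congr (openCycle_append_comm A B),
    show (A ++ B).length = (B ++ A).length by simp [add_comm]]
  rw [hXY] at hr ⊢
  obtain ⟨𝒰, hU⟩ := hr.exists_ready_of_diag hs hpq
  simpa using hU.lit hr hy

theorem OPoly.mem_lit (h : OPoly σ L G) (hs : s ∈ G) {y : Plane} (hy : y ∈ G) :
    y ∈ Lit L G s (L.length / 2 - 1) := by
  rcases h.spot hs with ⟨p, hp, q, hq, hne, h1, h2⟩ | ⟨p, hp, q, hq, r, hr, h1, h2⟩
  · exact h.mem_lit_of_diag hp hq hne.symm h1 h2 hy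
  have hsp : s ≠ p := fun e => h.vertex_notMem hp (e ▸ hs)
  obtain ⟨x, hsx, hsxG, e, he, hxe⟩ := h.first_hit hs hsp.symm
  have hpx := openSegment_subset_of_mem hsx hs
    ((openSegment_subset_tri_of_mem h1).trans h2) hsxG
  have hxp : x ≠ p := by
    rintro rfl
    rw [openSegment_same] at hsx
    exact hsp hsx
  rcases mem_segment_cases hxe with rfl | rfl | hx
  · exact h.mem_lit_of_diag hp (fst_mem_of_mem_cycEdges he) hxp hsx hpx hy
  · exact h.mem_lit_of_diag hp (snd_mem_of_mem_cycEdges he) hxp hsx hpx hy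
  obtain ⟨u, v⟩ := e
  obtain ⟨A, B, rfl⟩ := List.append_of_mem hp
  have h' := OPoly.rotate h
  rw [mem_cycEdges_append_comm] at he
  rw [Lit.congr (openCycle_append_comm A (p :: B)),
    show (A ++ p :: B).length = (p :: B ++ A).length by simp; omega]
  have hed := he
  rw [List.cons_append, cycEdges_cons] at he
  obtain ⟨X, Y, hXY⟩ := exists_split_of_mem_pathEdges he
  have hnot : s ∉ openSegment ℝ u v := fun h3 => h'.openSegment_disjoint hed h3 hs
  rcases X with - | ⟨p', X⟩
  · obtain ⟨rfl, -⟩ := List.cons.inj hXY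
    exact absurd (openSegment_subset_left hx hsx) hnot
  obtain ⟨rfl, hXY⟩ := List.cons.inj hXY
  rcases List.eq_nil_or_concat Y with rfl | ⟨Y, p', rfl⟩
  · have : p = v := by
      have e : (p :: B ++ A) ++ [p] = (p :: X ++ [u]) ++ [v] := by simpa using hXY
      simpa using (List.append_inj' e rfl).2
    subst this
    rw [openSegment_symm] at hx hnot
    exact absurd (openSegment_subset_left hx hsx) hnot
  · have hBA : B ++ A = X ++ u :: v :: Y := by
      rw [List.concat_eq_append] at hXY
      have : (B ++ A) ++ [p] = (X ++ u :: v :: Y) ++ [p'] := by simpa using hXY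
      exact (List.append_inj' this rfl).1
    have hmem : ∀ z ∈ A ++ p :: B, z ∈ p :: X ++ u :: v :: Y := fun z hz => by
      rw [List.cons_append, ← hBA]
      simp at hz ⊢
      tauto
    rw [List.cons_append, hBA] at h' ⊢
    obtain ⟨h3, h4, h5⟩ := h1
    have hsq : openSegment ℝ s q ⊆ G := by
      rw [openSegment_symm]
      exact (openSegment_subset_tri_of_mem (r := p) ⟨h4, h5, h3⟩).trans
        ((tri_cycle σ p q r).le.trans h2)
    have hsr : openSegment ℝ s r ⊆ G := by
      rw [openSegment_symm]
      exact (openSegment_subset_tri_of_mem (r := q) ⟨h5, h3, h4⟩).trans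
        ((tri_cycle σ q r p).le.trans ((tri_cycle σ p q r).le.trans h2))
    have hrot : ∀ a b : Plane, orient s a b = orient a b s := fun a b => by unfold orient; ring
    obtain ⟨𝒰, hU⟩ := OPoly.exists_ready_of_hit (X := X) h' hx hpx hsx (hmem q hq) (hmem r hr)
      hsq hsr (by rwa [hrot]) (by rwa [hrot]) (by rwa [hrot])
    simpa using hU.lit h' hy

theorem exists_path_of_mem_lit {k : ℕ} {y : Plane} (hy : y ∈ Lit L G s k) :
    ∃ m ≤ k, ∃ f : ℕ → Plane, f 0 = s ∧ f (m + 1) = y ∧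
      (∀ i, 0 < i → i ≤ m → f i ∈ openCycle L) ∧
      ∀ i ≤ m, openSegment ℝ (f i) (f (i + 1)) ⊆ G := by
  induction k generalizing y with
  | zero =>
    refine ⟨0, le_rfl, fun i => if i = 0 then s else y, by simp, by simp, by omega, fun i hi => ?_⟩
    obtain rfl : i = 0 := by omega
    simpa [Lit] using hy
  | succ k ih =>
    rcases hy with hy | ⟨x, hx, hxs, hxy⟩
    · obtain ⟨m, hm, h⟩ := ih hy
      exact ⟨m, by omega, h⟩
    · obtain ⟨m, hm, f, h0, h1, h2, h3⟩ := ih hxs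
      refine ⟨m + 1, by omega, fun i => if i ≤ m + 1 then f i else y, by simpa using h0, by simp,
        fun i hi hi' => ?_, fun i hi => ?_⟩
      · rcases hi'.lt_or_eq with hi' | rfl
        · simpa [hi'.le] using h2 i hi (by omega)
        · simpa [h1] using hx
      · rcases hi.lt_or_eq with hi | rfl
        · have h4 : i ≤ m := by omega
          simpa [hi.le, h4] using h3 i h4
        · simpa [h1] using hxy

end

end

/-- **Theorem 1 (upper bound).** For a simple polygon `P` with `n ≥ 3` vertices,
a point `s` in the interior of `P`, and any `k ≥ ⌊n/2⌋ - 1`, the interior of `P`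
is contained in `V_k(s)`. -/
theorem interior_subset_Vis (n : ℕ) (hn : 3 ≤ n) (P : Set Plane) (v : ℕ → Plane)
    (hP : IsSimplePolygon n P v) (s : Plane) (hs : s ∈ interior P)
    (k : ℕ) (hk : n / 2 - 1 ≤ k) :
    interior P ⊆ Vis n P v s k := by
  intro y hy
  obtain ⟨σ, hσ⟩ := (hP.polyInt hn).exists_oPoly
  have hlit := hσ.mem_lit hs hy
  rw [List.length_map, List.length_range] at hlit
  obtain ⟨m, hm, f, h0, h1, h2, h3⟩ := exists_path_of_mem_lit hlit
  have hedge : ∀ i, 0 < i → i < m + 1 → ∃ j < n, f i ∈ openSegment ℝ (v j) (v ((j + 1) % n)) := by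
    intro i hi hi'
    obtain ⟨e, he, hfe⟩ := h2 i hi (by omega)
    obtain ⟨j, hj, rfl⟩ := (mem_cycEdges_map_range (by omega)).1 he
    exact ⟨j, hj, hfe⟩
  refine ⟨interior_subset hy, m + 1, by omega, f, h0, h1, fun i hi => ?_, hedge,
    fun i hi => h3 i (by omega)⟩
  rcases Nat.eq_zero_or_pos i with rfl | hi0
  · exact h0 ▸ interior_subset hs
  rcases hi.lt_or_eq with hi | rfl
  · obtain ⟨j, hj, hfe⟩ := hedge i hi0 hi
    apply hP.1.isClosed.frontier_subset
    rw [hP.2.2.2.1]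
    exact mem_biUnion (Finset.mem_coe.2 (Finset.mem_range.2 hj)) (openSegment_subset_segment ℝ _ _ hfe)
  · exact h1 ▸ interior_subset hy
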